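/- Let X be an irreducible smooth projective variety of dimension d >= 2 in P^n over an algebraically closed field of characteristic 0, and let D be an ample divisor on X. Then there exists an integer n0 > 0 such that for all m >= n0 and for any q <= n+1 closed points P0, P1, ..., P_{q-1} on X in general position, a general member of |mD|_q is irreducible and smooth, where |mD|_q is the linear system of effective divisors in |mD| passing through the q points P_s, s = 0, 1, ..., q-1. -/

import Mathlib

open MvPolynomial

/-- Points of projective `n`-space over `k`. -/
abbrev ProjPt (k : Type) [Field k] (n : ℕ) : Type := Projectivization k (Fin (n+1) → k)

variable {k : Type} [Field k] {n : ℕ}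

/-- A polynomial vanishes at a projective point if it vanishes on every
representative vector of the point. -/
def VanishesAt (h : MvPolynomial (Fin (n+1)) k) (x : ProjPt k n) : Prop :=
  ∀ (v : Fin (n+1) → k) (hv : v ≠ 0), Projectivization.mk k v hv = x → eval v h = 0

/-- Common projective zero locus of a family of polynomials. -/
def projZeroLocus (I : Set (MvPolynomial (Fin (n+1)) k)) : Set (ProjPt k n) :=
  {x | ∀ h ∈ I, VanishesAt h x}

/-- Zariski-closed subsets of projective space: common zero loci of families of
homogeneous polynomials. -/
def IsClosedSub (S : Set (ProjPt k n)) : Prop :=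
  ∃ I : Set (MvPolynomial (Fin (n+1)) k),
    (∀ h ∈ I, ∃ m : ℕ, h.IsHomogeneous m) ∧ S = projZeroLocus I

/-- A subset is irreducible if it is nonempty and is not covered by two closed sets
unless it is contained in one of them. -/
def IsIrredSub (S : Set (ProjPt k n)) : Prop :=
  S.Nonempty ∧ ∀ C₁ C₂ : Set (ProjPt k n),
    IsClosedSub C₁ → IsClosedSub C₂ → S ⊆ C₁ ∪ C₂ → S ⊆ C₁ ∨ S ⊆ C₂

/-- `T` is an irreducible closed subset of `S` (in the subspace Zariski topology). -/
def IsClosedIrredIn (S T : Set (ProjPt k n)) : Prop :=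
  T ⊆ S ∧ (∃ C, IsClosedSub C ∧ T = C ∩ S) ∧ IsIrredSub T

/-- `S` has dimension at least `m` : there is a strictly increasing chain of `m+1`
irreducible closed subsets of `S`. -/
def DimGE (S : Set (ProjPt k n)) (m : ℕ) : Prop :=
  ∃ c : Fin (m+1) → Set (ProjPt k n), StrictMono c ∧ ∀ i, IsClosedIrredIn S (c i)

/-- `S` has (Krull) dimension exactly `d`. -/
def HasDim (S : Set (ProjPt k n)) (d : ℕ) : Prop :=
  DimGE S d ∧ ¬ DimGE S (d+1)

/-- The gradient vector of a polynomial at a vector. -/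
noncomputable def gradientAt (h : MvPolynomial (Fin (n+1)) k) (v : Fin (n+1) → k) :
    Fin (n+1) → k :=
  fun j => eval v (pderiv j h)

/-- The homogeneous polynomials vanishing identically on `S`. -/
def homVanishingPolys (S : Set (ProjPt k n)) : Set (MvPolynomial (Fin (n+1)) k) :=
  {h | (∃ m : ℕ, h.IsHomogeneous m) ∧ ∀ x ∈ S, VanishesAt h x}

/-- Jacobian criterion: `S` (of dimension `d`) is smooth at `x` if the span of the
gradients at `x` of the homogeneous polynomials vanishing on `S` has rank `n - d`. -/
def SmoothPtAt (S : Set (ProjPt k n)) (d : ℕ) (x : ProjPt k n) : Prop :=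
  ∀ (v : Fin (n+1) → k) (hv : v ≠ 0), Projectivization.mk k v hv = x →
    Module.finrank k
      ↥(Submodule.span k {w | ∃ h ∈ homVanishingPolys S, w = gradientAt h v}) = n - d

/-- `S` is an irreducible smooth projective variety of dimension `d`. -/
def IsSmoothVariety (S : Set (ProjPt k n)) (d : ℕ) : Prop :=
  IsClosedSub S ∧ IsIrredSub S ∧ HasDim S d ∧ ∀ x ∈ S, SmoothPtAt S d x

/-- Polynomial function on a `k`-vector space `W`. -/
def IsPolyFun (k : Type) [Field k] {W : Type} [AddCommGroup W] [Module k W] (F : W → k) : Prop :=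
  ∃ (r : ℕ) (lam : Fin r → (W →ₗ[k] k)) (p : MvPolynomial (Fin r) k),
    F = fun w => eval (fun i => lam i w) p

/-- Zariski-closed subsets of a `k`-vector space `W` : common zero loci of families
of polynomial functions. -/
def IsZClosed (k : Type) [Field k] {W : Type} [AddCommGroup W] [Module k W] (Z : Set W) : Prop :=
  ∃ ℱ : Set (W → k), (∀ F ∈ ℱ, IsPolyFun k F) ∧ Z = {w | ∀ F ∈ ℱ, F w = 0}

/-- `Z` is a cone: stable under scalar multiplication. -/
def IsCone (k : Type) [Field k] {W : Type} [AddCommGroup W] [Module k W] (Z : Set W) : Prop :=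
  ∀ (c : k) (w : W), w ∈ Z → c • w ∈ Z

/-- `q` points of projective space are in general position: if `q < n+1` their
representative vectors are linearly independent; if `q = n+1` any `n` of them are
linearly independent. -/
def InGeneralPosition {q : ℕ} (P : Fin q → ProjPt k n) : Prop :=
  if q < n + 1 then LinearIndependent k (fun s => (P s).rep)
  else ∀ s : Fin q, LinearIndependent k (fun t : {t : Fin q // t ≠ s} => (P t.1).rep)
/-- The ideal of polynomials vanishing identically on `S ⊆ ℙⁿ`. -/
def vanishingIdeal (S : Set (ProjPt k n)) : Ideal (MvPolynomial (Fin (n+1)) k) where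
  carrier := {f | ∀ x ∈ S, VanishesAt f x}
  zero_mem' := by intro x hx v hv hvx; simp
  add_mem' := by
    intro a b ha hb x hx v hv hvx
    simp [map_add, ha x hx v hv hvx, hb x hx v hv hvx]
  smul_mem' := by
    intro c a ha x hx v hv hvx
    simp [smul_eq_mul, map_mul, ha x hx v hv hvx]

/-- A prime divisor on the `d`-dimensional variety `X`: a closed irreducible subset
of `X` of dimension `d - 1` (codimension one). -/
def IsPrimeDivisorOn (X : Set (ProjPt k n)) (d : ℕ) (Y : Set (ProjPt k n)) : Prop :=
  Y ⊆ X ∧ IsClosedSub Y ∧ IsIrredSub Y ∧ HasDim Y (d - 1)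

/-- The order of vanishing of the polynomial `g` along the prime divisor `Y` of `X`,
defined via symbolic powers of the vanishing ideal of `Y` in the coordinate ring of `X`. -/
noncomputable def ordAlong (X Y : Set (ProjPt k n)) (g : MvPolynomial (Fin (n+1)) k) : ℕ :=
  sSup {r : ℕ | ∃ s : MvPolynomial (Fin (n+1)) k, s ∉ vanishingIdeal Y ∧
    s * g ∈ (vanishingIdeal Y) ^ r ⊔ vanishingIdeal X}

/-- A (Weil) divisor on `X` (of dimension `d`): an integer-valued function on the
prime divisors of `X`. -/
def DivisorOn (X : Set (ProjPt k n)) (d : ℕ) : Type :=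
  {Y : Set (ProjPt k n) // IsPrimeDivisorOn X d Y} → ℤ

/-- A divisor proper has finite support. -/
def HasFiniteSupport {X : Set (ProjPt k n)} {d : ℕ} (D : DivisorOn X d) : Prop :=
  {Y | D Y ≠ 0}.Finite

/-- An effective divisor. -/
def EffectiveDiv {X : Set (ProjPt k n)} {d : ℕ} (D : DivisorOn X d) : Prop :=
  ∀ Y, 0 ≤ D Y

/-- Linear equivalence of divisors on `X`: the difference is the divisor of a rational
function on `X`, i.e. of a ratio of two homogeneous polynomials of equal degree not
vanishing identically on `X`. -/
def LinEquivDiv {X : Set (ProjPt k n)} {d : ℕ} (D D' : DivisorOn X d) : Prop :=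
  ∃ (e : ℕ) (g h : MvPolynomial (Fin (n+1)) k),
    g.IsHomogeneous e ∧ h.IsHomogeneous e ∧
    g ∉ vanishingIdeal X ∧ h ∉ vanishingIdeal X ∧
    ∀ Y, D Y - D' Y = (ordAlong X Y.1 g : ℤ) - (ordAlong X Y.1 h : ℤ)

/-- A divisor passes through the point `P` if `P` lies on a component appearing in it. -/
def DivThrough {X : Set (ProjPt k n)} {d : ℕ} (D : DivisorOn X d) (P : ProjPt k n) : Prop :=
  ∃ Y, D Y ≠ 0 ∧ P ∈ Y.1

/-- `φ : ℙⁿ → ℙᵐ` restricts to a morphism on `X`: at every point of `X` it admits a local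
presentation by homogeneous forms of a common degree, valid wherever the forms do not all
vanish. -/
def IsMorphismOn {m : ℕ} (X : Set (ProjPt k n)) (φ : ProjPt k n → ProjPt k m) : Prop :=
  ∀ x ∈ X, ∃ (e : ℕ) (g : Fin (m+1) → MvPolynomial (Fin (n+1)) k),
    (∀ j, (g j).IsHomogeneous e) ∧ (∃ j, ¬ VanishesAt (g j) x) ∧
    ∀ y ∈ X, ∀ (v : Fin (n+1) → k) (hv : v ≠ 0), Projectivization.mk k v hv = y →
      ∀ hgv : (fun j => MvPolynomial.eval v (g j)) ≠ 0,
        Projectivization.mk k (fun j => MvPolynomial.eval v (g j)) hgv = φ y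

/-- `φ` is an isomorphism from `X` onto the closed subvariety `X'` of `ℙᵐ`, with inverse
morphism `ψ`. -/
def IsIsoOnto {m : ℕ} (X : Set (ProjPt k n)) (φ : ProjPt k n → ProjPt k m)
    (X' : Set (ProjPt k m)) (ψ : ProjPt k m → ProjPt k n) : Prop :=
  IsMorphismOn X φ ∧ X' = φ '' X ∧ IsClosedSub X' ∧ Set.InjOn φ X ∧
  IsMorphismOn X' ψ ∧ ∀ x ∈ X, ψ (φ x) = x

/-- `D'` is the pullback under `φ` of the hyperplane `ℓ = 0` of `ℙᵐ`: on each prime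
divisor `Y` its multiplicity is computed, via any presentation `g` of `φ` generically
valid along `Y`, as `ord_Y ℓ(g) − ord_Y gⱼ`. -/
def IsHyperplanePullback {m : ℕ} (X : Set (ProjPt k n)) (d : ℕ)
    (φ : ProjPt k n → ProjPt k m) (ℓ : MvPolynomial (Fin (m+1)) k)
    (D' : DivisorOn X d) : Prop :=
  ∀ (Y : {Y : Set (ProjPt k n) // IsPrimeDivisorOn X d Y})
    (e : ℕ) (g : Fin (m+1) → MvPolynomial (Fin (n+1)) k) (j : Fin (m+1)),
    (∀ j', (g j').IsHomogeneous e) →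
    (∀ y ∈ X, ∀ (v : Fin (n+1) → k) (hv : v ≠ 0), Projectivization.mk k v hv = y →
      ∀ hgv : (fun j' => MvPolynomial.eval v (g j')) ≠ 0,
        Projectivization.mk k (fun j' => MvPolynomial.eval v (g j')) hgv = φ y) →
    g j ∉ vanishingIdeal Y.1 →
    D' Y = (ordAlong X Y.1 (MvPolynomial.aeval g ℓ) : ℤ) - (ordAlong X Y.1 (g j) : ℤ)

/-- `D` is an ample divisor on `X`: some positive multiple `m₀ • D` is linearly equivalent
to the pullback of a hyperplane under an isomorphism of `X` onto a closed subvariety of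
some projective space. -/
def IsAmpleDiv (X : Set (ProjPt k n)) (d : ℕ) (D : DivisorOn X d) : Prop :=
  ∃ (m₀ : ℕ), 0 < m₀ ∧ ∃ (m : ℕ) (φ : ProjPt k n → ProjPt k m) (X' : Set (ProjPt k m))
    (ψ : ProjPt k m → ProjPt k n), IsIsoOnto X φ X' ψ ∧
    ∃ ℓ : MvPolynomial (Fin (m+1)) k, ℓ.IsHomogeneous 1 ∧
      (ℓ ∉ vanishingIdeal X') ∧
      ∃ D' : DivisorOn X d, IsHyperplanePullback X d φ ℓ D' ∧
        LinEquivDiv (fun Y => (m₀ : ℤ) * D Y) D'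


namespace Bert
section B1
variable {k : Type} [Field k]

/-- transcendence degree as a natural number -/
noncomputable def td (k : Type) [Field k] (A : Type) [CommRing A] [Algebra k A] : ℕ :=
  Cardinal.toNat (Algebra.trdeg k A)

variable {A B : Type} [CommRing A] [CommRing B] [Algebra k A] [Algebra k B]

theorem td_cast [Algebra.FiniteType k A] : (td k A : Cardinal) = Algebra.trdeg k A :=
  Cardinal.cast_toNat_of_lt_aleph0 trdeg_lt_aleph0_of_finiteType

theorem td_mvPoly (r : ℕ) : td k (MvPolynomial (Fin r) k) = r := by
  simp [td, MvPolynomial.trdeg_of_isDomain]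

theorem td_le_of_injective [Algebra.FiniteType k B] (f : A →ₐ[k] B)
    (hf : Function.Injective f) : td k A ≤ td k B :=
  Cardinal.toNat_le_toNat (trdeg_le_of_injective f hf)
    trdeg_lt_aleph0_of_finiteType

theorem td_le_of_surjective [Algebra.FiniteType k A] (f : A →ₐ[k] B)
    (hf : Function.Surjective f) : td k B ≤ td k A :=
  Cardinal.toNat_le_toNat (trdeg_le_of_surjective f hf)
    trdeg_lt_aleph0_of_finiteType

theorem td_eq_of_equiv (f : A ≃ₐ[k] B) : td k A = td k B := by
  unfold td; rw [f.trdeg_eq]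

theorem td_eq_of_integral [IsDomain A] [IsDomain B] (f : A →ₐ[k] B) (hf : Function.Injective f)
    (hi : f.toRingHom.IsIntegral) : td k A = td k B := by
  unfold td
  algebraize [f.toRingHom]
  have : FaithfulSMul A B := (faithfulSMul_iff_algebraMap_injective A B).mpr hf
  have : Algebra.IsIntegral A B := ⟨hi⟩
  have h := trdeg_add_eq k A (A := B)
  rw [trdeg_eq_zero (R := A) (A := B), add_zero] at h
  rw [h]

/-- more elements than the transcendence degree are algebraically dependent -/
theorem exists_aeval_zero_of_trdeg {r : ℕ} (h : Algebra.trdeg k A < r) (b : Fin r → A) :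
    ∃ p : MvPolynomial (Fin r) k, p ≠ 0 ∧ aeval b p = 0 := by
  by_contra hc
  push Not at hc
  have hai : AlgebraicIndependent k b := by
    rw [algebraicIndependent_iff]
    intro p hp
    by_contra h0
    exact hc p h0 hp
  have := hai.cardinalMk_le_trdeg
  rw [Cardinal.mk_fin] at this
  exact absurd h (not_lt.mpr this)

theorem exists_aeval_zero [Algebra.FiniteType k A] {r : ℕ} (h : td k A < r) (b : Fin r → A) :
    ∃ p : MvPolynomial (Fin r) k, p ≠ 0 ∧ aeval b p = 0 := by
  apply exists_aeval_zero_of_trdeg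
  rw [← td_cast]; exact_mod_cast h

/-- an integral (not nec. injective) map from a polynomial ring with nonzero kernel -/
theorem td_lt_of_ker {r : ℕ} [IsDomain B] [Algebra.FiniteType k B]
    (f : MvPolynomial (Fin r) k →ₐ[k] B)
    (hi : f.toRingHom.IsIntegral) (p : MvPolynomial (Fin r) k) (hp : p ≠ 0) (hfp : f p = 0) :
    td k B < r := by
  by_contra hc
  push Not at hc
  let x : Fin r → B := fun i => f (X i)
  have hf : f = aeval x := by ext i; simp [x]
  have hrange : Algebra.adjoin k (Set.range x) = f.range := by
    rw [Algebra.adjoin_range_eq_range_aeval, hf]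
  have halg : Algebra.IsAlgebraic (Algebra.adjoin k (Set.range x)) B := by
    constructor
    intro b
    apply IsIntegral.isAlgebraic
    obtain ⟨P, hP, h0⟩ := hi b
    refine ⟨P.map ((f.rangeRestrict.toRingHom)) |>.map (Subalgebra.equivOfEq _ _ hrange.symm).toRingEquiv.toRingHom, (hP.map _).map _, ?_⟩
    rw [Polynomial.eval₂_map, Polynomial.eval₂_map]
    exact h0
  have := Algebra.IsAlgebraic.isTranscendenceBasis_of_le_trdeg_of_finite k x (by
    rw [Cardinal.mk_fin, ← td_cast]; exact_mod_cast hc)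
  have h2 := this.1
  rw [algebraicIndependent_iff] at h2
  exact hp (h2 p (by rw [← hf]; exact hfp))

theorem td_quot_lt [Algebra.FiniteType k A] {P P' : Ideal A} [hP : P.IsPrime] [hP' : P'.IsPrime]
    (h : P < P') : td k (A ⧸ P') < td k (A ⧸ P) := by
  obtain ⟨r, g, ginj, gint⟩ := exists_integral_inj_algHom_of_fg k (A ⧸ P)
  rw [← td_eq_of_integral g ginj gint, td_mvPoly]
  obtain ⟨a, haP', haP⟩ := Set.exists_of_ssubset h
  let φ : (A ⧸ P) →ₐ[k] (A ⧸ P') := Ideal.Quotient.factorₐ k h.le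
  have hφ : Function.Surjective φ := Ideal.Quotient.factor_surjective h.le
  let _ := g.toRingHom.toAlgebra
  have hne : (RingHom.ker φ.toRingHom).comap (algebraMap (MvPolynomial (Fin r) k) (A ⧸ P)) ≠ ⊥ := by
    apply Ideal.comap_ne_bot_of_integral_mem (x := Ideal.Quotient.mk P a)
    · rwa [Ne, Ideal.Quotient.eq_zero_iff_mem]
    · change Ideal.Quotient.mk P' a = 0
      rwa [Ideal.Quotient.eq_zero_iff_mem]
    · exact gint _
  obtain ⟨p, hp, hp0⟩ := Submodule.exists_mem_ne_zero_of_ne_bot hne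
  exact td_lt_of_ker (φ.comp g) (gint.trans _ _ (RingHom.isIntegral_of_surjective _ hφ)) p hp0 hp

theorem td_hypersurface {r : ℕ} (g : MvPolynomial (Fin r) k) (hg : Prime g) :
    td k (MvPolynomial (Fin r) k ⧸ Ideal.span {g}) + 1 = r := by
  have hpr : (Ideal.span {g}).IsPrime := (Ideal.span_singleton_prime hg.ne_zero).mpr hg
  apply le_antisymm
  · exact td_lt_of_ker (Ideal.Quotient.mkₐ k (Ideal.span {g}))
      (RingHom.isIntegral_of_surjective _ Ideal.Quotient.mk_surjective) g hg.ne_zero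
      (Ideal.Quotient.eq_zero_iff_mem.mpr (Ideal.mem_span_singleton_self g))
  · have : ∃ i, degreeOf i g ≠ 0 := by
      by_contra hc
      push Not at hc
      have : g.totalDegree = 0 := by
        rw [totalDegree_eq_zero_iff]
        intro m hm i
        have := (degreeOf_le_iff.mp (hc i).le) m hm
        omega
      rw [totalDegree_eq_zero_iff_eq_C] at this
      apply hg.not_isUnit
      rw [this]
      apply IsUnit.map
      rw [isUnit_iff_ne_zero]
      intro h0
      rw [h0, C_0] at this
      exact hg.ne_zero this
    obtain ⟨i, hi⟩ := this
    cases r with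
    | zero => exact i.elim0
    | succ r =>
      apply Nat.succ_le_succ
      conv_lhs => rw [← td_mvPoly (k := k) r]
      refine td_le_of_injective
        ((Ideal.Quotient.mkₐ k (Ideal.span {g})).comp (rename (R := k) i.succAbove)) ?_
      rw [injective_iff_map_eq_zero]
      intro q hq
      by_contra hq0
      have hq' : rename i.succAbove q ∈ Ideal.span {g} := Ideal.Quotient.eq_zero_iff_mem.mp hq
      rw [Ideal.mem_span_singleton] at hq'
      obtain ⟨c, hc⟩ := hq'
      have hr0 : rename i.succAbove q ≠ 0 := by
        rwa [Ne, map_eq_zero_iff _ (rename_injective _ Fin.succAbove_right_injective)]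
      have hc0 : c ≠ 0 := by rintro rfl; simp at hc; exact hr0 (by simpa using hc)
      have hd : degreeOf i (rename i.succAbove q) = 0 := by
        by_contra hne
        have h1 : i ∈ (rename i.succAbove q).vars := by
          classical
          rw [vars_def, Multiset.mem_toFinset]
          rw [degreeOf_def] at hne
          exact Multiset.count_ne_zero.mp hne
        have h2 := vars_rename i.succAbove q h1
        simp only [Finset.mem_image] at h2
        obtain ⟨j, _, hj⟩ := h2
        exact Fin.succAbove_ne i j hj
      rw [hc, degreeOf_mul_eq hg.ne_zero hc0] at hd
      omega

/-- dimension formula -/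
theorem td_minimalPrime_domain [IsDomain A] [Algebra.FiniteType k A] {f : A} (hf : f ≠ 0)
    {P : Ideal A} (hP : P ∈ (Ideal.span {f}).minimalPrimes) : td k (A ⧸ P) + 1 = td k A := by
  have : IsNoetherianRing A := Algebra.FiniteType.isNoetherianRing k A
  have hPp : P.IsPrime := hP.1.1
  obtain ⟨r, g, ginj, gint⟩ := exists_integral_inj_algHom_of_fg k A
  rw [← td_eq_of_integral g ginj gint, td_mvPoly]
  let _ := g.toRingHom.toAlgebra
  have : FaithfulSMul (MvPolynomial (Fin r) k) A := (faithfulSMul_iff_algebraMap_injective _ _).mpr ginj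
  have : Algebra.IsIntegral (MvPolynomial (Fin r) k) A := ⟨gint⟩
  let p := P.under (MvPolynomial (Fin r) k)
  have hfP : f ∈ P := hP.1.2 (Ideal.mem_span_singleton_self f)
  have hp : p ≠ ⊥ := Ideal.comap_ne_bot_of_integral_mem hf hfP (gint f)
  obtain ⟨q, hqp, hq⟩ := Ideal.IsPrime.exists_mem_prime_of_ne_bot (I := p) inferInstance hp
  have hqs : (Ideal.span {q}).IsPrime := (Ideal.span_singleton_prime hq.ne_zero).mpr hq
  have hle : Ideal.span {q} ≤ p := by rwa [Ideal.span_singleton_le_iff_mem]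
  have hpq : Ideal.span {q} = p := by
    by_contra hne
    have hlt : Ideal.span {q} < p := lt_of_le_of_ne hle hne
    obtain ⟨P2, hP2lt, hP2, hlo⟩ := Ideal.exists_ideal_lt_liesOver_of_lt (S := A) P hlt
    have h0 : (⊥ : Ideal A) < P2 := by
      rw [bot_lt_iff_ne_bot]
      rintro rfl
      have h1 : q ∈ (⊥ : Ideal A).under (MvPolynomial (Fin r) k) := by
        rw [← hlo.over]; exact Ideal.mem_span_singleton_self q
      have h2 : g q = 0 := h1
      exact hq.ne_zero (ginj (by rw [h2, map_zero]))
    have e1 := Ideal.height_add_one_le_of_lt_of_isPrime h0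
    have e2 := Ideal.height_add_one_le_of_lt_of_isPrime hP2lt
    have e3 := Ideal.height_le_one_of_isPrincipal_of_mem_minimalPrimes (Ideal.span {f}) P hP
    have e4 : (1 : ℕ∞) ≤ P2.height := le_trans (by simp) e1
    have : (1 : ℕ∞) + 1 ≤ 1 := le_trans (add_le_add_left e4 1) (e2.trans e3)
    exact absurd this (by decide)
  rw [← td_hypersurface (k := k) q hq]
  congr 1
  symm
  let ψ : (MvPolynomial (Fin r) k ⧸ Ideal.span {q}) →ₐ[k] (A ⧸ P) :=
    Ideal.quotientMapₐ P g (hle)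
  refine td_eq_of_integral ψ ?_ ?_
  · exact Ideal.quotientMap_injective' (H := hle) hpq.ge
  · intro x
    obtain ⟨x, rfl⟩ := Ideal.Quotient.mk_surjective x
    obtain ⟨F, hF, h0⟩ := gint x
    refine ⟨F.map (Ideal.Quotient.mk _), hF.map _, ?_⟩
    rw [Polynomial.eval₂_map]
    have : (ψ.toRingHom.comp (Ideal.Quotient.mk (Ideal.span {q}))) =
      (Ideal.Quotient.mk P).comp g.toRingHom := RingHom.ext fun _ => rfl
    change Polynomial.eval₂ (ψ.toRingHom.comp (Ideal.Quotient.mk (Ideal.span {q}))) _ F = 0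
    rw [this, ← Polynomial.hom_eval₂, h0, map_zero]

theorem td_minimalPrime [Algebra.FiniteType k A] {P P' : Ideal A} [hPp : P.IsPrime] {f : A}
    (hf : f ∉ P) (hP' : P' ∈ (P ⊔ Ideal.span {f}).minimalPrimes) :
    td k (A ⧸ P') + 1 = td k (A ⧸ P) := by
  have hle : P ≤ P' := le_sup_left.trans hP'.1.2
  have hPp' : P'.IsPrime := hP'.1.1
  have hs : Function.Surjective (Ideal.Quotient.mk P) := Ideal.Quotient.mk_surjective
  have hker : RingHom.ker (Ideal.Quotient.mk P) ≤ P' := by rwa [Ideal.mk_ker]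
  have h1 : P'.map (Ideal.Quotient.mk P) ∈ (Ideal.span {Ideal.Quotient.mk P f}).minimalPrimes := by
    refine ⟨⟨Ideal.map_isPrime_of_surjective hs hker, ?_⟩, ?_⟩
    · rw [Ideal.span_singleton_le_iff_mem]
      exact Ideal.mem_map_of_mem _ (hP'.1.2 (Ideal.mem_sup_right (Ideal.mem_span_singleton_self f)))
    · rintro J ⟨hJ, hfJ⟩ hJP
      rw [Ideal.map_le_iff_le_comap]
      apply hP'.2
      · refine ⟨hJ.comap _, ?_⟩
        rw [sup_le_iff]
        constructor
        · intro x hx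
          rw [Ideal.mem_comap, Ideal.Quotient.eq_zero_iff_mem.mpr hx]; exact J.zero_mem
        · rw [Ideal.span_singleton_le_iff_mem]
          exact hfJ (Ideal.mem_span_singleton_self _)
      · calc J.comap _ ≤ (P'.map (Ideal.Quotient.mk P)).comap (Ideal.Quotient.mk P) :=
              Ideal.comap_mono hJP
          _ = P' := by rw [Ideal.comap_map_of_surjective' _ hs, sup_eq_left.mpr hker]
  have h2 := td_minimalPrime_domain (k := k) (f := Ideal.Quotient.mk P f)
    (by rwa [Ne, Ideal.Quotient.eq_zero_iff_mem]) h1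
  rw [← h2]
  congr 1
  exact (td_eq_of_equiv (DoubleQuot.quotQuotEquivQuotOfLEₐ k hle)).symm

end B1
end Bert


namespace Bert
section B2
variable {k : Type} [Field k] {n : ℕ}

/-- homogeneous ideals -/
def IsHom (J : Ideal (MvPolynomial (Fin (n+1)) k)) : Prop := ∀ f ∈ J, ∀ i, homogeneousComponent i f ∈ J

attribute [local instance] MvPolynomial.gradedAlgebra

lemma isHom_iff (J : Ideal (MvPolynomial (Fin (n+1)) k)) :
    IsHom J ↔ J.IsHomogeneous (homogeneousSubmodule (Fin (n+1)) k) := by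
  constructor
  · intro h i r hr
    have := h r hr i
    rw [← decomposition.decompose'_apply] at this
    exact this
  · intro h f hf i
    exact homogeneousComponent_mem_of_mem h hf i

lemma IsHom.mem_iff {J : Ideal (MvPolynomial (Fin (n+1)) k)} (h : IsHom J) (f : MvPolynomial (Fin (n+1)) k) :
    f ∈ J ↔ ∀ i, homogeneousComponent i f ∈ J :=
  mem_iff_homogeneousComponent_mem ((isHom_iff J).1 h) f

lemma IsHom.sup {J J' : Ideal (MvPolynomial (Fin (n+1)) k)} (h : IsHom J) (h' : IsHom J') : IsHom (J ⊔ J') := by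
  rw [isHom_iff] at *; exact h.sup h'

lemma isHom_span {s : Set (MvPolynomial (Fin (n+1)) k)} (h : ∀ f ∈ s, ∃ m, f.IsHomogeneous m) :
    IsHom (Ideal.span s) := by
  rw [isHom_iff]
  apply Ideal.homogeneous_span
  intro f hf
  obtain ⟨m, hm⟩ := h f hf
  exact ⟨m, hm⟩

lemma IsHom.isPrime {J : Ideal (MvPolynomial (Fin (n+1)) k)} (h : IsHom J) (h1 : J ≠ ⊤)
    (h2 : ∀ x y : MvPolynomial (Fin (n+1)) k, ∀ a b, x.IsHomogeneous a → y.IsHomogeneous b → x * y ∈ J → x ∈ J ∨ y ∈ J) :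
    J.IsPrime := by
  apply Ideal.IsHomogeneous.isPrime_of_homogeneous_mem_or_mem ((isHom_iff J).1 h) h1
  rintro x y ⟨a, ha⟩ ⟨b, hb⟩ hxy
  exact h2 x y a b ha hb hxy

lemma IsHom.minimalPrimes {J P : Ideal (MvPolynomial (Fin (n+1)) k)} (h : IsHom J) (hP : P ∈ J.minimalPrimes) :
    IsHom P := by
  have h0 := (isHom_iff J).1 h
  have hp : P.IsPrime := hP.1.1
  rw [isHom_iff, Ideal.IsHomogeneous.iff_eq]
  have hc := hp.homogeneousCore (𝒜 := homogeneousSubmodule (Fin (n+1)) k)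
  refine le_antisymm (Ideal.toIdeal_homogeneousCore_le _ _) (hP.2 ⟨hc, ?_⟩
    (Ideal.toIdeal_homogeneousCore_le _ _))
  rw [← h0.toIdeal_homogeneousCore_eq_self]
  exact Ideal.homogeneousCore_mono _ hP.1.2

/-- the affine cone over the zero set -/
def Cone (J : Ideal (MvPolynomial (Fin (n+1)) k)) : Set (Fin (n+1) → k) := {v | v ≠ 0 ∧ ∀ f ∈ J, eval v f = 0}

lemma eval_smul_hom {f : MvPolynomial (Fin (n+1)) k} {m : ℕ} (hf : f.IsHomogeneous m) (a : k) (v : Fin (n+1) → k) :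
    eval (a • v) f = a ^ m * eval v f := by
  rw [eval_eq', eval_eq', Finset.mul_sum]
  refine Finset.sum_congr rfl fun c hc => ?_
  have hdeg : ∑ i, c i = m := by
    have := hf (mem_support_iff.1 hc)
    rw [← this, Finsupp.weight_apply, Finsupp.sum_fintype] <;> simp
  simp only [Pi.smul_apply, smul_eq_mul, mul_pow, Finset.prod_mul_distrib, Finset.prod_pow_eq_pow_sum,
    hdeg]
  ring

lemma eval_smul_sum (f : MvPolynomial (Fin (n+1)) k) (a : k) (v : Fin (n+1) → k) :
    eval (a • v) f = ∑ i ∈ Finset.range (f.totalDegree + 1),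
      a ^ i * eval v (homogeneousComponent i f) := by
  conv_lhs => rw [← sum_homogeneousComponent f]
  rw [map_sum]
  refine Finset.sum_congr rfl fun i _ => ?_
  rw [eval_smul_hom (homogeneousComponent_isHomogeneous i f)]

lemma eval_comp_zero [Infinite k] (f : MvPolynomial (Fin (n+1)) k) (v : Fin (n+1) → k)
    (h : ∀ a : k, a ≠ 0 → eval (a • v) f = 0) (i : ℕ) :
    eval v (homogeneousComponent i f) = 0 := by
  by_cases hi : i < f.totalDegree + 1
  swap
  · rw [homogeneousComponent_eq_zero]; simp; omega
  set p : Polynomial k := ∑ i ∈ Finset.range (f.totalDegree + 1),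
      Polynomial.C (eval v (homogeneousComponent i f)) * Polynomial.X ^ i with hp
  have hp0 : p * Polynomial.X = 0 := by
    apply Polynomial.funext
    intro a
    by_cases ha : a = 0
    · simp [ha]
    · have := h a ha
      rw [eval_smul_sum] at this
      simp only [hp, Polynomial.eval_mul, Polynomial.eval_finsetSum, Polynomial.eval_C,
        Polynomial.eval_pow, Polynomial.eval_X, Polynomial.eval_zero]
      simp only [mul_comm (eval v _)]
      rw [this, zero_mul]
  have hp1 : p = 0 := by simpa using hp0
  have := congrArg (fun q => Polynomial.coeff q i) hp1
  simp only [hp, Polynomial.finsetSum_coeff, Polynomial.coeff_C_mul_X_pow, Polynomial.coeff_zero] at this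
  rw [Finset.sum_ite_eq] at this
  simpa [hi] using this

lemma exists_hom_component {f : MvPolynomial (Fin (n+1)) k} {v : Fin (n+1) → k} (h : eval v f ≠ 0) :
    ∃ i, eval v (homogeneousComponent i f) ≠ 0 := by
  by_contra! hc
  apply h
  rw [← sum_homogeneousComponent f, map_sum]
  exact Finset.sum_eq_zero fun i _ => hc i

lemma Cone.smul {J : Ideal (MvPolynomial (Fin (n+1)) k)} (h : IsHom J) {v : Fin (n+1) → k} (hv : v ∈ Cone J)
    {a : k} (ha : a ≠ 0) : a • v ∈ Cone J := by
  refine ⟨smul_ne_zero ha hv.1, fun f hf => ?_⟩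
  rw [eval_smul_sum]
  exact Finset.sum_eq_zero fun i _ => by rw [hv.2 _ (h f hf i), mul_zero]

lemma Cone.mono {J J' : Ideal (MvPolynomial (Fin (n+1)) k)} (h : J ≤ J') : Cone J' ⊆ Cone J :=
  fun _ hv => ⟨hv.1, fun f hf => hv.2 f (h hf)⟩

lemma mem_vI (S : Set (ProjPt k n)) (f : MvPolynomial (Fin (n+1)) k) : f ∈ _root_.vanishingIdeal S ↔
    ∀ v (hv : v ≠ 0), Projectivization.mk k v hv ∈ S → eval v f = 0 := by
  constructor
  · intro h v hv hS; exact h _ hS v hv rfl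
  · rintro h x hx v hv rfl; exact h v hv hx

lemma vI_hom [Infinite k] (S : Set (ProjPt k n)) : IsHom (_root_.vanishingIdeal S) := by
  intro f hf i
  rw [mem_vI] at *
  intro v hv hS
  apply eval_comp_zero
  intro a ha
  apply hf _ (smul_ne_zero ha hv)
  have : Projectivization.mk k (a • v) (smul_ne_zero ha hv) = Projectivization.mk k v hv := by
    rw [Projectivization.mk_eq_mk_iff']; exact ⟨a, rfl⟩
  rwa [this]

lemma vanishesAt_mk_iff {f : MvPolynomial (Fin (n+1)) k} {m : ℕ} (hf : f.IsHomogeneous m) {v} (hv : v ≠ 0) :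
    VanishesAt f (Projectivization.mk k v hv) ↔ eval v f = 0 := by
  constructor
  · intro h; exact h v hv rfl
  · intro h w hw hwv
    rw [Projectivization.mk_eq_mk_iff'] at hwv
    obtain ⟨a, rfl⟩ := hwv
    rw [eval_smul_hom hf, h, mul_zero]

lemma closed_mem_iff {Y : Set (ProjPt k n)} (hY : IsClosedSub Y) {v} (hv : v ≠ 0) :
    Projectivization.mk k v hv ∈ Y ↔ v ∈ Cone (_root_.vanishingIdeal Y) := by
  constructor
  · intro h; exact ⟨hv, fun f hf => (mem_vI Y f).1 hf v hv h⟩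
  · rintro ⟨_, h⟩
    obtain ⟨T, hT, rfl⟩ := hY
    intro f hf
    obtain ⟨m, hm⟩ := hT f hf
    rw [vanishesAt_mk_iff hm]
    apply h
    intro x hx
    exact hx f hf

lemma closed_projZero {J : Ideal (MvPolynomial (Fin (n+1)) k)} (hJ : IsHom J) :
    IsClosedSub (projZeroLocus (J : Set (MvPolynomial (Fin (n+1)) k))) ∧
    ∀ v (hv : v ≠ 0), Projectivization.mk k v hv ∈ projZeroLocus (J : Set (MvPolynomial (Fin (n+1)) k)) ↔ v ∈ Cone J := by
  have key : ∀ v (hv : v ≠ 0),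
      Projectivization.mk k v hv ∈ projZeroLocus (J : Set (MvPolynomial (Fin (n+1)) k)) ↔ v ∈ Cone J := by
    intro v hv
    constructor
    · intro h; exact ⟨hv, fun f hf => h f hf v hv rfl⟩
    · rintro h f hf w hw hwv
      rw [Projectivization.mk_eq_mk_iff'] at hwv
      obtain ⟨a, rfl⟩ := hwv
      have ha : a ≠ 0 := by rintro rfl; simp at hw
      exact (Cone.smul hJ h ha).2 f hf
  refine ⟨⟨{f | f ∈ J ∧ ∃ m, f.IsHomogeneous m}, fun f hf => hf.2, ?_⟩, key⟩
  ext x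
  constructor
  · intro h f hf; exact h f hf.1
  · intro h
    induction x using Projectivization.ind with
    | h v hv =>
      rw [key]
      refine ⟨hv, fun f hf => ?_⟩
      rw [← sum_homogeneousComponent f, map_sum]
      refine Finset.sum_eq_zero fun i _ => ?_
      exact h _ ⟨hJ f hf i, i, homogeneousComponent_isHomogeneous i f⟩ v hv rfl

lemma vI_prime [Infinite k] {Y : Set (ProjPt k n)} (hY : IsIrredSub Y) :
    (_root_.vanishingIdeal Y).IsPrime := by
  apply (vI_hom Y).isPrime
  · rw [Ideal.ne_top_iff_one]
    intro h
    obtain ⟨x, hx⟩ := hY.1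
    have := h x hx x.rep x.rep_nonzero x.mk_rep
    simp at this
  · intro x y a b ha hb hxy
    have hs : ∀ (z : MvPolynomial (Fin (n+1)) k) (m : ℕ), z.IsHomogeneous m → IsClosedSub (projZeroLocus {z}) :=
      fun z m hz => ⟨{z}, by rintro _ rfl; exact ⟨m, hz⟩, rfl⟩
    have hm : ∀ z : MvPolynomial (Fin (n+1)) k, Y ⊆ projZeroLocus {z} → z ∈ _root_.vanishingIdeal Y :=
      fun z hz p hp => hz hp z rfl
    refine (hY.2 _ _ (hs x a ha) (hs y b hb) ?_).imp (hm x) (hm y)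
    intro p hp
    induction p using Projectivization.ind with
    | h v hv =>
      have := (mem_vI Y _).1 hxy v hv hp
      rw [map_mul, mul_eq_zero] at this
      refine this.imp ?_ ?_
      · rintro h _ rfl; rwa [vanishesAt_mk_iff ha]
      · rintro h _ rfl; rwa [vanishesAt_mk_iff hb]

/-- a prime is nonirrelevant when some variable is not in it -/
lemma cone_vanish [IsAlgClosed k] {Q : Ideal (MvPolynomial (Fin (n+1)) k)} (hQ : Q.IsPrime) {i : Fin (n+1)}
    (hi : X i ∉ Q) {f : MvPolynomial (Fin (n+1)) k} (hf : ∀ v ∈ Cone Q, eval v f = 0) : f ∈ Q := by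
  have h : X i * f ∈ MvPolynomial.vanishingIdeal k (zeroLocus k Q) := by
    rw [MvPolynomial.mem_vanishingIdeal_iff]
    intro v hv
    by_cases h0 : v = 0
    · subst h0; simp
    · have : eval v f = 0 := hf v ⟨h0, fun g hg => by simpa [aeval_eq_eval] using hv g hg⟩
      simp [aeval_eq_eval, this]
  rw [MvPolynomial.IsPrime.vanishingIdeal_zeroLocus] at h
  exact (hQ.mem_or_mem h).resolve_left hi

lemma cone_nonempty [IsAlgClosed k] {Q : Ideal (MvPolynomial (Fin (n+1)) k)} (hQ : Q.IsPrime) {i : Fin (n+1)}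
    (hi : X i ∉ Q) : ∃ v ∈ Cone Q, v i ≠ 0 := by
  by_contra! h
  exact hi (cone_vanish hQ hi fun v hv => by simpa using h v hv)

lemma projZero_props [IsAlgClosed k] {Q : Ideal (MvPolynomial (Fin (n+1)) k)} (hQ : Q.IsPrime) (hh : IsHom Q)
    {i : Fin (n+1)} (hi : X i ∉ Q) :
    IsClosedSub (projZeroLocus (Q : Set (MvPolynomial (Fin (n+1)) k))) ∧
    IsIrredSub (projZeroLocus (Q : Set (MvPolynomial (Fin (n+1)) k))) ∧
    _root_.vanishingIdeal (projZeroLocus (Q : Set (MvPolynomial (Fin (n+1)) k))) = Q := by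
  obtain ⟨h1, h2⟩ := closed_projZero hh
  have h3 : _root_.vanishingIdeal (projZeroLocus (Q : Set (MvPolynomial (Fin (n+1)) k))) = Q := by
    ext f
    rw [mem_vI]
    constructor
    · intro h; exact cone_vanish hQ hi fun v hv => h v hv.1 ((h2 v hv.1).2 hv)
    · intro h v hv hv'; exact ((h2 v hv).1 hv').2 f h
  refine ⟨h1, ⟨?_, ?_⟩, h3⟩
  · obtain ⟨v, hv, _⟩ := cone_nonempty hQ hi
    exact ⟨_, (h2 v hv.1).2 hv⟩
  · intro C₁ C₂ hC₁ hC₂ hC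
    by_contra! hc
    obtain ⟨⟨x, hx, hx1⟩, ⟨y, hy, hy1⟩⟩ := And.imp Set.not_subset.1 Set.not_subset.1 hc
    have aux : ∀ (C : Set (ProjPt k n)) (x), IsClosedSub C → x ∈ projZeroLocus (Q : Set (MvPolynomial (Fin (n+1)) k)) →
        x ∉ C → ∃ f ∈ _root_.vanishingIdeal C, f ∉ Q := by
      intro C x hC hx hxC
      induction x using Projectivization.ind with
      | h v hv =>
        rw [closed_mem_iff hC] at hxC
        have : ∃ f ∈ _root_.vanishingIdeal C, eval v f ≠ 0 := by
          by_contra! hcon; exact hxC ⟨hv, hcon⟩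
        obtain ⟨f, hf, hfv⟩ := this
        exact ⟨f, hf, fun hfQ => hfv (((h2 v hv).1 hx).2 f hfQ)⟩
    obtain ⟨f, hf, hfQ⟩ := aux C₁ x hC₁ hx hx1
    obtain ⟨g, hg, hgQ⟩ := aux C₂ y hC₂ hy hy1
    have : f * g ∈ Q := by
      rw [← h3, mem_vI]
      intro v hv hvQ
      rw [map_mul, mul_eq_zero]
      rcases hC hvQ with h | h
      · left; exact (mem_vI _ _).1 hf v hv h
      · right; exact (mem_vI _ _).1 hg v hv h
    exact (hQ.mem_or_mem this).elim hfQ hgQ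

/-- ideal of a point -/
noncomputable def ptId (v : Fin (n+1) → k) : Ideal (MvPolynomial (Fin (n+1)) k) := RingHom.ker (eval v)

lemma mem_ptId {v : Fin (n+1) → k} {f : MvPolynomial (Fin (n+1)) k} : f ∈ ptId v ↔ eval v f = 0 := RingHom.mem_ker

instance ptId_max (v : Fin (n+1) → k) : (ptId v).IsMaximal :=
  RingHom.ker_isMaximal_of_surjective _ fun a => ⟨C a, by simp⟩

lemma ptId_eq_span (v : Fin (n+1) → k) :
    ptId v = Ideal.span (Set.range fun i => (X i - C (v i) : MvPolynomial (Fin (n+1)) k)) := by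
  apply le_antisymm
  · intro f hf
    set J := Ideal.span (Set.range fun i => (X i - C (v i) : MvPolynomial (Fin (n+1)) k))
    have : ∀ g : MvPolynomial (Fin (n+1)) k, g - C (eval v g) ∈ J := by
      intro g
      induction g using MvPolynomial.induction_on with
      | C a => simp
      | add p q hp hq =>
        have := J.add_mem hp hq
        rw [map_add, C_add]; convert this using 1; ring
      | mul_X p i hp =>
        have h1 : (X i - C (v i) : MvPolynomial (Fin (n+1)) k) ∈ J := Ideal.subset_span ⟨i, rfl⟩
        have := J.add_mem (J.mul_mem_left (X i) hp) (J.mul_mem_left (C (eval v p)) h1)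
        rw [map_mul, C_mul, eval_X]; convert this using 1; ring
    have := this f
    rwa [mem_ptId.1 hf, C_0, sub_zero] at this
  · rw [Ideal.span_le]
    rintro _ ⟨i, rfl⟩
    simp [mem_ptId]

lemma td_field_quot (v : Fin (n+1) → k) : td k (MvPolynomial (Fin (n+1)) k ⧸ ptId v) = 0 := by
  have hs : Function.Surjective (MvPolynomial.aeval (R := k) v) := fun a => ⟨C a, by simp⟩
  have hk : ptId v = RingHom.ker (MvPolynomial.aeval (R := k) v) := by
    ext f; rw [mem_ptId, RingHom.mem_ker, aeval_eq_eval]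
  have e : td k (MvPolynomial (Fin (n+1)) k ⧸ ptId v) = td k (MvPolynomial (Fin 0) k) := by
    rw [hk]
    exact td_eq_of_equiv ((Ideal.quotientKerAlgEquivOfSurjective hs).trans
      (MvPolynomial.isEmptyAlgEquiv k (Fin 0)).symm)
  rw [e, td_mvPoly]

lemma hom_le_ptId_zero {Q : Ideal (MvPolynomial (Fin (n+1)) k)} (hh : IsHom Q) (hQ : Q ≠ ⊤) : Q ≤ ptId 0 := by
  intro f hf
  rw [mem_ptId]
  have h := hh f hf 0
  rw [homogeneousComponent_zero] at h
  by_contra hc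
  apply hQ
  have h0 : eval 0 f = coeff 0 f := by
    rw [MvPolynomial.eval_zero]; rfl
  exact Ideal.eq_top_of_isUnit_mem _ h ((isUnit_iff_ne_zero.2 (h0 ▸ hc)).map C)

lemma td_zero_iff {Q : Ideal (MvPolynomial (Fin (n+1)) k)} (hQ : Q.IsPrime) (hh : IsHom Q) :
    td k (MvPolynomial (Fin (n+1)) k ⧸ Q) = 0 ↔ ∀ i, X i ∈ Q := by
  have hle := hom_le_ptId_zero hh hQ.ne_top
  constructor
  · intro h i
    by_contra hi
    have hlt : Q < ptId 0 := lt_of_le_of_ne hle fun h => hi (by rw [h, mem_ptId]; simp)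
    have := td_quot_lt (k := k) hlt
    omega
  · intro h
    have : Q = ptId 0 := by
      apply le_antisymm hle
      rw [ptId_eq_span, Ideal.span_le]
      rintro _ ⟨i, rfl⟩
      simpa using h i
    subst this
    exact td_field_quot 0

lemma exists_X_notMem {Q : Ideal (MvPolynomial (Fin (n+1)) k)} (hQ : Q.IsPrime) (hh : IsHom Q)
    (h : td k (MvPolynomial (Fin (n+1)) k ⧸ Q) ≠ 0) : ∃ i, X i ∉ Q := by
  by_contra! hc
  exact h ((td_zero_iff hQ hh).2 hc)

lemma irred_td_pos [IsAlgClosed k] {Y : Set (ProjPt k n)} (hY : IsIrredSub Y) :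
    td k (MvPolynomial (Fin (n+1)) k ⧸ _root_.vanishingIdeal Y) ≠ 0 := by
  rw [Ne, td_zero_iff (vI_prime hY) (vI_hom Y)]
  intro h
  obtain ⟨x, hx⟩ := hY.1
  apply x.rep_nonzero
  ext i
  have := h i x hx x.rep x.rep_nonzero x.mk_rep
  simpa using this

lemma inter_closed {C C' : Set (ProjPt k n)} (h : IsClosedSub C) (h' : IsClosedSub C') :
    IsClosedSub (C ∩ C') := by
  obtain ⟨T, hT, rfl⟩ := h
  obtain ⟨T', hT', rfl⟩ := h'
  refine ⟨T ∪ T', fun f hf => hf.elim (hT f) (hT' f), ?_⟩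
  ext x
  constructor
  · rintro ⟨h1, h2⟩ f (hf | hf)
    · exact h1 f hf
    · exact h2 f hf
  · intro h; exact ⟨fun f hf => h f (Or.inl hf), fun f hf => h f (Or.inr hf)⟩

lemma vI_anti {Y Y' : Set (ProjPt k n)} (h : Y ⊆ Y') :
    _root_.vanishingIdeal Y' ≤ _root_.vanishingIdeal Y := fun _ hf x hx => hf x (h hx)

lemma closed_subset_of_vI {Y Y' : Set (ProjPt k n)} (hY' : IsClosedSub Y')
    (h : _root_.vanishingIdeal Y' ≤ _root_.vanishingIdeal Y) : Y ⊆ Y' := by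
  intro x hx
  induction x using Projectivization.ind with
  | h v hv =>
    rw [closed_mem_iff hY']
    exact ⟨hv, fun f hf => (mem_vI Y f).1 (h hf) v hv hx⟩

lemma closed_eq_of_vI {Y Y' : Set (ProjPt k n)} (hY : IsClosedSub Y) (hY' : IsClosedSub Y')
    (h : _root_.vanishingIdeal Y' = _root_.vanishingIdeal Y) : Y = Y' :=
  (closed_subset_of_vI hY' h.le).antisymm (closed_subset_of_vI hY h.ge)

lemma dimGE_imp [IsAlgClosed k] {Y : Set (ProjPt k n)} (hc : IsClosedSub Y)
    {m : ℕ} (h : DimGE Y m) : m + 1 ≤ td k (MvPolynomial (Fin (n+1)) k ⧸ _root_.vanishingIdeal Y) := by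
  obtain ⟨c, hmono, hc'⟩ := h
  have hcl : ∀ i, IsClosedSub (c i) := fun i => by
    obtain ⟨_, ⟨C, hC, he⟩, _⟩ := hc' i
    rw [he]; exact inter_closed hC hc
  have key : ∀ j : ℕ, ∀ hj : j < m + 1,
      j + 1 ≤ td k (MvPolynomial (Fin (n+1)) k ⧸ _root_.vanishingIdeal (c ⟨j, hj⟩)) := by
    intro j
    induction j with
    | zero => intro hj; exact Nat.one_le_iff_ne_zero.2 (irred_td_pos (hc' _).2.2)
    | succ j ih =>
      intro hj
      have hj' : j < m + 1 := by omega
      have h1 := ih hj'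
      have hlt : c ⟨j, hj'⟩ < c ⟨j+1, hj⟩ := hmono (by simp)
      have hp := vI_prime (hc' ⟨j, hj'⟩).2.2
      have hp' := vI_prime (hc' ⟨j+1, hj⟩).2.2
      have := td_quot_lt (k := k) (P := _root_.vanishingIdeal (c ⟨j+1, hj⟩))
        (P' := _root_.vanishingIdeal (c ⟨j, hj'⟩))
        (lt_of_le_of_ne (vI_anti hlt.le) fun h => hlt.ne (closed_eq_of_vI (hcl _) (hcl _) h))
      omega
  have h1 := key m (by omega)
  refine h1.trans ?_
  have hle := vI_anti (hc' ⟨m, by omega⟩).1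
  exact td_le_of_surjective (Ideal.Quotient.factorₐ k hle)
    (Ideal.Quotient.factor_surjective hle)

lemma dimGE_of [IsAlgClosed k] (m : ℕ) : ∀ {Y : Set (ProjPt k n)}, IsClosedSub Y → IsIrredSub Y →
    m + 1 ≤ td k (MvPolynomial (Fin (n+1)) k ⧸ _root_.vanishingIdeal Y) → DimGE Y m := by
  induction m with
  | zero =>
    intro Y hc hi _
    exact ⟨fun _ => Y, fun a b h => absurd h (by have := a.2; have := b.2; simp only [Fin.lt_def]; omega),
      fun _ => ⟨le_rfl, ⟨Y, hc, (Set.inter_self Y).symm⟩, hi⟩⟩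
  | succ m ih =>
    intro Y hc hi htd
    have hp := vI_prime hi
    obtain ⟨i, hiX⟩ := exists_X_notMem hp (vI_hom Y) (irred_td_pos hi)
    have hne : _root_.vanishingIdeal Y ⊔ Ideal.span {(X i : MvPolynomial (Fin (n+1)) k)} ≠ ⊤ := by
      intro h
      have hle : _root_.vanishingIdeal Y ⊔ Ideal.span {(X i : MvPolynomial (Fin (n+1)) k)} ≤ ptId 0 := by
        apply sup_le (hom_le_ptId_zero (vI_hom Y) hp.ne_top)
        rw [Ideal.span_singleton_le_iff_mem, mem_ptId]; simp
      rw [h] at hle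
      exact (ptId_max (0 : Fin (n+1) → k)).ne_top (top_le_iff.1 hle)
    obtain ⟨Q, hQ⟩ := Ideal.nonempty_minimalPrimes hne
    have hQp : Q.IsPrime := hQ.1.1
    have hQh : IsHom Q := ((vI_hom Y).sup (isHom_span (by
      rintro _ rfl; exact ⟨1, isHomogeneous_X k i⟩))).minimalPrimes hQ
    have h1 := td_minimalPrime (k := k) hiX hQ
    obtain ⟨j, hj⟩ := exists_X_notMem hQp hQh (by omega)
    obtain ⟨c1, c2, c3⟩ := projZero_props hQp hQh hj
    obtain ⟨c, hmono, hcc⟩ := ih c1 c2 (by rw [c3]; omega)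
    have hle : _root_.vanishingIdeal Y ≤ Q := le_sup_left.trans hQ.1.2
    have hYs : projZeroLocus (Q : Set (MvPolynomial (Fin (n+1)) k)) ⊆ Y :=
      closed_subset_of_vI hc (by rw [c3]; exact hle)
    have hYne : projZeroLocus (Q : Set (MvPolynomial (Fin (n+1)) k)) ≠ Y := by
      intro h
      rw [h] at c3
      exact hiX (c3 ▸ hQ.1.2 (Ideal.mem_sup_right (Ideal.mem_span_singleton_self _)))
    refine ⟨Fin.snoc (α := fun _ => Set (ProjPt k n)) c Y, ?_, ?_⟩
    · intro a b hab
      induction b using Fin.lastCases with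
      | last =>
        induction a using Fin.lastCases with
        | last => exact absurd hab (lt_irrefl _)
        | cast a =>
          simp only [Fin.snoc_castSucc, Fin.snoc_last]
          exact lt_of_le_of_lt (hcc a).1 (lt_of_le_of_ne hYs hYne)
      | cast b =>
        induction a using Fin.lastCases with
        | last => exact absurd hab (by simp only [Fin.lt_def, Fin.val_last, Fin.val_castSucc]; omega)
        | cast a =>
          simp only [Fin.snoc_castSucc]
          exact hmono (by simpa using hab)
    · intro a
      induction a using Fin.lastCases with
      | last => simp only [Fin.snoc_last]; exact ⟨le_rfl, ⟨Y, hc, (Set.inter_self Y).symm⟩, hi⟩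
      | cast a =>
        simp only [Fin.snoc_castSucc]
        obtain ⟨a1, ⟨C, hC, a2⟩, a3⟩ := hcc a
        have hcl : IsClosedSub (c a) := by rw [a2]; exact inter_closed hC c1
        exact ⟨a1.trans hYs, ⟨c a, hcl, (Set.inter_eq_left.2 (a1.trans hYs)).symm⟩, a3⟩

lemma hasDim_iff [IsAlgClosed k] {Y : Set (ProjPt k n)} (hc : IsClosedSub Y) (hi : IsIrredSub Y)
    (e : ℕ) : HasDim Y e ↔ td k (MvPolynomial (Fin (n+1)) k ⧸ _root_.vanishingIdeal Y) = e + 1 := by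
  constructor
  · rintro ⟨h1, h2⟩
    have a1 := dimGE_imp hc h1
    by_contra h
    exact h2 (dimGE_of _ hc hi (by omega))
  · intro h
    exact ⟨dimGE_of _ hc hi h.ge, fun h' => by have := dimGE_imp hc h'; omega⟩

end B2
end Bert


namespace Bert
section B3
variable {k : Type} [Field k] {n : ℕ}

lemma comp_mul_hom (g : MvPolynomial (Fin (n+1)) k) {l : MvPolynomial (Fin (n+1)) k} {e : ℕ} (hl : l.IsHomogeneous e) (i : ℕ) :
    homogeneousComponent (i + e) (g * l) = homogeneousComponent i g * l := by
  conv_lhs => rw [← sum_homogeneousComponent g, Finset.sum_mul, map_sum]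
  have h : ∀ j, homogeneousComponent (i + e) (homogeneousComponent j g * l) =
      if j = i then homogeneousComponent i g * l else 0 := by
    intro j
    rw [homogeneousComponent_of_mem ((homogeneousComponent_isHomogeneous j g).mul hl)]
    by_cases hj : j = i
    · subst hj; simp
    · rw [if_neg (by omega), if_neg hj]
  simp_rw [h]
  rw [Finset.sum_ite_eq']
  split_ifs with hi
  · rfl
  · rw [homogeneousComponent_eq_zero, zero_mul]
    simpa using hi

/-- linear forms centred at a point -/
noncomputable def Lv (w : Fin (n+1) → k) : (Fin (n+1) → k) →ₗ[k] MvPolynomial (Fin (n+1)) k :=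
  Fintype.linearCombination k (fun i => (X i - C (w i) : MvPolynomial (Fin (n+1)) k))

lemma Lv_apply (w l : Fin (n+1) → k) : Lv w l = ∑ i, l i • (X i - C (w i) : MvPolynomial (Fin (n+1)) k) := by
  simp [Lv, Fintype.linearCombination_apply]

lemma Lv_single (w : Fin (n+1) → k) (i : Fin (n+1)) : Lv w (Pi.single i 1) = X i - C (w i) := by
  simp [Lv]

lemma Lv_mem (w l : Fin (n+1) → k) : Lv w l ∈ ptId w := by
  rw [Lv_apply, mem_ptId]; simp [smul_eval]

lemma Lv_zero_hom (l : Fin (n+1) → k) : (Lv 0 l : MvPolynomial (Fin (n+1)) k).IsHomogeneous 1 := by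
  rw [Lv_apply]
  refine IsHomogeneous.sum _ _ _ fun i _ => ?_
  rw [smul_eq_C_mul]
  simpa using (isHomogeneous_C (Fin (n+1)) (l i)).mul (isHomogeneous_X k i)

lemma eval_Lv (w l u : Fin (n+1) → k) : eval u (Lv w l : MvPolynomial (Fin (n+1)) k) = ∑ i, l i * (u i - w i) := by
  rw [Lv_apply]; simp [smul_eval]

lemma Lv_eq (w l : Fin (n+1) → k) :
    (Lv w l : MvPolynomial (Fin (n+1)) k) = Lv 0 l - C (eval w (Lv 0 l : MvPolynomial (Fin (n+1)) k)) := by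
  rw [eval_Lv, Lv_apply, Lv_apply, map_sum, ← Finset.sum_sub_distrib]
  refine Finset.sum_congr rfl fun i _ => ?_
  simp [smul_eq_C_mul]; ring

lemma ptId_le_of_Lv {w : Fin (n+1) → k} {P : Ideal (MvPolynomial (Fin (n+1)) k)} (h : ∀ l, Lv w l ∈ P) :
    ptId w ≤ P := by
  rw [ptId_eq_span, Ideal.span_le]
  rintro _ ⟨i, rfl⟩
  have := h (Pi.single i 1)
  rwa [Lv_single] at this

/-- Taylor -/
lemma taylor (v : Fin (n+1) → k) (f : MvPolynomial (Fin (n+1)) k) :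
    f - C (eval v f) - Lv v (gradientAt f v) ∈ (ptId v) ^ 2 := by
  induction f using MvPolynomial.induction_on with
  | C a =>
    have : gradientAt (C a : MvPolynomial (Fin (n+1)) k) v = 0 := by ext; simp [gradientAt]
    simp [this]
  | add p q hp hq =>
    have : gradientAt (p + q : MvPolynomial (Fin (n+1)) k) v = gradientAt p v + gradientAt q v := by
      ext; simp [gradientAt]
    rw [this]
    have := add_mem hp hq
    convert this using 1
    simp; ring
  | mul_X p i hp =>
    have : gradientAt (p * X i : MvPolynomial (Fin (n+1)) k) v = v i • gradientAt p v + eval v p • Pi.single i 1 := by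
      ext j
      simp [gradientAt, pderiv_X, Pi.single_apply, apply_ite (eval v)]
      by_cases h : i = j
      · subst h; simp; ring
      · simp [h, Ne.symm h]
    rw [this]
    have h1 : (p - C (eval v p)) * (X i - C (v i)) ∈ (ptId v) ^ 2 := by
      rw [pow_two]
      apply Ideal.mul_mem_mul <;> simp [mem_ptId]
    have := add_mem h1 (Ideal.mul_mem_left _ (C (v i)) hp)
    convert this using 1
    rw [map_add, map_smul, map_smul, Lv_single]
    simp [smul_eq_C_mul]; ring

/-- avoiding finitely many proper subspaces -/
lemma avoid [Infinite k] {E : Type} [AddCommGroup E] [Module k E] {ι : Type} (s : Set ι)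
    (hs : s.Finite) (p : ι → Submodule k E) (hp : ∀ i ∈ s, p i ≠ ⊤) :
    ∃ x, ∀ i ∈ s, x ∉ p i := by
  classical
  have h := Subspace.biUnion_ne_univ_of_top_notMem (k := k) (E := E) (s := hs.toFinset.image p)
    (by simpa using fun i hi => hp i hi)
  rw [Set.ne_univ_iff_exists_notMem] at h
  obtain ⟨x, hx⟩ := h
  refine ⟨x, fun i hi hx' => hx ?_⟩
  simp only [Set.mem_iUnion]
  exact ⟨p i, by simpa using ⟨i, hi, rfl⟩, hx'⟩

/-- selection of linear forms -/
lemma select [Infinite k] {Q : Ideal (MvPolynomial (Fin (n+1)) k)} [hQ : Q.IsPrime] {d : ℕ}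
    (hd : td k (MvPolynomial (Fin (n+1)) k ⧸ Q) = d) (v : Fin (n+1) → k) (N : Submodule k (Fin (n+1) → k))
    (hN : n ≤ d + Module.finrank k N) (r : ℕ) :
    ∃ y : Fin r → (Fin (n+1) → k),
      (∀ w, (w = 0 ∨ w = v) → ∀ P ∈ (Q ⊔ Ideal.span (Lv w '' Set.range y)).minimalPrimes,
        P = ptId w ∨ td k (MvPolynomial (Fin (n+1)) k ⧸ P) + r ≤ d) ∧
      (N ⊔ Submodule.span k (Set.range y) = ⊤ ∨
        n + r ≤ d + Module.finrank k ↥(N ⊔ Submodule.span k (Set.range y))) := by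
  induction r with
  | zero =>
    refine ⟨Fin.elim0, ?_, Or.inr ?_⟩
    · intro w _ P hP
      simp only [Set.range_eq_empty, Set.image_empty, Ideal.span_empty, sup_bot_eq] at hP
      rw [Ideal.minimalPrimes_eq_subsingleton_self] at hP
      rw [Set.mem_singleton_iff.1 hP]; right; omega
    · rw [Set.range_eq_empty, Submodule.span_empty, sup_bot_eq]; simpa using hN
  | succ r ih =>
    obtain ⟨y, hy1, hy2⟩ := ih
    -- subspaces to avoid
    let W : Submodule k (Fin (n+1) → k) := N ⊔ Submodule.span k (Set.range y)
    let s1 : Set ((Fin (n+1) → k) × Ideal (MvPolynomial (Fin (n+1)) k)) :=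
      ⋃ w ∈ ({0, v} : Set (Fin (n+1) → k)),
        (fun P => (w, P)) '' {P ∈ (Q ⊔ Ideal.span (Lv w '' Set.range y)).minimalPrimes | P ≠ ptId w}
    have hs1 : s1.Finite := by
      refine Set.Finite.biUnion (by simp) fun w _ => Set.Finite.image _ ?_
      exact (Ideal.finite_minimalPrimes_of_isNoetherianRing _ _).subset (Set.sep_subset _ _)
    let p : Option ((Fin (n+1) → k) × Ideal (MvPolynomial (Fin (n+1)) k)) → Submodule k (Fin (n+1) → k) := fun o =>
      match o with
      | none => if W = ⊤ then ⊥ else W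
      | some (w, P) => (P.restrictScalars k).comap (Lv w)
    have hnt : (⊥ : Submodule k (Fin (n+1) → k)) ≠ ⊤ := bot_ne_top
    obtain ⟨l, hl⟩ := avoid (k := k) (insert none (some '' s1)) ((hs1.image _).insert _) p (by
      rintro o (rfl | ⟨⟨w, P⟩, hwP, rfl⟩)
      · simp only [p]
        split_ifs with h
        · exact hnt
        · exact h
      · simp only [s1, Set.mem_iUnion, Set.mem_image, Prod.mk.injEq] at hwP
        obtain ⟨w', hw', P', ⟨hP', hne⟩, rfl, rfl⟩ := hwP
        intro htop
        apply hne
        have hle : ptId w' ≤ P' := ptId_le_of_Lv (fun l => by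
          have : l ∈ p (some (w', P')) := by rw [htop]; trivial
          exact this)
        exact ((ptId_max w').eq_of_le hP'.1.1.ne_top hle).symm)
    refine ⟨Fin.cons l y, ?_, ?_⟩
    · intro w hw P' hP'
      rw [Fin.range_cons, Set.image_insert_eq, Ideal.span_insert] at hP'
      have hP'p : P'.IsPrime := hP'.1.1
      have hle : Q ⊔ Ideal.span (Lv w '' Set.range y) ≤ P' :=
        le_trans (sup_le_sup_left le_sup_right _) hP'.1.2
      have hl' : Lv w l ∈ P' := hP'.1.2 (Ideal.mem_sup_right (Ideal.mem_sup_left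
        (Ideal.mem_span_singleton_self _)))
      obtain ⟨P, hP, hPP'⟩ := Ideal.exists_minimalPrimes_le hle
      have hPp : P.IsPrime := hP.1.1
      by_cases hPw : P = ptId w
      · left
        subst hPw
        exact ((ptId_max w).eq_of_le hP'p.ne_top hPP').symm
      · right
        have h1 : Lv w l ∉ P := by
          refine hl (some (w, P)) (Or.inr ⟨(w, P), ?_, rfl⟩)
          simp only [s1, Set.mem_iUnion]
          exact ⟨w, by simpa using hw, P, ⟨hP, hPw⟩, rfl⟩
        have hlt : P < P' := lt_of_le_of_ne hPP' (fun h => h1 (h ▸ hl'))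
        have := td_quot_lt (k := k) hlt
        rcases hy1 w hw P hP with h | h
        · exact absurd h hPw
        · omega
    · rw [Fin.range_cons]
      have hsub : N ⊔ Submodule.span k (insert l (Set.range y)) = W ⊔ Submodule.span k {l} := by
        rw [Submodule.span_insert, sup_comm (Submodule.span k {l}), ← sup_assoc]
      rw [hsub]
      by_cases hW : W = ⊤
      · left; rw [hW]; simp
      · right
        have hlW : l ∉ W := by
          have := hl none (Or.inl rfl)
          simpa [p, hW] using this
        have hlt : W < W ⊔ Submodule.span k {l} := by
          refine lt_of_le_of_ne le_sup_left fun h => hlW ?_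
          rw [h]; exact Submodule.mem_sup_right (Submodule.mem_span_singleton_self _)
        have h2 := Submodule.finrank_lt_finrank_of_lt hlt
        rcases hy2 with h | h
        · exact absurd h hW
        · change n + r ≤ d + Module.finrank k W at h
          omega


/-- finiteness of the projection -/
lemma finite_proj {B : Type} [CommRing B] (π : MvPolynomial (Fin (n+1)) k →+* B) (hπ : Function.Surjective π)
    {Q : Ideal (MvPolynomial (Fin (n+1)) k)} (hπQ : ∀ q ∈ Q, π q = 0) (hh : IsHom Q) {r : ℕ} (y : Fin r → (Fin (n+1) → k))
    (N : ℕ) (hN : (ptId 0) ^ N ≤ Q ⊔ Ideal.span (Lv 0 '' Set.range y)) :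
    (π.comp (aeval (fun i => (Lv 0 (y i) : MvPolynomial (Fin (n+1)) k)) : _ →ₐ[k] MvPolynomial (Fin (n+1)) k).toRingHom).Finite := by
  set ψ := π.comp (aeval (fun i => (Lv 0 (y i) : MvPolynomial (Fin (n+1)) k)) : _ →ₐ[k] MvPolynomial (Fin (n+1)) k).toRingHom with hψ
  let _ : Algebra (MvPolynomial (Fin r) k) B := ψ.toAlgebra
  have hsm : ∀ (a : MvPolynomial (Fin r) k) (b : B), a • b = ψ a * b := fun a b => rfl
  have hfin : {e : Fin (n+1) →₀ ℕ | e.degree ≤ N}.Finite := Finsupp.finite_of_degree_le N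
  let M : Submodule (MvPolynomial (Fin r) k) (B) := Submodule.span _
    ((fun e => π (monomial e (1:k))) '' {e : Fin (n+1) →₀ ℕ | e.degree ≤ N})
  have hC : ∀ (c : k) (b : MvPolynomial (Fin (n+1)) k), π b ∈ M → π (C c * b) ∈ M := by
    intro c b hb
    have := M.smul_mem (C c) hb
    rw [hsm] at this
    convert this using 1
    simp [hψ]
  have key : ∀ e, ∀ g : MvPolynomial (Fin (n+1)) k, g.IsHomogeneous e → π g ∈ M := by
    intro e
    induction e with
    | zero =>
      intro g hg
      have hg' : g = C (coeff 0 g) * monomial 0 1 := by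
        conv_lhs => rw [← homogeneousComponent_eq_self hg, homogeneousComponent_zero]
        simp
      rw [hg']
      exact hC _ _ (Submodule.subset_span ⟨0, by simp, rfl⟩)
    | succ e ih =>
      have hmon : ∀ t : Fin (n+1) →₀ ℕ, t.degree = e + 1 →
          π (monomial t (1:k)) ∈ M := by
        intro t ht
        by_cases hle : e + 1 ≤ N
        · exact Submodule.subset_span ⟨t, by simpa [ht] using hle, rfl⟩
        · have hmem : (monomial t (1:k) : MvPolynomial (Fin (n+1)) k) ∈ (ptId 0) ^ N := by
            have h1 : (monomial t (1:k) : MvPolynomial (Fin (n+1)) k) ∈ (ptId 0) ^ (t.degree) := by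
              rw [monomial_eq, map_one, one_mul, Finsupp.degree_apply, Finsupp.prod]
              rw [← Finset.prod_pow_eq_pow_sum]
              refine Ideal.prod_mem_prod fun i _ => Ideal.pow_mem_pow ?_ _
              simp [mem_ptId]
            exact Ideal.pow_le_pow_right (by omega) h1
          have h2 := hN hmem
          obtain ⟨q, hq, z, hz, hqz⟩ := Submodule.mem_sup.1 h2
          rw [← Set.range_comp, Ideal.mem_span_range_iff_exists_fun] at hz
          obtain ⟨c, hc⟩ := hz
          have h3 : (monomial t (1:k) : MvPolynomial (Fin (n+1)) k) = homogeneousComponent (e+1) q +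
              ∑ i, homogeneousComponent e (c i) * Lv 0 (y i) := by
            have h4 : (monomial t (1:k) : MvPolynomial (Fin (n+1)) k).IsHomogeneous (e+1) := isHomogeneous_monomial _ ht
            rw [← homogeneousComponent_eq_self h4, ← hqz, map_add, ← hc, map_sum]
            congr 1
            refine Finset.sum_congr rfl fun i _ => ?_
            exact comp_mul_hom (c i) (Lv_zero_hom (y i)) e
          rw [h3, map_add, hπQ _ (hh q hq _), zero_add, map_sum]
          refine M.sum_mem fun i _ => ?_
          have h5 := M.smul_mem (X i) (ih _ (homogeneousComponent_isHomogeneous e (c i)))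
          rw [hsm] at h5
          convert h5 using 1
          rw [map_mul, mul_comm]
          simp [hψ]
      intro g hg
      rw [g.as_sum, map_sum]
      refine M.sum_mem fun t ht => ?_
      have : (monomial t (coeff t g) : MvPolynomial (Fin (n+1)) k) = C (coeff t g) * monomial t 1 := by
        rw [C_mul_monomial, mul_one]
      rw [this]
      refine hC _ _ (hmon t ?_)
      have := hg (mem_support_iff.1 ht)
      rw [Finsupp.degree_eq_weight_one]; exact this
  have htop : M = ⊤ := by
    rw [eq_top_iff]
    intro b _
    obtain ⟨g, rfl⟩ := hπ b
    rw [← sum_homogeneousComponent g, map_sum]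
    exact M.sum_mem fun i _ => key i _ (homogeneousComponent_isHomogeneous i g)
  exact ⟨⟨(hfin.image _).toFinset, by rw [Set.Finite.coe_toFinset]; exact htop⟩⟩

/-- the normal space -/
def gradSpan (I : Ideal (MvPolynomial (Fin (n+1)) k)) (v : Fin (n+1) → k) : Submodule k (Fin (n+1) → k) :=
  Submodule.span k {w | ∃ h ∈ I, w = gradientAt h v}

lemma iterate_sq {m J : Ideal (MvPolynomial (Fin (n+1)) k)} (h : m ≤ J ⊔ m ^ 2) (N : ℕ) : m ≤ J ⊔ m ^ (N+1) := by
  induction N with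
  | zero => simp
  | succ N ih =>
    calc m ≤ J ⊔ m ^ 2 := h
      _ ≤ J ⊔ m ^ (N+1+1) := by
        apply sup_le le_sup_left
        calc m ^ 2 = m * m := pow_two m
          _ ≤ m * (J ⊔ m ^ (N+1)) := Ideal.mul_mono_right ih
          _ = m * J ⊔ m * m ^ (N+1) := Ideal.mul_sup _ _ _
          _ ≤ J ⊔ m ^ (N+1+1) := sup_le_sup Ideal.mul_le_right (by rw [pow_succ' m (N+1)])

lemma nak2 {A B : Type} [CommRing A] [CommRing B] (ψ : A →+* B) (hfin : ψ.Finite) (J : Ideal A)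
    (h : ∀ b, ∃ a, b - ψ a ∈ J.map ψ) : ∃ a, a - 1 ∈ J ∧ ∀ b, ∃ α, ψ a * b = ψ α := by
  let _ : Algebra A B := ψ.toAlgebra
  have hf : Module.Finite A B := hfin
  obtain ⟨a, ha, ha'⟩ := Submodule.exists_sub_one_mem_and_smul_le_of_fg_of_le_sup
    (I := J) (N := LinearMap.range (Algebra.linearMap A B)) (N' := ⊤) (P := ⊤)
    hf.1 le_rfl (by
      intro b _
      obtain ⟨a, ha⟩ := h b
      rw [Ideal.smul_top_eq_map]
      have : b = ψ a + (b - ψ a) := by ring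
      rw [this]
      exact Submodule.add_mem_sup ⟨a, rfl⟩ ha)
  refine ⟨a, ha, fun b => ?_⟩
  obtain ⟨α, hα⟩ := ha' (Submodule.smul_mem_pointwise_smul b a ⊤ trivial)
  exact ⟨α, hα.symm⟩

set_option maxHeartbeats 2000000 in
/-- height one homogeneous primes are locally principal at smooth points -/
theorem LF [IsAlgClosed k] {I Q : Ideal (MvPolynomial (Fin (n+1)) k)} (hIQ : I ≤ Q) [hQ : Q.IsPrime] (hh : IsHom Q) {d : ℕ}
    (hd : td k (MvPolynomial (Fin (n+1)) k ⧸ Q) = d) {v : Fin (n+1) → k} (hv : v ∈ Cone Q)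
    (hN : n ≤ d + Module.finrank k (gradSpan I v)) :
    ∃ f ∈ Q, ∃ s, eval v s ≠ 0 ∧ ∀ q ∈ Q, s * q ∈ Ideal.span {f} ⊔ I := by
  classical
  have : Infinite k := IsAlgClosed.instInfinite
  set m := ptId v with hm
  have hmm : m.IsMaximal := ptId_max v
  have hQm : Q ≤ m := fun q hq => hv.2 q hq
  obtain ⟨y, hy1, hy2⟩ := select (k := k) hd v (gradSpan I v) hN (d+1)
  have hrad : ∀ w, (w = 0 ∨ w = v) → ∃ N, ptId w ^ N ≤ Q ⊔ Ideal.span (Lv w '' Set.range y) := by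
    intro w hw
    apply Ideal.exists_pow_le_of_le_radical_of_fg _ (IsNoetherian.noetherian _)
    rw [← Ideal.sInf_minimalPrimes]
    refine le_sInf fun P hP => ?_
    rcases hy1 w hw P hP with h | h
    · exact h.ge
    · omega
  have hspan : gradSpan I v ⊔ Submodule.span k (Set.range y) = ⊤ := by
    rcases hy2 with h | h
    · exact h
    · apply Submodule.eq_top_of_finrank_eq
      have := Submodule.finrank_le (gradSpan I v ⊔ Submodule.span k (Set.range y))
      simp only [Module.finrank_fintype_fun_eq_card, Fintype.card_fin] at this ⊢
      omega
  obtain ⟨N0, hN0⟩ := hrad 0 (Or.inl rfl)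
  obtain ⟨Nv, hNv⟩ := hrad v (Or.inr rfl)
  -- the ideal generated by the forms
  set nR : Ideal (MvPolynomial (Fin (n+1)) k) := Ideal.span (Lv v '' Set.range y) with hnR
  have hnm : nR ≤ m := by
    rw [hnR, Ideal.span_le]; rintro _ ⟨l, _, rfl⟩; exact Lv_mem v l
  have hT : m ≤ (nR ⊔ I) ⊔ m ^ 2 := by
    have hLv : ∀ l, Lv v l ∈ (nR ⊔ I) ⊔ m ^ 2 := by
      let W : Submodule k (Fin (n+1) → k) := (((nR ⊔ I) ⊔ m ^ 2).restrictScalars k).comap (Lv v)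
      have hW : (⊤ : Submodule k (Fin (n+1) → k)) ≤ W := by
        rw [← hspan]
        refine sup_le (Submodule.span_le.2 ?_) (Submodule.span_le.2 ?_)
        · rintro _ ⟨h, hhI, rfl⟩
          change Lv v (gradientAt h v) ∈ (nR ⊔ I) ⊔ m ^ 2
          have h1 := taylor v h
          rw [hv.2 h (hIQ hhI), map_zero, sub_zero] at h1
          have h2 : h ∈ (nR ⊔ I) ⊔ m ^ 2 := Ideal.mem_sup_left (Ideal.mem_sup_right hhI)
          have h3 := sub_mem h2 (Ideal.mem_sup_right h1 : _ ∈ (nR ⊔ I) ⊔ m ^ 2)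
          simpa using h3
        · intro l hl
          exact Ideal.mem_sup_left (Ideal.mem_sup_left (Ideal.subset_span ⟨l, hl, rfl⟩))
      exact fun l => hW trivial
    exact ptId_le_of_Lv hLv
  -- m ≤ Q + nR
  have hmQ : m ≤ nR ⊔ Q := by
    have h1 : m ≤ (nR ⊔ Q) ⊔ m ^ 2 := hT.trans (sup_le_sup_right (sup_le_sup_left hIQ _) _)
    have h2 := iterate_sq h1 Nv
    refine h2.trans (sup_le le_rfl ?_)
    refine (Ideal.pow_le_pow_right (Nat.le_succ Nv)).trans (hNv.trans ?_)
    rw [sup_comm]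
  -- Nakayama 1
  obtain ⟨s1, hs1, hs1'⟩ := Submodule.exists_sub_one_mem_and_smul_le_of_fg_of_le_sup
    (I := m) (N := nR ⊔ I) (N' := m) (P := m) (IsNoetherian.noetherian _) le_rfl
    (by rw [smul_eq_mul, ← pow_two]; exact hT)
  -- the projection
  set φ : MvPolynomial (Fin (d+1)) k →ₐ[k] MvPolynomial (Fin (n+1)) k := aeval (fun i => (Lv 0 (y i) : MvPolynomial (Fin (n+1)) k)) with hφ
  set π := Ideal.Quotient.mk Q with hπ
  have hfin : (π.comp φ.toRingHom).Finite :=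
    finite_proj π Ideal.Quotient.mk_surjective (fun q hq => Ideal.Quotient.eq_zero_iff_mem.2 hq) hh y N0 hN0
  set u : Fin (d+1) → k := fun i => eval v (Lv 0 (y i) : MvPolynomial (Fin (n+1)) k) with hu
  have hφX : ∀ i, φ (X i - C (u i)) = Lv v (y i) := by
    intro i; rw [Lv_eq v, map_sub]; simp [hφ, hu]
  -- kernel
  obtain ⟨F, hF⟩ : ∃ F : MvPolynomial (Fin (d+1)) k, ∀ a, φ a ∈ Q ↔ a ∈ Ideal.span {F} := by
    let ψ : MvPolynomial (Fin (d+1)) k →ₐ[k] MvPolynomial (Fin (n+1)) k ⧸ Q := (Ideal.Quotient.mkₐ k Q).comp φ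
    let P := RingHom.ker ψ
    have hP : P.IsPrime := RingHom.ker_isPrime ψ
    have hintg : (Ideal.kerLiftAlg ψ).toRingHom.IsIntegral := by
      have h1 : ψ.toRingHom.IsIntegral := hfin.to_isIntegral
      intro b
      obtain ⟨p, hp, hpb⟩ := h1 b
      refine ⟨p.map (Ideal.Quotient.mk P), hp.map _, ?_⟩
      rw [Polynomial.eval₂_map]
      exact hpb
    have htd : td k (MvPolynomial (Fin (d+1)) k ⧸ P) = d := by
      refine Eq.trans ?_ hd
      exact td_eq_of_integral (Ideal.kerLiftAlg ψ) (Ideal.kerLiftAlg_injective ψ) hintg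
    have hPb : P ≠ ⊥ := by
      intro hb
      have e1 : td k (MvPolynomial (Fin (d+1)) k ⧸ P) = td k (MvPolynomial (Fin (d+1)) k) :=
        td_eq_of_equiv ((Ideal.quotientEquivAlgOfEq k hb).trans (AlgEquiv.quotientBot k _))
      rw [td_mvPoly] at e1; omega
    obtain ⟨F, hFP, hFp⟩ := Ideal.IsPrime.exists_mem_prime_of_ne_bot hP hPb
    refine ⟨F, fun a => ?_⟩
    have hle : Ideal.span {F} ≤ P := by rw [Ideal.span_le]; simpa using hFP
    have hFpr : (Ideal.span {F}).IsPrime := (Ideal.span_singleton_prime hFp.ne_zero).2 hFp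
    have heq : Ideal.span {F} = P := by
      by_contra hne
      have := td_quot_lt (k := k) (lt_of_le_of_ne hle hne)
      have := td_hypersurface F hFp
      omega
    rw [heq]
    change _ ↔ ψ a = 0
    exact Ideal.Quotient.eq_zero_iff_mem.symm
  -- Nakayama 2
  obtain ⟨a, ha, ha'⟩ : ∃ a : MvPolynomial (Fin (d+1)) k, eval u a ≠ 0 ∧
      ∀ g : MvPolynomial (Fin (n+1)) k, ∃ α, φ a * g - φ α ∈ Q := by
    obtain ⟨a, ha, ha'⟩ := nak2 (π.comp φ.toRingHom) hfin (RingHom.ker (eval u)) (by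
      intro b
      obtain ⟨g, rfl⟩ := Ideal.Quotient.mk_surjective b
      refine ⟨C (eval v g), ?_⟩
      have h1 : g - C (eval v g) ∈ nR ⊔ Q := hmQ (by simp [hm, mem_ptId])
      obtain ⟨p, hp, q, hq, hpq⟩ := Submodule.mem_sup.1 h1
      have h2 : Ideal.Quotient.mk Q g - (π.comp φ.toRingHom) (C (eval v g)) = π p := by
        have e1 : (π.comp φ.toRingHom) (C (eval v g)) = π (C (eval v g)) := by simp [hφ]
        rw [e1, ← hπ, ← map_sub, ← hpq, map_add, Ideal.Quotient.eq_zero_iff_mem.2 hq, add_zero]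
      rw [h2]
      have h3 : nR ≤ (Ideal.map (π.comp φ.toRingHom) (RingHom.ker (eval u))).comap π := by
        rw [hnR, Ideal.span_le]
        rintro _ ⟨_, ⟨i, rfl⟩, rfl⟩
        rw [← hφX]
        exact Ideal.mem_map_of_mem (π.comp φ.toRingHom) (by simp [RingHom.mem_ker])
      exact h3 hp)
    refine ⟨a, ?_, fun g => ?_⟩
    · have : eval u (a - 1) = 0 := ha
      intro h0; simp [h0] at this
    · obtain ⟨α, hα⟩ := ha' (π g)
      refine ⟨α, Ideal.Quotient.eq_zero_iff_mem.1 ?_⟩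
      rw [map_sub, map_mul, sub_eq_zero]; exact hα
  have hva : eval v (φ a) = eval u a := by
    have : (eval v : MvPolynomial (Fin (n+1)) k →+* k).comp φ.toRingHom = eval u := by
      ext i <;> simp [hφ, hu]
    exact congrArg (fun f => f a) this
  have hFQ : φ F ∈ Q := (hF F).2 (Ideal.mem_span_singleton_self F)
  -- key containment
  have hkey : ∀ q ∈ Q, φ a * s1 * q ∈ (Ideal.span {φ F} ⊔ I) ⊔ m * Q := by
    intro q hq
    have h1 : s1 * q ∈ nR ⊔ I := hs1' (Submodule.smul_mem_pointwise_smul _ _ _ (hQm hq))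
    obtain ⟨p, hp, t, ht, hpt⟩ := Submodule.mem_sup.1 h1
    rw [hnR, ← Set.range_comp, Ideal.mem_span_range_iff_exists_fun] at hp
    obtain ⟨g, hg⟩ := hp
    choose α hα using fun i => ha' (g i)
    have hL : ∀ i, Lv v (y i) ∈ m := fun i => Lv_mem v (y i)
    set β := ∑ i, α i * (X i - C (u i)) with hβ
    have e1 : φ a * s1 * q = φ β + (∑ i, (φ a * g i - φ (α i)) * Lv v (y i)) + φ a * t := by
      rw [mul_assoc, ← hpt, ← hg, hβ, map_sum, ← Finset.sum_add_distrib, mul_add, Finset.mul_sum]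
      congr 1
      refine Finset.sum_congr rfl fun i _ => ?_
      rw [map_mul, hφX]; simp only [Function.comp]; ring
    have h2 : (∑ i, (φ a * g i - φ (α i)) * Lv v (y i)) ∈ m * Q := by
      refine sum_mem fun i _ => ?_
      rw [mul_comm _ (Lv v (y i))]
      exact Ideal.mul_mem_mul (hL i) (hα i)
    have h3 : φ β ∈ Q := by
      have : φ β = φ a * s1 * q - (∑ i, (φ a * g i - φ (α i)) * Lv v (y i)) - φ a * t := by
        rw [e1]; ring
      rw [this]
      exact sub_mem (sub_mem (Ideal.mul_mem_left _ _ hq) (Ideal.mul_le_right h2))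
        (Ideal.mul_mem_left _ _ (hIQ ht))
    rw [hF, Ideal.mem_span_singleton] at h3
    obtain ⟨c, hc⟩ := h3
    rw [e1]
    refine add_mem (add_mem (Ideal.mem_sup_left (Ideal.mem_sup_left ?_)) (Ideal.mem_sup_right h2))
      (Ideal.mem_sup_left (Ideal.mem_sup_right (Ideal.mul_mem_left _ _ ht)))
    rw [hc, map_mul, Ideal.mem_span_singleton]
    exact dvd_mul_right _ _
  have hunit : eval v (φ a * s1) ≠ 0 := by
    have : eval v (s1 - 1) = 0 := hs1
    rw [map_sub, map_one, sub_eq_zero] at this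
    rw [map_mul, this, mul_one, hva]; exact ha
  set c := eval v (φ a * s1) with hc
  have hle : Q ≤ (Ideal.span {φ F} ⊔ I) ⊔ m • Q := by
    intro q hq
    have h1 := hkey q hq
    have h2 : (φ a * s1 - C c) * q ∈ m * Q := Ideal.mul_mem_mul (by simp [hm, mem_ptId, hc]) hq
    have h3 := Ideal.mul_mem_left _ (C c⁻¹) (sub_mem h1 (Ideal.mem_sup_right h2 :
      _ ∈ (Ideal.span {φ F} ⊔ I) ⊔ m * Q))
    have e : C c⁻¹ * (φ a * s1 * q - (φ a * s1 - C c) * q) = q := by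
      have : (C c⁻¹ * C c : MvPolynomial (Fin (n+1)) k) = 1 := by rw [← C_mul, inv_mul_cancel₀ hunit, C_1]
      linear_combination q * this
    rwa [e] at h3
  obtain ⟨s, hs, hs'⟩ := Submodule.exists_sub_one_mem_and_smul_le_of_fg_of_le_sup
    (I := m) (N := Ideal.span {φ F} ⊔ I) (N' := Q) (P := Q) (IsNoetherian.noetherian _) le_rfl hle
  refine ⟨φ F, hFQ, s, ?_, fun q hq => hs' (Submodule.smul_mem_pointwise_smul _ _ _ hq)⟩
  have : eval v (s - 1) = 0 := hs
  intro h0; simp [h0] at this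

theorem LFh [IsAlgClosed k] {I Q : Ideal (MvPolynomial (Fin (n+1)) k)} [hI : I.IsPrime] (hhI : IsHom I) (hIQ : I < Q) [hQ : Q.IsPrime]
    (hh : IsHom Q) {d : ℕ} (hd : td k (MvPolynomial (Fin (n+1)) k ⧸ Q) = d) {v : Fin (n+1) → k} (hv : v ∈ Cone Q)
    (hN : n ≤ d + Module.finrank k (gradSpan I v)) :
    ∃ e f, f.IsHomogeneous e ∧ f ∈ Q ∧ f ∉ I ∧ ∃ e' s, s.IsHomogeneous e' ∧ eval v s ≠ 0 ∧
      ∀ q ∈ Q, s * q ∈ Ideal.span {f} ⊔ I := by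
  obtain ⟨f, hfQ, s, hs, hsq⟩ := LF hIQ.le hh hd hv hN
  have hvI : ∀ g ∈ I, eval v g = 0 := fun g hg => hv.2 g (hIQ.le hg)
  have hfI : f ∉ I := by
    intro hf
    apply not_le_of_gt hIQ
    intro q hq
    have h1 := hsq q hq
    have h2 : Ideal.span {f} ⊔ I = I := by
      rw [sup_eq_right, Ideal.span_le]; simpa using hf
    rw [h2] at h1
    rcases hI.mem_or_mem h1 with h | h
    · exact absurd (hvI _ h) hs
    · exact h
  have h1 : ∀ j, ∃ c, s * homogeneousComponent j f - c * f ∈ I := by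
    intro j
    have := hsq _ (hh f hfQ j)
    rw [Ideal.mem_span_singleton_sup] at this
    obtain ⟨a, b, hb, hab⟩ := this
    exact ⟨a, by rw [← hab]; simpa using hb⟩
  choose c hc using h1
  obtain ⟨j, hj⟩ : ∃ j, eval v (c j) ≠ 0 := by
    by_contra hcon
    push Not at hcon
    have h2 : (s - ∑ j ∈ Finset.range (f.totalDegree + 1), c j) * f ∈ I := by
      have h3 : ∑ j ∈ Finset.range (f.totalDegree + 1), (s * homogeneousComponent j f - c j * f) ∈ I :=
        sum_mem fun j _ => hc j
      rw [Finset.sum_sub_distrib, ← Finset.mul_sum, ← Finset.sum_mul, sum_homogeneousComponent,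
        ← sub_mul] at h3
      exact h3
    rcases hI.mem_or_mem h2 with h | h
    · apply hs
      have := hvI _ h
      rw [map_sub, map_sum, Finset.sum_eq_zero (fun j _ => hcon j), sub_zero] at this
      exact this
    · exact hfI h
  set g := homogeneousComponent j f with hg
  have hgh : g.IsHomogeneous j := homogeneousComponent_isHomogeneous j f
  have hmem : ∀ q ∈ Q, (c j * s) * q ∈ Ideal.span {g} ⊔ I := by
    intro q hq
    obtain ⟨a, b, hb, hab⟩ := Ideal.mem_span_singleton_sup.1 (hsq q hq)
    have : c j * s * q = (a * s) * g + (c j * b - a * (s * g - c j * f)) := by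
      rw [mul_assoc, ← hab]; ring
    rw [this, Ideal.mem_span_singleton_sup]
    exact ⟨a * s, _, sub_mem (Ideal.mul_mem_left _ _ hb) (Ideal.mul_mem_left _ _ (hc j)), rfl⟩
  have hev : eval v (c j * s) ≠ 0 := by rw [map_mul]; exact mul_ne_zero hj hs
  obtain ⟨i, hi⟩ := exists_hom_component hev
  have hJ : IsHom (Ideal.span {g} ⊔ I) :=
    IsHom.sup (isHom_span (by rintro _ rfl; exact ⟨j, hgh⟩)) hhI
  refine ⟨j, g, hgh, hh f hfQ j, ?_, i, _, homogeneousComponent_isHomogeneous i (c j * s), hi, ?_⟩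
  · intro hgI
    have h4 : c j * f ∈ I := by
      have := sub_mem (Ideal.mul_mem_left I s hgI) (hc j)
      have e : s * g - (s * homogeneousComponent j f - c j * f) = c j * f := by rw [← hg]; ring
      rwa [e] at this
    rcases hI.mem_or_mem h4 with h | h
    · exact hj (hvI _ h)
    · exact hfI h
  · intro q hq
    rw [← sum_homogeneousComponent q, Finset.mul_sum]
    refine sum_mem fun l _ => ?_
    rw [← comp_mul_hom _ (homogeneousComponent_isHomogeneous l q)]
    exact hJ _ (hmem _ (hh q hq l)) _

end B3
end Bert


namespace Bert
section B4
variable {k : Type} [Field k] {n : ℕ} {K : Type} [Field K] [Algebra k K]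

/-- homogeneous fractions of degree zero with denominators in `M` -/
noncomputable def Fr (κ : MvPolynomial (Fin (n+1)) k →ₐ[k] K) (M : Submonoid (MvPolynomial (Fin (n+1)) k)) : Subalgebra k K where
  carrier := {z | ∃ e a s, a.IsHomogeneous e ∧ s.IsHomogeneous e ∧ s ∈ M ∧ κ s ≠ 0 ∧ z * κ s = κ a}
  mul_mem' := by
    rintro z w ⟨e, a, s, ha, hs, hM, h0, h⟩ ⟨e', a', s', ha', hs', hM', h0', h'⟩
    refine ⟨e + e', a * a', s * s', ha.mul ha', hs.mul hs', M.mul_mem hM hM', ?_, ?_⟩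
    · rw [map_mul]; exact mul_ne_zero h0 h0'
    · rw [map_mul, map_mul, ← h, ← h']; ring
  add_mem' := by
    rintro z w ⟨e, a, s, ha, hs, hM, h0, h⟩ ⟨e', a', s', ha', hs', hM', h0', h'⟩
    refine ⟨e + e', a * s' + s * a', s * s', (ha.mul hs').add (hs.mul ha'), hs.mul hs',
      M.mul_mem hM hM', ?_, ?_⟩
    · rw [map_mul]; exact mul_ne_zero h0 h0'
    · rw [map_add, map_mul, map_mul, map_mul, ← h, ← h']; ring
  algebraMap_mem' := by
    intro c
    refine ⟨0, C c, 1, isHomogeneous_C _ _, isHomogeneous_one _ _, M.one_mem, by simp, ?_⟩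
    rw [map_one, mul_one]
    exact (κ.commutes c).symm

lemma Fr_mem {κ : MvPolynomial (Fin (n+1)) k →ₐ[k] K} {M : Submonoid (MvPolynomial (Fin (n+1)) k)} {z : K} : z ∈ Fr κ M ↔
    ∃ e a s, a.IsHomogeneous e ∧ s.IsHomogeneous e ∧ s ∈ M ∧ κ s ≠ 0 ∧ z * κ s = κ a := Iff.rfl

lemma Fr_mono {κ : MvPolynomial (Fin (n+1)) k →ₐ[k] K} {M M' : Submonoid (MvPolynomial (Fin (n+1)) k)} (h : M ≤ M') : Fr κ M ≤ Fr κ M' := by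
  rintro z ⟨e, a, s, ha, hs, hM, h0, hz⟩
  exact ⟨e, a, s, ha, hs, h hM, h0, hz⟩

/-- degree zero function field -/
noncomputable def K0 (κ : MvPolynomial (Fin (n+1)) k →ₐ[k] K) : Subalgebra k K := Fr κ ⊤

lemma Fr_le_K0 {κ : MvPolynomial (Fin (n+1)) k →ₐ[k] K} {M : Submonoid (MvPolynomial (Fin (n+1)) k)} : Fr κ M ≤ K0 κ := Fr_mono le_top

lemma K0_inv {κ : MvPolynomial (Fin (n+1)) k →ₐ[k] K} {z : K} (hz : z ∈ K0 κ) : z⁻¹ ∈ K0 κ := by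
  obtain ⟨e, a, s, ha, hs, -, h0, h⟩ := hz
  by_cases hz0 : z = 0
  · rw [hz0, inv_zero]; exact zero_mem _
  · refine ⟨e, s, a, hs, ha, trivial, ?_, ?_⟩
    · rw [← h]; exact mul_ne_zero hz0 h0
    · rw [← h]; field_simp

lemma K0_div {κ : MvPolynomial (Fin (n+1)) k →ₐ[k] K} {z w : K} (hz : z ∈ K0 κ) (hw : w ∈ K0 κ) : z / w ∈ K0 κ := by
  rw [div_eq_mul_inv]; exact mul_mem hz (K0_inv hw)

lemma K0_zpow {κ : MvPolynomial (Fin (n+1)) k →ₐ[k] K} {z : K} (hz : z ∈ K0 κ) (r : ℤ) : z ^ r ∈ K0 κ := by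
  cases r with
  | ofNat r => simpa using pow_mem hz r
  | negSucc r => rw [zpow_negSucc]; exact K0_inv (pow_mem hz _)

/-- the fraction of two homogeneous polynomials -/
lemma frac_mem_K0 {κ : MvPolynomial (Fin (n+1)) k →ₐ[k] K} {e : ℕ} {a s : MvPolynomial (Fin (n+1)) k} (ha : a.IsHomogeneous e)
    (hs : s.IsHomogeneous e) : κ a / κ s ∈ K0 κ := by
  by_cases h : κ s = 0
  · rw [h, div_zero]; exact zero_mem _
  · exact ⟨e, a, s, ha, hs, trivial, h, div_mul_cancel₀ _ h⟩

/-- abstract discrete valuation data on a subfield -/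
structure DV (F O : Subalgebra k K) (ϖ : K) : Prop where
  le : O ≤ F
  mem : ϖ ∈ O
  ne : ϖ ≠ 0
  ninv : ϖ⁻¹ ∉ O
  ex : ∀ z ∈ F, z ≠ 0 → ∃ r : ℤ, z * ϖ ^ (-r) ∈ O ∧ (z * ϖ ^ (-r))⁻¹ ∈ O

/-- the order -/
noncomputable def ordv (O : Subalgebra k K) (ϖ z : K) : ℤ :=
  Classical.epsilon (fun r : ℤ => z * ϖ ^ (-r) ∈ O ∧ (z * ϖ ^ (-r))⁻¹ ∈ O)

namespace DV
variable {F O : Subalgebra k K} {ϖ : K}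

lemma spec (h : DV F O ϖ) {z : K} (hz : z ∈ F) (h0 : z ≠ 0) :
    z * ϖ ^ (-ordv O ϖ z) ∈ O ∧ (z * ϖ ^ (-ordv O ϖ z))⁻¹ ∈ O :=
  Classical.epsilon_spec (p := fun r : ℤ => z * ϖ ^ (-r) ∈ O ∧ (z * ϖ ^ (-r))⁻¹ ∈ O) (h.ex z hz h0)

lemma pow_mem (h : DV F O ϖ) {r : ℤ} : ϖ ^ r ∈ O ↔ 0 ≤ r := by
  constructor
  · intro hr
    by_contra hneg
    apply h.ninv
    have h1 : ϖ ^ r * ϖ ^ (-r - 1) = ϖ⁻¹ := by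
      rw [← zpow_add₀ h.ne, ← zpow_neg_one]; congr 1; ring
    rw [← h1]
    refine mul_mem hr ?_
    have h2 : -r - 1 = (((-r - 1).toNat : ℕ) : ℤ) := by omega
    rw [h2, zpow_natCast]
    exact _root_.pow_mem h.mem _
  · intro hr
    have h2 : r = ((r.toNat : ℕ) : ℤ) := by omega
    rw [h2, zpow_natCast]
    exact _root_.pow_mem h.mem _

lemma ge_iff (h : DV F O ϖ) {z : K} (hz : z ∈ F) (h0 : z ≠ 0) (r : ℤ) :
    z * ϖ ^ (-r) ∈ O ↔ r ≤ ordv O ϖ z := by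
  obtain ⟨h1, h2⟩ := h.spec hz h0
  set t := ordv O ϖ z
  have e1 : z * ϖ ^ (-r) = (z * ϖ ^ (-t)) * ϖ ^ (t - r) := by
    rw [mul_assoc, ← zpow_add₀ h.ne]; congr 2; ring
  have hne : z * ϖ ^ (-t) ≠ 0 := mul_ne_zero h0 (zpow_ne_zero _ h.ne)
  have e2 : ϖ ^ (t - r) = (z * ϖ ^ (-t))⁻¹ * (z * ϖ ^ (-r)) := by
    rw [e1, inv_mul_cancel_left₀ hne]
  constructor
  · intro h3
    have : ϖ ^ (t - r) ∈ O := by rw [e2]; exact mul_mem h2 h3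
    rw [h.pow_mem] at this; omega
  · intro h3
    rw [e1]; exact mul_mem h1 (h.pow_mem.2 (by omega))

lemma unique (h : DV F O ϖ) {z : K} (hz : z ∈ F) (h0 : z ≠ 0) {r : ℤ}
    (h1 : z * ϖ ^ (-r) ∈ O) (h2 : (z * ϖ ^ (-r))⁻¹ ∈ O) : ordv O ϖ z = r := by
  refine le_antisymm ?_ ((h.ge_iff hz h0 r).1 h1)
  obtain ⟨h3, h4⟩ := h.spec hz h0
  set t := ordv O ϖ z
  rw [← sub_nonneg, ← h.pow_mem]
  have : ϖ ^ (r - t) = (z * ϖ ^ (-r))⁻¹ * (z * ϖ ^ (-t)) := by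
    rw [mul_inv, mul_mul_mul_comm, inv_mul_cancel₀ h0, one_mul, ← zpow_neg, ← zpow_add₀ h.ne]
    congr 1; ring
  rw [this]; exact mul_mem h2 h3

lemma ord_mul (h : DV F O ϖ) {z w : K} (hz : z ∈ F) (h0 : z ≠ 0) (hw : w ∈ F) (hw0 : w ≠ 0) :
    ordv O ϖ (z * w) = ordv O ϖ z + ordv O ϖ w := by
  obtain ⟨h1, h2⟩ := h.spec hz h0
  obtain ⟨h3, h4⟩ := h.spec hw hw0
  have e : z * w * ϖ ^ (-(ordv O ϖ z + ordv O ϖ w)) =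
      (z * ϖ ^ (-ordv O ϖ z)) * (w * ϖ ^ (-ordv O ϖ w)) := by
    rw [neg_add, zpow_add₀ h.ne]; ring
  apply h.unique (mul_mem hz hw) (mul_ne_zero h0 hw0)
  · rw [e]; exact mul_mem h1 h3
  · rw [e, mul_inv]; exact mul_mem h2 h4

lemma ord_one (h : DV F O ϖ) : ordv O ϖ 1 = 0 :=
  h.unique (one_mem _) one_ne_zero (by simp) (by simp)

lemma ord_inv (h : DV F O ϖ) {z : K} (h0 : z ≠ 0) (hz : z ∈ F) (hz' : z⁻¹ ∈ F) :
    ordv O ϖ z⁻¹ = - ordv O ϖ z := by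
  have := h.ord_mul hz h0 hz' (inv_ne_zero h0)
  rw [mul_inv_cancel₀ h0, h.ord_one] at this
  omega

lemma ord_zpow (h : DV F O ϖ) {z : K} (hz : z ∈ F) (h0 : z ≠ 0) (r : ℤ) (hF : ∀ r : ℤ, z ^ r ∈ F) :
    ordv O ϖ (z ^ r) = r * ordv O ϖ z := by
  obtain ⟨h1, h2⟩ := h.spec hz h0
  set t := ordv O ϖ z
  have e : z ^ r * ϖ ^ (-(r * t)) = (z * ϖ ^ (-t)) ^ r := by
    rw [mul_zpow, ← zpow_mul]; congr 2; ring
  have key : ∀ r : ℤ, (z * ϖ ^ (-t)) ^ r ∈ O := by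
    intro r
    cases r with
    | ofNat r => simpa using _root_.pow_mem h1 r
    | negSucc r => rw [zpow_negSucc, ← inv_pow]; exact _root_.pow_mem h2 _
  apply h.unique (hF r) (zpow_ne_zero _ h0)
  · rw [e]; exact key r
  · rw [e, ← zpow_neg]; exact key _

lemma ord_pi (h : DV F O ϖ) : ordv O ϖ ϖ = 1 :=
  h.unique (h.le h.mem) h.ne (by simp [h.ne]) (by simp [h.ne])

end DV
end B4
end Bert


namespace Bert
section B5
variable {k : Type} [Field k] {n : ℕ} {K : Type} [Field K] [Algebra k K]

/-- the standing geometric hypotheses -/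
structure Geo (κ : MvPolynomial (Fin (n+1)) k →ₐ[k] K) (d : ℕ) : Prop where
  hom : IsHom (RingHom.ker κ)
  tdim : td k (MvPolynomial (Fin (n+1)) k ⧸ RingHom.ker κ) = d + 1
  two : 2 ≤ d
  sm : ∀ v ∈ Cone (RingHom.ker κ), Module.finrank k (gradSpan (RingHom.ker κ) v) + d = n

/-- prime divisors as homogeneous primes -/
structure PD (κ : MvPolynomial (Fin (n+1)) k →ₐ[k] K) (d : ℕ) (Q : Ideal (MvPolynomial (Fin (n+1)) k)) : Prop where
  pr : Q.IsPrime
  hom : IsHom Q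
  le : RingHom.ker κ ≤ Q
  tdim : td k (MvPolynomial (Fin (n+1)) k ⧸ Q) = d

/-- type of prime divisors -/
abbrev PDt (κ : MvPolynomial (Fin (n+1)) k →ₐ[k] K) (d : ℕ) : Type := {Q : Ideal (MvPolynomial (Fin (n+1)) k) // PD κ d Q}

variable {κ : MvPolynomial (Fin (n+1)) k →ₐ[k] K} {d : ℕ}

instance (Q : PDt κ d) : Q.1.IsPrime := Q.2.pr

/-- local ring at a point -/
noncomputable def Ov (κ : MvPolynomial (Fin (n+1)) k →ₐ[k] K) (v : Fin (n+1) → k) : Subalgebra k K :=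
  Fr κ (ptId v).primeCompl

/-- local ring at a prime divisor -/
noncomputable def OQ (Q : PDt κ d) : Subalgebra k K := Fr κ Q.1.primeCompl

lemma mem_compl {v : Fin (n+1) → k} {s : MvPolynomial (Fin (n+1)) k} : s ∈ (ptId v).primeCompl ↔ eval v s ≠ 0 := by
  rw [Ideal.mem_primeCompl_iff, mem_ptId]

lemma kne {v : Fin (n+1) → k} (hv : v ∈ Cone (RingHom.ker κ)) {s : MvPolynomial (Fin (n+1)) k} (hs : eval v s ≠ 0) :
    κ s ≠ 0 := fun h => hs (hv.2 s h)

lemma kne' {s : MvPolynomial (Fin (n+1)) k} (Q : PDt κ d) (hs : s ∉ Q.1) : κ s ≠ 0 :=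
  fun h => hs (Q.2.le h)

lemma Ov_mem {v : Fin (n+1) → k} (hv : v ∈ Cone (RingHom.ker κ)) {z : K} : z ∈ Ov κ v ↔
    ∃ e a s, a.IsHomogeneous e ∧ s.IsHomogeneous e ∧ eval v s ≠ 0 ∧ z * κ s = κ a := by
  constructor
  · rintro ⟨e, a, s, ha, hs, h1, h2, h3⟩
    exact ⟨e, a, s, ha, hs, mem_compl.1 h1, h3⟩
  · rintro ⟨e, a, s, ha, hs, h1, h3⟩
    exact ⟨e, a, s, ha, hs, mem_compl.2 h1, kne hv h1, h3⟩

lemma OQ_mem {Q : PDt κ d} {z : K} : z ∈ OQ Q ↔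
    ∃ e a s, a.IsHomogeneous e ∧ s.IsHomogeneous e ∧ s ∉ Q.1 ∧ z * κ s = κ a := by
  constructor
  · rintro ⟨e, a, s, ha, hs, h1, h2, h3⟩
    exact ⟨e, a, s, ha, hs, h1, h3⟩
  · rintro ⟨e, a, s, ha, hs, h1, h3⟩
    exact ⟨e, a, s, ha, hs, h1, kne' Q h1, h3⟩

lemma cone_iff {Q : Ideal (MvPolynomial (Fin (n+1)) k)} {v : Fin (n+1) → k} (h0 : v ≠ 0) : v ∈ Cone Q ↔ Q ≤ ptId v :=
  ⟨fun h f hf => mem_ptId.2 (h.2 f hf), fun h => ⟨h0, fun f hf => mem_ptId.1 (h hf)⟩⟩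

lemma Ov_le_OQ {Q : PDt κ d} {v : Fin (n+1) → k} (hv : v ∈ Cone Q.1) : Ov κ v ≤ OQ Q := by
  apply Fr_mono
  intro s hs h
  exact mem_compl.1 hs (hv.2 s h)

/-- units -/
def IsU (O : Subalgebra k K) (z : K) : Prop := z ≠ 0 ∧ z ∈ O ∧ z⁻¹ ∈ O

lemma IsU.mul {O : Subalgebra k K} {z w : K} (h : IsU O z) (h' : IsU O w) : IsU O (z * w) :=
  ⟨mul_ne_zero h.1 h'.1, mul_mem h.2.1 h'.2.1, by rw [mul_inv]; exact mul_mem h.2.2 h'.2.2⟩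

lemma IsU.inv {O : Subalgebra k K} {z : K} (h : IsU O z) : IsU O z⁻¹ :=
  ⟨inv_ne_zero h.1, h.2.2, by rw [inv_inv]; exact h.2.1⟩

lemma IsU.div {O : Subalgebra k K} {z w : K} (h : IsU O z) (h' : IsU O w) : IsU O (z / w) := by
  rw [div_eq_mul_inv]; exact h.mul h'.inv

lemma IsU.one {O : Subalgebra k K} : IsU O 1 := ⟨one_ne_zero, one_mem _, by simp⟩

lemma IsU.pow {O : Subalgebra k K} {z : K} (h : IsU O z) (r : ℕ) : IsU O (z ^ r) :=
  ⟨pow_ne_zero _ h.1, pow_mem h.2.1 r, by rw [← inv_pow]; exact pow_mem h.2.2 r⟩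

lemma IsU.zpow {O : Subalgebra k K} {z : K} (h : IsU O z) (r : ℤ) : IsU O (z ^ r) := by
  cases r with
  | ofNat r => simpa using h.pow r
  | negSucc r => rw [zpow_negSucc]; exact (h.pow _).inv

lemma IsU.mono {O O' : Subalgebra k K} (hO : O ≤ O') {z : K} (h : IsU O z) : IsU O' z :=
  ⟨h.1, hO h.2.1, hO h.2.2⟩

lemma isU_frac {v : Fin (n+1) → k} (hv : v ∈ Cone (RingHom.ker κ)) {e : ℕ} {a b : MvPolynomial (Fin (n+1)) k}
    (ha : a.IsHomogeneous e) (hb : b.IsHomogeneous e) (ha' : eval v a ≠ 0) (hb' : eval v b ≠ 0) :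
    IsU (Ov κ v) (κ a / κ b) := by
  have h1 := kne hv ha'
  have h2 := kne hv hb'
  refine ⟨div_ne_zero h1 h2, (Ov_mem hv).2 ⟨e, a, b, ha, hb, hb', div_mul_cancel₀ _ h2⟩,
    (Ov_mem hv).2 ⟨e, b, a, hb, ha, ha', ?_⟩⟩
  field_simp

lemma isU_fracQ {Q : PDt κ d} {e : ℕ} {a b : MvPolynomial (Fin (n+1)) k}
    (ha : a.IsHomogeneous e) (hb : b.IsHomogeneous e) (ha' : a ∉ Q.1) (hb' : b ∉ Q.1) :
    IsU (OQ Q) (κ a / κ b) := by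
  have h1 := kne' Q ha'
  have h2 := kne' Q hb'
  refine ⟨div_ne_zero h1 h2, OQ_mem.2 ⟨e, a, b, ha, hb, hb', div_mul_cancel₀ _ h2⟩,
    OQ_mem.2 ⟨e, b, a, hb, ha, ha', ?_⟩⟩
  field_simp

lemma comp_mul_lt (g : MvPolynomial (Fin (n+1)) k) {l : MvPolynomial (Fin (n+1)) k} {e : ℕ} (hl : l.IsHomogeneous e) {i : ℕ} (hi : i < e) :
    homogeneousComponent i (g * l) = 0 := by
  rw [← sum_homogeneousComponent g, Finset.sum_mul, map_sum]
  apply Finset.sum_eq_zero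
  intro j _
  rw [homogeneousComponent_of_mem ((homogeneousComponent_isHomogeneous j g).mul hl), if_neg (by omega)]

lemma hom_quot {I : Ideal (MvPolynomial (Fin (n+1)) k)} (hI : IsHom I) {e ef : ℕ} {a f : MvPolynomial (Fin (n+1)) k} (ha : a.IsHomogeneous e)
    (hf : f.IsHomogeneous ef) (hm : a ∈ Ideal.span {f} ⊔ I) (hn : a ∉ I) :
    ∃ e' a', a'.IsHomogeneous e' ∧ e' + ef = e ∧ a - a' * f ∈ I := by
  obtain ⟨g, i, hi, h⟩ := Ideal.mem_span_singleton_sup.1 hm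
  have h1 : homogeneousComponent e (g * f) + homogeneousComponent e i = a := by
    rw [← map_add, h, homogeneousComponent_of_mem ha, if_pos rfl]
  have h2 := hI i hi e
  by_cases hlt : e < ef
  · rw [comp_mul_lt g hf hlt, zero_add] at h1
    exact absurd (h1 ▸ h2) hn
  · refine ⟨e - ef, homogeneousComponent (e - ef) g, homogeneousComponent_isHomogeneous _ _, by omega, ?_⟩
    have h3 := comp_mul_hom g hf (e - ef)
    rw [Nat.sub_add_cancel (by omega)] at h3
    rw [← h3, ← h1]; simpa using h2

/-- local parameter data -/
structure LP (Q : PDt κ d) (v : Fin (n+1) → k) (e : ℕ) (f x : MvPolynomial (Fin (n+1)) k) : Prop where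
  fh : f.IsHomogeneous e
  xh : x.IsHomogeneous e
  xv : eval v x ≠ 0
  fQ : f ∈ Q.1
  fI : κ f ≠ 0
  gen : ∃ e' s, s.IsHomogeneous e' ∧ eval v s ≠ 0 ∧ ∀ q ∈ Q.1, s * q ∈ Ideal.span {f} ⊔ RingHom.ker κ

lemma Geo.lt (G : Geo κ d) (Q : PDt κ d) : RingHom.ker κ < Q.1 := by
  refine lt_of_le_of_ne Q.2.le ?_
  intro h
  have h1 := Q.2.tdim
  have h2 := G.tdim
  rw [h] at h2
  omega

lemma exists_LP [IsAlgClosed k] (G : Geo κ d) (Q : PDt κ d) {v : Fin (n+1) → k} (hv : v ∈ Cone Q.1) :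
    ∃ e f x, LP Q v e f x := by
  have hvI : v ∈ Cone (RingHom.ker κ) := Cone.mono Q.2.le hv
  have : (RingHom.ker κ).IsPrime := RingHom.ker_isPrime κ
  have hN := G.sm v hvI
  obtain ⟨e, f, hf, hfQ, hfI, e', s, hs, hsv, h⟩ := LFh G.hom (G.lt Q) Q.2.hom Q.2.tdim hv (by omega)
  obtain ⟨i, hi⟩ := Function.ne_iff.1 hv.1
  refine ⟨e, f, X i ^ e, hf, ?_, by simpa using fun h => absurd h hi, hfQ, hfI, e', s, hs, hsv, h⟩
  simpa using (isHomogeneous_X k i).pow e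

open Classical in
/-- local parameter of `Q` at `v` -/
noncomputable def pil (Q : PDt κ d) (v : Fin (n+1) → k) : K :=
  if h : v ∈ Cone Q.1 ∧ ∃ z : K, ∃ e f x, LP Q v e f x ∧ z = κ f / κ x then h.2.choose else 1

lemma pil_spec [IsAlgClosed k] (G : Geo κ d) (Q : PDt κ d) {v : Fin (n+1) → k} (hv : v ∈ Cone Q.1) :
    ∃ e f x, LP Q v e f x ∧ pil Q v = κ f / κ x := by
  obtain ⟨e, f, x, h⟩ := exists_LP G Q hv
  have h' : v ∈ Cone Q.1 ∧ ∃ z : K, ∃ e f x, LP Q v e f x ∧ z = κ f / κ x := ⟨hv, _, e, f, x, h, rfl⟩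
  rw [pil, dif_pos h']
  exact h'.2.choose_spec

lemma pil_one (Q : PDt κ d) {v : Fin (n+1) → k} (hv : v ∉ Cone Q.1) : pil Q v = 1 := by
  rw [pil, dif_neg (fun h => hv h.1)]

lemma pil_ne [IsAlgClosed k] (G : Geo κ d) (Q : PDt κ d) (v : Fin (n+1) → k) : pil Q v ≠ 0 := by
  by_cases hv : v ∈ Cone Q.1
  · obtain ⟨e, f, x, h, h'⟩ := pil_spec G Q hv
    rw [h']
    exact div_ne_zero h.fI (kne (Cone.mono Q.2.le hv) h.xv)
  · rw [pil_one Q hv]; exact one_ne_zero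

lemma pil_K0 [IsAlgClosed k] (G : Geo κ d) (Q : PDt κ d) (v : Fin (n+1) → k) : pil Q v ∈ K0 κ := by
  by_cases hv : v ∈ Cone Q.1
  · obtain ⟨e, f, x, h, h'⟩ := pil_spec G Q hv
    rw [h']
    exact frac_mem_K0 h.fh h.xh
  · rw [pil_one Q hv]; exact one_mem _

lemma pil_Ov [IsAlgClosed k] (G : Geo κ d) (Q : PDt κ d) {v : Fin (n+1) → k}
    (hvI : v ∈ Cone (RingHom.ker κ)) : pil Q v ∈ Ov κ v := by
  by_cases hv : v ∈ Cone Q.1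
  · obtain ⟨e, f, x, h, h'⟩ := pil_spec G Q hv
    rw [h']
    exact (Ov_mem hvI).2 ⟨e, f, x, h.fh, h.xh, h.xv, div_mul_cancel₀ _ (kne hvI h.xv)⟩
  · rw [pil_one Q hv]; exact one_mem _

/-- product of local parameters -/
noncomputable def gam (v : Fin (n+1) → k) (m : PDt κ d →₀ ℤ) : K := m.prod fun Q r => pil Q v ^ r

lemma gam_add [IsAlgClosed k] (G : Geo κ d) (v : Fin (n+1) → k) (m m' : PDt κ d →₀ ℤ) :
    gam v (m + m') = gam v m * gam v m' :=
  Finsupp.prod_add_index' (fun _ => zpow_zero _) fun Q _ _ => zpow_add₀ (pil_ne G Q v) _ _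

lemma gam_zero (v : Fin (n+1) → k) : gam v (0 : PDt κ d →₀ ℤ) = 1 := Finsupp.prod_zero_index

lemma gam_single (v : Fin (n+1) → k) (Q : PDt κ d) (r : ℤ) :
    gam v (Finsupp.single Q r) = pil Q v ^ r :=
  Finsupp.prod_single_index (zpow_zero _)

lemma gam_ne [IsAlgClosed k] (G : Geo κ d) (v : Fin (n+1) → k) (m : PDt κ d →₀ ℤ) : gam v m ≠ 0 :=
  Finset.prod_ne_zero_iff.2 fun Q _ => zpow_ne_zero _ (pil_ne G Q v)

lemma gam_K0 [IsAlgClosed k] (G : Geo κ d) (v : Fin (n+1) → k) (m : PDt κ d →₀ ℤ) : gam v m ∈ K0 κ :=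
  prod_mem fun Q _ => K0_zpow (pil_K0 G Q v) _

lemma gam_neg [IsAlgClosed k] (G : Geo κ d) (v : Fin (n+1) → k) (m : PDt κ d →₀ ℤ) :
    gam v (-m) = (gam v m)⁻¹ := by
  have := gam_add G v m (-m)
  rw [add_neg_cancel, gam_zero] at this
  exact (eq_inv_of_mul_eq_one_right this.symm)

lemma gam_nsmul [IsAlgClosed k] (G : Geo κ d) (v : Fin (n+1) → k) (m : PDt κ d →₀ ℤ) (r : ℕ) :
    gam v (r • m) = gam v m ^ r := by
  induction r with
  | zero => simp [gam_zero]
  | succ r ih => rw [succ_nsmul, gam_add G, ih, pow_succ]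

/-- auxiliary ideal for the descent -/
def Jdesc (I : Ideal (MvPolynomial (Fin (n+1)) k)) (v : Fin (n+1) → k) (a : MvPolynomial (Fin (n+1)) k) : Ideal (MvPolynomial (Fin (n+1)) k) where
  carrier := {t | ∃ s, eval v s ≠ 0 ∧ s * t ∈ Ideal.span {a} ⊔ I}
  zero_mem' := ⟨1, by simp, by simp⟩
  add_mem' := by
    rintro t t' ⟨s, hs, h⟩ ⟨s', hs', h'⟩
    refine ⟨s * s', by simp [hs, hs'], ?_⟩
    have : s * s' * (t + t') = s' * (s * t) + s * (s' * t') := by ring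
    rw [this]
    exact Ideal.add_mem _ (Ideal.mul_mem_left _ _ h) (Ideal.mul_mem_left _ _ h')
  smul_mem' := by
    rintro c t ⟨s, hs, h⟩
    refine ⟨s, hs, ?_⟩
    have : s * (c • t) = c * (s * t) := by rw [smul_eq_mul]; ring
    rw [this]
    exact Ideal.mul_mem_left _ _ h

lemma Jdesc_lt {I : Ideal (MvPolynomial (Fin (n+1)) k)} [hI : I.IsPrime] {v : Fin (n+1) → k} (hv : v ∈ Cone I) {a a1 f s : MvPolynomial (Fin (n+1)) k}
    (hs : eval v s ≠ 0) (hf : eval v f = 0) (ha1 : a1 ∉ I) (h : s * a - a1 * f ∈ I) :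
    Jdesc I v a < Jdesc I v a1 := by
  rw [lt_iff_le_and_ne]
  constructor
  · rintro t ⟨s', hs', h'⟩
    refine ⟨s * s', by simp [hs, hs'], ?_⟩
    obtain ⟨g, i, hi, h2⟩ := Ideal.mem_span_singleton_sup.1 h'
    have : s * s' * t = (g * f) * a1 + (g * (s * a - a1 * f) + s * i) := by
      rw [mul_assoc, ← h2]; ring
    rw [this]
    exact Ideal.mem_span_singleton_sup.2 ⟨_, _, I.add_mem (I.mul_mem_left _ h) (I.mul_mem_left _ hi), rfl⟩
  · intro heq
    have h1 : a1 ∈ Jdesc I v a1 := ⟨1, by simp, by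
      rw [one_mul]; exact Ideal.mem_sup_left (Ideal.mem_span_singleton_self _)⟩
    rw [← heq] at h1
    obtain ⟨s', hs', h'⟩ := h1
    obtain ⟨g, i, hi, h2⟩ := Ideal.mem_span_singleton_sup.1 h'
    have h3 : a1 * (s * s' - g * f) ∈ I := by
      have : a1 * (s * s' - g * f) = g * (s * a - a1 * f) + s * i := by
        have : a1 * (s * s' - g * f) = s * (s' * a1) - g * (a1 * f) := by ring
        rw [this, ← h2]; ring
      rw [this]
      exact I.add_mem (I.mul_mem_left _ h) (I.mul_mem_left _ hi)
    have h4 := hv.2 _ ((hI.mem_or_mem h3).resolve_left ha1)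
    simp [hf, hs, hs'] at h4

lemma minPrime_PD (G : Geo κ d) {e : ℕ} {a : MvPolynomial (Fin (n+1)) k} (ha : a.IsHomogeneous e) (haI : κ a ≠ 0)
    {Q : Ideal (MvPolynomial (Fin (n+1)) k)} (hQ : Q ∈ (RingHom.ker κ ⊔ Ideal.span {a}).minimalPrimes) : PD κ d Q := by
  have hI : (RingHom.ker κ).IsPrime := RingHom.ker_isPrime κ
  refine ⟨hQ.1.1, ?_, le_sup_left.trans hQ.1.2, ?_⟩
  · apply IsHom.minimalPrimes _ hQ
    apply IsHom.sup G.hom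
    apply isHom_span
    rintro f rfl
    exact ⟨e, ha⟩
  · have := td_minimalPrime (k := k) (f := a) (P := RingHom.ker κ) haI hQ
    have := G.tdim
    omega

/-- unique factorisation at a point -/
theorem UF0 [IsAlgClosed k] (G : Geo κ d) {v : Fin (n+1) → k} (hv : v ∈ Cone (RingHom.ker κ))
    {i : Fin (n+1)} (hi : v i ≠ 0) : ∀ (J : Ideal (MvPolynomial (Fin (n+1)) k)) (e : ℕ) (a : MvPolynomial (Fin (n+1)) k),
    J = Jdesc (RingHom.ker κ) v a → a.IsHomogeneous e → κ a ≠ 0 →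
    ∃ m : PDt κ d →₀ ℤ, IsU (Ov κ v) (κ a / κ (X i) ^ e * (gam v m)⁻¹) := by
  have hI : (RingHom.ker κ).IsPrime := RingHom.ker_isPrime κ
  intro J
  induction J using WellFoundedGT.induction with
  | ind J ih =>
  intro e a hJ ha haI
  have hXp : ∀ e, (X i ^ e : MvPolynomial (Fin (n+1)) k).IsHomogeneous e := fun e => by
    simpa using (isHomogeneous_X k i).pow e
  have hXv : ∀ e, eval v (X i ^ e : MvPolynomial (Fin (n+1)) k) ≠ 0 := fun e => by simpa using fun h => absurd h hi
  have hX0 : κ (X i) ≠ 0 := kne hv (by simpa using hi)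
  by_cases hav : eval v a = 0
  · have hle : RingHom.ker κ ⊔ Ideal.span {a} ≤ ptId v := by
      rw [sup_le_iff, Ideal.span_singleton_le_iff_mem, mem_ptId]
      exact ⟨(cone_iff hv.1).1 hv, hav⟩
    obtain ⟨Q0, hQ0, hQv⟩ := Ideal.exists_minimalPrimes_le hle
    let Q : PDt κ d := ⟨Q0, minPrime_PD G ha haI hQ0⟩
    have hvQ : v ∈ Cone Q.1 := (cone_iff hv.1).2 hQv
    have haQ : a ∈ Q.1 := hQ0.1.2 (Ideal.mem_sup_right (Ideal.mem_span_singleton_self a))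
    obtain ⟨ef, f, x, hL, hpi⟩ := pil_spec G Q hvQ
    obtain ⟨es, s, hs, hsv, hgen⟩ := hL.gen
    have hks : κ s ≠ 0 := kne hv hsv
    have hkx : κ x ≠ 0 := kne hv hL.xv
    have hsa : s * a ∉ RingHom.ker κ := by
      rw [RingHom.mem_ker, map_mul]; exact mul_ne_zero hks haI
    obtain ⟨e1, a1, ha1, he, hdiff⟩ := hom_quot G.hom (hs.mul ha) hL.fh (hgen a haQ) hsa
    have hk : κ s * κ a = κ a1 * κ f := by
      rw [RingHom.mem_ker, map_sub, map_mul, map_mul, sub_eq_zero] at hdiff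
      exact hdiff
    have ha1I : κ a1 ≠ 0 := by
      intro h0; rw [h0, zero_mul] at hk; exact mul_ne_zero hks haI hk
    have hlt := Jdesc_lt (a := a) hv hsv (hvQ.2 f hL.fQ) (show a1 ∉ RingHom.ker κ from ha1I) hdiff
    obtain ⟨m, hm⟩ := ih _ (by rw [hJ]; exact hlt) e1 a1 rfl ha1 ha1I
    refine ⟨m + Finsupp.single Q 1, ?_⟩
    rw [gam_add G, gam_single, zpow_one, hpi]
    have u1 := isU_frac hv (hXp es) hs (hXv es) hsv
    have u2 := isU_frac hv hL.xh (hXp ef) hL.xv (hXv ef)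
    have := (hm.mul u1).mul u2
    convert this using 1
    have hf := hL.fI
    have hg := gam_ne G v m
    simp only [map_pow]
    have hpw : κ (X i) ^ e1 * κ (X i) ^ ef = κ (X i) ^ es * κ (X i) ^ e := by
      rw [← pow_add, ← pow_add, he]
    field_simp
    linear_combination (κ (X i) ^ e1 * κ (X i) ^ ef) * hk + κ a1 * κ f * hpw
  · refine ⟨0, ?_⟩
    rw [gam_zero, inv_one, mul_one, ← map_pow]
    exact isU_frac hv ha (hXp e) hav (hXv e)

theorem UF [IsAlgClosed k] (G : Geo κ d) {v : Fin (n+1) → k} (hv : v ∈ Cone (RingHom.ker κ))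
    {z : K} (hz : z ∈ K0 κ) (h0 : z ≠ 0) : ∃ m : PDt κ d →₀ ℤ, IsU (Ov κ v) (z * (gam v m)⁻¹) := by
  obtain ⟨e, a, s, ha, hs, -, hs0, h⟩ := hz
  obtain ⟨i, hi⟩ := Function.ne_iff.1 hv.1
  have ha0 : κ a ≠ 0 := by rw [← h]; exact mul_ne_zero h0 hs0
  obtain ⟨m, hm⟩ := UF0 G hv hi _ e a rfl ha ha0
  obtain ⟨m', hm'⟩ := UF0 G hv hi _ e s rfl hs hs0
  refine ⟨m + (-m'), ?_⟩
  have := hm.div hm'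
  convert this using 1
  rw [gam_add G, gam_neg G]
  have hX0 : κ (X i) ≠ 0 := kne hv (by simpa using hi)
  have h1 := gam_ne G v m
  have h2 := gam_ne G v m'
  field_simp
  exact h

end B5
end Bert


namespace Bert
section B6
variable {k : Type} [Field k] {n : ℕ} {K : Type} [Field K] [Algebra k K]
variable {κ : MvPolynomial (Fin (n+1)) k →ₐ[k] K} {d : ℕ}

lemma DV.ord_indep {F O : Subalgebra k K} {ϖ ϖ' : K} (h : DV F O ϖ) (h' : DV F O ϖ') (z : K) :
    ordv O ϖ z = ordv O ϖ' z := by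
  have key : ∀ {ϖ ϖ' : K}, DV F O ϖ → DV F O ϖ' → ϖ' * ϖ⁻¹ ∈ O := by
    intro ϖ ϖ' h h'
    have h1 : 0 ≤ ordv O ϖ ϖ' := (h.ge_iff (h'.le h'.mem) h'.ne 0).1 (by simpa using h'.mem)
    have h2 : ordv O ϖ ϖ' ≠ 0 := by
      intro h0
      have := (h.spec (h'.le h'.mem) h'.ne).2
      rw [h0] at this
      exact h'.ninv (by simpa using this)
    have := (h.ge_iff (h'.le h'.mem) h'.ne 1).2 (by omega)
    simpa using this
  have u1 := key h h'
  have u2 := key h' h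
  have hU : IsU O (ϖ' * ϖ⁻¹) := ⟨mul_ne_zero h'.ne (inv_ne_zero h.ne), u1, by
    rw [mul_inv, inv_inv, mul_comm]; exact u2⟩
  have hiff : ∀ r : ℤ, (z * ϖ ^ (-r) ∈ O ∧ (z * ϖ ^ (-r))⁻¹ ∈ O) ↔
      (z * ϖ' ^ (-r) ∈ O ∧ (z * ϖ' ^ (-r))⁻¹ ∈ O) := by
    intro r
    have hr := hU.zpow (-r)
    have e1 : z * ϖ' ^ (-r) = z * ϖ ^ (-r) * (ϖ' * ϖ⁻¹) ^ (-r) := by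
      rw [mul_zpow, mul_assoc, mul_left_comm (ϖ ^ (-r)), ← mul_zpow ϖ, mul_inv_cancel₀ h.ne, one_zpow, mul_one]
    have e2 : z * ϖ ^ (-r) = z * ϖ' ^ (-r) * ((ϖ' * ϖ⁻¹) ^ (-r))⁻¹ := by
      rw [e1, mul_assoc, mul_inv_cancel₀ hr.1, mul_one]
    constructor
    · rintro ⟨h1, h2⟩
      rw [e1]
      exact ⟨mul_mem h1 hr.2.1, by rw [mul_inv]; exact mul_mem h2 hr.2.2⟩
    · rintro ⟨h1, h2⟩
      rw [e2]
      exact ⟨mul_mem h1 hr.2.2, by rw [mul_inv, inv_inv]; exact mul_mem h2 hr.2.1⟩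
  unfold ordv
  congr 1
  ext r
  exact hiff r

lemma PDt.le_imp_eq {Q Q' : PDt κ d} (h : Q.1 ≤ Q'.1) : Q = Q' := by
  by_contra hne
  have hlt : Q.1 < Q'.1 := lt_of_le_of_ne h fun h => hne (Subtype.ext h)
  have := td_quot_lt (k := k) hlt
  rw [Q.2.tdim, Q'.2.tdim] at this
  omega

variable [IsAlgClosed k]

lemma pil_isU (G : Geo κ d) {Q Q' : PDt κ d} (hne : Q' ≠ Q) {v : Fin (n+1) → k} (hv : v ∈ Cone Q.1) :
    IsU (OQ Q) (pil Q' v) := by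
  by_cases hv' : v ∈ Cone Q'.1
  · obtain ⟨e, f, x, hL, hp⟩ := pil_spec G Q' hv'
    rw [hp]
    apply isU_fracQ hL.fh hL.xh
    · intro hf
      obtain ⟨e', s, hs, hsv, hg⟩ := hL.gen
      apply hne
      apply PDt.le_imp_eq
      intro q hq
      have h1 : s * q ∈ Q.1 := by
        refine (sup_le ?_ Q.2.le : Ideal.span {f} ⊔ RingHom.ker κ ≤ Q.1) (hg q hq)
        rwa [Ideal.span_singleton_le_iff_mem]
      exact (Q.2.pr.mem_or_mem h1).resolve_left fun h => hsv (hv.2 s h)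
    · exact fun h => hL.xv (hv.2 x h)
  · rw [pil_one Q' hv']; exact IsU.one

lemma gam_split (G : Geo κ d) {Q : PDt κ d} {v : Fin (n+1) → k} (hv : v ∈ Cone Q.1)
    (m : PDt κ d →₀ ℤ) : IsU (OQ Q) (gam v m * pil Q v ^ (- m Q)) := by
  classical
  have hm : m = Finsupp.single Q (m Q) + m.erase Q := (Finsupp.single_add_erase Q m).symm
  have h1 : gam v m * pil Q v ^ (- m Q) = gam v (m.erase Q) := by
    conv_lhs => rw [hm]
    rw [gam_add G, gam_single]
    have : (Finsupp.single Q (m Q) + Finsupp.erase Q m) Q = m Q := by rw [← hm]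
    rw [this, mul_right_comm, ← zpow_add₀ (pil_ne G Q v), add_neg_cancel, zpow_zero, one_mul]
  rw [h1]
  unfold gam Finsupp.prod
  apply Finset.prod_induction _ (IsU (OQ Q)) (fun _ _ => IsU.mul) IsU.one
  intro Q' hQ'
  apply (pil_isU G ?_ hv).zpow
  rintro rfl
  simp at hQ'

lemma DVat (G : Geo κ d) {Q : PDt κ d} {v : Fin (n+1) → k} (hv : v ∈ Cone Q.1) :
    DV (K0 κ) (OQ Q) (pil Q v) := by
  have hvI := Cone.mono Q.2.le hv
  refine ⟨Fr_le_K0, Ov_le_OQ hv (pil_Ov G Q hvI), pil_ne G Q v, ?_, ?_⟩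
  · intro h
    obtain ⟨e, a, s, ha, hs, hsQ, h1⟩ := OQ_mem.1 h
    obtain ⟨e', f, x, hL, hp⟩ := pil_spec G Q hv
    rw [hp] at h1
    have h2 : κ x * κ s = κ a * κ f := by
      have := hL.fI
      have := kne hvI hL.xv
      field_simp at h1
      linear_combination h1
    have h3 : x * s - a * f ∈ RingHom.ker κ := by
      rw [RingHom.mem_ker, map_sub, map_mul, map_mul, h2, sub_self]
    have h4 : x * s ∈ Q.1 := by
      have := Q.1.add_mem (Q.2.le h3) (Q.1.mul_mem_left a hL.fQ)
      simpa using this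
    rcases Q.2.pr.mem_or_mem h4 with h5 | h5
    · exact hL.xv (hv.2 x h5)
    · exact hsQ h5
  · intro z hz h0
    obtain ⟨m, hm⟩ := UF G hvI hz h0
    refine ⟨m Q, ?_⟩
    have h1 := (hm.mono (Ov_le_OQ hv)).mul (gam_split G hv m)
    have e : z * (gam v m)⁻¹ * (gam v m * pil Q v ^ (-m Q)) = z * pil Q v ^ (-m Q) := by
      rw [mul_assoc, inv_mul_cancel_left₀ (gam_ne G v m)]
    rw [e] at h1
    exact h1.2

lemma exists_pt (G : Geo κ d) (Q : PDt κ d) : ∃ v, v ∈ Cone Q.1 := by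
  obtain ⟨i, hi⟩ := exists_X_notMem Q.2.pr Q.2.hom (by rw [Q.2.tdim]; have := G.two; omega)
  obtain ⟨v, hv, -⟩ := cone_nonempty Q.2.pr hi
  exact ⟨v, hv⟩

open Classical in
/-- order along a prime divisor -/
noncomputable def ord (Q : PDt κ d) (z : K) : ℤ :=
  ordv (OQ Q) (if h : ∃ v, v ∈ Cone Q.1 then pil Q h.choose else 1) z

lemma ord_eq (G : Geo κ d) {Q : PDt κ d} {v : Fin (n+1) → k} (hv : v ∈ Cone Q.1) (z : K) :
    ord Q z = ordv (OQ Q) (pil Q v) z := by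
  have h : ∃ v, v ∈ Cone Q.1 := ⟨v, hv⟩
  rw [ord, dif_pos h]
  exact (DVat G h.choose_spec).ord_indep (DVat G hv) z

lemma ord_mul (G : Geo κ d) (Q : PDt κ d) {z w : K} (hz : z ∈ K0 κ) (h0 : z ≠ 0) (hw : w ∈ K0 κ)
    (hw0 : w ≠ 0) : ord Q (z * w) = ord Q z + ord Q w := by
  obtain ⟨v, hv⟩ := exists_pt G Q
  simp only [ord_eq G hv]
  exact (DVat G hv).ord_mul hz h0 hw hw0

lemma ord_inv (G : Geo κ d) (Q : PDt κ d) {z : K} (hz : z ∈ K0 κ) (h0 : z ≠ 0) :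
    ord Q z⁻¹ = - ord Q z := by
  obtain ⟨v, hv⟩ := exists_pt G Q
  simp only [ord_eq G hv]
  exact (DVat G hv).ord_inv h0 hz (K0_inv hz)

lemma ord_div (G : Geo κ d) (Q : PDt κ d) {z w : K} (hz : z ∈ K0 κ) (h0 : z ≠ 0) (hw : w ∈ K0 κ)
    (hw0 : w ≠ 0) : ord Q (z / w) = ord Q z - ord Q w := by
  rw [div_eq_mul_inv, ord_mul G Q hz h0 (K0_inv hw) (inv_ne_zero hw0), ord_inv G Q hw hw0]; ring

lemma ord_pow (G : Geo κ d) (Q : PDt κ d) {z : K} (hz : z ∈ K0 κ) (h0 : z ≠ 0) (r : ℕ) :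
    ord Q (z ^ r) = r * ord Q z := by
  obtain ⟨v, hv⟩ := exists_pt G Q
  simp only [ord_eq G hv]
  have := (DVat G hv).ord_zpow hz h0 r (K0_zpow hz)
  simpa using this

lemma ord_nonneg_iff (G : Geo κ d) (Q : PDt κ d) {z : K} (hz : z ∈ K0 κ) (h0 : z ≠ 0) :
    0 ≤ ord Q z ↔ z ∈ OQ Q := by
  obtain ⟨v, hv⟩ := exists_pt G Q
  rw [ord_eq G hv, ← (DVat G hv).ge_iff hz h0]
  simp

lemma ord_zero_iff (G : Geo κ d) (Q : PDt κ d) {z : K} (hz : z ∈ K0 κ) (h0 : z ≠ 0) :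
    ord Q z = 0 ↔ IsU (OQ Q) z := by
  have h1 := ord_nonneg_iff G Q hz h0
  have h2 := ord_nonneg_iff G Q (K0_inv hz) (inv_ne_zero h0)
  rw [ord_inv G Q hz h0] at h2
  constructor
  · intro h; exact ⟨h0, h1.1 (by omega), h2.1 (by omega)⟩
  · rintro ⟨-, h3, h4⟩
    have := h1.2 h3
    have := h2.2 h4
    omega

lemma ord_gam (G : Geo κ d) {Q : PDt κ d} {v : Fin (n+1) → k} (hv : v ∈ Cone Q.1)
    (m : PDt κ d →₀ ℤ) : ord Q (gam v m) = m Q := by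
  rw [ord_eq G hv]
  obtain ⟨-, h1, h2⟩ := gam_split G hv m
  exact (DVat G hv).unique (gam_K0 G v m) (gam_ne G v m) h1 h2

lemma gam_mem_Ov (G : Geo κ d) {v : Fin (n+1) → k} (hv : v ∈ Cone (RingHom.ker κ))
    {m : PDt κ d →₀ ℤ} (hm : ∀ Q : PDt κ d, v ∈ Cone Q.1 → 0 ≤ m Q) : gam v m ∈ Ov κ v := by
  apply prod_mem
  intro Q _
  by_cases hQ : v ∈ Cone Q.1
  · obtain ⟨r, hr⟩ := Int.eq_ofNat_of_zero_le (hm Q hQ)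
    rw [hr]; simpa using pow_mem (pil_Ov G Q hv) r
  · show pil Q v ^ _ ∈ _
    rw [pil_one Q hQ]; simp

/-- regularity at a point is detected by orders -/
theorem Ov_iff (G : Geo κ d) {v : Fin (n+1) → k} (hv : v ∈ Cone (RingHom.ker κ))
    {z : K} (hz : z ∈ K0 κ) (h0 : z ≠ 0) :
    z ∈ Ov κ v ↔ ∀ Q : PDt κ d, v ∈ Cone Q.1 → 0 ≤ ord Q z := by
  constructor
  · intro h Q hQ
    exact (ord_nonneg_iff G Q hz h0).2 (Ov_le_OQ hQ h)
  · intro h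
    obtain ⟨m, hm⟩ := UF G hv hz h0
    have h1 : ∀ Q : PDt κ d, v ∈ Cone Q.1 → ord Q z = m Q := by
      intro Q hQ
      have h2 := (ord_zero_iff G Q (mul_mem hz (K0_inv (gam_K0 G v m))) hm.1).2 (hm.mono (Ov_le_OQ hQ))
      rw [ord_mul G Q hz h0 (K0_inv (gam_K0 G v m)) (inv_ne_zero (gam_ne G v m)),
        ord_inv G Q (gam_K0 G v m) (gam_ne G v m), ord_gam G hQ] at h2
      omega
    have h3 : z = z * (gam v m)⁻¹ * gam v m := by rw [inv_mul_cancel_right₀ (gam_ne G v m)]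
    rw [h3]
    refine mul_mem hm.2.1 (gam_mem_Ov G hv ?_)
    intro Q hQ
    rw [← h1 Q hQ]; exact h Q hQ

theorem isU_iff (G : Geo κ d) {v : Fin (n+1) → k} (hv : v ∈ Cone (RingHom.ker κ))
    {z : K} (hz : z ∈ K0 κ) (h0 : z ≠ 0) :
    IsU (Ov κ v) z ↔ ∀ Q : PDt κ d, v ∈ Cone Q.1 → ord Q z = 0 := by
  have h1 := Ov_iff G hv hz h0
  have h2 := Ov_iff G hv (K0_inv hz) (inv_ne_zero h0)
  constructor
  · rintro ⟨-, h3, h4⟩ Q hQ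
    have := h1.1 h3 Q hQ
    have := h2.1 h4 Q hQ
    rw [ord_inv G Q hz h0] at this
    omega
  · intro h
    exact ⟨h0, h1.2 fun Q hQ => (h Q hQ).ge, h2.2 fun Q hQ => by rw [ord_inv G Q hz h0, h Q hQ]; rfl⟩

/-- finite support -/
theorem ord_finite (G : Geo κ d) {z : K} (hz : z ∈ K0 κ) (h0 : z ≠ 0) :
    {Q : PDt κ d | ord Q z ≠ 0}.Finite := by
  obtain ⟨e, a, s, ha, hs, -, hs0, h⟩ := id hz
  have ha0 : κ a ≠ 0 := by rw [← h]; exact mul_ne_zero h0 hs0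
  have hfin : ∀ {e : ℕ} {a : MvPolynomial (Fin (n+1)) k}, a.IsHomogeneous e → κ a ≠ 0 → {Q : PDt κ d | a ∈ Q.1}.Finite := by
    intro e a ha ha0
    have hI : (RingHom.ker κ).IsPrime := RingHom.ker_isPrime κ
    have h1 := Ideal.finite_minimalPrimes_of_isNoetherianRing (MvPolynomial (Fin (n+1)) k) (RingHom.ker κ ⊔ Ideal.span {a})
    refine Set.Finite.of_finite_image (f := Subtype.val) (h1.subset ?_) Subtype.val_injective.injOn
    rintro _ ⟨Q, hQ, rfl⟩
    have hle : RingHom.ker κ ⊔ Ideal.span {a} ≤ Q.1 := by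
      rw [sup_le_iff, Ideal.span_singleton_le_iff_mem]; exact ⟨Q.2.le, hQ⟩
    obtain ⟨Q0, hQ0, hQv⟩ := Ideal.exists_minimalPrimes_le hle
    have : (⟨Q0, minPrime_PD G ha ha0 hQ0⟩ : PDt κ d) = Q := PDt.le_imp_eq hQv
    rw [← this]; exact hQ0
  refine ((hfin ha ha0).union (hfin hs hs0)).subset ?_
  intro Q hQ
  by_contra hn
  simp only [Set.mem_union, Set.mem_ofPred_eq, not_or] at hn
  apply hQ
  rw [ord_zero_iff G Q hz h0]
  have : z = κ a / κ s := by rw [← h]; field_simp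
  rw [this]
  exact isU_fracQ ha hs hn.1 hn.2

/-- link with symbolic powers -/
theorem ordAlong_eq (G : Geo κ d) {X' Y : Set (ProjPt k n)} (Q : PDt κ d)
    (hX : _root_.vanishingIdeal X' = RingHom.ker κ) (hY : _root_.vanishingIdeal Y = Q.1)
    {e : ℕ} {g x : MvPolynomial (Fin (n+1)) k} (hg : g.IsHomogeneous e) (hx : x.IsHomogeneous e) (hg0 : κ g ≠ 0)
    (hxQ : x ∉ Q.1) : (ordAlong X' Y g : ℤ) = ord Q (κ g / κ x) := by
  obtain ⟨v, hv⟩ := exists_pt G Q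
  have hvI := Cone.mono Q.2.le hv
  have hI : (RingHom.ker κ).IsPrime := RingHom.ker_isPrime κ
  have hx0 := kne' Q hxQ
  have hzK := frac_mem_K0 (κ := κ) hg hx
  have hz0 : κ g / κ x ≠ 0 := div_ne_zero hg0 hx0
  have hn : 0 ≤ ord Q (κ g / κ x) := (ord_nonneg_iff G Q hzK hz0).2
    (OQ_mem.2 ⟨e, g, x, hg, hx, hxQ, div_mul_cancel₀ _ hx0⟩)
  obtain ⟨m, hm⟩ := Int.eq_ofNat_of_zero_le hn
  obtain ⟨hu, hu'⟩ := (DVat G hv).spec hzK hz0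
  rw [← ord_eq G hv, hm] at hu hu'
  obtain ⟨ef, f, y, hL, hp⟩ := pil_spec G Q hv
  obtain ⟨e0, s0, hs0, hs0v, hgen⟩ := hL.gen
  have hy0 := kne hvI hL.xv
  have hyQ : y ∉ Q.1 := fun h => hL.xv (hv.2 y h)
  have hs0Q : s0 ∉ Q.1 := fun h => hs0v (hv.2 s0 h)
  obtain ⟨e1, a, s, ha, hs, hsQ, h1⟩ := OQ_mem.1 hu
  obtain ⟨e2, a', s', ha', hs', hsQ', h2⟩ := OQ_mem.1 hu'
  have hf0 := hL.fI
  rw [hp] at h1 h2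
  -- s g y^m = a f^m x
  have E1 : κ (s * y ^ m * g) = κ (a * x * f ^ m) := by
    simp only [map_mul, map_pow]
    rw [zpow_neg, zpow_natCast, div_pow] at h1
    rw [← h1]; field_simp
  have haQ : a ∉ Q.1 := by
    intro haQ
    have hs'0 := kne' Q hsQ'
    have hs00 := kne' Q hsQ
    have : κ (s * s') = κ (a * a') := by
      rw [map_mul, map_mul, ← h1, ← h2]
      have : κ g / κ x * (κ f / κ y) ^ (-(m:ℤ)) ≠ 0 := mul_ne_zero hz0 (zpow_ne_zero _ (div_ne_zero hf0 hy0))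
      field_simp
    have h3 : s * s' - a * a' ∈ RingHom.ker κ := by rw [RingHom.mem_ker, map_sub, this, sub_self]
    have h4 := Q.1.add_mem (Q.2.le h3) (Q.1.mul_mem_right a' haQ)
    rw [sub_add_cancel] at h4
    exact (Q.2.pr.mem_or_mem h4).elim hsQ hsQ'
  have hker : s * y ^ m * g - a * x * f ^ m ∈ RingHom.ker κ := by
    rw [RingHom.mem_ker, map_sub, E1, sub_self]
  rw [hm]
  congr 1
  unfold ordAlong
  rw [hX, hY]
  apply IsGreatest.csSup_eq
  constructor
  · refine ⟨s * y ^ m, fun h => ?_, ?_⟩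
    · rcases Q.2.pr.mem_or_mem h with h | h
      · exact hsQ h
      · exact hyQ (Q.2.pr.mem_of_pow_mem _ h)
    · have : s * y ^ m * g = a * x * f ^ m + (s * y ^ m * g - a * x * f ^ m) := by ring
      rw [this]
      exact Ideal.add_mem _ (Ideal.mem_sup_left (Ideal.mul_mem_left _ _ (Ideal.pow_mem_pow hL.fQ m)))
        (Ideal.mem_sup_right hker)
  · rintro r ⟨t, htQ, ht⟩
    by_contra hlt
    have hlt : m + 1 ≤ r := by omega
    have hpow : ∀ r : ℕ, ∀ q ∈ Q.1 ^ r, s0 ^ r * q ∈ Ideal.span {f ^ r} ⊔ RingHom.ker κ := by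
      intro r
      have hle : Ideal.span {s0 ^ r} * Q.1 ^ r ≤ Ideal.span {f ^ r} ⊔ RingHom.ker κ := by
        have h5 : Ideal.span {s0} * Q.1 ≤ Ideal.span {f} ⊔ RingHom.ker κ := by
          rw [Ideal.span_singleton_mul_le_iff]; exact hgen
        rw [← Ideal.span_singleton_pow, ← mul_pow, ← Ideal.span_singleton_pow]
        refine (Ideal.pow_right_mono h5 r).trans ?_
        clear h5 hlt ht
        induction r with
        | zero => simp
        | succ r ih =>
          rw [pow_succ, pow_succ]
          refine (Ideal.mul_mono_left ih).trans ?_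
          rw [Ideal.sup_mul, Ideal.mul_sup]
          refine sup_le (sup_le le_sup_left (le_sup_of_le_right Ideal.mul_le_right)) (le_sup_of_le_right Ideal.mul_le_left)
      rwa [Ideal.span_singleton_mul_le_iff] at hle
    have h6 : s0 ^ r * (t * g) ∈ Ideal.span {f ^ r} ⊔ RingHom.ker κ := by
      obtain ⟨q, hq, i, hi, hqi⟩ := Submodule.mem_sup.1 ht
      rw [← hqi, mul_add]
      exact Ideal.add_mem _ (hpow r q hq) (Ideal.mem_sup_right (Ideal.mul_mem_left _ _ hi))
    obtain ⟨c, i, hi, h7⟩ := Ideal.mem_span_singleton_sup.1 h6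
    have h8 : f ^ m * (s0 ^ r * t * (a * x) - s * y ^ m * c * f ^ (r - m)) ∈ RingHom.ker κ := by
      have hfr : f ^ r = f ^ m * f ^ (r - m) := by rw [← pow_add]; congr 1; omega
      have : f ^ m * (s0 ^ r * t * (a * x) - s * y ^ m * c * f ^ (r - m)) =
          s * y ^ m * i - s0 ^ r * t * (s * y ^ m * g - a * x * f ^ m) := by
        rw [hfr] at h7
        linear_combination (-(s * y ^ m)) * h7
      rw [this]
      exact Ideal.sub_mem _ (Ideal.mul_mem_left _ _ hi) (Ideal.mul_mem_left _ _ hker)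
    have h9 := (hI.mem_or_mem h8).resolve_left fun h => hf0 (hI.mem_of_pow_mem _ h)
    have h10 : s0 ^ r * t * (a * x) ∈ Q.1 := by
      have := Q.1.add_mem (Q.2.le h9) (Q.1.mul_mem_left (s * y ^ m * c)
        (Ideal.pow_mem_of_mem _ hL.fQ (r - m) (by omega)))
      rwa [sub_add_cancel] at this
    rcases Q.2.pr.mem_or_mem h10 with h | h
    · rcases Q.2.pr.mem_or_mem h with h | h
      · exact hs0Q (Q.2.pr.mem_of_pow_mem _ h)
      · exact htQ h
    · rcases Q.2.pr.mem_or_mem h with h | h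
      · exact haQ h
      · exact hxQ h

end B6
end Bert


namespace Bert
section B7
variable {k : Type} [Field k] {n : ℕ} {K : Type} [Field K] [Algebra k K]
variable {κ : MvPolynomial (Fin (n+1)) k →ₐ[k] K} {d : ℕ}

/-! values and differentials at points -/

lemma grad_add (f g : MvPolynomial (Fin (n+1)) k) (v : Fin (n+1) → k) :
    gradientAt (f + g) v = gradientAt f v + gradientAt g v := by
  ext i; simp [gradientAt]

lemma grad_sub (f g : MvPolynomial (Fin (n+1)) k) (v : Fin (n+1) → k) :
    gradientAt (f - g) v = gradientAt f v - gradientAt g v := by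
  ext i; simp [gradientAt]

lemma grad_mul (f g : MvPolynomial (Fin (n+1)) k) (v : Fin (n+1) → k) :
    gradientAt (f * g) v = eval v f • gradientAt g v + eval v g • gradientAt f v := by
  ext i; simp [gradientAt, Derivation.leibniz]

lemma grad_smul (c : k) (f : MvPolynomial (Fin (n+1)) k) (v : Fin (n+1) → k) :
    gradientAt (c • f) v = c • gradientAt f v := by
  ext i; simp [gradientAt]

lemma grad_C (c : k) (v : Fin (n+1) → k) : gradientAt (C c : MvPolynomial (Fin (n+1)) k) v = 0 := by
  ext i; simp [gradientAt]

lemma grad_mem {I : Ideal (MvPolynomial (Fin (n+1)) k)} {f : MvPolynomial (Fin (n+1)) k} (hf : f ∈ I) (v : Fin (n+1) → k) :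
    gradientAt f v ∈ gradSpan I v := Submodule.subset_span ⟨f, hf, rfl⟩

/-- presentation of a local function -/
def Pres (κ : MvPolynomial (Fin (n+1)) k →ₐ[k] K) (v : Fin (n+1) → k) (z : K) (a s : MvPolynomial (Fin (n+1)) k) : Prop :=
  (∃ e, a.IsHomogeneous e ∧ s.IsHomogeneous e) ∧ eval v s ≠ 0 ∧ z * κ s = κ a

lemma exists_pres {v : Fin (n+1) → k} {z : K} (hz : z ∈ Ov κ v) : ∃ a s, Pres κ v z a s := by
  obtain ⟨e, a, s, ha, hs, h1, h2, h3⟩ := hz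
  exact ⟨a, s, ⟨e, ha, hs⟩, mem_compl.1 h1, h3⟩

lemma Pres.mem {v : Fin (n+1) → k} (hv : v ∈ Cone (RingHom.ker κ)) {z : K} {a s : MvPolynomial (Fin (n+1)) k}
    (h : Pres κ v z a s) : z ∈ Ov κ v := by
  obtain ⟨⟨e, ha, hs⟩, h1, h2⟩ := h
  exact (Ov_mem hv).2 ⟨e, a, s, ha, hs, h1, h2⟩

lemma Pres.ker {v : Fin (n+1) → k} {z : K} {a s a' s' : MvPolynomial (Fin (n+1)) k}
    (h : Pres κ v z a s) (h' : Pres κ v z a' s') : a * s' - a' * s ∈ RingHom.ker κ := by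
  rw [RingHom.mem_ker, map_sub, map_mul, map_mul, ← h.2.2, ← h'.2.2]; ring

/-- value at a point -/
noncomputable def ev (κ : MvPolynomial (Fin (n+1)) k →ₐ[k] K) (v : Fin (n+1) → k) (z : K) : k :=
  Classical.epsilon fun c => ∃ a s, Pres κ v z a s ∧ c = eval v a / eval v s

lemma Pres.ev {v : Fin (n+1) → k} (hv : v ∈ Cone (RingHom.ker κ)) {z : K} {a s : MvPolynomial (Fin (n+1)) k}
    (h : Pres κ v z a s) : ev κ v z = eval v a / eval v s := by
  have hex : ∃ c, ∃ a s, Pres κ v z a s ∧ c = eval v a / eval v s := ⟨_, a, s, h, rfl⟩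
  obtain ⟨a', s', h', h1⟩ := Classical.epsilon_spec hex
  have h2 := hv.2 _ (h.ker h')
  rw [map_sub, map_mul, map_mul] at h2
  rw [Bert.ev, h1, div_eq_div_iff h'.2.1 h.2.1]
  linear_combination -h2

lemma Pres.mul {v : Fin (n+1) → k} {z w : K} {a s b t : MvPolynomial (Fin (n+1)) k}
    (h : Pres κ v z a s) (h' : Pres κ v w b t) : Pres κ v (z * w) (a * b) (s * t) := by
  obtain ⟨⟨e, ha, hs⟩, h1, h2⟩ := h
  obtain ⟨⟨e', ha', hs'⟩, h1', h2'⟩ := h'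
  refine ⟨⟨e + e', ha.mul ha', hs.mul hs'⟩, by simp [h1, h1'], ?_⟩
  rw [map_mul, map_mul, ← h2, ← h2']; ring

lemma Pres.add {v : Fin (n+1) → k} {z w : K} {a s b t : MvPolynomial (Fin (n+1)) k}
    (h : Pres κ v z a s) (h' : Pres κ v w b t) : Pres κ v (z + w) (a * t + b * s) (s * t) := by
  obtain ⟨⟨e, ha, hs⟩, h1, h2⟩ := h
  obtain ⟨⟨e', ha', hs'⟩, h1', h2'⟩ := h'
  refine ⟨⟨e + e', (ha.mul hs').add (by rw [add_comm e]; exact ha'.mul hs), hs.mul hs'⟩, by simp [h1, h1'], ?_⟩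
  rw [map_add, map_mul, map_mul, map_mul, ← h2, ← h2']; ring

lemma Pres.const (v : Fin (n+1) → k) (c : k) : Pres κ v (algebraMap k K c) (C c) 1 := by
  refine ⟨⟨0, isHomogeneous_C _ _, isHomogeneous_one _ _⟩, by simp, ?_⟩
  rw [map_one, mul_one]; exact (κ.commutes c).symm

lemma ev_mul {v : Fin (n+1) → k} (hv : v ∈ Cone (RingHom.ker κ)) {z w : K} (hz : z ∈ Ov κ v)
    (hw : w ∈ Ov κ v) : ev κ v (z * w) = ev κ v z * ev κ v w := by
  obtain ⟨a, s, h⟩ := exists_pres hz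
  obtain ⟨b, t, h'⟩ := exists_pres hw
  rw [(h.mul h').ev hv, h.ev hv, h'.ev hv, map_mul, map_mul, div_mul_div_comm]

lemma ev_add {v : Fin (n+1) → k} (hv : v ∈ Cone (RingHom.ker κ)) {z w : K} (hz : z ∈ Ov κ v)
    (hw : w ∈ Ov κ v) : ev κ v (z + w) = ev κ v z + ev κ v w := by
  obtain ⟨a, s, h⟩ := exists_pres hz
  obtain ⟨b, t, h'⟩ := exists_pres hw
  rw [(h.add h').ev hv, h.ev hv, h'.ev hv, map_mul, map_add, map_mul, map_mul,
    div_add_div _ _ h.2.1 h'.2.1]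
  ring

lemma ev_const {v : Fin (n+1) → k} (hv : v ∈ Cone (RingHom.ker κ)) (c : k) :
    ev κ v (algebraMap k K c) = c := by
  rw [(Pres.const v c).ev hv]; simp

/-- evaluation as an algebra map -/
noncomputable def evA {v : Fin (n+1) → k} (hv : v ∈ Cone (RingHom.ker κ)) : Ov κ v →ₐ[k] k where
  toFun z := ev κ v z.1
  map_one' := by simpa using ev_const hv (1 : k)
  map_zero' := by simpa using ev_const hv (0 : k)
  map_mul' z w := ev_mul hv z.2 w.2
  map_add' z w := ev_add hv z.2 w.2
  commutes' c := ev_const hv c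

lemma evA_apply {v : Fin (n+1) → k} (hv : v ∈ Cone (RingHom.ker κ)) (z : Ov κ v) :
    evA hv z = ev κ v z.1 := rfl

lemma ev_zero {v : Fin (n+1) → k} (hv : v ∈ Cone (RingHom.ker κ)) : ev κ v 0 = 0 :=
  map_zero (evA hv)

lemma ev_one {v : Fin (n+1) → k} (hv : v ∈ Cone (RingHom.ker κ)) : ev κ v 1 = 1 :=
  map_one (evA hv)

lemma ev_pow {v : Fin (n+1) → k} (hv : v ∈ Cone (RingHom.ker κ)) {z : K} (hz : z ∈ Ov κ v) (r : ℕ) :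
    ev κ v (z ^ r) = ev κ v z ^ r :=
  map_pow (evA hv) ⟨z, hz⟩ r

lemma ev_smul {v : Fin (n+1) → k} (hv : v ∈ Cone (RingHom.ker κ)) (c : k) {z : K} (hz : z ∈ Ov κ v) :
    ev κ v (c • z) = c * ev κ v z :=
  map_smul (evA hv) c ⟨z, hz⟩

lemma ev_sum {v : Fin (n+1) → k} (hv : v ∈ Cone (RingHom.ker κ)) {ι : Type} (s : Finset ι) {z : ι → K}
    (hz : ∀ i, z i ∈ Ov κ v) : ev κ v (∑ i ∈ s, z i) = ∑ i ∈ s, ev κ v (z i) := by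
  classical
  induction s using Finset.induction_on with
  | empty => simpa using ev_zero hv
  | insert a s ha ih => rw [Finset.sum_insert ha, Finset.sum_insert ha,
      ev_add hv (hz a) (sum_mem fun i _ => hz i), ih]

lemma ev_aeval {v : Fin (n+1) → k} (hv : v ∈ Cone (RingHom.ker κ)) {σ : Type} {z : σ → K}
    (hz : ∀ i, z i ∈ Ov κ v) (p : MvPolynomial σ k) :
    aeval z p ∈ Ov κ v ∧ ev κ v (aeval z p) = eval (fun i => ev κ v (z i)) p := by
  have h1 : aeval z p = (aeval (fun i => (⟨z i, hz i⟩ : Ov κ v)) p : Ov κ v).1 := by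
    have := (comp_aeval_apply (fun i => (⟨z i, hz i⟩ : Ov κ v)) (Ov κ v).val p)
    exact this.symm
  refine ⟨h1 ▸ Subtype.property _, ?_⟩
  rw [h1]
  have := (comp_aeval_apply (fun i => (⟨z i, hz i⟩ : Ov κ v)) (evA hv) p)
  rw [← evA_apply hv, this, aeval_eq_eval]
  rfl

lemma isU_iff_ev {v : Fin (n+1) → k} (hv : v ∈ Cone (RingHom.ker κ)) {z : K} (hz : z ∈ Ov κ v) :
    IsU (Ov κ v) z ↔ ev κ v z ≠ 0 := by
  constructor
  · rintro ⟨h0, -, h2⟩ h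
    have := ev_mul hv hz h2
    rw [mul_inv_cancel₀ h0, ev_one hv, h, zero_mul] at this
    exact one_ne_zero this
  · intro h
    obtain ⟨a, s, hp⟩ := exists_pres hz
    rw [hp.ev hv] at h
    have ha : eval v a ≠ 0 := fun h0 => h (by rw [h0, zero_div])
    obtain ⟨⟨e, h1, h2⟩, h3, h4⟩ := hp
    have := isU_frac hv h1 h2 ha h3
    rwa [← h4, mul_div_cancel_right₀ _ (kne hv h3)] at this

/-- differential at a point -/
noncomputable def dv (κ : MvPolynomial (Fin (n+1)) k →ₐ[k] K) (v : Fin (n+1) → k) (z : K) :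
    (Fin (n+1) → k) ⧸ gradSpan (RingHom.ker κ) v :=
  Classical.epsilon fun c => ∃ a s, Pres κ v z a s ∧
    c = Submodule.Quotient.mk ((eval v s)⁻¹ • (gradientAt a v - ev κ v z • gradientAt s v))

lemma Pres.dv {v : Fin (n+1) → k} (hv : v ∈ Cone (RingHom.ker κ)) {z : K} {a s : MvPolynomial (Fin (n+1)) k}
    (h : Pres κ v z a s) : Bert.dv κ v z =
    Submodule.Quotient.mk ((eval v s)⁻¹ • (gradientAt a v - Bert.ev κ v z • gradientAt s v)) := by
  have hex : ∃ c : (Fin (n+1) → k) ⧸ gradSpan (RingHom.ker κ) v, ∃ a s, Pres κ v z a s ∧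
    c = Submodule.Quotient.mk ((eval v s)⁻¹ • (gradientAt a v - Bert.ev κ v z • gradientAt s v)) := ⟨_, a, s, h, rfl⟩
  obtain ⟨a', s', h', h1⟩ := Classical.epsilon_spec hex
  have h2 := grad_mem (h.ker h') v
  rw [Bert.dv, h1, Submodule.Quotient.eq]
  have e1 := h.ev hv
  have e2 := h'.ev hv
  have n1 := h.2.1
  have n2 := h'.2.1
  rw [eq_div_iff n1] at e1
  rw [eq_div_iff n2] at e2
  have h3 : (eval v s)⁻¹ * (eval v s')⁻¹ ≠ 0 := mul_ne_zero (inv_ne_zero n1) (inv_ne_zero n2)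
  have := (gradSpan (RingHom.ker κ) v).smul_mem (-((eval v s)⁻¹ * (eval v s')⁻¹)) h2
  convert this using 1
  ext i
  simp only [grad_sub, grad_mul, Pi.sub_apply, Pi.smul_apply, Pi.add_apply, smul_eq_mul, ← e1, ← e2]
  field_simp
  ring

lemma dv_mul {v : Fin (n+1) → k} (hv : v ∈ Cone (RingHom.ker κ)) {z w : K} (hz : z ∈ Ov κ v)
    (hw : w ∈ Ov κ v) : dv κ v (z * w) = ev κ v z • dv κ v w + ev κ v w • dv κ v z := by
  obtain ⟨a, s, h⟩ := exists_pres hz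
  obtain ⟨b, t, h'⟩ := exists_pres hw
  rw [(h.mul h').dv hv, h.dv hv, h'.dv hv, ← Submodule.Quotient.mk_smul, ← Submodule.Quotient.mk_smul,
    ← Submodule.Quotient.mk_add, ev_mul hv hz hw]
  congr 1
  have e1 := h.ev hv
  have e2 := h'.ev hv
  have n1 := h.2.1
  have n2 := h'.2.1
  rw [eq_div_iff n1] at e1
  rw [eq_div_iff n2] at e2
  ext i
  simp only [grad_mul, Pi.sub_apply, Pi.smul_apply, Pi.add_apply, smul_eq_mul, ← e1, ← e2, map_mul]
  field_simp
  ring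

lemma dv_add {v : Fin (n+1) → k} (hv : v ∈ Cone (RingHom.ker κ)) {z w : K} (hz : z ∈ Ov κ v)
    (hw : w ∈ Ov κ v) : dv κ v (z + w) = dv κ v z + dv κ v w := by
  obtain ⟨a, s, h⟩ := exists_pres hz
  obtain ⟨b, t, h'⟩ := exists_pres hw
  rw [(h.add h').dv hv, h.dv hv, h'.dv hv, ← Submodule.Quotient.mk_add, ev_add hv hz hw]
  congr 1
  have e1 := h.ev hv
  have e2 := h'.ev hv
  have n1 := h.2.1
  have n2 := h'.2.1
  rw [eq_div_iff n1] at e1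
  rw [eq_div_iff n2] at e2
  ext i
  simp only [grad_mul, grad_add, Pi.sub_apply, Pi.smul_apply, Pi.add_apply, smul_eq_mul, ← e1, ← e2, map_mul]
  field_simp
  ring

lemma dv_const {v : Fin (n+1) → k} (hv : v ∈ Cone (RingHom.ker κ)) (c : k) :
    dv κ v (algebraMap k K c) = 0 := by
  rw [(Pres.const v c).dv hv, grad_C, ← C_1, grad_C]; simp

lemma dv_smul {v : Fin (n+1) → k} (hv : v ∈ Cone (RingHom.ker κ)) (c : k) {z : K} (hz : z ∈ Ov κ v) :
    dv κ v (c • z) = c • dv κ v z := by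
  rw [Algebra.smul_def, dv_mul hv (Subalgebra.algebraMap_mem _ _) hz, dv_const hv, ev_const hv]; simp

/-- differential as a linear map -/
noncomputable def dvL {v : Fin (n+1) → k} (hv : v ∈ Cone (RingHom.ker κ)) :
    Ov κ v →ₗ[k] (Fin (n+1) → k) ⧸ gradSpan (RingHom.ker κ) v where
  toFun z := dv κ v z.1
  map_add' z w := dv_add hv z.2 w.2
  map_smul' c z := dv_smul hv c z.2

variable [IsAlgClosed k]

/-- sections of a divisor -/
noncomputable def Gam (κ : MvPolynomial (Fin (n+1)) k →ₐ[k] K) (B : PDt κ d →₀ ℤ) : Submodule k K where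
  carrier := {z | z ∈ K0 κ ∧ ∀ v ∈ Cone (RingHom.ker κ), z * gam v B ∈ Ov κ v}
  zero_mem' := ⟨zero_mem _, fun v _ => by rw [zero_mul]; exact zero_mem _⟩
  add_mem' := by
    rintro z w ⟨h, h1⟩ ⟨h', h1'⟩
    exact ⟨add_mem h h', fun v hv => by rw [add_mul]; exact add_mem (h1 v hv) (h1' v hv)⟩
  smul_mem' := by
    rintro c z ⟨h, h1⟩
    exact ⟨Subalgebra.smul_mem _ h c, fun v hv => by
      rw [smul_mul_assoc]; exact Subalgebra.smul_mem _ (h1 v hv) c⟩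

/-- a section generating at `v` -/
def Gen (B : PDt κ d →₀ ℤ) (v : Fin (n+1) → k) (z : K) : Prop := IsU (Ov κ v) (z * gam v B)

lemma mem_Gam_iff (G : Geo κ d) {B : PDt κ d →₀ ℤ} {z : K} (hz : z ∈ K0 κ) (h0 : z ≠ 0) :
    z ∈ Gam κ B ↔ ∀ Q, - B Q ≤ ord Q z := by
  have key : ∀ v, z * gam v B ∈ K0 κ ∧ z * gam v B ≠ 0 := fun v =>
    ⟨mul_mem hz (gam_K0 G v B), mul_ne_zero h0 (gam_ne G v B)⟩
  have ho : ∀ v, ∀ Q : PDt κ d, v ∈ Cone Q.1 → ord Q (z * gam v B) = ord Q z + B Q := by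
    intro v Q hv
    rw [ord_mul G Q hz h0 (gam_K0 G v B) (gam_ne G v B), ord_gam G hv]
  constructor
  · rintro ⟨-, h⟩ Q
    obtain ⟨v, hv⟩ := exists_pt G Q
    have := (Ov_iff G (Cone.mono Q.2.le hv) (key v).1 (key v).2).1 (h v (Cone.mono Q.2.le hv)) Q hv
    rw [ho v Q hv] at this
    omega
  · intro h
    refine ⟨hz, fun v hv => (Ov_iff G hv (key v).1 (key v).2).2 fun Q hQ => ?_⟩
    rw [ho v Q hQ]
    have := h Q
    omega

lemma Gen_iff (G : Geo κ d) {B : PDt κ d →₀ ℤ} {v : Fin (n+1) → k} (hv : v ∈ Cone (RingHom.ker κ))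
    {z : K} (hz : z ∈ K0 κ) (h0 : z ≠ 0) :
    Gen B v z ↔ ∀ Q : PDt κ d, v ∈ Cone Q.1 → ord Q z = - B Q := by
  rw [Gen, isU_iff G hv (mul_mem hz (gam_K0 G v B)) (mul_ne_zero h0 (gam_ne G v B))]
  refine forall₂_congr fun Q hQ => ?_
  rw [ord_mul G Q hz h0 (gam_K0 G v B) (gam_ne G v B), ord_gam G hQ]
  omega

lemma Gen.ne {B : PDt κ d →₀ ℤ} {v : Fin (n+1) → k} {z : K} (h : Gen B v z) : z ≠ 0 :=
  left_ne_zero_of_mul h.1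

lemma Gam_mul (G : Geo κ d) {B B' : PDt κ d →₀ ℤ} {z w : K} (hz : z ∈ Gam κ B) (hw : w ∈ Gam κ B') :
    z * w ∈ Gam κ (B + B') := by
  refine ⟨mul_mem hz.1 hw.1, fun v hv => ?_⟩
  rw [gam_add G, mul_mul_mul_comm]
  exact mul_mem (hz.2 v hv) (hw.2 v hv)

lemma Gam_pow (G : Geo κ d) {B : PDt κ d →₀ ℤ} {z : K} (hz : z ∈ Gam κ B) (r : ℕ) :
    z ^ r ∈ Gam κ (r • B) := by
  refine ⟨pow_mem hz.1 r, fun v hv => ?_⟩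
  rw [gam_nsmul G, ← mul_pow]
  exact pow_mem (hz.2 v hv) r

lemma Gen_mul (G : Geo κ d) {B B' : PDt κ d →₀ ℤ} {v : Fin (n+1) → k} {z w : K} (hz : Gen B v z)
    (hw : Gen B' v w) : Gen (B + B') v (z * w) := by
  rw [Gen, gam_add G, mul_mul_mul_comm]
  exact IsU.mul hz hw

lemma Gen_pow (G : Geo κ d) {B : PDt κ d →₀ ℤ} {v : Fin (n+1) → k} {z : K} (hz : Gen B v z) (r : ℕ) :
    Gen (r • B) v (z ^ r) := by
  rw [Gen, gam_nsmul G, ← mul_pow]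
  exact IsU.pow hz r

/-- ratio to a generator is regular -/
lemma div_Gen {B : PDt κ d →₀ ℤ} {v : Fin (n+1) → k} (hv : v ∈ Cone (RingHom.ker κ)) (G : Geo κ d)
    {z w : K} (hz : z ∈ Gam κ B) (hw : Gen B v w) : z / w ∈ Ov κ v := by
  have : z / w = (z * gam v B) * (w * gam v B)⁻¹ := by
    rw [← div_eq_mul_inv, mul_div_mul_right _ _ (gam_ne G v B)]
  rw [this]
  exact mul_mem (hz.2 v hv) hw.2.2

lemma aeval_hom_div {σ : Type} (p : MvPolynomial σ k) {r : ℕ} (hp : p.IsHomogeneous r) (z : σ → K) (w : K)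
    (hw : w ≠ 0) : aeval (fun i => z i / w) p = aeval z p / w ^ r := by
  have h1 : aeval z p = w ^ r * aeval (fun i => z i / w) p := by
    rw [aeval_def, aeval_def, eval₂_eq, eval₂_eq, Finset.mul_sum]
    apply Finset.sum_congr rfl
    intro m hm
    have hd : m.degree = r := by
      have := hp (mem_support_iff.1 hm)
      rw [Finsupp.degree_eq_weight_one]; exact this
    simp_rw [div_pow]
    rw [Finset.prod_div_distrib, Finset.prod_pow_eq_pow_sum]
    rw [Finsupp.degree_apply] at hd
    rw [hd]
    field_simp
  rw [h1]; field_simp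

lemma Gam_form (G : Geo κ d) {B : PDt κ d →₀ ℤ} {σ : Type} {s : σ → K} (hs : ∀ i, s i ∈ Gam κ B)
    {r : ℕ} {p : MvPolynomial σ k} (hp : p.IsHomogeneous r) : aeval s p ∈ Gam κ (r • B) := by
  have h1 : ∀ m ∈ p.support, p.coeff m • (m.prod fun i e => s i ^ e) ∈ Gam κ (r • B) := by
    intro m hm
    apply Submodule.smul_mem
    have hd : m.degree = r := by
      have := hp (mem_support_iff.1 hm)
      rw [Finsupp.degree_eq_weight_one]; exact this
    refine ⟨prod_mem fun i _ => pow_mem (hs i).1 _, fun v hv => ?_⟩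
    rw [gam_nsmul G, ← hd, Finsupp.degree_apply, ← Finset.prod_pow_eq_pow_sum, Finsupp.prod,
      ← Finset.prod_mul_distrib]
    apply prod_mem
    intro i _
    rw [← mul_pow]
    exact pow_mem ((hs i).2 v hv) _
  have : aeval s p = ∑ m ∈ p.support, p.coeff m • (m.prod fun i e => s i ^ e) := by
    rw [aeval_def, eval₂_eq]
    apply Finset.sum_congr rfl
    intro m _
    rw [Algebra.smul_def]; rfl
  rw [this]
  exact Submodule.sum_mem _ h1

end B7
end Bert


namespace Bert
section B8

lemma noeth_norm (k B : Type) [Field k] [CharZero k] [CommRing B] [IsDomain B] [Algebra k B]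
    [Algebra.FiniteType k B] {F : Type} [Field F] [Algebra B F] [FaithfulSMul B F] (Y : Set F)
    (hY : ∀ y ∈ Y, IsIntegral B y ∧ ∃ p q : B, q ≠ 0 ∧ y * algebraMap B F q = algebraMap B F p) :
    (Submodule.span B Y).FG := by
  obtain ⟨s, g, hg, hfin⟩ := exists_finite_inj_algHom_of_fg k B
  let A := MvPolynomial (Fin s) k
  let _ : Algebra A B := g.toRingHom.toAlgebra
  have hAB : Module.Finite A B := hfin
  have : FaithfulSMul A B := (faithfulSMul_iff_algebraMap_injective A B).2 hg
  let L := FractionRing B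
  let E := FractionRing A
  let _ : Algebra E L := FractionRing.liftAlgebra A L
  have : IsScalarTower A E L := inferInstance
  have : FiniteDimensional E L := inferInstance
  have : CharZero E := charZero_of_injective_algebraMap
    (R := k) (A := E) (FaithfulSMul.algebraMap_injective k E)
  have hn : IsNoetherian A (integralClosure A L) := IsIntegralClosure.isNoetherian A E L _
  let _ : Algebra A F := ((algebraMap B F).comp (algebraMap A B)).toAlgebra
  have tABF : IsScalarTower A B F := IsScalarTower.of_algebraMap_eq fun _ => rfl
  have hinj : Function.Injective (algebraMap B F) := FaithfulSMul.algebraMap_injective B F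
  let j : L →ₐ[B] F := IsFractionRing.liftAlgHom (g := Algebra.ofId B F) hinj
  let jA : L →ₐ[A] F := j.restrictScalars A
  let N : Submodule A F := ((integralClosure A L).toSubmodule).map jA.toLinearMap
  have hN : IsNoetherian A N := by
    have h1 : IsNoetherian A (integralClosure A L).toSubmodule := hn
    exact isNoetherian_of_surjective _ (LinearMap.range_eq_top.2
      (LinearMap.submoduleMap_surjective jA.toLinearMap (integralClosure A L).toSubmodule))
  have hsub : (Submodule.span B Y).restrictScalars A ≤ N := by
    intro y hy
    rw [Submodule.restrictScalars_mem] at hy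
    induction hy using Submodule.span_induction with
    | mem y hy =>
      obtain ⟨h1, p, q, hq, h2⟩ := hY y hy
      have hq' : algebraMap B F q ≠ 0 := by
        rw [Ne, FaithfulSMul.algebraMap_eq_zero_iff]; exact hq
      have hqL : algebraMap B L q ≠ 0 := by
        rw [Ne, FaithfulSMul.algebraMap_eq_zero_iff]; exact hq
      have hy' : j (algebraMap B L p / algebraMap B L q) = y := by
        rw [map_div₀, j.commutes, j.commutes, ← h2, mul_div_cancel_right₀ _ hq']
      refine ⟨algebraMap B L p / algebraMap B L q, ?_, hy'⟩
      have h3 : IsIntegral A y := isIntegral_trans (R := A) (A := B) y h1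
      rw [← hy'] at h3
      exact (isIntegral_algHom_iff jA j.toRingHom.injective).1 h3
    | zero => exact N.zero_mem
    | add x y _ _ hx hy => exact N.add_mem hx hy
    | smul b y _ hy =>
      obtain ⟨c, hc, rfl⟩ := hy
      refine ⟨b • c, ?_, map_smul j b c⟩
      rw [Algebra.smul_def]
      exact mul_mem (s := integralClosure A L) ((Algebra.IsIntegral.isIntegral (R := A) b).algebraMap) hc
  apply Submodule.FG.of_restrictScalars A
  have : IsNoetherian A ((Submodule.span B Y).restrictScalars A) := isNoetherian_of_le hsub
  exact (Module.Finite.iff_fg).1 (Module.IsNoetherian.finite _ _)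


variable {k : Type} [Field k] {n : ℕ} {L : Type} [Field L] [Algebra k L] [IsAlgClosed k]
variable {μ : MvPolynomial (Fin (n+1)) k →ₐ[k] L}

/-- valuation rings are centered at points -/
lemma val_pt (hh : IsHom (RingHom.ker μ)) (hi : ∃ i, μ (X i) ≠ 0) (V : ValuationSubring L)
    (hk : ∀ c, algebraMap k L c ∈ V) : ∃ v ∈ Cone (RingHom.ker μ), ∀ z ∈ Ov μ v, z ∈ V := by
  obtain ⟨i0, hmax⟩ := Finite.exists_max fun i => V.valuation (μ (X i))
  have h0 : μ (X i0) ≠ 0 := by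
    obtain ⟨i, hi⟩ := hi
    intro h
    have := hmax i
    rw [h, map_zero, le_zero_iff, map_eq_zero] at this
    exact hi this
  have hy : ∀ i, μ (X i) / μ (X i0) ∈ V := by
    intro i
    rw [← V.valuation_le_one_iff, map_div₀]
    exact div_le_one_of_le₀ (hmax i) zero_le
  let ψ : MvPolynomial (Fin (n+1)) k →+* V := eval₂Hom ((algebraMap k L).codRestrict V.toSubring hk) (fun i => ⟨_, hy i⟩)
  have hψ : ∀ p, (ψ p : L) = aeval (fun i => μ (X i) / μ (X i0)) p := by
    intro p
    have : (V.subtype.comp ψ) = (aeval (fun i => μ (X i) / μ (X i0)) : MvPolynomial (Fin (n+1)) k →ₐ[k] L).toRingHom := by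
      ext i
      · simp [ψ]
      · simp [ψ]
    exact RingHom.congr_fun this p
  have hψh : ∀ (p : MvPolynomial (Fin (n+1)) k) e, p.IsHomogeneous e → (ψ p : L) = μ p / μ (X i0) ^ e := by
    intro p e hp
    rw [hψ, aeval_hom_div p hp _ _ h0]
    congr 1
    have : (aeval (fun i => μ (X i)) : MvPolynomial (Fin (n+1)) k →ₐ[k] L) = μ := by ext i; simp
    rw [this]
  let P : Ideal (MvPolynomial (Fin (n+1)) k) := (IsLocalRing.maximalIdeal V).comap ψ
  have hP : P ≠ ⊤ := Ideal.comap_ne_top _ (Ideal.IsPrime.ne_top inferInstance)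
  obtain ⟨m, hm, hPm⟩ := Ideal.exists_le_maximal P hP
  obtain ⟨v, rfl⟩ := isMaximal_iff_eq_vanishingIdeal_singleton.1 hm
  have hz : ∀ p ∈ P, eval v p = 0 := by
    intro p hp
    exact (mem_vanishingIdeal_singleton_iff v p).1 (hPm hp)
  have hu : ∀ p, eval v p ≠ 0 → (ψ p : L)⁻¹ ∈ V := by
    intro p hp
    have h1 : IsUnit (ψ p) := by
      by_contra h
      exact hp (hz p h)
    obtain ⟨u, hu⟩ := h1
    have : (ψ p : L)⁻¹ = (u⁻¹ : Vˣ) := by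
      apply inv_eq_of_mul_eq_one_right
      rw [← hu, ← MulMemClass.coe_mul]; simp
    rw [this]
    exact Subtype.property _
  refine ⟨v, ⟨?_, ?_⟩, ?_⟩
  · intro hv
    have : eval v (X i0 - 1 : MvPolynomial (Fin (n+1)) k) = 0 := by
      apply hz
      have : ψ (X i0 - 1) = 0 := by
        apply Subtype.ext
        rw [hψ]; simp [h0]
      rw [Ideal.mem_comap, this]; exact zero_mem _
    rw [hv] at this
    simp at this
  · intro f hf
    rw [← sum_homogeneousComponent f, map_sum]
    apply Finset.sum_eq_zero
    intro i _
    apply hz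
    have h1 : μ (homogeneousComponent i f) = 0 := hh f hf i
    have : ψ (homogeneousComponent i f) = 0 := by
      apply Subtype.ext
      rw [hψh _ i (homogeneousComponent_isHomogeneous _ _), h1]; simp
    rw [Ideal.mem_comap, this]; exact zero_mem _
  · rintro z ⟨e, a, s, ha, hs, h1, h2, h3⟩
    have : z = (ψ a : L) * (ψ s : L)⁻¹ := by
      rw [hψh a e ha, hψh s e hs, ← h3]
      have := pow_ne_zero e h0
      field_simp
    rw [this]
    exact V.mul_mem _ _ (ψ a).2 (hu s (mem_compl.1 h1))

/-- integrality criterion -/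
lemma int_crit (hh : IsHom (RingHom.ker μ)) (hi : ∃ i, μ (X i) ≠ 0) {F : Type} [Field F] [Algebra L F]
    [Algebra k F] [IsScalarTower k L F] (S : Subalgebra k F) (y : F)
    (h : ∀ v ∈ Cone (RingHom.ker μ), ∃ N, N ≠ 0 ∧ ∃ g ∈ Ov μ v, ∃ s ∈ S, y ^ N = algebraMap L F g * s) :
    IsIntegral S y := by
  have key : y ∈ (integralClosure (Subring.closure (S : Set F)) F).toSubring := by
    rw [← iInf_valuationSubring_superset, Subring.mem_iInf]
    rintro ⟨W, hW⟩
    show y ∈ W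
    obtain ⟨v, hv, hv'⟩ := val_pt hh hi (W.comap (algebraMap L F)) (fun c => by
      rw [ValuationSubring.mem_comap, ← IsScalarTower.algebraMap_apply]
      exact hW (S.algebraMap_mem c))
    obtain ⟨N, hN, g, hg, s, hs, e⟩ := h v hv
    have h1 : y ^ N ∈ W := by
      rw [e]
      exact W.mul_mem _ _ (hv' g hg) (hW hs)
    rw [← W.valuation_le_one_iff, map_pow] at h1
    rw [← W.valuation_le_one_iff]
    exact (pow_le_one_iff hN).1 h1
  have e : Subring.closure (S : Set F) = S.toSubring := Subring.closure_eq S.toSubring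
  have key2 : IsIntegral (Subring.closure (S : Set F)) y := key
  rw [e] at key2
  exact key2

/-- everywhere regular functions are constant -/
lemma const_of_reg (hh : IsHom (RingHom.ker μ)) (hi : ∃ i, μ (X i) ≠ 0) {z : L}
    (h : ∀ v ∈ Cone (RingHom.ker μ), z ∈ Ov μ v) : ∃ c, z = algebraMap k L c := by
  have h1 : IsIntegral (⊥ : Subalgebra k L) z := int_crit hh hi _ _ fun v hv =>
    ⟨1, one_ne_zero, z, h v hv, 1, one_mem _, by simp⟩
  have h2 : IsIntegral k z := isIntegral_trans (A := (⊥ : Subalgebra k L)) z h1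
  obtain ⟨c, hc⟩ := IsAlgClosed.algebraMap_bijective_of_isIntegral (k := k) (K := integralClosure k L) |>.2 ⟨z, h2⟩
  exact ⟨c, by rw [← Subalgebra.coe_algebraMap (integralClosure k L), hc]⟩


lemma noeth_norm2 (k A B : Type) [Field k] [CharZero k] [CommRing A] [IsNoetherianRing A] [CommRing B] [IsDomain B]
    [Algebra k B] [Algebra.FiniteType k B] [Algebra A B] [Module.Finite A B]
    {F : Type} [Field F] [Algebra B F] [FaithfulSMul B F] [Algebra A F] [IsScalarTower A B F] (Y : Set F)
    (hY : ∀ y ∈ Y, IsIntegral B y ∧ ∃ p q : B, q ≠ 0 ∧ y * algebraMap B F q = algebraMap B F p) :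
    (Submodule.span A Y).FG := by
  have h1 := noeth_norm k B Y hY
  have h2 : Module.Finite B (Submodule.span B Y) := Module.Finite.iff_fg.2 h1
  have h3 : Module.Finite A (Submodule.span B Y) := Module.Finite.trans B _
  have h4 : IsNoetherian A ((Submodule.span B Y).restrictScalars A) := isNoetherian_of_isNoetherianRing_of_finite A (Submodule.span B Y)
  have h5 : Submodule.span A Y ≤ (Submodule.span B Y).restrictScalars A :=
    Submodule.span_le_restrictScalars A B Y
  have : IsNoetherian A (Submodule.span A Y) := isNoetherian_of_le h5
  exact Module.Finite.iff_fg.1 (Module.IsNoetherian.finite _ _)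

lemma aeval_CX {ι : Type} (w : ι → L) (N : ℕ) {e : ℕ} {p : MvPolynomial ι k} (hp : p.IsHomogeneous e) :
    aeval (fun l => Polynomial.C (w l) * Polynomial.X ^ N) p =
      Polynomial.C (aeval w p) * Polynomial.X ^ (N * e) := by
  rw [aeval_def, aeval_def, eval₂_eq, eval₂_eq, map_sum, Finset.sum_mul]
  apply Finset.sum_congr rfl
  intro m hm
  have hd : m.degree = e := by
    have := hp (mem_support_iff.1 hm)
    rw [Finsupp.degree_eq_weight_one]; exact this
  rw [Finsupp.degree_apply] at hd
  simp_rw [mul_pow]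
  rw [Finset.prod_mul_distrib, map_mul, map_prod, Finset.prod_pow_eq_pow_sum, hd, ← pow_mul, mul_assoc]
  simp

/-- finiteness of rings of sections -/
lemma FINw [CharZero k] (hh : IsHom (RingHom.ker μ)) (hi : ∃ i, μ (X i) ≠ 0) {ι ι' : Type} [Finite ι] [Finite ι']
    (u : ι → L) (N : ℕ) (hN : N ≠ 0) (T : ι' → MvPolynomial ι k) (hT : ∀ l, (T l).IsHomogeneous N)
    (hTu : ∀ v ∈ Cone (RingHom.ker μ), ∃ l, aeval u (T l) ≠ 0 ∧ ∀ i, u i ^ N / aeval u (T l) ∈ Ov μ v)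
    (Y : Set (ℕ × L)) (hY : ∀ y ∈ Y, (∀ v ∈ Cone (RingHom.ker μ), ∃ i, u i ≠ 0 ∧ y.2 / u i ^ y.1 ∈ Ov μ v) ∧
      ∃ (r : ℕ) (p q : MvPolynomial ι k), p.IsHomogeneous (r + y.1) ∧ q.IsHomogeneous r ∧ aeval u q ≠ 0 ∧ y.2 * aeval u q = aeval u p) :
    ∃ S : Finset (ℕ × L), (S : Set (ℕ × L)) ⊆ Y ∧ ∀ y ∈ Y, ∃ P : ℕ × L → MvPolynomial ι' k,
      (∀ s ∈ S, ∃ e, (P s).IsHomogeneous e ∧ (P s = 0 ∨ N * e + s.1 = y.1)) ∧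
      y.2 = ∑ s ∈ S, aeval (fun l => aeval u (T l)) (P s) * s.2 := by
  let F := FractionRing (Polynomial L)
  let am : Polynomial L →ₐ[k] F := IsScalarTower.toAlgHom k (Polynomial L) F
  have ami : Function.Injective am := IsFractionRing.injective (Polynomial L) F
  let y : ι → F := fun i => am (Polynomial.C (u i) * Polynomial.X ^ 1)
  let τ : ι' → F := fun l => am (Polynomial.C (aeval u (T l)) * Polynomial.X ^ N)
  let B : Subalgebra k F := (aeval y : MvPolynomial ι k →ₐ[k] F).range
  let A : Subalgebra k F := (aeval τ : MvPolynomial ι' k →ₐ[k] F).range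
  have hy : ∀ e (p : MvPolynomial ι k), p.IsHomogeneous e →
      aeval y p = am (Polynomial.C (aeval u p) * Polynomial.X ^ e) := by
    intro e p hp
    rw [← comp_aeval_apply, aeval_CX u 1 hp, one_mul]
  have hτ : ∀ e (p : MvPolynomial ι' k), p.IsHomogeneous e →
      aeval τ p = am (Polynomial.C (aeval (fun l => aeval u (T l)) p) * Polynomial.X ^ (N * e)) := by
    intro e p hp
    rw [← comp_aeval_apply, aeval_CX _ N hp]
  have hAB : A ≤ B := by
    rintro _ ⟨p, rfl⟩
    have : ∀ l, τ l ∈ B := fun l => ⟨T l, hy N _ (hT l)⟩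
    have h2 : aeval τ p = (B.val (aeval (fun l => (⟨τ l, this l⟩ : B)) p)) := by
      rw [comp_aeval_apply]; rfl
    show aeval τ p ∈ B
    rw [h2]; exact Subtype.property _
  let _ : Algebra A B := (Subalgebra.inclusion hAB).toRingHom.toAlgebra
  have tw : IsScalarTower A B F := IsScalarTower.of_algebraMap_eq fun _ => rfl
  have tk : IsScalarTower k A B := IsScalarTower.of_algebraMap_eq fun _ => rfl
  have fB : Algebra.FiniteType k B := Algebra.FiniteType.of_surjective (aeval y : MvPolynomial ι k →ₐ[k] F).rangeRestrict (AlgHom.rangeRestrict_surjective _)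
  have fA : Algebra.FiniteType k A := Algebra.FiniteType.of_surjective (aeval τ : MvPolynomial ι' k →ₐ[k] F).rangeRestrict (AlgHom.rangeRestrict_surjective _)
  have nA : IsNoetherianRing A := Algebra.FiniteType.isNoetherianRing k A
  have fAB : Algebra.FiniteType A B := Algebra.FiniteType.of_restrictScalars_finiteType k A B
  have iy : ∀ i, IsIntegral A (y i) := by
    intro i
    refine int_crit hh hi A _ fun v hv => ?_
    obtain ⟨l, h1, h2⟩ := hTu v hv
    refine ⟨N, hN, _, h2 i, τ l, ⟨X l, by simp⟩, ?_⟩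
    have : algebraMap L F (u i ^ N / aeval u (T l)) = am (Polynomial.C (u i ^ N / aeval u (T l))) := by
      rw [IsScalarTower.algebraMap_apply L (Polynomial L) F]; rfl
    rw [this]
    simp only [y, τ]
    rw [← map_pow, ← map_mul, ← mul_assoc, ← Polynomial.C_mul, div_mul_cancel₀ _ h1, mul_pow, ← Polynomial.C_pow, pow_one]
  have iB : Algebra.IsIntegral A B := by
    constructor
    rintro ⟨b, p, rfl⟩
    have : IsIntegral A (aeval y p) := by
      have h3 : ∀ i, y i ∈ (integralClosure A F).restrictScalars k := fun i => iy i
      have h2 : aeval y p = (((integralClosure A F).restrictScalars k).val (aeval (fun l => (⟨y l, h3 l⟩ : (integralClosure A F).restrictScalars k)) p)) := by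
        rw [comp_aeval_apply]; rfl
      rw [h2]; exact Subtype.property _
    exact (isIntegral_algHom_iff (IsScalarTower.toAlgHom A B F) Subtype.val_injective).1 this
  have mAB : Module.Finite A B := Algebra.IsIntegral.finite
  let E : ℕ × L → F := fun s => am (Polynomial.C s.2 * Polynomial.X ^ s.1)
  have fg := noeth_norm2 k A B (E '' Y) (by
    rintro _ ⟨⟨j, z⟩, hjz, rfl⟩
    obtain ⟨h1, r, p, q, hp, hq, hq0, hpq⟩ := hY _ hjz
    simp only at h1 hp hpq
    constructor
    · refine int_crit hh hi B _ fun v hv => ?_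
      obtain ⟨i, h2, h3⟩ := h1 v hv
      refine ⟨1, one_ne_zero, _, h3, y i ^ j, pow_mem (show y i ∈ B from ⟨X i, by simp⟩) _, ?_⟩
      have : algebraMap L F (z / u i ^ j) = am (Polynomial.C (z / u i ^ j)) := by
        rw [IsScalarTower.algebraMap_apply L (Polynomial L) F]; rfl
      rw [this]
      simp only [y, E]
      rw [pow_one, ← map_pow, ← map_mul, mul_pow, ← mul_assoc, ← Polynomial.C_pow, ← Polynomial.C_mul,
        div_mul_cancel₀ _ (pow_ne_zero _ h2), pow_one]
    · refine ⟨⟨aeval y p, p, rfl⟩, ⟨aeval y q, q, rfl⟩, ?_, ?_⟩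
      · intro h
        have h2 : aeval y q = 0 := congrArg Subtype.val h
        rw [hy r q hq, ← map_zero am] at h2
        have h3 := ami h2
        rw [mul_eq_zero, Polynomial.C_eq_zero] at h3
        rcases h3 with h3 | h3
        · exact hq0 h3
        · exact pow_ne_zero _ Polynomial.X_ne_zero h3
      · show E (j, z) * aeval y q = aeval y p
        rw [hy r q hq, hy _ p hp, ← hpq]
        simp only [E]
        rw [← map_mul, Polynomial.C_mul]
        congr 1
        ring)
  obtain ⟨S', hS', hspan⟩ := (Submodule.fg_span_iff_fg_span_finset_subset _).1 fg
  classical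
  obtain ⟨S, hS, hSS⟩ := Finset.subset_set_image_iff.1 hS'
  refine ⟨S, hS, ?_⟩
  rintro ⟨j, z⟩ hjz
  have hmem : E (j, z) ∈ Submodule.span A (E '' (S : Set (ℕ × L))) := by
    have : E (j, z) ∈ Submodule.span A (E '' Y) := Submodule.subset_span ⟨_, hjz, rfl⟩
    rw [hspan, ← hSS] at this
    simpa using this
  obtain ⟨c, hc⟩ := (Submodule.mem_span_image_finset_iff_exists_fun' A).1 hmem
  choose p hp using fun s => (c s).2
  have hp' : ∀ s, (c s : F) = aeval τ (p s) := fun s => (hp s).symm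
  have hsum : Polynomial.C z * Polynomial.X ^ j = ∑ s ∈ S,
      (aeval (fun l => Polynomial.C (aeval u (T l)) * Polynomial.X ^ N) (p s)) * (Polynomial.C s.2 * Polynomial.X ^ s.1) := by
    apply ami
    rw [map_sum]
    refine Eq.trans hc.symm ?_
    apply Finset.sum_congr rfl
    intro s _
    rw [map_mul, comp_aeval_apply]
    show (c s : F) * E s = _
    rw [hp']
  have hj := congrArg (fun f => Polynomial.coeff f j) hsum
  simp only [Polynomial.coeff_C_mul_X_pow, Polynomial.finsetSum_coeff, if_true] at hj
  refine ⟨fun s => if N ∣ j - s.1 ∧ s.1 ≤ j then homogeneousComponent ((j - s.1) / N) (p s) else 0, ?_, ?_⟩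
  · intro s _
    refine ⟨(j - s.1) / N, ?_, ?_⟩
    · simp only
      split_ifs
      · exact homogeneousComponent_isHomogeneous _ _
      · exact isHomogeneous_zero _ _ _
    · simp only
      split_ifs with h
      · right
        rw [Nat.mul_div_cancel' h.1]; omega
      · left; rfl
  · simp only
    rw [hj]
    apply Finset.sum_congr rfl
    intro s _
    conv_lhs => rw [← sum_homogeneousComponent (p s), map_sum, Finset.sum_mul, Polynomial.finsetSum_coeff]
    have h1 : ∀ e, ((aeval fun l => Polynomial.C (aeval u (T l)) * Polynomial.X ^ N) (homogeneousComponent e (p s)) *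
        (Polynomial.C s.2 * Polynomial.X ^ s.1)).coeff j = if j = N * e + s.1 then
          aeval (fun l => aeval u (T l)) (homogeneousComponent e (p s)) * s.2 else 0 := by
      intro e
      rw [aeval_CX _ N (homogeneousComponent_isHomogeneous e (p s)), mul_mul_mul_comm, ← Polynomial.C_mul, ← pow_add,
        Polynomial.coeff_C_mul_X_pow]
    simp_rw [h1]
    split_ifs with h
    · have h2 : ∀ e, j = N * e + s.1 ↔ e = (j - s.1) / N := by
        intro e
        obtain ⟨⟨m, hm⟩, h4⟩ := h
        rw [hm, Nat.mul_div_cancel_left _ (Nat.pos_of_ne_zero hN)]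
        constructor
        · intro h5
          apply Nat.eq_of_mul_eq_mul_left (Nat.pos_of_ne_zero hN)
          omega
        · rintro rfl; omega
      simp_rw [h2]
      rw [Finset.sum_ite_eq']
      split_ifs with h5
      · rfl
      · rw [homogeneousComponent_eq_zero, map_zero, zero_mul]
        rw [Finset.mem_range] at h5; omega
    · rw [map_zero, zero_mul]
      apply Finset.sum_eq_zero
      intro e _
      rw [if_neg]
      intro h3
      apply h
      constructor
      · exact ⟨e, by omega⟩
      · omega

end B8
end Bert


namespace Bert
set_option linter.unusedSectionVars false
section B9
variable {k : Type} [Field k] {n : ℕ} {K : Type} [Field K] [Algebra k K] {κ : MvPolynomial (Fin (n+1)) k →ₐ[k] K} {d : ℕ} [IsAlgClosed k]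

lemma exists_sep {Q : Ideal (MvPolynomial (Fin (n+1)) k)} (hQ : IsHom Q) {v : Fin (n+1) → k} (h0 : v ≠ 0) (hv : v ∉ Cone Q) :
    ∃ (e : ℕ) (f : MvPolynomial (Fin (n+1)) k), f.IsHomogeneous e ∧ f ∈ Q ∧ eval v f ≠ 0 := by
  have : ∃ f ∈ Q, eval v f ≠ 0 := by
    by_contra hc
    push Not at hc
    exact hv ⟨h0, hc⟩
  obtain ⟨f, hf, hfv⟩ := this
  obtain ⟨i, hi⟩ := exists_hom_component hfv
  exact ⟨i, _, homogeneousComponent_isHomogeneous i f, hQ f hf i, hi⟩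

lemma kap_hom_ne (G : Geo κ d) : ∃ i, κ (X i) ≠ 0 := by
  have : (RingHom.ker κ).IsPrime := RingHom.ker_isPrime κ
  obtain ⟨i, hi⟩ := exists_X_notMem this G.hom (by rw [G.tdim]; omega)
  exact ⟨i, hi⟩

lemma PDt.X_notMem (G : Geo κ d) (Q : PDt κ d) : ∃ i, (X i : MvPolynomial (Fin (n+1)) k) ∉ Q.1 :=
  exists_X_notMem Q.2.pr Q.2.hom (by rw [Q.2.tdim]; have := G.two; omega)

lemma exists_off (G : Geo κ d) (S : Finset (PDt κ d)) :
    ∃ v ∈ Cone (RingHom.ker κ), ∀ Q ∈ S, v ∉ Cone Q.1 := by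
  have hp : (RingHom.ker κ).IsPrime := RingHom.ker_isPrime κ
  have : ∀ Q : PDt κ d, ∃ f ∈ Q.1, f ∉ RingHom.ker κ := fun Q => SetLike.exists_of_lt (G.lt Q)
  choose f hf hf' using this
  have hF : ∏ Q ∈ S, f Q ∉ RingHom.ker κ := by
    intro h
    obtain ⟨Q, -, hQ⟩ := (Ideal.IsPrime.prod_mem_iff).1 h
    exact hf' Q hQ
  obtain ⟨i, hi⟩ := kap_hom_ne G
  by_contra hc
  push Not at hc
  apply hF
  apply cone_vanish hp hi
  intro v hv
  obtain ⟨Q, hQS, hQ⟩ := hc v hv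
  rw [map_prod]
  exact Finset.prod_eq_zero hQS (hQ.2 _ (hf Q))

/-- order of a form along `Q` -/
lemma ord_form_nonneg (G : Geo κ d) (Q : PDt κ d) {e : ℕ} {f x : MvPolynomial (Fin (n+1)) k} (hf : f.IsHomogeneous e)
    (hx : x.IsHomogeneous e) (hf0 : κ f ≠ 0) (hxQ : x ∉ Q.1) : 0 ≤ ord Q (κ f / κ x) := by
  rw [ord_nonneg_iff G Q (frac_mem_K0 hf hx) (div_ne_zero hf0 (kne' Q hxQ)), OQ_mem]
  exact ⟨e, f, x, hf, hx, hxQ, div_mul_cancel₀ _ (kne' Q hxQ)⟩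

lemma ord_form_pos (G : Geo κ d) (Q : PDt κ d) {e : ℕ} {f x : MvPolynomial (Fin (n+1)) k} (hf : f.IsHomogeneous e)
    (hx : x.IsHomogeneous e) (hf0 : κ f ≠ 0) (hxQ : x ∉ Q.1) (hfQ : f ∈ Q.1) : 1 ≤ ord Q (κ f / κ x) := by
  have h1 := ord_form_nonneg G Q hf hx hf0 hxQ
  have h2 : ord Q (κ f / κ x) ≠ 0 := by
    intro h
    rw [ord_zero_iff G Q (frac_mem_K0 hf hx) (div_ne_zero hf0 (kne' Q hxQ))] at h
    obtain ⟨e', a, s, ha, hs, hsQ, h3⟩ := OQ_mem.1 h.2.2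
    rw [inv_div, div_mul_eq_mul_div, div_eq_iff hf0, ← map_mul, ← map_mul] at h3
    have : x * s - a * f ∈ Q.1 := Q.2.le (by rw [RingHom.mem_ker, map_sub, h3, sub_self])
    have h4 : x * s ∈ Q.1 := by
      have := Ideal.add_mem _ this (Ideal.mul_mem_left _ a hfQ)
      simpa using this
    rcases Q.2.pr.mem_or_mem h4 with h | h
    exacts [hxQ h, hsQ h]
  omega

lemma exists_killer (G : Geo κ d) (S : Finset (PDt κ d)) {v : Fin (n+1) → k}
    (hv : v ∈ Cone (RingHom.ker κ)) (hS : ∀ Q ∈ S, v ∉ Cone Q.1) (b : ℕ) :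
    ∃ (N : ℕ) (F : MvPolynomial (Fin (n+1)) k), F.IsHomogeneous N ∧ eval v F ≠ 0 ∧ (0 < b → ∀ Q ∈ S, F ∈ Q.1) ∧
      ∀ Q ∈ S, ∀ x : MvPolynomial (Fin (n+1)) k, x.IsHomogeneous N → x ∉ Q.1 → (b : ℤ) ≤ ord Q (κ F / κ x) := by
  classical
  induction S using Finset.induction_on with
  | empty => exact ⟨0, 1, isHomogeneous_one _ _, by simp, by simp, by simp⟩
  | insert Q0 S hQ0 ih =>
    obtain ⟨N, F, hF, hFv, hFm, hFo⟩ := ih fun Q hQ => hS Q (Finset.mem_insert_of_mem hQ)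
    obtain ⟨e, f, hf, hfQ, hfv⟩ := exists_sep Q0.2.hom hv.1 (hS Q0 (Finset.mem_insert_self _ _))
    have hfb : (f ^ b).IsHomogeneous (e * b) := hf.pow b
    have hfbv : eval v (f ^ b) ≠ 0 := by rw [map_pow]; exact pow_ne_zero _ hfv
    refine ⟨N + e * b, F * f ^ b, hF.mul hfb, by rw [map_mul]; exact mul_ne_zero hFv hfbv, ?_, ?_⟩
    · intro hb Q hQ
      rcases Finset.mem_insert.1 hQ with rfl | hQ
      · exact Ideal.mul_mem_left _ _ (Ideal.pow_mem_of_mem _ hfQ _ hb)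
      · exact Ideal.mul_mem_right _ _ (hFm hb Q hQ)
    · intro Q hQ x hx hxQ
      obtain ⟨i, hi⟩ := PDt.X_notMem G Q
      have hX : ∀ m, ((X i : MvPolynomial (Fin (n+1)) k) ^ m).IsHomogeneous m := fun m => by
        simpa using (isHomogeneous_X k i).pow m
      have hXQ : ∀ m, (X i : MvPolynomial (Fin (n+1)) k) ^ m ∉ Q.1 := fun m h => hi (Q.2.pr.mem_of_pow_mem _ h)
      have h1 : ord Q (κ (F * f ^ b) / κ x) = ord Q (κ F / κ (X i ^ N)) + ord Q (κ (f ^ b) / κ (X i ^ (e * b)))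
          + ord Q (κ (X i ^ (N + e * b)) / κ x) := by
        have a1 := kne' Q (hXQ N)
        have a2 := kne' Q (hXQ (e * b))
        have a3 := kne' Q (hXQ (N + e * b))
        have a4 := kne' Q hxQ
        have b1 := kne hv hFv
        have b2 := kne hv hfbv
        rw [← ord_mul G Q (frac_mem_K0 hF (hX _)) (div_ne_zero b1 a1) (frac_mem_K0 hfb (hX _)) (div_ne_zero b2 a2),
          ← ord_mul G Q (mul_mem (frac_mem_K0 hF (hX _)) (frac_mem_K0 hfb (hX _)))
            (mul_ne_zero (div_ne_zero b1 a1) (div_ne_zero b2 a2)) (frac_mem_K0 (hX _) hx) (div_ne_zero a3 a4)]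
        congr 1
        rw [pow_add, map_mul, map_mul]
        field_simp
      rw [h1]
      have h2 := ord_form_nonneg G Q (hX (N + e * b)) hx (kne' Q (hXQ _)) hxQ
      have h3 := ord_form_nonneg G Q hF (hX N) (kne hv hFv) (hXQ _)
      have h4 := ord_form_nonneg G Q hfb (hX _) (kne hv hfbv) (hXQ _)
      rcases Finset.mem_insert.1 hQ with rfl | hQ
      · have hfe : κ (f ^ b) / κ (X i ^ (e * b)) = (κ f / κ (X i ^ e)) ^ b := by
          rw [pow_mul, map_pow, map_pow, div_pow]
        have h5 := ord_form_pos G Q hf (hX e) (kne hv hfv) (hXQ _) hfQ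
        have h6 : ord Q (κ (f ^ b) / κ (X i ^ (e * b))) = b * ord Q (κ f / κ (X i ^ e)) := by
          rw [hfe, ord_pow G Q (frac_mem_K0 hf (hX _)) (div_ne_zero (kne hv hfv) (kne' Q (hXQ _)))]
        have : (b : ℤ) * 1 ≤ b * ord Q (κ f / κ (X i ^ e)) := mul_le_mul_of_nonneg_left h5 (by positivity)
        omega
      · have := hFo Q hQ _ (hX N) (hXQ N)
        omega

lemma ord_bound (S : Finset (PDt κ d)) (g : PDt κ d → ℤ) : ∃ b : ℕ, ∀ Q ∈ S, g Q ≤ b := by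
  refine ⟨∑ Q ∈ S, (g Q).toNat, fun Q hQ => ?_⟩
  have : (g Q).toNat ≤ ∑ Q ∈ S, (g Q).toNat := Finset.single_le_sum (f := fun Q => (g Q).toNat) (fun _ _ => Nat.zero_le _) hQ
  omega

theorem Gam_fin [CharZero k] (G : Geo κ d) (B : PDt κ d →₀ ℤ) : FiniteDimensional k (Gam κ B) := by
  classical
  obtain ⟨v0, hv0, hoff⟩ := exists_off G B.support
  obtain ⟨b, hb⟩ := ord_bound B.support B
  obtain ⟨N, H, hH, hHv, -, hHo⟩ := exists_killer G B.support hv0 hoff b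
  have hH0 : κ H ≠ 0 := kne hv0 hHv
  have hX : ∀ i m, ((X i : MvPolynomial (Fin (n+1)) k) ^ m).IsHomogeneous m := fun i m => by
    simpa using (isHomogeneous_X k i).pow m
  have haev : ∀ p : MvPolynomial (Fin (n+1)) k, aeval (fun i => κ (X i)) p = κ p := fun p => by
    have : aeval (fun i => κ (X i)) = κ := by ext i; simp
    rw [this]
  obtain ⟨S, hS, hS2⟩ := FINw (μ := κ) G.hom (kap_hom_ne G) (fun i => κ (X i)) 1 one_ne_zero
    (fun i : Fin (n+1) => (X i : MvPolynomial (Fin (n+1)) k)) (fun i => isHomogeneous_X k i) (by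
      intro v hv
      obtain ⟨i, hi⟩ := Function.ne_iff.1 hv.1
      refine ⟨i, ?_, ?_⟩
      · rw [haev]; exact kne hv (by simpa using hi)
      · intro j
        rw [haev, pow_one]
        refine (Ov_mem hv).2 ⟨1, X j, X i, isHomogeneous_X k j, isHomogeneous_X k i, by simpa using hi, ?_⟩
        exact div_mul_cancel₀ _ (kne hv (by simpa using hi)))
    {y | y.1 = N ∧ ∃ z ∈ Gam κ B, y.2 = z * κ H} (by
      rintro ⟨N', y⟩ ⟨rfl, z, hz, rfl⟩
      dsimp only
      constructor
      · intro v hv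
        obtain ⟨i, hi⟩ := Function.ne_iff.1 hv.1
        have hi' : κ (X i) ≠ 0 := kne hv (by simpa using hi)
        refine ⟨i, hi', ?_⟩
        by_cases h0 : z = 0
        · rw [h0]; simp
        have e1 : z * κ H / κ (X i) ^ N' = z * (κ H / κ (X i ^ N')) := by rw [map_pow]; ring
        have hm := frac_mem_K0 (κ := κ) hH (hX i N')
        have hm0 : κ H / κ (X i ^ N') ≠ 0 := div_ne_zero hH0 (by rw [map_pow]; exact pow_ne_zero _ hi')
        rw [e1, Ov_iff G hv (mul_mem hz.1 hm) (mul_ne_zero h0 hm0)]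
        intro Q hQ
        have hiQ : (X i : MvPolynomial (Fin (n+1)) k) ^ N' ∉ Q.1 := fun h => by
          have := hQ.2 _ h
          rw [map_pow, eval_X] at this
          exact pow_ne_zero _ hi this
        rw [ord_mul G Q hz.1 h0 hm hm0]
        have h1 := (mem_Gam_iff G hz.1 h0).1 hz Q
        have h2 := ord_form_nonneg G Q hH (hX i N') hH0 hiQ
        by_cases hQB : Q ∈ B.support
        · have := hHo Q hQB _ (hX i N') hiQ
          have := hb Q hQB
          omega
        · rw [Finsupp.notMem_support_iff] at hQB
          omega
      · obtain ⟨e, a, s, ha, hs, -, hs0, h⟩ := id hz.1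
        refine ⟨e, a * H, s, ha.mul hH, hs, by rwa [haev], ?_⟩
        rw [haev, haev, map_mul, ← h]; ring)
  have hle : Submodule.map (LinearMap.mulRight k (κ H)) (Gam κ B) ≤ Submodule.span k (↑(S.image Prod.snd) : Set K) := by
    rintro _ ⟨z, hz, rfl⟩
    obtain ⟨P, hP, hP2⟩ := hS2 (N, z * κ H) ⟨rfl, z, hz, rfl⟩
    rw [LinearMap.mulRight_apply]
    dsimp only at hP2
    rw [hP2]
    apply Submodule.sum_mem
    intro s hs
    obtain ⟨e, h1, h2⟩ := hP s hs
    have h3 : s.1 = N := (hS hs).1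
    have hmem : s.2 ∈ Submodule.span k (↑(S.image Prod.snd) : Set K) :=
      Submodule.subset_span (Finset.mem_coe.2 (Finset.mem_image_of_mem _ hs))
    rcases h2 with h2 | h2
    · rw [h2, map_zero, zero_mul]; exact zero_mem _
    · have he : e = 0 := by dsimp only at h2; omega
      subst he
      rw [(totalDegree_eq_zero_iff_eq_C).1 (Nat.le_zero.1 h1.totalDegree_le), aeval_C, ← Algebra.smul_def]
      exact Submodule.smul_mem _ _ hmem
  have hfd : FiniteDimensional k (Submodule.span k (↑(S.image Prod.snd) : Set K)) :=
    FiniteDimensional.span_finset k _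
  have hinj : Function.Injective (LinearMap.mulRight k (κ H)) := fun a b h => mul_right_cancel₀ hH0 h
  have := Submodule.finiteDimensional_of_le hle
  exact (LinearEquiv.finiteDimensional (Submodule.equivMapOfInjective _ hinj (Gam κ B)).symm)

end B9
end Bert


namespace Bert
set_option linter.unusedSectionVars false
section B10
variable {k : Type} [Field k] {n : ℕ} {K : Type} [Field K] [Algebra k K] {κ : MvPolynomial (Fin (n+1)) k →ₐ[k] K} {d : ℕ} [IsAlgClosed k]

lemma Gen.K0 (G : Geo κ d) {B : PDt κ d →₀ ℤ} {v : Fin (n+1) → k} {z : K} (h : Gen B v z) : z ∈ K0 κ := by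
  have h1 := mul_mem (Fr_le_K0 h.2.1) (K0_inv (gam_K0 G v B))
  rwa [mul_assoc, mul_inv_cancel₀ (gam_ne G v B), mul_one] at h1

lemma Gen_of_unit {B : PDt κ d →₀ ℤ} {v : Fin (n+1) → k} {z u : K} (h : Gen B v z) (hu : IsU (Ov κ v) u) :
    Gen B v (u * z) := by
  rw [Gen, mul_assoc]; exact hu.mul h

lemma Gen_gam (G : Geo κ d) (B : PDt κ d →₀ ℤ) (v : Fin (n+1) → k) : Gen B v (gam v B)⁻¹ := by
  rw [Gen, inv_mul_cancel₀ (gam_ne G v B)]; exact IsU.one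

lemma Gen_open (G : Geo κ d) {B : PDt κ d →₀ ℤ} {v : Fin (n+1) → k} (hv : v ∈ Cone (RingHom.ker κ)) {z : K}
    (h : Gen B v z) : ∃ (e : ℕ) (f : MvPolynomial (Fin (n+1)) k), f.IsHomogeneous e ∧ eval v f ≠ 0 ∧
      ∀ v' ∈ Cone (RingHom.ker κ), eval v' f ≠ 0 → Gen B v' z := by
  classical
  have hz := h.K0 G
  have hfin : {Q : PDt κ d | ord Q z ≠ - B Q}.Finite := by
    refine ((ord_finite G hz h.ne).union (B.support.finite_toSet)).subset fun Q hQ => ?_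
    by_contra hc
    simp only [Set.mem_union, Set.mem_ofPred_eq, not_or, not_not, Finset.mem_coe, Finsupp.notMem_support_iff] at hc
    apply hQ
    rw [hc.1, hc.2, neg_zero]
  obtain ⟨N, F, hF, hFv, hFm, -⟩ := exists_killer G hfin.toFinset hv (fun Q hQ hvQ => by
    rw [Set.Finite.mem_toFinset] at hQ
    exact hQ ((Gen_iff G hv hz h.ne).1 h Q hvQ)) 1
  refine ⟨N, F, hF, hFv, fun v' hv' hFv' => (Gen_iff G hv' hz h.ne).2 fun Q hQ => ?_⟩
  by_contra hc
  exact hFv' (hQ.2 F (hFm one_pos Q (by rw [Set.Finite.mem_toFinset]; exact hc)))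

lemma qc {σ : Type} [Finite σ] (Cn : Set (σ → k)) (P : MvPolynomial σ k → Prop)
    (h : ∀ v ∈ Cn, ∃ f, P f ∧ eval v f ≠ 0) :
    ∃ T : Finset (MvPolynomial σ k), (∀ f ∈ T, P f) ∧ ∀ v ∈ Cn, ∃ f ∈ T, eval v f ≠ 0 := by
  have hfg : (Submodule.span (MvPolynomial σ k) {f | P f}).FG := IsNoetherian.noetherian _
  obtain ⟨T, hT, hT2⟩ := (Submodule.fg_span_iff_fg_span_finset_subset {f | P f}).1 hfg
  refine ⟨T, fun f hf => hT hf, fun v hv => ?_⟩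
  by_contra hc
  push Not at hc
  obtain ⟨f, hf, hfv⟩ := h v hv
  have h1 : f ∈ Submodule.span (MvPolynomial σ k) (T : Set (MvPolynomial σ k)) := by
    rw [← hT2]; exact Submodule.subset_span hf
  have h2 : Ideal.span (T : Set (MvPolynomial σ k)) ≤ RingHom.ker (eval v) := by
    rw [Ideal.span_le]
    intro g hg
    exact hc g hg
  exact hfv (h2 h1)

/-- the family `s` of sections of `B` is generating at `v` and recovers the coordinates near `v` -/
def EmbAt {ι : Type} (B : PDt κ d →₀ ℤ) (s : ι → K) (v : Fin (n+1) → k) : Prop :=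
  (∃ j, Gen B v (s j)) ∧ ∃ (r : ℕ) (p : Fin (n+1) → MvPolynomial ι k) (θ : K),
    (∀ i, (p i).IsHomogeneous r) ∧ θ ≠ 0 ∧ (∀ i, aeval s (p i) = θ * κ (X i)) ∧
    ∃ i, v i ≠ 0 ∧ Gen (r • B) v (aeval s (p i))

lemma aeval_scale {σ : Type} (p : MvPolynomial σ k) {r : ℕ} (hp : p.IsHomogeneous r) (z : σ → K) {w : K}
    (hw : w ≠ 0) : aeval (fun i => w * z i) p = w ^ r * aeval z p := by
  have := aeval_hom_div p hp z w⁻¹ (inv_ne_zero hw)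
  simp only [div_inv_eq_mul, inv_pow] at this
  rw [mul_comm, ← this]
  congr 2
  ext i
  exact mul_comm _ _

/-- consequences of the embedding property -/
structure EmbUse {ι : Type} (B : PDt κ d →₀ ℤ) (s : ι → K) (v : Fin (n+1) → k) (r : ℕ)
    (p : Fin (n+1) → MvPolynomial ι k) (θ : K) : Prop where
  hom : ∀ i, (p i).IsHomogeneous r
  ne : θ ≠ 0
  rel : ∀ (e : ℕ) (a : MvPolynomial (Fin (n+1)) k), a.IsHomogeneous e → aeval s (aeval p a) = θ ^ e * κ a
  gen : ∀ (e : ℕ) (a : MvPolynomial (Fin (n+1)) k), a.IsHomogeneous e → eval v a ≠ 0 → Gen ((r * e) • B) v (θ ^ e * κ a)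

lemma EmbUse.deg {ι : Type} {B : PDt κ d →₀ ℤ} {s : ι → K} {v : Fin (n+1) → k} {r : ℕ}
    {p : Fin (n+1) → MvPolynomial ι k} {θ : K} (h : EmbUse B s v r p θ) {e : ℕ} {a : MvPolynomial (Fin (n+1)) k}
    (ha : a.IsHomogeneous e) : (aeval p a).IsHomogeneous (r * e) := ha.aeval p h.hom

lemma EmbUse.X {ι : Type} {B : PDt κ d →₀ ℤ} {s : ι → K} {v : Fin (n+1) → k} {r : ℕ}
    {p : Fin (n+1) → MvPolynomial ι k} {θ : K} (h : EmbUse B s v r p θ) (i : Fin (n+1)) :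
    aeval s (p i) = θ * κ (X i) := by
  have := h.rel 1 (MvPolynomial.X i) (isHomogeneous_X k i)
  rwa [aeval_X, pow_one] at this

lemma EmbAt.use {ι : Type} (G : Geo κ d) {B : PDt κ d →₀ ℤ} {s : ι → K} {v : Fin (n+1) → k}
    (hv : v ∈ Cone (RingHom.ker κ)) (h : EmbAt B s v) : ∃ r p θ, EmbUse B s v r p θ := by
  obtain ⟨-, r, p, θ, h1, h2, h3, i, hi, h4⟩ := h
  refine ⟨r, p, θ, h1, h2, ?_, ?_⟩
  · intro e a ha
    rw [comp_aeval_apply]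
    simp_rw [h3]
    rw [aeval_scale a ha _ h2]
    congr 1
    have : aeval (fun i => κ (X i)) = κ := by ext i; simp
    rw [this]
  · intro e a ha hav
    have hi' : eval v (X i : MvPolynomial (Fin (n+1)) k) ≠ 0 := by simpa using hi
    have hx : ((X i : MvPolynomial (Fin (n+1)) k) ^ e).IsHomogeneous e := by simpa using (isHomogeneous_X k i).pow e
    have e1 : θ ^ e * κ a = (κ a / κ (X i ^ e)) * (θ * κ (X i)) ^ e := by
      have := kne hv hi'
      rw [map_pow]; field_simp; ring
    rw [e1, mul_smul, smul_comm, ← h3 i]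
    have := Gen_pow G h4 e
    exact Gen_of_unit this (isU_frac hv ha hx hav (by rw [map_pow]; exact pow_ne_zero _ hi'))

lemma EmbUse.ord {ι : Type} (G : Geo κ d) {B : PDt κ d →₀ ℤ} {s : ι → K} {v : Fin (n+1) → k} {r : ℕ}
    {p : Fin (n+1) → MvPolynomial ι k} {θ : K} (h : EmbUse B s v r p θ) (hs : ∀ i, s i ∈ Gam κ B)
    {N : ℕ} {F : MvPolynomial (Fin (n+1)) k} (hF : F.IsHomogeneous N) (hF0 : κ F ≠ 0) (Q : PDt κ d) {i : Fin (n+1)}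
    (hi : (MvPolynomial.X i : MvPolynomial (Fin (n+1)) k) ∉ Q.1) :
    - ((r * N) • B) Q + ord Q (κ F / κ (MvPolynomial.X i ^ N)) ≤ ord Q (θ ^ N * κ F) := by
  have hx : ((MvPolynomial.X i : MvPolynomial (Fin (n+1)) k) ^ N).IsHomogeneous N := by simpa using (isHomogeneous_X k i).pow N
  have hi' := kne' Q hi
  have hxi : κ (MvPolynomial.X i ^ N) ≠ 0 := by rw [map_pow]; exact pow_ne_zero _ hi'
  have e1 : θ ^ N * κ F = (κ F / κ (MvPolynomial.X i ^ N)) * (θ ^ N * κ (MvPolynomial.X i ^ N)) := by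
    field_simp
  have h1 : θ ^ N * κ (MvPolynomial.X i ^ N) ∈ Gam κ ((r * N) • B) := by
    rw [← h.rel N _ hx]
    exact Gam_form G hs (h.deg hx)
  have h10 : θ ^ N * κ (MvPolynomial.X i ^ N) ≠ 0 := mul_ne_zero (pow_ne_zero _ h.ne) hxi
  rw [e1, ord_mul G Q (frac_mem_K0 hF hx) (div_ne_zero hF0 hxi) h1.1 h10]
  have := (mem_Gam_iff G h1.1 h10).1 h1 Q
  omega

lemma gen_at {ι : Type} (G : Geo κ d) {B : PDt κ d →₀ ℤ} {s : ι → K} {v : Fin (n+1) → k}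
    (hv : v ∈ Cone (RingHom.ker κ)) (hs : ∀ i, s i ∈ Gam κ B) (h : EmbAt B s v) (B0 : PDt κ d →₀ ℤ) :
    ∃ (b : ℕ) (τ : K), τ ∈ Gam κ (B0 + b • B) ∧ Gen (B0 + b • B) v τ := by
  classical
  obtain ⟨r, p, θ, hU⟩ := h.use G hv
  set ρ := (gam v B0)⁻¹ with hρ
  have hgρ : Gen B0 v ρ := Gen_gam G B0 v
  have hρK := hgρ.K0 G
  have hfin : {Q : PDt κ d | ord Q ρ < - B0 Q}.Finite := by
    refine ((ord_finite G hρK hgρ.ne).union (B0.support.finite_toSet)).subset fun Q hQ => ?_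
    by_contra hc
    simp only [Set.mem_union, Set.mem_ofPred_eq, not_or, not_not, Finset.mem_coe, Finsupp.notMem_support_iff] at hc hQ
    rw [hc.1, hc.2, neg_zero] at hQ
    exact lt_irrefl _ hQ
  obtain ⟨b, hb⟩ := ord_bound hfin.toFinset fun Q => - B0 Q - ord Q ρ
  obtain ⟨N, F, hF, hFv, -, hFo⟩ := exists_killer G hfin.toFinset hv (fun Q hQ hvQ => by
    rw [Set.Finite.mem_toFinset] at hQ
    have := (Gen_iff G hv hρK hgρ.ne).1 hgρ Q hvQ
    simp only [Set.mem_ofPred_eq] at hQ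
    omega) b
  have hgen := Gen_mul G hgρ (hU.gen N F hF hFv)
  refine ⟨r * N, ρ * (θ ^ N * κ F), ?_, hgen⟩
  rw [mem_Gam_iff G (hgen.K0 G) hgen.ne]
  intro Q
  have hF0 := kne hv hFv
  have hm : θ ^ N * κ F ∈ Gam κ ((r * N) • B) := by
    rw [← hU.rel N _ hF]
    exact Gam_form G hs (hU.deg hF)
  rw [ord_mul G Q hρK hgρ.ne hm.1 (mul_ne_zero (pow_ne_zero _ hU.ne) hF0)]
  obtain ⟨i, hi⟩ := PDt.X_notMem G Q
  have h1 := hU.ord G hs hF hF0 Q hi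
  have hx : ((X i : MvPolynomial (Fin (n+1)) k) ^ N).IsHomogeneous N := by simpa using (isHomogeneous_X k i).pow N
  have hxQ : (X i : MvPolynomial (Fin (n+1)) k) ^ N ∉ Q.1 := fun h => hi (Q.2.pr.mem_of_pow_mem _ h)
  have h2 := ord_form_nonneg G Q hF hx hF0 hxQ
  rw [Finsupp.add_apply]
  by_cases hQ : Q ∈ hfin.toFinset
  · have h3 := hb Q hQ
    have h4 := hFo Q hQ _ hx hxQ
    omega
  · rw [Set.Finite.mem_toFinset] at hQ
    simp only [Set.mem_ofPred_eq, not_lt] at hQ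
    omega

lemma gen_unif {ι : Type} (G : Geo κ d) {B : PDt κ d →₀ ℤ} {s : ι → K} (hs : ∀ i, s i ∈ Gam κ B)
    (h : ∀ v ∈ Cone (RingHom.ker κ), EmbAt B s v) (B0 : PDt κ d →₀ ℤ) :
    ∃ b0 : ℕ, ∀ b, b0 ≤ b → ∀ v ∈ Cone (RingHom.ker κ), ∃ τ ∈ Gam κ (B0 + b • B), Gen (B0 + b • B) v τ := by
  classical
  obtain ⟨T, hT, hT2⟩ := qc (Cone (RingHom.ker κ)) (fun f : MvPolynomial (Fin (n+1)) k => ∃ (b : ℕ) (τ : K),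
    τ ∈ Gam κ (B0 + b • B) ∧ ∀ v ∈ Cone (RingHom.ker κ), eval v f ≠ 0 → Gen (B0 + b • B) v τ) (by
      intro v hv
      obtain ⟨b, τ, h1, h2⟩ := gen_at G hv hs (h v hv) B0
      obtain ⟨e, f, -, h3, h4⟩ := Gen_open G hv h2
      exact ⟨f, ⟨b, τ, h1, h4⟩, h3⟩)
  choose! bb τ hτ hg using hT
  refine ⟨∑ f ∈ T, bb f, fun b hb v hv => ?_⟩
  obtain ⟨f, hf, hfv⟩ := hT2 v hv
  have h1 : bb f ≤ ∑ f ∈ T, bb f := Finset.single_le_sum (f := bb) (fun _ _ => Nat.zero_le _) hf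
  obtain ⟨c, rfl⟩ := Nat.exists_eq_add_of_le (h1.trans hb)
  obtain ⟨⟨j, hj⟩, -⟩ := h v hv
  refine ⟨τ f * s j ^ c, ?_, ?_⟩
  · rw [add_smul, ← add_assoc]
    exact Gam_mul G (hτ f hf) (Gam_pow G (hs j) c)
  · rw [add_smul, ← add_assoc]
    exact Gen_mul G (hg f hf v hv hfv) (Gen_pow G hj c)

/-- global generation of large multiples with control -/
theorem gen_main {ι : Type} (G : Geo κ d) {D : PDt κ d →₀ ℤ} {m0 : ℕ} (hm0 : 0 < m0) {s : ι → K}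
    (hs : ∀ i, s i ∈ Gam κ (m0 • D)) (h : ∀ v ∈ Cone (RingHom.ker κ), EmbAt (m0 • D) s v) (c : ℕ) :
    ∃ n0 : ℕ, 0 < n0 ∧ ∀ nn, n0 ≤ nn → ∃ C : PDt κ d →₀ ℤ, C + c • (m0 • D) = nn • D ∧
      ∀ v ∈ Cone (RingHom.ker κ), ∃ τ ∈ Gam κ C, Gen C v τ := by
  have := fun r : ℕ => gen_unif G hs h (r • D)
  choose b0 hb0 using this
  refine ⟨m0 * (∑ r ∈ Finset.range m0, b0 r + c + 1), by positivity, fun nn hnn => ?_⟩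
  have hr : nn % m0 < m0 := Nat.mod_lt _ hm0
  have h1 : b0 (nn % m0) ≤ ∑ r ∈ Finset.range m0, b0 r :=
    Finset.single_le_sum (f := b0) (fun _ _ => Nat.zero_le _) (Finset.mem_range.2 hr)
  have h2 : ∑ r ∈ Finset.range m0, b0 r + c + 1 ≤ nn / m0 := (Nat.le_div_iff_mul_le hm0).2 (by rw [mul_comm]; exact hnn)
  refine ⟨(nn % m0) • D + (nn / m0 - c) • (m0 • D), ?_, hb0 _ _ (by omega)⟩
  rw [add_assoc, ← add_smul, Nat.sub_add_cancel (by omega), ← mul_smul, ← add_smul]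
  congr 1
  rw [mul_comm]; exact Nat.mod_add_div nn m0

lemma EmbAt.twist {ι : Type} (G : Geo κ d) {B C : PDt κ d →₀ ℤ} {s : ι → K} {v : Fin (n+1) → k}
    (h : EmbAt B s v) {τ : K} (hτ : Gen C v τ) : EmbAt (C + B) (fun l => τ * s l) v := by
  obtain ⟨⟨j, hj⟩, r, p, θ, h1, h2, h3, i, hi, h4⟩ := h
  refine ⟨⟨j, Gen_mul G hτ hj⟩, r, p, τ ^ r * θ, h1, mul_ne_zero (pow_ne_zero _ hτ.ne) h2, ?_, i, hi, ?_⟩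
  · intro i
    rw [aeval_scale _ (h1 i) _ hτ.ne, h3, mul_assoc]
  · rw [aeval_scale _ (h1 i) _ hτ.ne, smul_add]
    exact Gen_mul G (Gen_pow G hτ r) h4

lemma Gen_iff_ev {B : PDt κ d →₀ ℤ} {v : Fin (n+1) → k} (hv : v ∈ Cone (RingHom.ker κ)) {z : K}
    (hz : z ∈ Gam κ B) : Gen B v z ↔ ev κ v (z * gam v B) ≠ 0 := isU_iff_ev hv (hz.2 v hv)

lemma exists_Gen_span {ι : Type} [Fintype ι] {B : PDt κ d →₀ ℤ} {v : Fin (n+1) → k}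
    (hv : v ∈ Cone (RingHom.ker κ)) {t : ι → K} (ht : ∀ i, t i ∈ Gam κ B) {z : K}
    (hz : z ∈ Submodule.span k (Set.range t)) (hg : Gen B v z) : ∃ j, Gen B v (t j) := by
  by_contra hc
  push Not at hc
  obtain ⟨c, rfl⟩ := (Submodule.mem_span_range_iff_exists_fun k).1 hz
  have hm : ∀ i, c i • t i ∈ Gam κ B := fun i => Submodule.smul_mem _ _ (ht i)
  rw [Gen_iff_ev hv (Submodule.sum_mem _ fun i _ => hm i), Finset.sum_mul,
    ev_sum hv _ (fun i => (hm i).2 v hv)] at hg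
  apply hg
  apply Finset.sum_eq_zero
  intro i _
  rw [smul_mul_assoc, ev_smul hv _ ((ht i).2 v hv)]
  have := hc i
  rw [Gen_iff_ev hv (ht i), not_not] at this
  rw [this, mul_zero]

lemma EmbAt.lin {ι ι' : Type} [Fintype ι'] {B : PDt κ d →₀ ℤ} {s : ι → K} {v : Fin (n+1) → k}
    (hv : v ∈ Cone (RingHom.ker κ))
    (h : EmbAt B s v) {t : ι' → K} (ht : ∀ i, t i ∈ Gam κ B) (hst : ∀ i, s i ∈ Submodule.span k (Set.range t)) :
    EmbAt B t v := by
  obtain ⟨⟨j, hj⟩, r, p, θ, h1, h2, h3, i, hi, h4⟩ := h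
  have := fun i => (Submodule.mem_span_range_iff_exists_fun k).1 (hst i)
  choose c hc using this
  set L : ι → MvPolynomial ι' k := fun i => ∑ l, C (c i l) * X l with hL
  have hLh : ∀ i, (L i).IsHomogeneous 1 := fun i => IsHomogeneous.sum _ _ _ fun l _ => by
    simpa using (isHomogeneous_C ι' (c i l)).mul (isHomogeneous_X k l)
  have hLe : ∀ q : MvPolynomial ι k, aeval t (aeval L q) = aeval s q := by
    intro q
    rw [comp_aeval_apply]
    congr 2
    ext i
    rw [← hc i, hL, map_sum]
    simp [Algebra.smul_def]
  refine ⟨exists_Gen_span hv ht (hst j) hj, r, fun i => aeval L (p i), θ, ?_, h2, ?_, i, hi, ?_⟩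
  · intro i
    simpa using (h1 i).aeval L hLh
  · intro i; rw [hLe, h3]
  · rw [hLe]; exact h4

end B10
end Bert


namespace Bert
set_option linter.unusedSectionVars false
section B11
variable {k : Type} [Field k] {n : ℕ} {K : Type} [Field K] [Algebra k K] {κ : MvPolynomial (Fin (n+1)) k →ₐ[k] K} {d : ℕ} [IsAlgClosed k]

lemma dv_aeval_span {ι : Type} {v : Fin (n+1) → k} (hv : v ∈ Cone (RingHom.ker κ)) {t : ι → K}
    (ht : ∀ i, t i ∈ Ov κ v) (q : MvPolynomial ι k) :
    dv κ v (aeval t q) ∈ Submodule.span k (Set.range fun i => dv κ v (t i)) := by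
  induction q using MvPolynomial.induction_on with
  | C a => rw [aeval_C, dv_const hv]; exact zero_mem _
  | add p q hp hq =>
    rw [map_add, dv_add hv (ev_aeval hv ht p).1 (ev_aeval hv ht q).1]; exact add_mem hp hq
  | mul_X p i hp =>
    rw [map_mul, aeval_X, dv_mul hv (ev_aeval hv ht p).1 (ht i)]
    exact add_mem (Submodule.smul_mem _ _ (Submodule.subset_span ⟨i, rfl⟩)) (Submodule.smul_mem _ _ hp)

lemma Gen_div_isU (G : Geo κ d) {B : PDt κ d →₀ ℤ} {v : Fin (n+1) → k} {z w : K} (hz : Gen B v z)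
    (hw : Gen B v w) : IsU (Ov κ v) (z / w) := by
  have : z / w = (z * gam v B) / (w * gam v B) := by
    rw [mul_div_mul_right _ _ (gam_ne G v B)]
  rw [this]
  exact IsU.div hz hw

lemma Gen_iff_ev_div (G : Geo κ d) {B : PDt κ d →₀ ℤ} {v : Fin (n+1) → k} (hv : v ∈ Cone (RingHom.ker κ))
    {z w : K} (hz : z ∈ Gam κ B) (hw : Gen B v w) : Gen B v z ↔ ev κ v (z / w) ≠ 0 := by
  rw [← isU_iff_ev hv (div_Gen hv G hz hw)]
  constructor
  · intro h; exact Gen_div_isU G h hw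
  · intro h
    have := Gen_of_unit hw h
    rwa [div_mul_cancel₀ _ hw.ne] at this

lemma dv_span {ι : Type} (G : Geo κ d) {B : PDt κ d →₀ ℤ} {v : Fin (n+1) → k}
    (hv : v ∈ Cone (RingHom.ker κ)) {s : ι → K} (hs : ∀ i, s i ∈ Gam κ B) (h : EmbAt B s v) {j : ι}
    (hj : Gen B v (s j)) {z : K} (hz : z ∈ Ov κ v) :
    dv κ v z ∈ Submodule.span k (Set.range fun i => dv κ v (s i / s j)) := by
  obtain ⟨r, p, θ, hU⟩ := h.use G hv
  obtain ⟨a, b, ⟨e, ha, hb⟩, hbv, hab⟩ := exists_pres hz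
  have ht : ∀ i, s i / s j ∈ Ov κ v := fun i => div_Gen hv G (hs i) hj
  have hba := aeval_hom_div (K := K) _ (hU.deg hb) s (s j) hj.ne
  have haa := aeval_hom_div (K := K) _ (hU.deg ha) s (s j) hj.ne
  rw [hU.rel e _ hb] at hba
  rw [hU.rel e _ ha] at haa
  set b' := aeval (fun i => s i / s j) (aeval p b) with hb'
  set a' := aeval (fun i => s i / s j) (aeval p a) with ha'
  have hU2 : IsU (Ov κ v) b' := by
    rw [hba]
    exact Gen_div_isU G (hU.gen e b hb hbv) (Gen_pow G hj _)
  have h1 : z * b' = a' := by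
    rw [hba, haa, ← hab]; ring
  have hbm : b' ∈ Ov κ v := hU2.2.1
  have h2 := dv_mul hv hz hbm
  rw [h1] at h2
  have h3 := (isU_iff_ev hv hbm).1 hU2
  have h4 : dv κ v z = (ev κ v b')⁻¹ • (dv κ v a' - ev κ v z • dv κ v b') := by
    rw [h2, add_sub_cancel_left, smul_smul, inv_mul_cancel₀ h3, one_smul]
  rw [h4]
  exact Submodule.smul_mem _ _ (sub_mem (dv_aeval_span hv ht _) (Submodule.smul_mem _ _ (dv_aeval_span hv ht _)))

lemma jet0 {ι : Type} [Fintype ι] (G : Geo κ d) {B : PDt κ d →₀ ℤ} {v : Fin (n+1) → k}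
    (hv : v ∈ Cone (RingHom.ker κ)) {s : ι → K} (hs : ∀ i, s i ∈ Gam κ B) (h : EmbAt B s v) {j : ι}
    (hj : Gen B v (s j)) {z : K} (hz : z ∈ Ov κ v) :
    ∃ y ∈ Gam κ B, ev κ v (y / s j) = ev κ v z ∧ dv κ v (y / s j) = dv κ v z := by
  have ht : ∀ i, s i / s j ∈ Ov κ v := fun i => div_Gen hv G (hs i) hj
  obtain ⟨c, hc⟩ := (Submodule.mem_span_range_iff_exists_fun k).1 (dv_span G hv hs h hj hz)
  set u : K := ∑ i, c i • (s i / s j) with hu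
  have hum : u ∈ Ov κ v := sum_mem fun i _ => Subalgebra.smul_mem _ (ht i) _
  have hud : dv κ v u = dv κ v z := by
    rw [← hc]
    have := map_sum (dvL hv) (fun i => c i • (⟨s i / s j, ht i⟩ : Ov κ v)) Finset.univ
    simp only [map_smul] at this
    refine Eq.trans ?_ (Eq.trans this rfl)
    show dv κ v u = dv κ v _
    congr 1
    rw [hu]
    simp
  have hco : algebraMap k K (ev κ v z - ev κ v u) ∈ Ov κ v := Subalgebra.algebraMap_mem _ _
  refine ⟨∑ i, c i • s i + (ev κ v z - ev κ v u) • s j, add_mem (sum_mem fun i _ => Submodule.smul_mem _ _ (hs i))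
    (Submodule.smul_mem _ _ (hs j)), ?_⟩
  have e1 : (∑ i, c i • s i + (ev κ v z - ev κ v u) • s j) / s j = u + algebraMap k K (ev κ v z - ev κ v u) := by
    rw [add_div, Finset.sum_div, Algebra.smul_def (_ - _) (s j), mul_div_cancel_right₀ _ hj.ne]
    simp_rw [smul_div_assoc]
    rfl
  rw [e1, ev_add hv hum hco, dv_add hv hum hco, ev_const hv, dv_const hv, hud]
  simp

lemma ev_sub {v : Fin (n+1) → k} (hv : v ∈ Cone (RingHom.ker κ)) {z w : K} (hz : z ∈ Ov κ v)
    (hw : w ∈ Ov κ v) : ev κ v (z - w) = ev κ v z - ev κ v w :=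
  map_sub (evA hv) ⟨z, hz⟩ ⟨w, hw⟩

lemma coord_rel {ι : Type} (G : Geo κ d) {B : PDt κ d →₀ ℤ} {v : Fin (n+1) → k}
    (hv : v ∈ Cone (RingHom.ker κ)) {s : ι → K} (hs : ∀ i, s i ∈ Gam κ B) {r : ℕ}
    {p : Fin (n+1) → MvPolynomial ι k} {θ : K} (h1 : ∀ i, (p i).IsHomogeneous r)
    (h3 : ∀ i, aeval s (p i) = θ * κ (X i)) {j : ι} (hj : Gen B v (s j)) (i i' : Fin (n+1)) :
    eval (fun l => ev κ v (s l / s j)) (p i) * v i' = eval (fun l => ev κ v (s l / s j)) (p i') * v i := by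
  have ht : ∀ i, s i / s j ∈ Ov κ v := fun i => div_Gen hv G (hs i) hj
  obtain ⟨i0, hi0⟩ := Function.ne_iff.1 hv.1
  have hi0' : eval v (X i0 : MvPolynomial (Fin (n+1)) k) ≠ 0 := by simpa using hi0
  have hk := kne hv hi0'
  have hX : ∀ i, κ (X i) / κ (X i0) ∈ Ov κ v ∧ ev κ v (κ (X i) / κ (X i0)) = v i / v i0 := by
    intro i
    have hp : Pres κ v (κ (X i) / κ (X i0)) (X i) (X i0) :=
      ⟨⟨1, isHomogeneous_X k i, isHomogeneous_X k i0⟩, hi0', div_mul_cancel₀ _ hk⟩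
    exact ⟨hp.mem hv, by rw [hp.ev hv]; simp⟩
  have e1 : aeval (fun l => s l / s j) (p i) * (κ (X i') / κ (X i0)) =
      aeval (fun l => s l / s j) (p i') * (κ (X i) / κ (X i0)) := by
    rw [aeval_hom_div _ (h1 i) _ _ hj.ne, aeval_hom_div _ (h1 i') _ _ hj.ne, h3, h3]; ring
  have e2 := congrArg (ev κ v) e1
  rw [ev_mul hv (ev_aeval hv ht _).1 (hX _).1, ev_mul hv (ev_aeval hv ht _).1 (hX _).1, (hX _).2, (hX _).2,
    (ev_aeval hv ht _).2, (ev_aeval hv ht _).2] at e2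
  have hi0 : v i0 ≠ 0 := hi0
  field_simp at e2
  exact e2

lemma sep {ι : Type} (G : Geo κ d) {B : PDt κ d →₀ ℤ} {v P : Fin (n+1) → k}
    (hv : v ∈ Cone (RingHom.ker κ)) (hP : P ∈ Cone (RingHom.ker κ)) {s : ι → K} (hs : ∀ i, s i ∈ Gam κ B)
    (h : EmbAt B s v) (h' : EmbAt B s P) (hne : ¬ ∃ c : k, P = c • v) :
    ∃ y ∈ Gam κ B, Gen B v y ∧ ¬ Gen B P y := by
  obtain ⟨⟨j, hj⟩, r, p, θ, h1, h2, h3, i, hi, h4⟩ := h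
  obtain ⟨⟨j', hj'⟩, -⟩ := h'
  set y : ι → k := fun l => ev κ v (s l / s j) with hy
  set y' : ι → k := fun l => ev κ P (s l / s j') with hy'
  have ht : ∀ i, s i / s j ∈ Ov κ v := fun i => div_Gen hv G (hs i) hj
  have ht' : ∀ i, s i / s j' ∈ Ov κ P := fun i => div_Gen hP G (hs i) hj'
  by_contra hc
  push Not at hc
  have key : ∀ a b, y' a * y b = y' b * y a := by
    intro a b
    have hm : y' a • s b - y' b • s a ∈ Gam κ B := sub_mem (Submodule.smul_mem _ _ (hs b)) (Submodule.smul_mem _ _ (hs a))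
    by_contra hne
    have g1 : Gen B v (y' a • s b - y' b • s a) := by
      rw [Gen_iff_ev_div G hv hm hj, sub_div, smul_div_assoc, smul_div_assoc,
        ev_sub hv (Subalgebra.smul_mem _ (ht b) _) (Subalgebra.smul_mem _ (ht a) _), ev_smul hv _ (ht b), ev_smul hv _ (ht a)]
      exact sub_ne_zero.2 hne
    have g2 := hc _ hm g1
    rw [Gen_iff_ev_div G hP hm hj', sub_div, smul_div_assoc, smul_div_assoc,
        ev_sub hP (Subalgebra.smul_mem _ (ht' b) _) (Subalgebra.smul_mem _ (ht' a) _), ev_smul hP _ (ht' b), ev_smul hP _ (ht' a)] at g2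
    apply g2
    show y' a * y' b - y' b * y' a = 0
    ring
  have hy'1 : y' j' = 1 := by rw [hy']; simp only [div_self hj'.ne]; exact ev_one hP
  have hy1 : y j = 1 := by rw [hy]; simp only [div_self hj.ne]; exact ev_one hv
  have hyy : y = fun b => y j' * y' b := by
    ext b
    have := key j' b
    rw [hy'1, one_mul] at this
    rw [this]; ring
  have hc0 : y j' ≠ 0 := by
    intro h0
    rw [hyy] at hy1
    simp [h0] at hy1
  have c1 := coord_rel G hv hs h1 h3 hj
  have c2 := coord_rel G hP hs h1 h3 hj'
  have hpy : ∀ i, eval y (p i) = y j' ^ r * eval y' (p i) := by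
    intro i
    have := aeval_scale (K := k) (p i) (h1 i) y' hc0
    rw [← hyy] at this
    simpa [aeval_eq_eval] using this
  have hpi : eval y (p i) ≠ 0 := by
    rw [← (ev_aeval hv ht (p i)).2, ← isU_iff_ev hv (ev_aeval hv ht (p i)).1, aeval_hom_div _ (h1 i) _ _ hj.ne]
    exact Gen_div_isU G h4 (Gen_pow G hj r)
  have hpi' : eval y' (p i) ≠ 0 := fun h0 => hpi (by rw [hpy, h0, mul_zero])
  apply hne
  refine ⟨P i / v i, ?_⟩
  ext l
  have d1 := c1 i l
  have d2 := c2 i l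
  change eval y (p i) * v l = eval y (p l) * v i at d1
  change eval y' (p i) * P l = eval y' (p l) * P i at d2
  rw [hpy, hpy] at d1
  have d3 : eval y' (p i) * v l = eval y' (p l) * v i := by
    have := pow_ne_zero r hc0
    apply mul_left_cancel₀ this
    linear_combination d1
  rw [Pi.smul_apply, smul_eq_mul]
  field_simp
  apply mul_left_cancel₀ hpi'
  linear_combination v i * d2 - P i * d3

lemma Cone_smul_iff {Q : Ideal (MvPolynomial (Fin (n+1)) k)} (hQ : IsHom Q) {c : k} (hc : c ≠ 0) {v : Fin (n+1) → k} :
    c • v ∈ Cone Q ↔ v ∈ Cone Q := by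
  constructor
  · intro h
    have := Cone.smul hQ h (inv_ne_zero hc)
    rwa [smul_smul, inv_mul_cancel₀ hc, one_smul] at this
  · intro h
    exact Cone.smul hQ h hc

lemma Gen_smul (G : Geo κ d) {B : PDt κ d →₀ ℤ} {v : Fin (n+1) → k} (hv : v ∈ Cone (RingHom.ker κ)) {z : K}
    {c : k} (hc : c ≠ 0) : Gen B (c • v) z ↔ Gen B v z := by
  have hcv := Cone.smul G.hom hv hc
  constructor
  · intro h
    have hz := h.K0 G
    have hne := h.ne
    rw [Gen_iff G hcv hz h.ne] at h
    rw [Gen_iff G hv hz hne]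
    exact fun Q hQ => h Q ((Cone_smul_iff Q.2.hom hc).2 hQ)
  · intro h
    have hz := h.K0 G
    have hne := h.ne
    rw [Gen_iff G hv hz h.ne] at h
    rw [Gen_iff G hcv hz hne]
    exact fun Q hQ => h Q ((Cone_smul_iff Q.2.hom hc).1 hQ)

/-- sections vanishing at given points -/
noncomputable def GamP (A : PDt κ d →₀ ℤ) {q : ℕ} (P : Fin q → (Fin (n+1) → k))
    (hP : ∀ s, P s ∈ Cone (RingHom.ker κ)) : Submodule k K where
  carrier := {w | w ∈ Gam κ A ∧ ∀ s, ev κ (P s) (w * gam (P s) A) = 0}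
  zero_mem' := ⟨zero_mem _, fun s => by rw [zero_mul, ev_zero (hP s)]⟩
  add_mem' := by
    rintro z w ⟨h, h1⟩ ⟨h', h1'⟩
    exact ⟨add_mem h h', fun s => by
      rw [add_mul, ev_add (hP s) (h.2 _ (hP s)) (h'.2 _ (hP s)), h1, h1', add_zero]⟩
  smul_mem' := by
    rintro c z ⟨h, h1⟩
    exact ⟨Submodule.smul_mem _ _ h, fun s => by
      rw [smul_mul_assoc, ev_smul (hP s) _ (h.2 _ (hP s)), h1, mul_zero]⟩

lemma mem_GamP {A : PDt κ d →₀ ℤ} {q : ℕ} {P : Fin q → (Fin (n+1) → k)}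
    {hP : ∀ s, P s ∈ Cone (RingHom.ker κ)} {w : K} :
    w ∈ GamP A P hP ↔ w ∈ Gam κ A ∧ ∀ s, ¬ Gen A (P s) w := by
  constructor
  · rintro ⟨h, h1⟩
    exact ⟨h, fun s => by rw [Gen_iff_ev (hP s) h, not_not]; exact h1 s⟩
  · rintro ⟨h, h1⟩
    exact ⟨h, fun s => by have := h1 s; rwa [Gen_iff_ev (hP s) h, not_not] at this⟩

lemma not_Gen_mul (G : Geo κ d) {B B' : PDt κ d →₀ ℤ} {v : Fin (n+1) → k} (hv : v ∈ Cone (RingHom.ker κ)) {z w : K}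
    (hz : z ∈ Gam κ B) (hw : w ∈ Gam κ B') (h : ¬ Gen B v z) : ¬ Gen (B + B') v (z * w) := by
  rw [Gen_iff_ev hv (Gam_mul G hz hw), not_not, gam_add G, mul_mul_mul_comm, ev_mul hv (hz.2 v hv) (hw.2 v hv)]
  rw [Gen_iff_ev hv hz, not_not] at h
  rw [h, zero_mul]

lemma Gam_prod (G : Geo κ d) {B : PDt κ d →₀ ℤ} {ι : Type} (T : Finset ι) {y : ι → K}
    (hy : ∀ i ∈ T, y i ∈ Gam κ B) : ∏ i ∈ T, y i ∈ Gam κ (T.card • B) := by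
  classical
  induction T using Finset.induction_on with
  | empty =>
    rw [Finset.prod_empty, Finset.card_empty, zero_smul]
    exact ⟨one_mem _, fun v _ => by rw [gam_zero, one_mul]; exact one_mem _⟩
  | insert a T ha ih =>
    rw [Finset.prod_insert ha, Finset.card_insert_of_notMem ha, succ_nsmul']
    exact Gam_mul G (hy a (Finset.mem_insert_self _ _)) (ih fun i hi => hy i (Finset.mem_insert_of_mem hi))

lemma Gen_prod (G : Geo κ d) {B : PDt κ d →₀ ℤ} {ι : Type} (T : Finset ι) {y : ι → K} {v : Fin (n+1) → k}
    (hy : ∀ i ∈ T, Gen B v (y i)) : Gen (T.card • B) v (∏ i ∈ T, y i) := by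
  classical
  induction T using Finset.induction_on with
  | empty =>
    rw [Finset.prod_empty, Finset.card_empty, zero_smul, Gen, gam_zero, one_mul]
    exact IsU.one
  | insert a T ha ih =>
    rw [Finset.prod_insert ha, Finset.card_insert_of_notMem ha, succ_nsmul']
    exact Gen_mul G (hy a (Finset.mem_insert_self _ _)) (ih fun i hi => hy i (Finset.mem_insert_of_mem hi))

/-- jets through points -/
theorem JET {ι : Type} [Fintype ι] (G : Geo κ d) {A B C : PDt κ d →₀ ℤ} {c q : ℕ} (hA : C + c • B = A)
    (hq : q + 1 ≤ c) {s : ι → K} (hs : ∀ i, s i ∈ Gam κ B) (h : ∀ v ∈ Cone (RingHom.ker κ), EmbAt B s v)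
    (hC : ∀ v ∈ Cone (RingHom.ker κ), ∃ τ ∈ Gam κ C, Gen C v τ)
    (P : Fin q → (Fin (n+1) → k)) (hP : ∀ s, P s ∈ Cone (RingHom.ker κ))
    {v : Fin (n+1) → k} (hv : v ∈ Cone (RingHom.ker κ)) :
    ∃ w0 ∈ Gam κ A, Gen A v w0 ∧ ∀ z ∈ Ov κ v, ((∀ i, ¬ ∃ c : k, P i = c • v) ∨ ev κ v z = 0) →
      ∃ w ∈ GamP A P hP, ev κ v (w / w0) = ev κ v z ∧ dv κ v (w / w0) = dv κ v z := by
  classical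
  obtain ⟨⟨j, hj⟩, -⟩ := h v hv
  obtain ⟨τ, hτ, hτg⟩ := hC v hv
  have : ∀ i, ∃ y ∈ Gam κ B, Gen B v y ∧ ((¬ ∃ c : k, P i = c • v) → ¬ Gen B (P i) y) := by
    intro i
    by_cases hi : ∃ c : k, P i = c • v
    · exact ⟨s j, hs j, hj, fun h => absurd hi h⟩
    · obtain ⟨y, h1, h2, h3⟩ := sep G hv (hP i) hs (h v hv) (h _ (hP i)) hi
      exact ⟨y, h1, h2, fun _ => h3⟩
  choose y hy1 hy2 hy3 using this
  obtain ⟨c', rfl⟩ := Nat.exists_eq_add_of_le hq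
  have hcard : (Finset.univ : Finset (Fin q)).card = q := by simp
  set ω := τ * s j ^ c' * ∏ i, y i with hω
  have hωm : ω ∈ Gam κ (C + c' • B + q • B) := by
    have := Gam_mul G (Gam_mul G hτ (Gam_pow G (hs j) c')) (Gam_prod G Finset.univ fun i _ => hy1 i)
    rwa [hcard] at this
  have hωg : Gen (C + c' • B + q • B) v ω := by
    have := Gen_mul G (Gen_mul G hτg (Gen_pow G hj c')) (Gen_prod G Finset.univ fun i _ => hy2 i)
    rwa [hcard] at this
  have hA' : C + c' • B + q • B + B = A := by
    rw [← hA, add_smul, add_smul, one_smul]; abel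
  have hωP : ∀ i, (¬ ∃ c : k, P i = c • v) → ¬ Gen (C + c' • B + q • B) (P i) ω := by
    intro i hi
    have e1 : ω = y i * (τ * s j ^ c' * ∏ l ∈ Finset.univ.erase i, y l) := by
      rw [hω, ← Finset.mul_prod_erase Finset.univ y (Finset.mem_univ i)]; ring
    have hcard2 : (Finset.univ.erase i : Finset (Fin q)).card = q - 1 := by
      rw [Finset.card_erase_of_mem (Finset.mem_univ i), hcard]
    have e2 : C + c' • B + q • B = B + (C + c' • B + (q - 1) • B) := by
      have : q = (q - 1) + 1 := by have := i.pos; omega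
      conv_lhs => rw [this, add_smul, one_smul]
      abel
    rw [e1, e2]
    apply not_Gen_mul G (hP i) (hy1 i) _ (hy3 i hi)
    have := Gam_mul G (Gam_mul G hτ (Gam_pow G (hs j) c')) (Gam_prod G (Finset.univ.erase i) fun i _ => hy1 i)
    rwa [hcard2] at this
  subst hA'
  refine ⟨ω * s j, Gam_mul G hωm (hs j), Gen_mul G hωg hj, fun z hz hcase => ?_⟩
  obtain ⟨u, hu, hu1, hu2⟩ := jet0 G hv hs (h v hv) hj hz
  have e3 : ω * u / (ω * s j) = u / s j := mul_div_mul_left _ _ hωg.ne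
  refine ⟨ω * u, mem_GamP.2 ⟨Gam_mul G hωm hu, fun i => ?_⟩, by rw [e3, hu1], by rw [e3, hu2]⟩
  by_cases hi : ∃ c : k, P i = c • v
  · have h0 : ev κ v z = 0 := hcase.resolve_left fun h => h i hi
    obtain ⟨c0, hc0⟩ := hi
    have hc00 : c0 ≠ 0 := by
      rintro rfl
      exact (hP i).1 (by rw [hc0, zero_smul])
    rw [hc0, Gen_smul G hv hc00, mul_comm ω, add_comm]
    apply not_Gen_mul G hv hu hωm
    rw [Gen_iff_ev_div G hv hu hj, not_not, hu1, h0]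
  · exact not_Gen_mul G (hP i) hωm hu (hωP i hi)

end B11
end Bert


namespace Bert
set_option linter.unusedSectionVars false
section B12
variable {k : Type} [Field k] {n : ℕ} {K : Type} [Field K] [Algebra k K] {κ : MvPolynomial (Fin (n+1)) k →ₐ[k] K} {d : ℕ} [IsAlgClosed k]

/-- singular vanishing of a section at a point -/
def Bad (A : PDt κ d →₀ ℤ) (v : Fin (n+1) → k) (w : K) : Prop :=
  ev κ v (w * gam v A) = 0 ∧ dv κ v (w * gam v A) = 0

lemma Bad_iff (G : Geo κ d) {A : PDt κ d →₀ ℤ} {v : Fin (n+1) → k} (hv : v ∈ Cone (RingHom.ker κ)) {w τ : K}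
    (hw : w ∈ Gam κ A) (hτ : Gen A v τ) : Bad A v w ↔ ev κ v (w / τ) = 0 ∧ dv κ v (w / τ) = 0 := by
  have e1 : w * gam v A = (w / τ) * (τ * gam v A) := by
    have := hτ.ne
    field_simp
  have h1 := div_Gen hv G hw hτ
  have h2 : τ * gam v A ∈ Ov κ v := hτ.2.1
  have h3 := (isU_iff_ev hv h2).1 hτ
  rw [Bad, e1, ev_mul hv h1 h2, dv_mul hv h1 h2]
  constructor
  · rintro ⟨h, h'⟩
    have h0 : ev κ v (w / τ) = 0 := (mul_eq_zero.1 h).resolve_right h3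
    rw [h0, zero_smul, zero_add] at h'
    exact ⟨h0, (smul_eq_zero.1 h').resolve_left h3⟩
  · rintro ⟨h, h'⟩
    rw [h, h']; simp

lemma good_pt (G : Geo κ d) {A : PDt κ d →₀ ℤ} {v : Fin (n+1) → k} (hv : v ∈ Cone (RingHom.ker κ)) {w : K}
    (hw : w ∈ Gam κ A) (hw0 : w ≠ 0) (hbad : ¬ Bad A v w) {Q : PDt κ d} (hQ : v ∈ Cone Q.1)
    (hne : ord Q w + A Q ≠ 0) :
    ord Q w + A Q = 1 ∧ (∀ Q' : PDt κ d, v ∈ Cone Q'.1 → Q' ≠ Q → ord Q' w + A Q' = 0) ∧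
      Module.finrank k (gradSpan Q.1 v) + d = n + 1 := by
  classical
  have hK : w ∈ K0 κ := hw.1
  have hgK := gam_K0 G v A
  have hg0 := gam_ne G v A
  set z := w * gam v A with hz
  have hzK : z ∈ K0 κ := mul_mem hK hgK
  have hz0 : z ≠ 0 := mul_ne_zero hw0 hg0
  have hzO : z ∈ Ov κ v := hw.2 v hv
  have hord : ∀ Q' : PDt κ d, v ∈ Cone Q'.1 → ord Q' z = ord Q' w + A Q' := fun Q' h' => by
    rw [hz, ord_mul G Q' hK hw0 hgK hg0, ord_gam G h']
  have hpK := pil_K0 G Q v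
  have hp0 := pil_ne G Q v
  have hpo : ∀ Q' : PDt κ d, v ∈ Cone Q'.1 → ord Q' (pil Q v) = if Q' = Q then 1 else 0 := fun Q' h' => by
    have := ord_gam G h' (Finsupp.single Q 1)
    rw [gam_single, zpow_one, Finsupp.single_apply] at this
    rw [this]
    simp [eq_comm]
  have hQ1 : 1 ≤ ord Q z := by
    have h1 := (Ov_iff G hv hzK hz0).1 hzO Q hQ
    have h2 := hord Q hQ
    omega
  set y := z / pil Q v with hy
  have hyK : y ∈ K0 κ := K0_div hzK hpK
  have hy0 : y ≠ 0 := div_ne_zero hz0 hp0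
  have hyo : ∀ Q' : PDt κ d, v ∈ Cone Q'.1 → ord Q' y = ord Q' z - if Q' = Q then 1 else 0 := fun Q' h' => by
    rw [hy, ord_div G Q' hzK hz0 hpK hp0, hpo Q' h']
  have hyO : y ∈ Ov κ v := by
    rw [Ov_iff G hv hyK hy0]
    intro Q' h'
    rw [hyo Q' h']
    split_ifs with h
    · subst h; omega
    · have := (Ov_iff G hv hzK hz0).1 hzO Q' h'
      omega
  obtain ⟨e, f, x, hL, hpil⟩ := pil_spec G Q hQ
  have hxk := kne hv hL.xv
  have hP : Pres κ v (pil Q v) f x := ⟨⟨e, hL.fh, hL.xh⟩, hL.xv, by rw [hpil, div_mul_cancel₀ _ hxk]⟩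
  have hpO := hP.mem hv
  have hev : ev κ v (pil Q v) = 0 := by rw [hP.ev hv, hQ.2 f hL.fQ, zero_div]
  have hzy : z = pil Q v * y := by rw [hy, mul_div_cancel₀ _ hp0]
  have hdz : dv κ v z = ev κ v y • dv κ v (pil Q v) := by
    rw [hzy, dv_mul hv hpO hyO, hev, zero_smul, zero_add]
  have hez : ev κ v z = 0 := by rw [hzy, ev_mul hv hpO hyO, hev, zero_mul]
  have hdz0 : dv κ v z ≠ 0 := fun h => hbad ⟨hez, h⟩
  have hy1 : ev κ v y ≠ 0 := by
    intro h; apply hdz0; rw [hdz, h, zero_smul]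
  have hd0 : dv κ v (pil Q v) ≠ 0 := by
    intro h; apply hdz0; rw [hdz, h, smul_zero]
  have hyU := (isU_iff G hv hyK hy0).1 ((isU_iff_ev hv hyO).2 hy1)
  refine ⟨?_, ?_, ?_⟩
  · have h1 := hyU Q hQ
    rw [hyo Q hQ, hord Q hQ, if_pos rfl] at h1
    omega
  · intro Q' h' hne'
    have h1 := hyU Q' h'
    rw [hyo Q' h', hord Q' h', if_neg hne'] at h1
    omega
  · rw [hP.dv hv, hev, zero_smul, sub_zero, Ne, Submodule.Quotient.mk_eq_zero] at hd0
    set N := gradSpan (RingHom.ker κ) v with hN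
    have hfN : gradientAt f v ∉ N := fun h => hd0 (Submodule.smul_mem _ _ h)
    have heq : gradSpan Q.1 v = N ⊔ Submodule.span k {gradientAt f v} := by
      apply le_antisymm
      · rw [gradSpan, Submodule.span_le]
        rintro _ ⟨q, hq, rfl⟩
        obtain ⟨e', s, -, hsv, h⟩ := hL.gen
        obtain ⟨a, ha⟩ := Ideal.mem_span_singleton_sup.1 (h q hq)
        obtain ⟨b, hb, hab⟩ := ha
        have h1 := congrArg (fun p => gradientAt p v) hab
        simp only [grad_add, grad_mul] at h1
        rw [hQ.2 f hL.fQ, hQ.2 q hq] at h1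
        simp only [zero_smul, add_zero] at h1
        have h2 : gradientAt q v = (eval v s)⁻¹ • (eval v s • gradientAt q v) := by
          rw [smul_smul, inv_mul_cancel₀ hsv, one_smul]
        rw [SetLike.mem_coe, h2, ← h1]
        refine Submodule.smul_mem _ _ (add_mem ?_ ?_)
        · exact Submodule.mem_sup_right (Submodule.smul_mem _ _ (Submodule.mem_span_singleton_self _))
        · exact Submodule.mem_sup_left (grad_mem hb v)
      · refine sup_le ?_ ?_
        · rw [hN, gradSpan, Submodule.span_le]
          rintro _ ⟨q, hq, rfl⟩
          exact grad_mem (Q.2.le hq) v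
        · rw [Submodule.span_singleton_le_iff_mem]
          exact grad_mem hL.fQ v
    have hinf : N ⊓ Submodule.span k {gradientAt f v} = ⊥ := by
      rw [Submodule.eq_bot_iff]
      rintro u ⟨hu1, hu2⟩
      obtain ⟨c, rfl⟩ := Submodule.mem_span_singleton.1 hu2
      by_cases hc : c = 0
      · rw [hc, zero_smul]
      · exfalso; apply hfN
        have := Submodule.smul_mem N c⁻¹ hu1
        rwa [smul_smul, inv_mul_cancel₀ hc, one_smul] at this
    have h1 := Submodule.finrank_sup_add_finrank_inf_eq N (Submodule.span k {gradientAt f v})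
    have hf0 : gradientAt f v ≠ 0 := fun h => hfN (h ▸ zero_mem _)
    rw [hinf, finrank_bot, finrank_span_singleton hf0, ← heq] at h1
    have h2 := G.sm v hv
    rw [← hN] at h2
    rw [add_zero] at h1
    rw [h1]
    omega

lemma elim {A' : Type} [CommRing A'] [IsDomain A'] [Algebra k A'] [Algebra.FiniteType k A']
    {ι J : Type} [Fintype ι] [Fintype J] (hc : td k A' + Fintype.card J = Fintype.card ι)
    (b : Option ι → MvPolynomial J A') :
    ∃ Φ : MvPolynomial ι k, Φ ≠ 0 ∧ ∀ c : ι → k,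
      (∀ μ : k, μ ≠ 0 → ∃ θ : MvPolynomial J A' →ₐ[k] k, θ (b none) = μ ∧ ∀ i, θ (b (some i)) = μ * c i) →
      eval c Φ = 0 := by
  have ht : Algebra.trdeg k (MvPolynomial J A') < ((Fintype.card (Option ι) : ℕ) : Cardinal) := by
    have h1 := trdeg_add_eq k A' (A := MvPolynomial J A')
    rw [MvPolynomial.trdeg_of_isDomain, ← td_cast] at h1
    rw [← h1, Fintype.card_option, ← hc]
    simp only [Cardinal.lift_id, Cardinal.mk_fintype]
    exact_mod_cast Nat.lt_succ_self _
  let e := Fintype.equivFin (Option ι)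
  obtain ⟨p, hp, hp0⟩ := exists_aeval_zero_of_trdeg ht (b ∘ e.symm)
  set P : MvPolynomial (Option ι) k := rename e.symm p with hP
  have hP0 : P ≠ 0 := by
    rw [hP]
    intro h
    exact hp (rename_injective _ e.symm.injective (by rw [h, map_zero]))
  have hPb : aeval b P = 0 := by rw [hP, aeval_rename, hp0]
  have : ∃ y : Option ι → k, eval y (X none * P) ≠ 0 := by
    by_contra hcon
    push Not at hcon
    have : X none * P = 0 := MvPolynomial.funext fun y => by rw [hcon y, map_zero]
    exact (mul_ne_zero (X_ne_zero _) hP0) this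
  obtain ⟨y, hy⟩ := this
  rw [map_mul, eval_X] at hy
  have hy1 := left_ne_zero_of_mul hy
  have hy2 := right_ne_zero_of_mul hy
  set g : Option ι → MvPolynomial ι k := fun o => o.elim (C (y none)) fun i => C (y none) * X i with hg
  have hgc : ∀ c : ι → k, eval c (aeval g P) = eval (fun o : Option ι => o.elim (y none) fun i => y none * c i) P := by
    intro c
    have : eval c (aeval g P) = aeval (fun o => aeval c (g o)) P := by
      rw [← comp_aeval_apply]; rfl
    rw [this, aeval_eq_eval]
    congr 1
    congr 1
    ext o
    cases o <;> simp [hg]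
  refine ⟨aeval g P, ?_, ?_⟩
  · intro h0
    apply hy2
    have := hgc fun i => y (some i) / y none
    rw [h0, map_zero] at this
    rw [this]
    congr 1
    congr 1
    ext o
    cases o with
    | none => rfl
    | some i => simp [mul_div_cancel₀ _ hy1]
  · intro c hcc
    obtain ⟨θ, h1, h2⟩ := hcc _ hy1
    rw [hgc]
    have h3 := congrArg θ hPb
    rw [comp_aeval_apply, map_zero, aeval_eq_eval] at h3
    rw [← h3]
    congr 1
    congr 1
    ext o
    cases o with
    | none => exact h1.symm
    | some i => exact (h2 i).symm

lemma hom_gradSpan {I : Ideal (MvPolynomial (Fin (n+1)) k)} (hI : IsHom I) (v : Fin (n+1) → k) :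
    gradSpan I v = Submodule.span k (Set.range fun h : {h : MvPolynomial (Fin (n+1)) k // h ∈ I ∧ ∃ m, h.IsHomogeneous m} => gradientAt h.1 v) := by
  apply le_antisymm
  · rw [gradSpan, Submodule.span_le]
    rintro _ ⟨h, hh, rfl⟩
    have e1 : gradientAt h v = ∑ i ∈ Finset.range (h.totalDegree + 1), gradientAt (homogeneousComponent i h) v := by
      ext j
      conv_lhs => rw [gradientAt, ← sum_homogeneousComponent h]
      simp [gradientAt]
    rw [SetLike.mem_coe, e1]
    refine sum_mem fun i _ => Submodule.subset_span ⟨⟨_, hI h hh i, i, homogeneousComponent_isHomogeneous i h⟩, rfl⟩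
  · rw [Submodule.span_le]
    rintro _ ⟨h, rfl⟩
    exact grad_mem h.2.1 v

lemma frame (G : Geo κ d) {v : Fin (n+1) → k} (hv : v ∈ Cone (RingHom.ker κ)) {ι : Type} (a : ι → MvPolynomial (Fin (n+1)) k)
    (hs : Submodule.span k (Set.range fun i => (gradSpan (RingHom.ker κ) v).mkQ (gradientAt (a i) v)) = ⊤) :
    ∃ (κ₁ κ₂ : Type) (_ : Fintype κ₁) (_ : Fintype κ₂) (_ : DecidableEq κ₁) (_ : DecidableEq κ₂)
      (h : κ₁ → MvPolynomial (Fin (n+1)) k) (σ : κ₂ → ι) (ε : κ₁ ⊕ κ₂ ≃ Fin (n+1)), Function.Injective σ ∧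
      (∀ j, h j ∈ RingHom.ker κ ∧ ∃ m, (h j).IsHomogeneous m) ∧ Fintype.card κ₁ + d = n ∧
      Fintype.card κ₂ = d + 1 ∧
      (Matrix.of fun r c => eval v (pderiv (ε r) (Sum.elim h (a ∘ σ) c)) : Matrix (κ₁ ⊕ κ₂) (κ₁ ⊕ κ₂) k).det ≠ 0 := by
  classical
  have hN := hom_gradSpan G.hom v
  set N := gradSpan (RingHom.ker κ) v with hNdef
  obtain ⟨κ₁, a₁, hinj₁, hspan₁, hli₁⟩ := exists_linearIndependent' k
    (fun h : {h : MvPolynomial (Fin (n+1)) k // h ∈ RingHom.ker κ ∧ ∃ m, h.IsHomogeneous m} => gradientAt h.1 v)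
  obtain ⟨κ₂, σ, hinj₂, hspan₂, hli₂⟩ := exists_linearIndependent' k (fun i => N.mkQ (gradientAt (a i) v))
  have : Finite κ₁ := hli₁.finite
  have : Finite κ₂ := hli₂.finite
  let _ := Fintype.ofFinite κ₁
  let _ := Fintype.ofFinite κ₂
  have c1 : Fintype.card κ₁ + d = n := by
    have h1 := finrank_span_eq_card hli₁
    have h2 := G.sm v hv
    rw [hspan₁, ← hN] at h1
    rw [← h1]; exact h2
  have c2 : Fintype.card κ₂ = d + 1 := by
    have h1 := finrank_span_eq_card hli₂
    rw [hspan₂, hs, finrank_top] at h1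
    have h2 := N.finrank_quotient_add_finrank
    have h3 := G.sm v hv
    rw [← hNdef] at h3
    rw [Module.finrank_fin_fun] at h2
    omega
  have hcard : Fintype.card (κ₁ ⊕ κ₂) = Fintype.card (Fin (n+1)) := by
    rw [Fintype.card_sum, Fintype.card_fin]; omega
  let ε := Fintype.equivOfCardEq hcard
  refine ⟨κ₁, κ₂, inferInstance, inferInstance, inferInstance, inferInstance, fun j => (a₁ j).1, σ, ε, hinj₂,
    fun j => (a₁ j).2, c1, c2, ?_⟩
  have hmem : ∀ j, gradientAt (a₁ j).1 v ∈ N := fun j => grad_mem (a₁ j).2.1 v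
  have hf : LinearIndependent k (fun j => (⟨gradientAt (a₁ j).1 v, hmem j⟩ : N)) := by
    apply LinearIndependent.of_comp N.subtype
    exact hli₁
  have hli := LinearIndependent.sumElim_of_quotient hf (fun j => gradientAt (a (σ j)) v) hli₂
  have hcol : LinearIndependent k
      (Matrix.of fun r c => eval v (pderiv (ε r) (Sum.elim (fun j => (a₁ j).1) (a ∘ σ) c)) : Matrix (κ₁ ⊕ κ₂) (κ₁ ⊕ κ₂) k).col := by
    have h2 := hli.map' (LinearEquiv.funCongrLeft k k ε).toLinearMap (LinearEquiv.ker _)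
    refine Eq.mp ?_ h2
    congr 1
    ext c r
    cases c <;> rfl
  have := Matrix.linearIndependent_cols_iff_isUnit.1 hcol
  rw [Matrix.isUnit_iff_isUnit_det] at this
  exact this.ne_zero

lemma grad_hom_smul {f : MvPolynomial (Fin (n+1)) k} {m : ℕ} (hf : f.IsHomogeneous m) (c : k) (v : Fin (n+1) → k) :
    gradientAt f (c • v) = c ^ (m - 1) • gradientAt f v := by
  ext j
  exact eval_smul_hom hf.pderiv c v

lemma det_hom {m : Type} [Fintype m] [DecidableEq m] (M : Matrix m m (MvPolynomial (Fin (n+1)) k)) (g : m → ℕ)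
    (hM : ∀ r c, (M r c).IsHomogeneous (g c)) : M.det.IsHomogeneous (∑ c, g c) := by
  rw [Matrix.det_apply]
  refine MvPolynomial.IsHomogeneous.sum _ _ _ fun τ _ => ?_
  have h1 : (∏ i, M (τ i) i).IsHomogeneous (∑ c, g c) := MvPolynomial.IsHomogeneous.prod _ _ _ fun i _ => hM _ _
  rcases Int.units_eq_one_or (Equiv.Perm.sign τ) with h | h
  · rw [h, one_smul]; exact h1
  · rw [h, Units.neg_smul, one_smul]; exact h1.neg

lemma sum_split {ι κ₂ : Type} [Fintype ι] [Fintype κ₂] [DecidableEq ι] {σ : κ₂ → ι} (hσ : Function.Injective σ)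
    {M : Type} [AddCommMonoid M] (f : ι → M) :
    ∑ i, f i = ∑ s, f (σ s) + ∑ i : {i // i ∉ Set.range σ}, f i := by
  classical
  rw [← Fintype.sum_subtype_add_sum_subtype (fun i => i ∈ Set.range σ) f]
  congr 1
  symm
  convert Fintype.sum_equiv (Equiv.ofInjective σ hσ) (fun s => f (σ s)) (fun i => f i.1) fun s => rfl

variable {ι κ₁ κ₂ : Type} [Fintype ι] [DecidableEq ι] [Fintype κ₁] [Fintype κ₂] [DecidableEq κ₁] [DecidableEq κ₂]

lemma cramer (a : ι → MvPolynomial (Fin (n+1)) k) (h : κ₁ → MvPolynomial (Fin (n+1)) k) {σ : κ₂ → ι} (hσ : Function.Injective σ) (ε : κ₁ ⊕ κ₂ ≃ Fin (n+1))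
    (Mx : Matrix (κ₁ ⊕ κ₂) (κ₁ ⊕ κ₂) (MvPolynomial (Fin (n+1)) k)) (hMx : ∀ r c, Mx r c = pderiv (ε r) (Sum.elim h (a ∘ σ) c))
    {v : Fin (n+1) → k} {c : ι → k} {x : κ₁ → k}
    (hx : ∑ i, c i • gradientAt (a i) v = ∑ j, x j • gradientAt (h j) v) (s : κ₂) :
    eval v Mx.det * c (σ s) =
      ∑ i : {i // i ∉ Set.range σ}, eval v (-∑ r, Mx.adjugate (Sum.inr s) r * pderiv (ε r) (a i)) * c i := by
  set y : κ₁ ⊕ κ₂ → k := Sum.elim (fun j => - x j) (fun s => c (σ s)) with hy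
  set Mv : Matrix (κ₁ ⊕ κ₂) (κ₁ ⊕ κ₂) k := (eval v).mapMatrix Mx with hMv
  have h1 : Mv.mulVec y = fun r => - ∑ i : {i // i ∉ Set.range σ}, c i * eval v (pderiv (ε r) (a i)) := by
    ext r
    have h2 := congrFun hx (ε r)
    simp only [Finset.sum_apply, Pi.smul_apply, smul_eq_mul] at h2
    rw [sum_split hσ] at h2
    simp only [gradientAt] at h2
    rw [Matrix.mulVec, dotProduct, Fintype.sum_sum_type]
    simp only [hMv, RingHom.mapMatrix_apply, Matrix.map_apply, hMx, hy, Sum.elim_inl, Sum.elim_inr, Function.comp]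
    simp only [mul_comm _ (c _), mul_neg, Finset.sum_neg_distrib]
    simp only [mul_comm _ (x _)]
    linear_combination h2
  have h2 : Mv.adjugate.mulVec (Mv.mulVec y) = Mv.det • y := by
    rw [Matrix.mulVec_mulVec, Matrix.adjugate_mul, Matrix.smul_mulVec, Matrix.one_mulVec]
  have h3 := congrFun h2 (Sum.inr s)
  rw [h1] at h3
  have h4 : Mv.det = eval v Mx.det := by rw [hMv, RingHom.map_det]
  have h5 : ∀ r, Mv.adjugate (Sum.inr s) r = eval v (Mx.adjugate (Sum.inr s) r) := fun r => by
    rw [hMv, ← RingHom.map_adjugate]; rfl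
  rw [Pi.smul_apply, h4, smul_eq_mul] at h3
  change _ = eval v Mx.det * c (σ s) at h3
  rw [← h3, Matrix.mulVec, dotProduct]
  simp only [h5, map_neg, map_sum, map_mul, mul_neg, neg_mul, Finset.mul_sum, Finset.sum_mul, Finset.sum_neg_distrib]
  rw [Finset.sum_comm]
  congr 1
  refine Finset.sum_congr rfl fun i _ => Finset.sum_congr rfl fun r _ => ?_
  ring

lemma core0 {A' : Type} [CommRing A'] [IsDomain A'] [Algebra k A'] [Algebra.FiniteType k A']
    (π : MvPolynomial (Fin (n+1)) k →ₐ[k] A') (V : Set (Fin (n+1) → k)) (hV : ∀ v ∈ V, ∃ L : A' →ₐ[k] k, ∀ r, L (π r) = eval v r)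
    (ht : td k A' = Fintype.card κ₂) {σ : κ₂ → ι} (hσ : Function.Injective σ)
    (δ : MvPolynomial (Fin (n+1)) k) (F : κ₂ → {i // i ∉ Set.range σ} → MvPolynomial (Fin (n+1)) k) :
    ∃ Φ : MvPolynomial ι k, Φ ≠ 0 ∧ ∀ c : ι → k,
      (∀ μ : k, μ ≠ 0 → ∃ v ∈ V, eval v δ = μ ∧ ∀ s, eval v δ * c (σ s) = ∑ i, eval v (F s i) * c i) →
      eval c Φ = 0 := by
  classical
  have hcard : td k A' + Fintype.card {i // i ∉ Set.range σ} = Fintype.card ι := by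
    have h1 := sum_split hσ (fun _ => 1)
    simp only [Finset.sum_const, Finset.card_univ, smul_eq_mul, mul_one] at h1
    rw [h1, ht]
  obtain ⟨Φ, h0, hΦ⟩ := elim hcard (fun o : Option ι => o.elim (C (π δ)) fun i =>
    if h : ∃ s, σ s = i then ∑ l, C (π (F h.choose l)) * X l else C (π δ) * X ⟨i, h⟩)
  refine ⟨Φ, h0, fun c hc => hΦ c fun μ hμ => ?_⟩
  obtain ⟨v, hv, h1, h2⟩ := hc μ hμ
  obtain ⟨L, hL⟩ := hV v hv
  refine ⟨aevalTower L fun i => c i.1, ?_, fun i => ?_⟩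
  · simp [hL, h1]
  · simp only [Option.elim]
    split_ifs with h
    · have h3 := h2 h.choose
      rw [h.choose_spec, h1] at h3
      rw [h3]
      simp [hL]
    · simp [hL, h1]

lemma core (G : Geo κ d) (a : ι → MvPolynomial (Fin (n+1)) k) {e : ℕ} (ha : ∀ i, (a i).IsHomogeneous e) (h : κ₁ → MvPolynomial (Fin (n+1)) k)
    (hh : ∀ j, h j ∈ RingHom.ker κ ∧ ∃ m, (h j).IsHomogeneous m) {σ : κ₂ → ι} (hσ : Function.Injective σ)
    (ε : κ₁ ⊕ κ₂ ≃ Fin (n+1)) (hc1 : Fintype.card κ₁ + d = n) (hc2 : Fintype.card κ₂ = d + 1)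
    (Mx : Matrix (κ₁ ⊕ κ₂) (κ₁ ⊕ κ₂) (MvPolynomial (Fin (n+1)) k)) (hMx : ∀ r c, Mx r c = pderiv (ε r) (Sum.elim h (a ∘ σ) c))
    (i0 : Fin (n+1)) : (∃ g, Mx.det.IsHomogeneous g) ∧ ∃ Φ : MvPolynomial ι k, Φ ≠ 0 ∧ ∀ v ∈ Cone (RingHom.ker κ), v i0 ≠ 0 → eval v Mx.det ≠ 0 →
      ∀ c : ι → k, ∑ i, c i • gradientAt (a i) v ∈ gradSpan (RingHom.ker κ) v → eval c Φ = 0 := by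
  choose hk m hm using hh
  have hdet : Mx.det.IsHomogeneous (∑ c, Sum.elim (fun j => m j - 1) (fun _ : κ₂ => e - 1) c) := by
    refine det_hom Mx _ fun r c => ?_
    rw [hMx]
    cases c with
    | inl j => exact (hm j).pderiv
    | inr s => exact (ha _).pderiv
  refine ⟨⟨_, hdet⟩, ?_⟩
  set g := ∑ c, Sum.elim (fun j => m j - 1) (fun _ : κ₂ => e - 1) c
  have hX : (X i0 * Mx.det).IsHomogeneous (1 + g) := (isHomogeneous_X k i0).mul hdet
  have : (RingHom.ker κ).IsPrime := RingHom.ker_isPrime κ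
  obtain ⟨Φ, h0, hΦ⟩ := core0 (A' := MvPolynomial (Fin (n+1)) k ⧸ RingHom.ker κ) (Ideal.Quotient.mkₐ k _) (Cone (RingHom.ker κ))
    (fun v hv => ⟨Ideal.Quotient.liftₐ _ (aeval v) (fun f hf => by rw [aeval_eq_eval]; exact hv.2 f hf), fun r => by
      simp⟩)
    (by rw [G.tdim, hc2]) hσ (X i0 * Mx.det)
    (fun s i => X i0 * (-∑ r, Mx.adjugate (Sum.inr s) r * pderiv (ε r) (a i)))
  refine ⟨Φ, h0, fun v hv hi0 hδ c hcN => hΦ c fun μ hμ => ?_⟩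
  -- span of the columns
  have hcol : LinearIndependent k (fun j => gradientAt (h j) v) := by
    have h1 : ((eval v).mapMatrix Mx).det ≠ 0 := by rwa [← RingHom.map_det]
    have h2 := Matrix.linearIndependent_cols_of_det_ne_zero h1
    have h3 := h2.comp Sum.inl Sum.inl_injective
    have h4 := h3.map' (LinearEquiv.funCongrLeft k k ε.symm).toLinearMap (LinearEquiv.ker _)
    refine Eq.mp ?_ h4
    congr 1
    ext j r
    show eval v (Mx (ε.symm r) (Sum.inl j)) = _
    rw [hMx, Equiv.apply_symm_apply]
    rfl
  have hspan : Submodule.span k (Set.range fun j => gradientAt (h j) v) = gradSpan (RingHom.ker κ) v := by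
    apply Submodule.eq_of_le_of_finrank_eq
    · rw [Submodule.span_le]
      rintro _ ⟨j, rfl⟩
      exact grad_mem (hk j) v
    · rw [finrank_span_eq_card hcol]
      have := G.sm v hv
      omega
  rw [← hspan] at hcN
  obtain ⟨x, hx⟩ := (Submodule.mem_span_range_iff_exists_fun k).1 hcN
  have hvd : eval v (X i0 * Mx.det) ≠ 0 := by rw [map_mul, eval_X]; exact mul_ne_zero hi0 hδ
  obtain ⟨t, ht⟩ := IsAlgClosed.exists_pow_nat_eq (μ / eval v (X i0 * Mx.det)) (n := 1 + g) (by omega)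
  have ht0 : t ≠ 0 := by
    rintro rfl
    rw [zero_pow (by omega)] at ht
    exact (div_ne_zero hμ hvd) ht.symm
  refine ⟨t • v, Cone.smul G.hom hv ht0, ?_, fun s => ?_⟩
  · rw [eval_smul_hom hX, ht, div_mul_cancel₀ _ hvd]
  · have h1 := cramer a h hσ ε Mx hMx (v := t • v) (c := c) (x := fun j => t ^ (e-1) * x j / t ^ (m j - 1)) (by
      simp only [grad_hom_smul (ha _), grad_hom_smul (hm _)]
      simp_rw [smul_comm (c _) (t ^ (e-1))]
      rw [← Finset.smul_sum, ← hx, Finset.smul_sum]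
      refine Finset.sum_congr rfl fun j _ => ?_
      rw [smul_smul, smul_smul, div_mul_cancel₀ _ (pow_ne_zero _ ht0)]) s
    rw [map_mul, mul_assoc, h1, Finset.mul_sum]
    refine Finset.sum_congr rfl fun i _ => ?_
    rw [map_mul]; ring

end B12
end Bert


namespace Bert
set_option linter.unusedSectionVars false
section B13
variable {k : Type} [Field k] {n : ℕ} {K : Type} [Field K] [Algebra k K] {κ : MvPolynomial (Fin (n+1)) k →ₐ[k] K} {d : ℕ} [IsAlgClosed k]
variable {ι : Type} [Fintype ι] [DecidableEq ι]

lemma common_den {v : Fin (n+1) → k} (hv : v ∈ Cone (RingHom.ker κ)) {z : ι → K} (hz : ∀ i, z i ∈ Ov κ v) :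
    ∃ (e : ℕ) (β : MvPolynomial (Fin (n+1)) k) (a : ι → MvPolynomial (Fin (n+1)) k), 1 ≤ e ∧ β.IsHomogeneous e ∧ eval v β ≠ 0 ∧
      ∀ i, (a i).IsHomogeneous e ∧ z i * κ β = κ (a i) := by
  have : ∀ i, ∃ e a s, MvPolynomial.IsHomogeneous a e ∧ MvPolynomial.IsHomogeneous s e ∧ eval v s ≠ 0 ∧ z i * κ s = κ a :=
    fun i => (Ov_mem hv).1 (hz i)
  choose e a s ha hs hsv h using this
  obtain ⟨i0, hi0⟩ := Function.ne_iff.1 hv.1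
  refine ⟨∑ i, e i + 1, (∏ i, s i) * X i0, fun i => (a i * ∏ j ∈ Finset.univ.erase i, s j) * X i0, by omega,
    (MvPolynomial.IsHomogeneous.prod _ _ _ fun i _ => hs i).mul (isHomogeneous_X k i0), ?_, fun i => ⟨?_, ?_⟩⟩
  · rw [map_mul, map_prod, eval_X]
    exact mul_ne_zero (Finset.prod_ne_zero_iff.2 fun i _ => hsv i) hi0
  · rw [← Finset.add_sum_erase Finset.univ e (Finset.mem_univ i)]
    exact ((ha i).mul (MvPolynomial.IsHomogeneous.prod _ _ _ fun i _ => hs i)).mul (isHomogeneous_X k i0)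
  · rw [← Finset.mul_prod_erase Finset.univ s (Finset.mem_univ i)]
    simp only [map_mul]
    rw [← h]; ring

lemma grad_pow_X (i0 : Fin (n+1)) (e : ℕ) (v : Fin (n+1) → k) :
    gradientAt (X i0 ^ e : MvPolynomial (Fin (n+1)) k) v = ((e : k) * v i0 ^ (e-1)) • (Pi.single i0 1 : Fin (n+1) → k) := by
  classical
  ext j
  by_cases h : i0 = j
  · simp [gradientAt, pderiv_pow, pderiv_X, Pi.single_apply, h]
  · simp [gradientAt, pderiv_pow, pderiv_X, Pi.single_apply, h, Ne.symm h]

lemma grad_X (i : Fin (n+1)) (v : Fin (n+1) → k) :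
    gradientAt (X i : MvPolynomial (Fin (n+1)) k) v = (Pi.single i 1 : Fin (n+1) → k) := by
  classical
  ext j
  simp [gradientAt, pderiv_X, Pi.single_apply, eq_comm]

lemma grads_top [CharZero k] {v : Fin (n+1) → k} (hv : v ≠ 0) {e : ℕ} (he : 1 ≤ e) (W : Submodule k (Fin (n+1) → k))
    (h : ∀ g : MvPolynomial (Fin (n+1)) k, g.IsHomogeneous e → gradientAt g v ∈ W) : W = ⊤ := by
  classical
  obtain ⟨i0, hi0⟩ := Function.ne_iff.1 hv
  have hi0 : v i0 ≠ 0 := hi0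
  have h0 : (Pi.single i0 1 : Fin (n+1) → k) ∈ W := by
    have h1 := h (X i0 ^ e) (by simpa using (isHomogeneous_X k i0).pow e)
    rw [grad_pow_X] at h1
    have hne : (e : k) * v i0 ^ (e-1) ≠ 0 := mul_ne_zero (by exact_mod_cast (by omega : e ≠ 0)) (pow_ne_zero _ hi0)
    have := W.smul_mem ((e : k) * v i0 ^ (e-1))⁻¹ h1
    rwa [smul_smul, inv_mul_cancel₀ hne, one_smul] at this
  have h1 : ∀ i, (Pi.single i 1 : Fin (n+1) → k) ∈ W := by
    intro i
    have h1 := h (X i * X i0 ^ (e - 1)) (by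
      have := (isHomogeneous_X k i).mul ((isHomogeneous_X k i0).pow (e-1))
      rwa [show 1 + 1 * (e - 1) = e by omega] at this)
    rw [grad_mul, grad_pow_X, grad_X] at h1
    simp only [map_pow, eval_X] at h1
    have hne := pow_ne_zero (e-1) hi0
    have h2 : (v i0 ^ (e-1)) • (Pi.single i 1 : Fin (n+1) → k) ∈ W := by
      exact (W.add_mem_iff_right (W.smul_mem _ (W.smul_mem _ h0))).1 h1
    have := W.smul_mem (v i0 ^ (e-1))⁻¹ h2
    rwa [smul_smul, inv_mul_cancel₀ hne, one_smul] at this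
  rw [eq_top_iff]
  intro u _
  rw [pi_eq_sum_univ' u]
  refine sum_mem fun i _ => W.smul_mem _ ?_
  convert h1 i using 1

lemma grad_sum (c : ι → k) (a : ι → MvPolynomial (Fin (n+1)) k) (v : Fin (n+1) → k) :
    gradientAt (∑ i, c i • a i) v = ∑ i, c i • gradientAt (a i) v := by
  ext j
  simp [gradientAt, smul_eval]

lemma hom_comb {a : ι → MvPolynomial (Fin (n+1)) k} {e : ℕ} (ha : ∀ i, (a i).IsHomogeneous e) (c : ι → k) :
    (∑ i, c i • a i).IsHomogeneous e := by
  refine MvPolynomial.IsHomogeneous.sum _ _ _ fun i _ => ?_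
  rw [smul_eq_C_mul]
  simpa using (isHomogeneous_C (Fin (n+1)) (c i)).mul (ha i)

lemma pres_comb {v : Fin (n+1) → k} {e : ℕ} {β : MvPolynomial (Fin (n+1)) k} {a : ι → MvPolynomial (Fin (n+1)) k} {w : ι → K} {τ : K} (hβ : β.IsHomogeneous e)
    (hβv : eval v β ≠ 0) (h : ∀ i, (a i).IsHomogeneous e ∧ w i / τ * κ β = κ (a i)) (c : ι → k) :
    Pres κ v ((∑ i, c i • w i) / τ) (∑ i, c i • a i) β := by
  refine ⟨⟨e, hom_comb (fun i => (h i).1) c, hβ⟩, hβv, ?_⟩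
  rw [Finset.sum_div, Finset.sum_mul, map_sum]
  refine Finset.sum_congr rfl fun i _ => ?_
  rw [map_smul, ← (h i).2, smul_div_assoc, smul_mul_assoc]

/-- local Bertini -/
theorem bert_loc [CharZero k] (G : Geo κ d) {A : PDt κ d →₀ ℤ} {v0 : Fin (n+1) → k} (hv0 : v0 ∈ Cone (RingHom.ker κ))
    {w : ι → K} (hw : ∀ i, w i ∈ Gam κ A) {τ : K} (hτ : Gen A v0 τ)
    (hJ : ∀ z ∈ Ov κ v0, ∃ c : ι → k, ev κ v0 ((∑ i, c i • w i) / τ) = ev κ v0 z ∧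
      dv κ v0 ((∑ i, c i • w i) / τ) = dv κ v0 z) :
    ∃ f : MvPolynomial (Fin (n+1)) k, eval v0 f ≠ 0 ∧ ∃ Φ : MvPolynomial ι k, Φ ≠ 0 ∧
      ∀ v ∈ Cone (RingHom.ker κ), eval v f ≠ 0 → ∀ c : ι → k, Bad A v (∑ i, c i • w i) → eval c Φ = 0 := by
  obtain ⟨e, β, a, he, hβ, hβv, ha⟩ := common_den hv0 (z := fun i => w i / τ) (fun i => div_Gen hv0 G (hw i) hτ)
  obtain ⟨-, f0, -, hf0v, hf0⟩ := Gen_open G hv0 hτ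
  obtain ⟨i0, hi0⟩ := Function.ne_iff.1 hv0.1
  have hi0 : v0 i0 ≠ 0 := hi0
  set N := gradSpan (RingHom.ker κ) v0 with hN
  have hspan : Submodule.span k (Set.range fun i => N.mkQ (gradientAt (a i) v0)) = ⊤ := by
    set W := (Submodule.span k (Set.range fun i => N.mkQ (gradientAt (a i) v0))).comap N.mkQ with hW
    have hWt : W = ⊤ := by
      apply grads_top hv0.1 he
      intro g hg
      have hPg : Pres κ v0 (κ g / κ β) g β := ⟨⟨e, hg, hβ⟩, hβv, div_mul_cancel₀ _ (kne hv0 hβv)⟩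
      obtain ⟨c, hc1, hc2⟩ := hJ _ (hPg.mem hv0)
      have hPc := pres_comb (κ := κ) hβ hβv ha c
      rw [hPc.dv hv0, hPg.dv hv0, hc1, Submodule.Quotient.eq, ← smul_sub] at hc2
      have h3 := N.smul_mem (eval v0 β) hc2
      rw [smul_smul, mul_inv_cancel₀ hβv, one_smul, sub_sub_sub_cancel_right] at h3
      have h4 : N.mkQ (gradientAt g v0) = N.mkQ (gradientAt (∑ i, c i • a i) v0) :=
        ((Submodule.Quotient.eq N).2 h3).symm
      rw [hW, Submodule.mem_comap]
      rw [h4, grad_sum, map_sum]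
      refine sum_mem fun i _ => ?_
      rw [map_smul]
      exact Submodule.smul_mem _ _ (Submodule.subset_span ⟨i, rfl⟩)
    rw [eq_top_iff]
    intro u _
    obtain ⟨u, rfl⟩ := N.mkQ_surjective u
    have : u ∈ W := by rw [hWt]; trivial
    exact this
  obtain ⟨κ₁, κ₂, _, _, _, _, h, σ, ε, hσ, hh, hc1, hc2, hdet⟩ := frame G hv0 a hspan
  set Mx : Matrix (κ₁ ⊕ κ₂) (κ₁ ⊕ κ₂) (MvPolynomial (Fin (n+1)) k) := Matrix.of fun r c => pderiv (ε r) (Sum.elim h (a ∘ σ) c) with hMx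
  have hdet' : eval v0 Mx.det ≠ 0 := by
    rw [RingHom.map_det]
    exact hdet
  obtain ⟨-, Φ, hΦ0, hΦ⟩ := core G a (fun i => (ha i).1) h hh hσ ε hc1 hc2 Mx (fun r c => rfl) i0
  refine ⟨β * f0 * X i0 * Mx.det, ?_, Φ, hΦ0, fun v hv hfv c hbad => ?_⟩
  · simp only [map_mul, eval_X]
    exact mul_ne_zero (mul_ne_zero (mul_ne_zero hβv hf0v) hi0) hdet'
  · simp only [map_mul, eval_X, mul_ne_zero_iff] at hfv
    obtain ⟨⟨⟨h1, h2⟩, h3⟩, h4⟩ := hfv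
    refine hΦ v hv h3 h4 c ?_
    have hwc : ∑ i, c i • w i ∈ Gam κ A := sum_mem fun i _ => Submodule.smul_mem _ _ (hw i)
    rw [Bad_iff G hv hwc (hf0 v hv h2)] at hbad
    have hPc := pres_comb (κ := κ) (v := v) hβ h1 ha c
    have h5 := hbad.2
    rw [hPc.dv hv, hbad.1, zero_smul, sub_zero, Submodule.Quotient.mk_eq_zero] at h5
    have h6 := Submodule.smul_mem _ (eval v β) h5
    rw [smul_smul, mul_inv_cancel₀ h1, one_smul, grad_sum] at h6
    exact h6

end B13
end Bert


namespace Bert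
set_option linter.unusedSectionVars false
section B14
variable {k : Type} [Field k] {n : ℕ} {K : Type} [Field K] [Algebra k K] {κ : MvPolynomial (Fin (n+1)) k →ₐ[k] K} {d : ℕ} [IsAlgClosed k]

/-- one-jets are attained by sections through the points -/
def Jet (A : PDt κ d →₀ ℤ) {q : ℕ} (P : Fin q → (Fin (n+1) → k)) (hP : ∀ s, P s ∈ Cone (RingHom.ker κ)) : Prop :=
  ∀ v ∈ Cone (RingHom.ker κ),
    ∃ w0 ∈ Gam κ A, Gen A v w0 ∧ ∀ z ∈ Ov κ v, ((∀ i, ¬ ∃ c : k, P i = c • v) ∨ ev κ v z = 0) →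
      ∃ w ∈ GamP A P hP, ev κ v (w / w0) = ev κ v z ∧ dv κ v (w / w0) = dv κ v z

lemma exists_dv_ne (G : Geo κ d) {v : Fin (n+1) → k} (hv : v ∈ Cone (RingHom.ker κ)) :
    ∃ z ∈ Ov κ v, ev κ v z = 0 ∧ dv κ v z ≠ 0 := by
  classical
  by_contra hcon
  push Not at hcon
  have hall : ∀ z ∈ Ov κ v, dv κ v z = 0 := by
    intro z hz
    have hc : algebraMap k K (ev κ v z) ∈ Ov κ v := Subalgebra.algebraMap_mem _ _
    have h1 := hcon (z - algebraMap k K (ev κ v z)) (sub_mem hz hc)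
      (by rw [ev_sub hv hz hc, ev_const hv, sub_self])
    have h2 : dv κ v z = dv κ v (z - algebraMap k K (ev κ v z) + algebraMap k K (ev κ v z)) := by rw [sub_add_cancel]
    rw [h2, dv_add hv (sub_mem hz hc) hc, h1, dv_const hv, add_zero]
  obtain ⟨i0, hi0⟩ := Function.ne_iff.1 hv.1
  have hi0 : v i0 ≠ 0 := hi0
  set N := gradSpan (RingHom.ker κ) v with hN
  have htop : N ⊔ Submodule.span k {(Pi.single i0 1 : Fin (n+1) → k)} = ⊤ := by
    rw [eq_top_iff]
    intro u _
    rw [pi_eq_sum_univ' u]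
    refine sum_mem fun i _ => Submodule.smul_mem _ _ ?_
    have hp : Pres κ v (κ (X i) / κ (X i0)) (X i) (X i0) :=
      ⟨⟨1, isHomogeneous_X k i, isHomogeneous_X k i0⟩, by simpa using hi0,
        div_mul_cancel₀ _ (kne hv (by simpa using hi0))⟩
    have h1 := hall _ (hp.mem hv)
    rw [hp.dv hv, Submodule.Quotient.mk_eq_zero, grad_X, grad_X, eval_X] at h1
    have h2 := N.smul_mem (v i0) h1
    rw [smul_smul, mul_inv_cancel₀ hi0, one_smul] at h2
    have h3 : (Pi.single i 1 : Fin (n+1) → k) ∈ N ⊔ Submodule.span k {(Pi.single i0 1 : Fin (n+1) → k)} := by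
      rw [← sub_add_cancel (Pi.single i 1 : Fin (n+1) → k) (ev κ v (κ (X i) / κ (X i0)) • Pi.single i0 1)]
      exact Submodule.add_mem_sup h2 (Submodule.smul_mem _ _ (Submodule.mem_span_singleton_self _))
    convert h3 using 1
  have h1 := Submodule.finrank_add_le_finrank_add_finrank N (Submodule.span k {(Pi.single i0 1 : Fin (n+1) → k)})
  rw [htop, finrank_top, Module.finrank_fin_fun] at h1
  have h2 := finrank_span_le_card (R := k) ({(Pi.single i0 1 : Fin (n+1) → k)} : Set (Fin (n+1) → k))
  rw [Set.toFinset_singleton, Finset.card_singleton] at h2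
  have h3 : Module.finrank k N + d = n := G.sm v hv
  have := G.two
  omega

lemma dv_sum {v : Fin (n+1) → k} (hv : v ∈ Cone (RingHom.ker κ)) {ι : Type} (s : Finset ι) {z : ι → K} (c : ι → k)
    (hz : ∀ i, z i ∈ Ov κ v) : dv κ v (∑ i ∈ s, c i • z i) = ∑ i ∈ s, c i • dv κ v (z i) := by
  have := map_sum (dvL hv) (fun i => c i • (⟨z i, hz i⟩ : Ov κ v)) s
  simp only [map_smul] at this
  have e : ((∑ i ∈ s, c i • (⟨z i, hz i⟩ : Ov κ v) : Ov κ v) : K) = ∑ i ∈ s, c i • z i := by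
    push_cast; rfl
  rw [← e]
  exact this

/-- global Bertini -/
theorem bertini [CharZero k] (G : Geo κ d) {A : PDt κ d →₀ ℤ} {q : ℕ} {P : Fin q → (Fin (n+1) → k)}
    {hP : ∀ s, P s ∈ Cone (RingHom.ker κ)} (hJ : Jet A P hP) {ι : Type} [Fintype ι] (w : ι → K)
    (hw : Submodule.span k (Set.range w) = GamP A P hP) :
    ∃ Φ : MvPolynomial ι k, Φ ≠ 0 ∧ ∀ c : ι → k, eval c Φ ≠ 0 → ∀ v ∈ Cone (RingHom.ker κ),
      ∃ a : k, a ≠ 0 ∧ ¬ Bad A (a • v) (∑ i, c i • w i) := by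
  classical
  have hwm : ∀ i, w i ∈ GamP A P hP := fun i => hw ▸ Submodule.subset_span ⟨i, rfl⟩
  have hwG : ∀ i, w i ∈ Gam κ A := fun i => (hwm i).1
  have hex : ∀ x ∈ GamP A P hP, ∃ c : ι → k, ∑ i, c i • w i = x := fun x hx => by
    rw [← hw] at hx
    exact (Submodule.mem_span_range_iff_exists_fun k).1 hx
  -- points
  have hpt : ∀ s, ∃ Φ : MvPolynomial ι k, Φ ≠ 0 ∧ ∀ c : ι → k, Bad A (P s) (∑ i, c i • w i) → eval c Φ = 0 := by
    intro s
    obtain ⟨w0, hw0, hg, hz⟩ := hJ (P s) (hP s)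
    obtain ⟨z, hzO, hz0, hzd⟩ := exists_dv_ne G (hP s)
    obtain ⟨x, hx, hx1, hx2⟩ := hz z hzO (Or.inr hz0)
    obtain ⟨c0, rfl⟩ := hex x hx
    obtain ⟨lam, hlam⟩ : ∃ lam : Module.Dual k ((Fin (n+1) → k) ⧸ gradSpan (RingHom.ker κ) (P s)), lam (dv κ (P s) z) ≠ 0 := by
      by_contra hc
      push Not at hc
      exact hzd ((Module.forall_dual_apply_eq_zero_iff k _).1 hc)
    have hval : ∀ c : ι → k, eval c (∑ i, C (lam (dv κ (P s) (w i / w0))) * X i) =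
        lam (dv κ (P s) ((∑ i, c i • w i) / w0)) := by
      intro c
      have e : (∑ i, c i • w i) / w0 = ∑ i, c i • (w i / w0) := by
        rw [Finset.sum_div]
        exact Finset.sum_congr rfl fun i _ => smul_div_assoc _ _ _
      rw [e, dv_sum (hP s) _ _ (fun i => div_Gen (hP s) G (hwG i) hg)]
      simp [mul_comm]
    refine ⟨∑ i, C (lam (dv κ (P s) (w i / w0))) * X i, ?_, fun c hc => ?_⟩
    · intro h0
      have := hval c0
      rw [h0, map_zero, hx2] at this
      exact hlam this.symm
    · rw [hval, ((Bad_iff G (hP s) (sum_mem fun i _ => Submodule.smul_mem _ _ (hwG i)) hg).1 hc).2, map_zero]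
  choose Φ1 hΦ1 hbΦone using hpt
  obtain ⟨T, hT, hT2⟩ := qc {v | v ∈ Cone (RingHom.ker κ) ∧ ∀ i, ¬ ∃ c : k, P i = c • v}
    (fun f : MvPolynomial (Fin (n+1)) k => ∃ Φ : MvPolynomial ι k, Φ ≠ 0 ∧
      ∀ v ∈ Cone (RingHom.ker κ), eval v f ≠ 0 → ∀ c : ι → k, Bad A v (∑ i, c i • w i) → eval c Φ = 0) (by
      rintro v ⟨hv, hvP⟩
      obtain ⟨w0, hw0, hg, hz⟩ := hJ v hv
      obtain ⟨f, hf, h⟩ := bert_loc G hv hwG hg (fun z hzO => by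
        obtain ⟨x, hx, hx1⟩ := hz z hzO (Or.inl hvP)
        obtain ⟨c, rfl⟩ := hex x hx
        exact ⟨c, hx1⟩)
      exact ⟨f, h, hf⟩)
  choose! Φ2 hΦ2 hbΦtwo using hT
  refine ⟨(∏ s, Φ1 s) * ∏ f ∈ T, Φ2 f, mul_ne_zero (Finset.prod_ne_zero_iff.2 fun s _ => hΦ1 s)
    (Finset.prod_ne_zero_iff.2 fun f hf => hΦ2 f hf), fun c hc v hv => ?_⟩
  rw [map_mul, map_prod, map_prod, mul_ne_zero_iff, Finset.prod_ne_zero_iff, Finset.prod_ne_zero_iff] at hc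
  by_cases hvP : ∃ i, ∃ c : k, P i = c • v
  · obtain ⟨i, a, ha⟩ := hvP
    refine ⟨a, ?_, fun hb => ?_⟩
    · rintro rfl
      exact (hP i).1 (by rw [ha, zero_smul])
    · rw [← ha] at hb
      exact hc.1 i (Finset.mem_univ _) (hbΦone i c hb)
  · push Not at hvP
    obtain ⟨f, hf, hfv⟩ := hT2 v ⟨hv, fun i => by push Not; exact hvP i⟩
    refine ⟨1, one_ne_zero, fun hb => ?_⟩
    rw [one_smul] at hb
    exact hc.2 f hf (hbΦtwo f hf v hv hfv c hb)

end B14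
end Bert


namespace Bert
set_option linter.unusedSectionVars false
section B15
variable {k : Type} [Field k] {n : ℕ} {K : Type} [Field K] [Algebra k K] {κ : MvPolynomial (Fin (n+1)) k →ₐ[k] K} {d : ℕ} [IsAlgClosed k]
variable {L : Type} [Field L] [Algebra k L] {μ : MvPolynomial (Fin (n+1)) k →ₐ[k] L} {Q : PDt κ d} {ρ : K →ₗ[k] L}

/-- a linear extension of the residue map at a prime divisor -/
structure IsRes (Q : PDt κ d) (μ : MvPolynomial (Fin (n+1)) k →ₐ[k] L) (ρ : K →ₗ[k] L) : Prop where
  ker : RingHom.ker μ = Q.1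
  val : ∀ z e a s, a.IsHomogeneous e → s.IsHomogeneous e → s ∉ Q.1 → z * κ s = κ a → ρ z = μ a / μ s

lemma mu_ne (hμ : RingHom.ker μ = Q.1) {s : MvPolynomial (Fin (n+1)) k} (hs : s ∉ Q.1) : μ s ≠ 0 := fun h => hs (hμ ▸ h)

lemma res_wd (hμ : RingHom.ker μ = Q.1) {z : K} {a s a' s' : MvPolynomial (Fin (n+1)) k} (hs : s ∉ Q.1) (hs' : s' ∉ Q.1)
    (h : z * κ s = κ a) (h' : z * κ s' = κ a') : μ a / μ s = μ a' / μ s' := by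
  have h1 : a * s' - a' * s ∈ RingHom.ker μ := by
    rw [hμ]
    apply Q.2.le
    rw [RingHom.mem_ker, map_sub, map_mul, map_mul]
    rw [← h, ← h']; ring
  rw [RingHom.mem_ker, map_sub, map_mul, map_mul, sub_eq_zero] at h1
  rw [div_eq_div_iff (mu_ne hμ hs) (mu_ne hμ hs'), h1]

theorem exists_res (hμ : RingHom.ker μ = Q.1) : ∃ ρ : K →ₗ[k] L, IsRes Q μ ρ := by
  have hp : ∀ z : OQ Q, ∃ e a s, a.IsHomogeneous e ∧ s.IsHomogeneous e ∧ s ∉ Q.1 ∧ z.1 * κ s = κ a :=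
    fun z => OQ_mem.1 z.2
  choose e a s ha hs hsQ hz using hp
  have key : ∀ (z : OQ Q) (a' s' : MvPolynomial (Fin (n+1)) k), s' ∉ Q.1 → z.1 * κ s' = κ a' → μ (a z) / μ (s z) = μ a' / μ s' :=
    fun z a' s' hs' h => res_wd hμ (hsQ z) hs' (hz z) h
  let f : Subalgebra.toSubmodule (OQ Q) →ₗ[k] L :=
    { toFun := fun z => μ (a z) / μ (s z)
      map_add' := fun z w => by
        rw [key (z + w) (a z * s w + a w * s z) (s z * s w) (fun h => (Q.2.pr.mem_or_mem h).elim (hsQ z) (hsQ w)) ?_]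
        · rw [map_add, map_mul, map_mul, map_mul]
          have h1 := mu_ne hμ (hsQ z)
          have h2 := mu_ne hμ (hsQ w)
          field_simp
        · rw [map_add, map_mul, map_mul, map_mul, ← hz z, ← hz w]
          show ((z : K) + (w : K)) * _ = _
          ring
      map_smul' := fun c z => by
        rw [key (c • z) (c • a z) (s z) (hsQ z) ?_]
        · rw [map_smul, RingHom.id_apply, smul_div_assoc]
        · rw [map_smul, ← hz z]
          show (c • (z : K)) * _ = _
          rw [smul_mul_assoc] }
  obtain ⟨ρ, hρ⟩ := LinearMap.exists_extend f
  refine ⟨ρ, hμ, fun z e' a' s' ha' hs' hsQ' h => ?_⟩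
  have hzm : z ∈ OQ Q := OQ_mem.2 ⟨e', a', s', ha', hs', hsQ', h⟩
  have := LinearMap.congr_fun hρ ⟨z, hzm⟩
  have h2 : ρ z = f ⟨z, hzm⟩ := this
  rw [h2]
  exact key ⟨z, hzm⟩ a' s' hsQ' h

lemma IsRes.mul (h : IsRes Q μ ρ) {z w : K} (hz : z ∈ OQ Q) (hw : w ∈ OQ Q) : ρ (z * w) = ρ z * ρ w := by
  obtain ⟨e, a, s, ha, hs, hsQ, h1⟩ := OQ_mem.1 hz
  obtain ⟨e', a', s', ha', hs', hsQ', h1'⟩ := OQ_mem.1 hw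
  rw [h.val z e a s ha hs hsQ h1, h.val w e' a' s' ha' hs' hsQ' h1',
    h.val (z * w) (e + e') (a * a') (s * s') (ha.mul ha') (hs.mul hs')
      (fun hh => (Q.2.pr.mem_or_mem hh).elim hsQ hsQ') (by rw [map_mul, map_mul, ← h1, ← h1']; ring),
    map_mul, map_mul]
  have h2 := mu_ne h.ker hsQ
  have h3 := mu_ne h.ker hsQ'
  field_simp

lemma IsRes.const (h : IsRes Q μ ρ) (c : k) : ρ (algebraMap k K c) = algebraMap k L c := by
  rw [h.val _ 0 (C c) 1 (isHomogeneous_C _ _) (isHomogeneous_one _ _)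
    (fun hh => Q.2.pr.ne_top ((Ideal.eq_top_iff_one _).2 hh)) (by
      rw [map_one, mul_one]; exact (κ.commutes c).symm), map_one, div_one]
  exact μ.commutes c

lemma IsRes.one (h : IsRes Q μ ρ) : ρ 1 = 1 := by
  have := h.const 1
  rwa [(algebraMap k K).map_one, (algebraMap k L).map_one] at this

lemma IsRes.pow (h : IsRes Q μ ρ) {z : K} (hz : z ∈ OQ Q) (r : ℕ) : ρ (z ^ r) = ρ z ^ r := by
  induction r with
  | zero => rw [pow_zero, pow_zero, h.one]
  | succ r ih => rw [pow_succ, pow_succ, h.mul (pow_mem hz r) hz, ih]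

/-- residue as algebra map -/
noncomputable def IsRes.alg (h : IsRes Q μ ρ) : OQ Q →ₐ[k] L where
  toFun z := ρ z.1
  map_one' := h.one
  map_mul' z w := h.mul z.2 w.2
  map_zero' := map_zero ρ
  map_add' z w := map_add ρ _ _
  commutes' c := h.const c

lemma IsRes.aeval (h : IsRes Q μ ρ) {ι : Type} {z : ι → K} (hz : ∀ i, z i ∈ OQ Q) (p : MvPolynomial ι k) :
    MvPolynomial.aeval z p ∈ OQ Q ∧ ρ (MvPolynomial.aeval z p) = MvPolynomial.aeval (fun i => ρ (z i)) p := by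
  have e : ((MvPolynomial.aeval (fun i => (⟨z i, hz i⟩ : OQ Q)) p : OQ Q) : K) = MvPolynomial.aeval z p := by
    have := comp_aeval_apply (fun i => (⟨z i, hz i⟩ : OQ Q)) (OQ Q).val p
    exact this
  have e2 := comp_aeval_apply (fun i => (⟨z i, hz i⟩ : OQ Q)) h.alg p
  rw [← e]
  exact ⟨Subtype.property _, e2⟩

lemma IsRes.isU_iff (h : IsRes Q μ ρ) {z : K} (hz : z ∈ OQ Q) : IsU (OQ Q) z ↔ ρ z ≠ 0 := by
  constructor
  · rintro ⟨h0, h1, h2⟩ h3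
    have := h.mul h1 h2
    rw [mul_inv_cancel₀ h0, h.one, h3, zero_mul] at this
    exact one_ne_zero this
  · intro hne
    obtain ⟨e, a, s, ha, hs, hsQ, h1⟩ := OQ_mem.1 hz
    rw [h.val z e a s ha hs hsQ h1] at hne
    have haQ : a ∉ Q.1 := fun hh => hne (by
      rw [← h.ker] at hh
      rw [RingHom.mem_ker.1 hh, zero_div])
    have := isU_fracQ ha hs haQ hsQ
    rwa [← h1, mul_div_assoc, div_self (kne' Q hsQ), mul_one] at this

lemma IsRes.inv (h : IsRes Q μ ρ) {z : K} (hz : IsU (OQ Q) z) : ρ z⁻¹ = (ρ z)⁻¹ := by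
  have := h.mul hz.2.1 hz.2.2
  rw [mul_inv_cancel₀ hz.1, h.one] at this
  exact eq_inv_of_mul_eq_one_right this.symm

lemma IsRes.div (h : IsRes Q μ ρ) {z w : K} (hz : z ∈ OQ Q) (hw : IsU (OQ Q) w) : ρ (z / w) = ρ z / ρ w := by
  rw [div_eq_mul_inv, h.mul hz hw.2.2, h.inv hw, div_eq_mul_inv]

lemma IsRes.cone (h : IsRes Q μ ρ) {v : Fin (n+1) → k} : v ∈ Cone (RingHom.ker μ) ↔ v ∈ Cone Q.1 := by
  rw [h.ker]

lemma IsRes.Ov (h : IsRes Q μ ρ) {v : Fin (n+1) → k} (hv : v ∈ Cone Q.1) {z : K} (hz : z ∈ Bert.Ov κ v) :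
    ρ z ∈ Bert.Ov μ v := by
  obtain ⟨e, a, s, ha, hs, hsv, h1⟩ := (Ov_mem (Cone.mono Q.2.le hv)).1 hz
  have hsQ : s ∉ Q.1 := fun hh => hsv (hv.2 s hh)
  rw [h.val z e a s ha hs hsQ h1]
  exact (Ov_mem (h.cone.2 hv)).2 ⟨e, a, s, ha, hs, hsv, div_mul_cancel₀ _ (mu_ne h.ker hsQ)⟩

lemma IsRes.ord (G : Geo κ d) (h : IsRes Q μ ρ) {z : K} (hz : z ∈ K0 κ) (h0 : z ≠ 0) (hzQ : z ∈ OQ Q) :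
    ρ z = 0 ↔ 1 ≤ Bert.ord Q z := by
  have h1 := (ord_nonneg_iff G Q hz h0).2 hzQ
  have h2 := ord_zero_iff G Q hz h0
  rw [h.isU_iff hzQ] at h2
  constructor
  · intro h3
    by_contra h4
    exact (h2.1 (by omega)) h3
  · intro h3
    by_contra h4
    have := h2.2 h4
    omega

lemma IsRes.mu_X (G : Geo κ d) (h : IsRes Q μ ρ) : ∃ i, μ (X i) ≠ 0 := by
  obtain ⟨i, hi⟩ := PDt.X_notMem G Q
  exact ⟨i, mu_ne h.ker hi⟩

lemma td_small {μ : MvPolynomial (Fin (n+1)) k →ₐ[k] L} {i0 : Fin (n+1)} (h : ∀ i, ∃ c : k, μ (X i) = algebraMap k L c * μ (X i0)) :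
    td k (MvPolynomial (Fin (n+1)) k ⧸ RingHom.ker μ) ≤ 1 := by
  choose c hc using h
  have h1 := td_mvPoly (k := k) 1
  let f : MvPolynomial (Fin 1) k →ₐ[k] (MvPolynomial (Fin (n+1)) k ⧸ RingHom.ker μ) :=
    MvPolynomial.aeval fun _ => Ideal.Quotient.mkₐ k _ (X i0)
  have hf : Function.Surjective f := by
    intro x
    obtain ⟨p, rfl⟩ := Ideal.Quotient.mkₐ_surjective k _ x
    refine ⟨MvPolynomial.aeval (fun i => C (c i) * X 0) p, ?_⟩
    have : f.comp (MvPolynomial.aeval (fun i => C (c i) * X 0)) = Ideal.Quotient.mkₐ k (RingHom.ker μ) := by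
      apply MvPolynomial.algHom_ext
      intro i
      rw [AlgHom.comp_apply, aeval_X, map_mul]
      have h2 : f (C (c i)) = Ideal.Quotient.mkₐ k (RingHom.ker μ) (C (c i)) :=
        (f.commutes (c i)).trans ((Ideal.Quotient.mkₐ k (RingHom.ker μ)).commutes (c i)).symm
      have h3 : f (X 0) = Ideal.Quotient.mkₐ k (RingHom.ker μ) (X i0) := aeval_X _ _
      rw [h2, h3, ← map_mul]
      refine (Ideal.Quotient.mk_eq_mk_iff_sub_mem _ _).2 ?_
      rw [RingHom.mem_ker, map_sub, map_mul, hc i, sub_eq_zero]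
      congr 1
      exact μ.commutes (c i)
    exact AlgHom.congr_fun this p
  have := td_le_of_surjective f hf
  omega

end B15
end Bert


namespace Bert
set_option linter.unusedSectionVars false
section B16
variable {k : Type} [Field k] {n : ℕ} {K : Type} [Field K] [Algebra k K] {κ : MvPolynomial (Fin (n+1)) k →ₐ[k] K} {d : ℕ} [IsAlgClosed k]
variable {L : Type} [Field L] [Algebra k L] {μ : MvPolynomial (Fin (n+1)) k →ₐ[k] L} {Q : PDt κ d} {ρ : K →ₗ[k] L}
variable {ι : Type} {E : PDt κ d →₀ ℤ} {s : ι → K} {i0 : ι}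

/-- sections of a reduced divisor with disjoint components -/
structure Sec (E : PDt κ d →₀ ℤ) (s : ι → K) : Prop where
  mem : ∀ i, s i ∈ Gam κ E
  emb : ∀ v ∈ Cone (RingHom.ker κ), EmbAt E s v
  one : ∀ Q, E Q = 0 ∨ E Q = 1
  dis : ∀ (Q Q' : PDt κ d) (v : Fin (n+1) → k), E Q = 1 → E Q' = 1 → v ∈ Cone Q.1 → v ∈ Cone Q'.1 → Q = Q'

/-- a component together with its residue map and a local equation -/
structure SQ (E : PDt κ d →₀ ℤ) (s : ι → K) (Q : PDt κ d) (i0 : ι) (μ : MvPolynomial (Fin (n+1)) k →ₐ[k] L) (ρ : K →ₗ[k] L) : Prop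
    extends Sec E s where
  res : IsRes Q μ ρ
  hQ : E Q = 1
  h0 : s i0 ≠ 0
  ho : ord Q (s i0) = -1

/-- leading coefficient -/
noncomputable def lc (ρ : K →ₗ[k] L) (s0 : K) (j : ℕ) : K →ₗ[k] L := ρ ∘ₗ LinearMap.mulRight k (s0 ^ j)⁻¹

lemma lc_apply (ρ : K →ₗ[k] L) (s0 : K) (j : ℕ) (z : K) : lc ρ s0 j z = ρ (z / s0 ^ j) := by
  rw [div_eq_mul_inv]; rfl

/-- restricted sections -/
def uu (ρ : K →ₗ[k] L) (s : ι → K) (i0 : ι) : ι → L := fun i => ρ (s i / s i0)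

lemma SQ.k0 (S : SQ E s Q i0 μ ρ) : s i0 ∈ K0 κ := (S.mem i0).1

lemma SQ.ord_div_pow (G : Geo κ d) (S : SQ E s Q i0 μ ρ) {z : K} (hz : z ∈ K0 κ) (h0 : z ≠ 0) (j : ℕ) :
    ord Q (z / s i0 ^ j) = ord Q z + j := by
  rw [ord_div G Q hz h0 (pow_mem S.k0 j) (pow_ne_zero _ S.h0), ord_pow G Q S.k0 S.h0, S.ho]; ring

lemma SQ.mem_OQ (G : Geo κ d) (S : SQ E s Q i0 μ ρ) {z : K} (hz : z ∈ K0 κ) {j : ℕ} (h : z ≠ 0 → - (j : ℤ) ≤ ord Q z) :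
    z / s i0 ^ j ∈ OQ Q := by
  by_cases h0 : z = 0
  · rw [h0, zero_div]; exact zero_mem _
  · rw [← ord_nonneg_iff G Q (K0_div hz (pow_mem S.k0 j)) (div_ne_zero h0 (pow_ne_zero _ S.h0)), S.ord_div_pow G hz h0]
    have := h h0
    omega

lemma SQ.Gam_OQ (G : Geo κ d) (S : SQ E s Q i0 μ ρ) {B : PDt κ d →₀ ℤ} {z : K} (hz : z ∈ Gam κ B) {j : ℕ} (h : B Q ≤ j) :
    z / s i0 ^ j ∈ OQ Q :=
  S.mem_OQ G hz.1 fun h0 => by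
    have := (mem_Gam_iff G hz.1 h0).1 hz Q
    omega

lemma SQ.isU (G : Geo κ d) (S : SQ E s Q i0 μ ρ) {v : Fin (n+1) → k} (hv : v ∈ Cone Q.1) {N : ℕ} {z : K}
    (h : Gen (N • E) v z) : IsU (OQ Q) (z / s i0 ^ N) := by
  have hK := h.K0 G
  rw [← ord_zero_iff G Q (K0_div hK (pow_mem S.k0 N)) (div_ne_zero h.ne (pow_ne_zero _ S.h0)), S.ord_div_pow G hK h.ne,
    (Gen_iff G (Cone.mono Q.2.le hv) hK h.ne).1 h Q hv, Finsupp.smul_apply, S.hQ]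
  simp

lemma SQ.isU1 (G : Geo κ d) (S : SQ E s Q i0 μ ρ) {v : Fin (n+1) → k} (hv : v ∈ Cone Q.1) {z : K}
    (h : Gen E v z) : IsU (OQ Q) (z / s i0) := by
  have := S.isU G hv (N := 1) (z := z) (by rwa [one_smul])
  rwa [pow_one] at this

lemma SQ.s_OQ (G : Geo κ d) (S : SQ E s Q i0 μ ρ) (i : ι) : s i / s i0 ∈ OQ Q := by
  have := S.Gam_OQ G (S.mem i) (j := 1) (by rw [S.hQ]; simp)
  rwa [pow_one] at this

lemma SQ.u_aeval (G : Geo κ d) (S : SQ E s Q i0 μ ρ) {F : MvPolynomial ι k} {e : ℕ} (hF : F.IsHomogeneous e) :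
    aeval s F / s i0 ^ e ∈ OQ Q ∧ ρ (aeval s F / s i0 ^ e) = aeval (uu ρ s i0) F := by
  rw [← aeval_hom_div F hF s (s i0) S.h0]
  exact S.res.aeval (fun i => S.s_OQ G i) F

lemma SQ.u_ne (G : Geo κ d) (S : SQ E s Q i0 μ ρ) {v : Fin (n+1) → k} (hv : v ∈ Cone Q.1) {i : ι}
    (h : Gen E v (s i)) : uu ρ s i0 i ≠ 0 :=
  (S.res.isU_iff (S.s_OQ G i)).1 (S.isU1 G hv h)

/-- sections on the component -/
def Hs (E : PDt κ d →₀ ℤ) (s : ι → K) (Q : PDt κ d) (i0 : ι) (μ : MvPolynomial (Fin (n+1)) k →ₐ[k] L) (ρ : K →ₗ[k] L) (j : ℕ) (ξ : L) : Prop :=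
  ∀ v ∈ Cone Q.1, ∀ i, Gen E v (s i) → ξ / uu ρ s i0 i ^ j ∈ Ov μ v

/-- leading coefficients of sections vanishing on the other components -/
noncomputable def Lf (E : PDt κ d →₀ ℤ) (s : ι → K) (Q : PDt κ d) (i0 : ι) (ρ : K →ₗ[k] L) (j : ℕ) : Submodule k L :=
  (Gam κ (j • E - E + Finsupp.single Q 1)).map (lc ρ (s i0) j)

lemma SQ.Lf_mul (G : Geo κ d) (S : SQ E s Q i0 μ ρ) {F : MvPolynomial ι k} {e j : ℕ} (hF : F.IsHomogeneous e) {ξ : L}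
    (h : ξ ∈ Lf E s Q i0 ρ j) : aeval (uu ρ s i0) F * ξ ∈ Lf E s Q i0 ρ (e + j) := by
  obtain ⟨w, hw, rfl⟩ := h
  have hw : w ∈ Gam κ (j • E - E + Finsupp.single Q 1) := hw
  refine ⟨aeval s F * w, ?_, ?_⟩
  · have := Gam_mul G (Gam_form G S.mem hF) hw
    have e1 : (e + j) • E - E + Finsupp.single Q 1 = e • E + (j • E - E + Finsupp.single Q 1) := by rw [add_smul]; abel
    show _ ∈ Gam κ _
    rw [e1]; exact this
  · rw [lc_apply, lc_apply, pow_add, mul_div_mul_comm, S.res.mul (S.u_aeval G hF).1 (S.Gam_OQ G hw ?_), (S.u_aeval G hF).2]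
    simp [S.hQ]

lemma SQ.local_lift (G : Geo κ d) (S : SQ E s Q i0 μ ρ) {j : ℕ} {ξ : L} (hξ : Hs E s Q i0 μ ρ j ξ)
    {v : Fin (n+1) → k} (hv : v ∈ Cone Q.1) :
    ∃ (N : ℕ) (T : MvPolynomial ι k), T.IsHomogeneous N ∧ Gen (N • E) v (aeval s T) ∧
      aeval (uu ρ s i0) T * ξ ∈ Lf E s Q i0 ρ (N + j) := by
  classical
  have hvk := Cone.mono Q.2.le hv
  have hvμ := S.res.cone.2 hv
  obtain ⟨⟨i, hi⟩, -⟩ := S.emb v hvk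
  obtain ⟨e, a, b, ha, hb, hbv, hab⟩ := (Ov_mem hvμ).1 (hξ v hv i hi)
  obtain ⟨e', g, hg, hgv, hgQ, -⟩ := exists_killer G (E.support.erase Q) hvk (fun Q' hQ' hc => by
    rw [Finset.mem_erase, Finsupp.mem_support_iff] at hQ'
    exact hQ'.1 (S.dis Q' Q v ((S.one Q').resolve_left hQ'.2) S.hQ hc hv)) 1
  obtain ⟨r, p, θ, hu⟩ := (S.emb v hvk).use G hvk
  have hbg := hb.mul hg
  have hag := ha.mul hg
  have hbQ : b ∉ Q.1 := fun hh => hbv (hv.2 b hh)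
  have hTd := hu.deg hbg
  have hwd := hu.deg hag
  have hrel := hu.rel _ _ hbg
  have hrel' := hu.rel _ _ hag
  have hui := S.u_ne G hv hi
  have hdiv : κ a / κ b ∈ OQ Q := OQ_mem.2 ⟨e, a, b, ha, hb, hbQ, div_mul_cancel₀ _ (kne' Q hbQ)⟩
  refine ⟨r * (e + e'), aeval p (b * g), hTd, ?_, s i ^ j * aeval s (aeval p (a * g)), ?_, ?_⟩
  · rw [hrel]
    exact hu.gen _ _ hbg (by rw [map_mul]; exact mul_ne_zero hbv hgv)
  · show _ ∈ Gam κ _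
    have hm : s i ^ j * aeval s (aeval p (a * g)) ∈ Gam κ (j • E + (r * (e + e')) • E) :=
      Gam_mul G (Gam_pow G (S.mem i) j) (Gam_form G S.mem hwd)
    by_cases h0 : s i ^ j * aeval s (aeval p (a * g)) = 0
    · rw [h0]; exact zero_mem _
    rw [mem_Gam_iff G hm.1 h0]
    have h1 := (mem_Gam_iff G hm.1 h0).1 hm
    intro Q'
    have h2 := h1 Q'
    simp only [Finsupp.add_apply, Finsupp.sub_apply, Finsupp.smul_apply, smul_eq_mul, nsmul_eq_mul] at h2 ⊢
    by_cases hQQ : Q' = Q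
    · subst hQQ
      rw [Finsupp.single_eq_same]
      rw [S.hQ] at h2 ⊢
      push_cast at h2 ⊢
      linarith
    · rw [Finsupp.single_eq_of_ne hQQ]
      rcases S.one Q' with hE | hE
      · rw [hE] at h2 ⊢
        linarith
      · have hgQ' : g ∈ Q'.1 := hgQ one_pos Q' (by
          rw [Finset.mem_erase, Finsupp.mem_support_iff, hE]; exact ⟨hQQ, one_ne_zero⟩)
        obtain ⟨l, hl⟩ := PDt.X_notMem G Q'
        have hw0 := right_ne_zero_of_mul h0
        rw [hrel'] at hw0
        have hag0 : κ (a * g) ≠ 0 := right_ne_zero_of_mul hw0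
        have h3 := hu.ord G S.mem hag hag0 Q' hl
        have h4 := ord_form_pos G Q' hag (x := X l ^ (e + e')) (by simpa using (isHomogeneous_X k l).pow (e + e')) hag0
          (fun hh => hl (Q'.2.pr.mem_of_pow_mem _ hh)) (Ideal.mul_mem_left _ _ hgQ')
        have hs0 : s i ≠ 0 := hi.ne
        have hwG := Gam_form G S.mem hwd
        have h5 := (mem_Gam_iff G (Gam_pow G (S.mem i) j).1 (pow_ne_zero j hs0)).1 (Gam_pow G (S.mem i) j) Q'
        rw [ord_mul G Q' (Gam_pow G (S.mem i) j).1 (pow_ne_zero j hs0) hwG.1 (right_ne_zero_of_mul h0)]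
        rw [← hrel'] at h3
        simp only [Finsupp.smul_apply, smul_eq_mul, nsmul_eq_mul, hE] at h3 h5 ⊢
        push_cast at h3 h5 ⊢
        linarith
  · have e1 : s i ^ j * aeval s (aeval p (a * g)) / s i0 ^ (r * (e + e') + j) =
        (s i / s i0) ^ j * ((aeval s (aeval p (b * g)) / s i0 ^ (r * (e + e'))) * (κ a / κ b)) := by
      have hb0 := kne' Q hbQ
      have h00 := S.h0
      rw [hrel, hrel', div_pow, map_mul, map_mul, div_mul_div_comm, div_mul_div_comm,
        div_eq_div_iff (pow_ne_zero _ h00) (mul_ne_zero (pow_ne_zero _ h00) (mul_ne_zero (pow_ne_zero _ h00) hb0)),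
        pow_add (s i0)]
      ring
    rw [lc_apply, e1, S.res.mul (pow_mem (S.s_OQ G i) j) (mul_mem (S.u_aeval G hTd).1 hdiv), S.res.pow (S.s_OQ G i),
      S.res.mul (S.u_aeval G hTd).1 hdiv, (S.u_aeval G hTd).2,
      S.res.val _ e a b ha hb hbQ (div_mul_cancel₀ _ (kne' Q hbQ))]
    rw [div_mul_eq_mul_div, div_eq_iff (pow_ne_zero _ hui)] at hab
    have h6 := mu_ne S.res.ker hbQ
    show uu ρ s i0 i ^ j * _ = _
    have h7 : μ a / μ b * uu ρ s i0 i ^ j = ξ := by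
      rw [div_mul_eq_mul_div, ← hab, mul_div_assoc, div_self h6, mul_one]
    rw [← h7]; ring

lemma SQ.local_lift_fin (G : Geo κ d) (S : SQ E s Q i0 μ ρ) {v : Fin (n+1) → k} (hv : v ∈ Cone Q.1)
    (Y : Finset (ℕ × L)) (hY : ∀ y ∈ Y, Hs E s Q i0 μ ρ y.1 y.2) :
    ∃ (N : ℕ) (T : MvPolynomial ι k), N ≠ 0 ∧ T.IsHomogeneous N ∧ Gen (N • E) v (aeval s T) ∧
      ∀ y ∈ Y, aeval (uu ρ s i0) T * y.2 ∈ Lf E s Q i0 ρ (N + y.1) := by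
  classical
  induction Y using Finset.induction_on with
  | empty =>
    obtain ⟨⟨i, hi⟩, -⟩ := S.emb v (Cone.mono Q.2.le hv)
    exact ⟨1, X i, one_ne_zero, isHomogeneous_X _ _, by rwa [one_smul, aeval_X], by simp⟩
  | insert y Y hy ih =>
    obtain ⟨N, T, hN, hT, hg, h⟩ := ih fun y hy => hY y (Finset.mem_insert_of_mem hy)
    obtain ⟨N', T', hT', hg', h'⟩ := S.local_lift G (hY y (Finset.mem_insert_self _ _)) hv
    refine ⟨N + N', T * T', by omega, hT.mul hT', ?_, fun x hx => ?_⟩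
    · rw [map_mul, add_smul]; exact Gen_mul G hg hg'
    · rw [map_mul]
      rcases Finset.mem_insert.1 hx with rfl | hx
      · rw [mul_assoc, add_assoc]
        exact S.Lf_mul G hT h'
      · rw [mul_comm (aeval (uu ρ s i0) T), mul_assoc, add_comm N, add_assoc]
        exact S.Lf_mul G hT' (h x hx)

end B16
end Bert


namespace Bert
set_option linter.unusedSectionVars false
section B17
variable {k : Type} [Field k] {n : ℕ} {K : Type} [Field K] [Algebra k K] {κ : MvPolynomial (Fin (n+1)) k →ₐ[k] K} {d : ℕ} [IsAlgClosed k]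
variable {L : Type} [Field L] [Algebra k L] {μ : MvPolynomial (Fin (n+1)) k →ₐ[k] L} {Q : PDt κ d} {ρ : K →ₗ[k] L}
variable {ι : Type} {E : PDt κ d →₀ ℤ} {s : ι → K} {i0 : ι}

lemma SQ.res_form (G : Geo κ d) (S : SQ E s Q i0 μ ρ) {v : Fin (n+1) → k} {r : ℕ} {p : Fin (n+1) → MvPolynomial ι k} {θ : K}
    (hu : EmbUse E s v r p θ) {e : ℕ} {a b : MvPolynomial (Fin (n+1)) k} (ha : a.IsHomogeneous e) (hb : b.IsHomogeneous e) (hbQ : b ∉ Q.1) :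
    aeval (uu ρ s i0) (aeval p a) * μ b = aeval (uu ρ s i0) (aeval p b) * μ a := by
  have hb0 := kne' Q hbQ
  have hdiv : κ a / κ b ∈ OQ Q := OQ_mem.2 ⟨e, a, b, ha, hb, hbQ, div_mul_cancel₀ _ hb0⟩
  have hA := S.u_aeval G (hu.deg ha)
  have hB := S.u_aeval G (hu.deg hb)
  have e1 : aeval s (aeval p a) / s i0 ^ (r * e) = aeval s (aeval p b) / s i0 ^ (r * e) * (κ a / κ b) := by
    rw [hu.rel e a ha, hu.rel e b hb]
    field_simp
  have h := hA.2
  rw [e1, S.res.mul hB.1 hdiv, hB.2, S.res.val _ e a b ha hb hbQ (div_mul_cancel₀ _ hb0)] at h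
  rw [← h]
  have := mu_ne S.res.ker hbQ
  field_simp

lemma SQ.gen_ne (G : Geo κ d) (S : SQ E s Q i0 μ ρ) {v : Fin (n+1) → k} (hv : v ∈ Cone Q.1) {N : ℕ} {T : MvPolynomial ι k}
    (hT : T.IsHomogeneous N) (h : Gen (N • E) v (aeval s T)) : aeval (uu ρ s i0) T ≠ 0 := by
  rw [← (S.u_aeval G hT).2]
  exact (S.res.isU_iff (S.u_aeval G hT).1).1 (S.isU G hv h)

lemma SQ.gen_div (G : Geo κ d) (S : SQ E s Q i0 μ ρ) {v : Fin (n+1) → k} (hv : v ∈ Cone Q.1) {N : ℕ} {T : MvPolynomial ι k}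
    (hT : T.IsHomogeneous N) (h : Gen (N • E) v (aeval s T)) (i : ι) :
    uu ρ s i0 i ^ N / aeval (uu ρ s i0) T ∈ Ov μ v := by
  have hvk := Cone.mono Q.2.le hv
  have hO := div_Gen hvk G (Gam_pow G (S.mem i) N) h
  have hU := S.isU G hv h
  have h1 : ρ (s i ^ N / aeval s T) * aeval (uu ρ s i0) T = uu ρ s i0 i ^ N := by
    rw [← (S.u_aeval G hT).2, ← S.res.mul (Ov_le_OQ hv hO) (S.u_aeval G hT).1]
    show _ = (ρ (s i / s i0)) ^ N
    rw [← S.res.pow (S.s_OQ G i)]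
    congr 1
    have := h.ne
    have := S.h0
    rw [div_pow, div_mul_div_cancel₀ h.ne]
  rw [← h1, mul_div_assoc, div_self (S.gen_ne G hv hT h), mul_one]
  exact S.res.Ov hv hO

lemma SQ.Hs_pres (G : Geo κ d) (S : SQ E s Q i0 μ ρ) {j : ℕ} {ξ : L} (hξ : Hs E s Q i0 μ ρ j ξ) :
    (∀ v ∈ Cone (RingHom.ker μ), ∃ i, uu ρ s i0 i ≠ 0 ∧ ξ / uu ρ s i0 i ^ j ∈ Ov μ v) ∧
      ∃ (r : ℕ) (p q : MvPolynomial ι k), p.IsHomogeneous (r + j) ∧ q.IsHomogeneous r ∧ aeval (uu ρ s i0) q ≠ 0 ∧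
        ξ * aeval (uu ρ s i0) q = aeval (uu ρ s i0) p := by
  constructor
  · intro v hv
    have hv := S.res.cone.1 hv
    obtain ⟨⟨i, hi⟩, -⟩ := S.emb v (Cone.mono Q.2.le hv)
    exact ⟨i, S.u_ne G hv hi, hξ v hv i hi⟩
  · obtain ⟨v, hv⟩ := exists_pt G Q
    have hvk := Cone.mono Q.2.le hv
    obtain ⟨⟨i, hi⟩, -⟩ := S.emb v hvk
    obtain ⟨e, a, b, ha, hb, hbv, hab⟩ := (Ov_mem (S.res.cone.2 hv)).1 (hξ v hv i hi)
    obtain ⟨r, p, θ, hu⟩ := (S.emb v hvk).use G hvk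
    have hbQ : b ∉ Q.1 := fun hh => hbv (hv.2 b hh)
    have hg : Gen ((r * e) • E) v (aeval s (aeval p b)) := by
      rw [hu.rel e b hb]; exact hu.gen e b hb hbv
    have hui := S.u_ne G hv hi
    have hrf := S.res_form G hu ha hb hbQ
    have hb0 := mu_ne S.res.ker hbQ
    refine ⟨r * e, aeval p a * X i ^ j, aeval p b, (hu.deg ha).mul (by simpa using (isHomogeneous_X k i).pow j), hu.deg hb,
      S.gen_ne G hv (hu.deg hb) hg, ?_⟩
    rw [map_mul, map_pow, aeval_X]
    rw [div_mul_eq_mul_div, div_eq_iff (pow_ne_zero _ hui)] at hab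
    apply mul_right_cancel₀ hb0
    calc ξ * aeval (uu ρ s i0) (aeval p b) * μ b = (ξ * μ b) * aeval (uu ρ s i0) (aeval p b) := by ring
      _ = (aeval (uu ρ s i0) (aeval p b) * μ a) * uu ρ s i0 i ^ j := by rw [hab]; ring
      _ = _ := by rw [← hrf]; ring

lemma SQ.Lf_form (G : Geo κ d) (S : SQ E s Q i0 μ ρ) {ι' : Type} {N : ℕ} {T : ι' → MvPolynomial ι k}
    (hT : ∀ l, (T l).IsHomogeneous N) {j : ℕ} {h : L} (hl : ∀ l, aeval (uu ρ s i0) (T l) * h ∈ Lf E s Q i0 ρ (N + j))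
    {e : ℕ} (he : e ≠ 0) {P : MvPolynomial ι' k} (hP : P.IsHomogeneous e) :
    aeval (fun l => aeval (uu ρ s i0) (T l)) P * h ∈ Lf E s Q i0 ρ (N * e + j) := by
  classical
  rw [P.as_sum, map_sum, Finset.sum_mul]
  refine Submodule.sum_mem _ fun m hm => ?_
  have hdeg : m.degree = e := by
    have := hP (mem_support_iff.1 hm)
    rw [Finsupp.degree_eq_weight_one]; exact this
  have hm0 : m ≠ 0 := by rintro rfl; apply he; rw [← hdeg]; simp
  obtain ⟨l, hl0⟩ := Finsupp.ne_iff.1 hm0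
  have hl0 : m l ≠ 0 := hl0
  have hle : Finsupp.single l 1 ≤ m := by
    rw [Finsupp.single_le_iff]; omega
  have hsplit : monomial m (coeff m P) = monomial (m - Finsupp.single l 1) (coeff m P) * X l := by
    rw [X, monomial_mul, tsub_add_cancel_of_le hle, mul_one]
  have hd2 : (m - Finsupp.single l 1).degree + 1 = e := by
    rw [← hdeg]
    conv_rhs => rw [← tsub_add_cancel_of_le hle]
    rw [map_add]; simp
  have hmon : (monomial (m - Finsupp.single l 1) (coeff m P)).IsHomogeneous (e - 1) := by
    apply isHomogeneous_monomial; omega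
  have hhom : (aeval T (monomial (m - Finsupp.single l 1) (coeff m P))).IsHomogeneous (N * (e - 1)) := hmon.aeval T hT
  have e1 : aeval (fun l => aeval (uu ρ s i0) (T l)) (monomial (m - Finsupp.single l 1) (coeff m P)) =
      aeval (uu ρ s i0) (aeval T (monomial (m - Finsupp.single l 1) (coeff m P))) := by
    rw [comp_aeval_apply]
  rw [hsplit, map_mul, aeval_X, e1, mul_assoc]
  have := S.Lf_mul G hhom (hl l)
  have e2 : N * e + j = N * (e - 1) + (N + j) := by
    obtain ⟨e', rfl⟩ := Nat.exists_eq_succ_of_ne_zero he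
    simp only [Nat.succ_eq_add_one, Nat.add_sub_cancel]; ring
  rw [e2]; exact this

lemma SQ.lift [CharZero k] [Fintype ι] (G : Geo κ d) (S : SQ E s Q i0 μ ρ) :
    ∃ j0 : ℕ, ∀ j ≥ j0, ∀ ξ, Hs E s Q i0 μ ρ j ξ → ξ ∈ Lf E s Q i0 ρ j := by
  classical
  have hh : IsHom (RingHom.ker μ) := by rw [S.res.ker]; exact Q.2.hom
  have hi := S.res.mu_X G
  let Y : Set (ℕ × L) := {y | Hs E s Q i0 μ ρ y.1 y.2}
  have hY := fun (y : ℕ × L) (hy : y ∈ Y) => S.Hs_pres G (j := y.1) (ξ := y.2) hy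
  obtain ⟨S1, hS1, hS1'⟩ := FINw hh hi (uu ρ s i0) 1 one_ne_zero (fun i : ι => (X i : MvPolynomial ι k))
    (fun i => isHomogeneous_X _ _) (fun v hv => by
      have hv := S.res.cone.1 hv
      obtain ⟨⟨i, hi⟩, -⟩ := S.emb v (Cone.mono Q.2.le hv)
      have hg : Gen (1 • E) v (aeval s (X i : MvPolynomial ι k)) := by rwa [one_smul, aeval_X]
      exact ⟨i, S.gen_ne G hv (isHomogeneous_X _ _) hg, fun l => S.gen_div G hv (isHomogeneous_X _ _) hg l⟩) Y hY
  obtain ⟨W, hW, hW'⟩ := qc (Cone Q.1) (fun f => ∃ (N : ℕ) (T : MvPolynomial ι k), N ≠ 0 ∧ T.IsHomogeneous N ∧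
      (∀ y ∈ S1, aeval (uu ρ s i0) T * y.2 ∈ Lf E s Q i0 ρ (N + y.1)) ∧
      ∀ v ∈ Cone Q.1, eval v f ≠ 0 → Gen (N • E) v (aeval s T)) (fun v hv => by
    obtain ⟨N, T, hN, hT, hg, h⟩ := S.local_lift_fin G hv S1 hS1
    obtain ⟨e, f, -, hfv, hf⟩ := Gen_open G (Cone.mono Q.2.le hv) hg
    exact ⟨f, ⟨N, T, hN, hT, h, fun v' hv' => hf v' (Cone.mono Q.2.le hv')⟩, hfv⟩)
  have hW2 : ∀ f : W, ∃ (N : ℕ) (T : MvPolynomial ι k), N ≠ 0 ∧ T.IsHomogeneous N ∧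
      (∀ y ∈ S1, aeval (uu ρ s i0) T * y.2 ∈ Lf E s Q i0 ρ (N + y.1)) ∧
      ∀ v ∈ Cone Q.1, eval v f.1 ≠ 0 → Gen (N • E) v (aeval s T) := fun f => hW f.1 f.2
  choose Nf Tf hN hTh hTl hTg using hW2
  let N : ℕ := ∏ f : W, Nf f
  have hN0 : N ≠ 0 := Finset.prod_ne_zero_iff.2 fun f _ => hN f
  have hdvd : ∀ f, ∃ m, m ≠ 0 ∧ Nf f * m = N := fun f => by
    obtain ⟨m, hm⟩ := Finset.dvd_prod_of_mem Nf (Finset.mem_univ f)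
    refine ⟨m, ?_, hm.symm⟩
    rintro rfl
    exact hN0 (hm.trans (mul_zero _))
  choose mf hmf0 hmf using hdvd
  let T : W → MvPolynomial ι k := fun f => Tf f ^ mf f
  have hT : ∀ f, (T f).IsHomogeneous N := fun f => by rw [← hmf f]; exact (hTh f).pow (mf f)
  have hTG : ∀ f v, v ∈ Cone Q.1 → eval v f.1 ≠ 0 → Gen (N • E) v (aeval s (T f)) := fun f v hv hf => by
    have := Gen_pow G (hTg f v hv hf) (mf f)
    rw [← map_pow, ← mul_smul, mul_comm, hmf] at this
    exact this
  have hTL : ∀ f, ∀ y ∈ S1, aeval (uu ρ s i0) (T f) * y.2 ∈ Lf E s Q i0 ρ (N + y.1) := fun f y hy => by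
    obtain ⟨m', hm'⟩ := Nat.exists_eq_succ_of_ne_zero (hmf0 f)
    have h1 := S.Lf_mul G ((hTh f).pow m') (hTl f y hy)
    have e1 : N + y.1 = Nf f * m' + (Nf f + y.1) := by
      rw [← hmf f, hm', Nat.succ_eq_add_one]; ring
    rw [e1]
    show aeval _ (Tf f ^ mf f) * _ ∈ _
    rw [hm', pow_succ, map_mul, mul_assoc]
    exact h1
  have hTH : ∀ f, ∀ y ∈ Y, aeval (uu ρ s i0) (T f) * y.2 ∈ Lf E s Q i0 ρ (N + y.1) := fun f y hy => by
    obtain ⟨P, hP, hP'⟩ := hS1' y hy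
    rw [hP', Finset.mul_sum]
    refine Submodule.sum_mem _ fun x hx => ?_
    obtain ⟨e, he, h0⟩ := hP x hx
    rcases h0 with h0 | h0
    · rw [h0]; simp
    · have e1 : N + y.1 = e + (N + x.1) := by rw [← h0]; ring
      rw [e1, mul_left_comm]
      simp only [aeval_X]
      exact S.Lf_mul G he (hTL f x hx)
  obtain ⟨S2, hS2, hS2'⟩ := FINw hh hi (uu ρ s i0) N hN0 T hT (fun v hv => by
    have hv := S.res.cone.1 hv
    obtain ⟨f, hf, hfv⟩ := hW' v hv
    have hg := hTG ⟨f, hf⟩ v hv hfv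
    exact ⟨⟨f, hf⟩, S.gen_ne G hv (hT _) hg, S.gen_div G hv (hT _) hg⟩) Y hY
  refine ⟨S2.sup (fun y => y.1) + 1, fun j hj ξ hξ => ?_⟩
  obtain ⟨P, hP, hP'⟩ := hS2' (j, ξ) hξ
  have hP' : ξ = _ := hP'
  rw [hP']
  refine Submodule.sum_mem _ fun x hx => ?_
  obtain ⟨e, he, h0⟩ := hP x hx
  have hle : x.1 ≤ S2.sup (fun y => y.1) := Finset.le_sup (f := fun y : ℕ × L => y.1) hx
  rcases h0 with h0 | h0
  · rw [h0]; simp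
  · have h0 : N * e + x.1 = j := h0
    rw [← h0]
    refine S.Lf_form G hT (fun l => hTH l x (hS2 hx)) ?_ he
    rintro rfl
    rw [mul_zero] at h0
    omega

end B17
end Bert


namespace Bert
set_option linter.unusedSectionVars false
section B18
variable {k : Type} [Field k] {n : ℕ} {K : Type} [Field K] [Algebra k K] {κ : MvPolynomial (Fin (n+1)) k →ₐ[k] K} {d : ℕ} [IsAlgClosed k]
variable {ι : Type} {E : PDt κ d →₀ ℤ} {s : ι → K} {i0 : ι} {Q : PDt κ d}

lemma exists_frac (Q : Ideal (MvPolynomial (Fin (n+1)) k)) [hQ : Q.IsPrime] :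
    ∃ (L : Type) (_ : Field L) (_ : Algebra k L) (μ : MvPolynomial (Fin (n+1)) k →ₐ[k] L), RingHom.ker μ = Q ∧
      ∀ z : L, ∃ a b, μ b ≠ 0 ∧ z = μ a / μ b := by
  let μ : MvPolynomial (Fin (n+1)) k →ₐ[k] FractionRing (MvPolynomial (Fin (n+1)) k ⧸ Q) :=
    (IsScalarTower.toAlgHom k (MvPolynomial (Fin (n+1)) k ⧸ Q) (FractionRing (MvPolynomial (Fin (n+1)) k ⧸ Q))).comp (Ideal.Quotient.mkₐ k Q)
  have hμ : ∀ x, μ x = algebraMap (MvPolynomial (Fin (n+1)) k ⧸ Q) (FractionRing (MvPolynomial (Fin (n+1)) k ⧸ Q)) (Ideal.Quotient.mk Q x) := fun x => rfl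
  refine ⟨FractionRing (MvPolynomial (Fin (n+1)) k ⧸ Q), inferInstance, inferInstance, μ, ?_, fun z => ?_⟩
  · ext x
    rw [RingHom.mem_ker]
    show μ x = 0 ↔ _
    rw [hμ, FaithfulSMul.algebraMap_eq_zero_iff, Ideal.Quotient.eq_zero_iff_mem]
  · obtain ⟨a, b, hb, h⟩ := IsFractionRing.div_surjective (A := MvPolynomial (Fin (n+1)) k ⧸ Q) z
    obtain ⟨a, rfl⟩ := Ideal.Quotient.mk_surjective a
    obtain ⟨b, rfl⟩ := Ideal.Quotient.mk_surjective b
    refine ⟨a, b, ?_, ?_⟩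
    · rw [hμ]; exact IsFractionRing.to_map_ne_zero_of_mem_nonZeroDivisors hb
    · rw [hμ, hμ, h]

lemma Sec.exists_SQ (G : Geo κ d) (S : Sec E s) (hQ : E Q = 1) :
    ∃ (L : Type) (_ : Field L) (_ : Algebra k L) (μ : MvPolynomial (Fin (n+1)) k →ₐ[k] L) (ρ : K →ₗ[k] L) (i0 : ι), SQ E s Q i0 μ ρ := by
  obtain ⟨L, i1, i2, μ, hμ, -⟩ := exists_frac (Q.1) (hQ := Q.2.pr)
  obtain ⟨ρ, hρ⟩ := exists_res hμ
  obtain ⟨v, hv⟩ := exists_pt G Q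
  have hvk := Cone.mono Q.2.le hv
  obtain ⟨⟨i, hi⟩, -⟩ := S.emb v hvk
  refine ⟨L, i1, i2, μ, ρ, i, ⟨S, hρ, hQ, hi.ne, ?_⟩⟩
  rw [(Gen_iff G hvk (S.mem i).1 hi.ne).1 hi Q hv, hQ]

lemma mem_Gam_iff' (G : Geo κ d) {B : PDt κ d →₀ ℤ} {z : K} :
    z ∈ Gam κ B ↔ z ∈ K0 κ ∧ (z ≠ 0 → ∀ Q, - B Q ≤ ord Q z) := by
  constructor
  · intro h
    exact ⟨h.1, fun h0 => (mem_Gam_iff G h.1 h0).1 h⟩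
  · rintro ⟨h, h1⟩
    by_cases h0 : z = 0
    · rw [h0]; exact zero_mem _
    · exact (mem_Gam_iff G h h0).2 (h1 h0)

lemma Gam_mono (G : Geo κ d) {B B' : PDt κ d →₀ ℤ} (h : ∀ Q, B Q ≤ B' Q) {z : K} (hz : z ∈ Gam κ B) : z ∈ Gam κ B' := by
  rw [mem_Gam_iff' G] at hz ⊢
  refine ⟨hz.1, fun h0 Q => ?_⟩
  have := hz.2 h0 Q
  have := h Q
  omega

section
variable {L : Type} [Field L] [Algebra k L] {μ : MvPolynomial (Fin (n+1)) k →ₐ[k] L} {ρ : K →ₗ[k] L}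

lemma SQ.Hs_lc (G : Geo κ d) (S : SQ E s Q i0 μ ρ) {B : PDt κ d →₀ ℤ} {b : ℕ} (hB : B Q ≤ b)
    (hB0 : ∀ Q', E Q' = 0 → B Q' ≤ 0) {z : K} (hz : z ∈ Gam κ B) : Hs E s Q i0 μ ρ b (lc ρ (s i0) b z) := by
  intro v hv i hi
  have hvk := Cone.mono Q.2.le hv
  have hs := Gen_iff G hvk (S.mem i).1 hi.ne |>.1 hi
  have hO : z / s i ^ b ∈ Ov κ v := by
    by_cases h0 : z = 0
    · rw [h0, zero_div]; exact zero_mem _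
    have hp := pow_mem (S.mem i).1 b
    rw [Ov_iff G hvk (K0_div hz.1 hp) (div_ne_zero h0 (pow_ne_zero _ hi.ne))]
    intro Q' hQ'
    rw [ord_div G Q' hz.1 h0 hp (pow_ne_zero _ hi.ne), ord_pow G Q' (S.mem i).1 hi.ne, hs Q' hQ']
    have h1 := (mem_Gam_iff G hz.1 h0).1 hz Q'
    rcases S.one Q' with h2 | h2
    · have := hB0 Q' h2
      rw [h2]; simp; omega
    · obtain rfl := S.dis Q' Q v h2 S.hQ hQ' hv
      rw [h2]; simp; omega
  have hui := S.u_ne G hv hi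
  rw [lc_apply]
  have e1 : z / s i0 ^ b = (z / s i ^ b) * (s i / s i0) ^ b := by
    rw [div_pow, div_mul_div_cancel₀ (pow_ne_zero _ hi.ne)]
  rw [e1, S.res.mul (Ov_le_OQ hv hO) (pow_mem (S.s_OQ G i) b), S.res.pow (S.s_OQ G i)]
  have : ρ (s i / s i0) ^ b = uu ρ s i0 i ^ b := rfl
  rw [this, mul_div_assoc, div_self (pow_ne_zero _ hui), mul_one]
  exact S.res.Ov hv hO

lemma SQ.lc_zero (G : Geo κ d) (S : SQ E s Q i0 μ ρ) {b : ℕ} {z : K} (hz : z ∈ K0 κ) (h : z ≠ 0 → - (b : ℤ) ≤ ord Q z)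
    (h0 : lc ρ (s i0) b z = 0) (hz0 : z ≠ 0) : - (b : ℤ) + 1 ≤ ord Q z := by
  rw [lc_apply, S.res.ord G (K0_div hz (pow_mem S.k0 b)) (div_ne_zero hz0 (pow_ne_zero _ S.h0)) (S.mem_OQ G hz h),
    S.ord_div_pow G hz hz0] at h0
  omega

lemma SQ.Hs_up (G : Geo κ d) (S : SQ E s Q i0 μ ρ) {b : ℕ} (c : ℕ) {ξ : L} (h : Hs E s Q i0 μ ρ b ξ) :
    Hs E s Q i0 μ ρ (b + c) ξ := by
  intro v hv i hi
  have hvk := Cone.mono Q.2.le hv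
  have hui := S.u_ne G hv hi
  have h1 : (uu ρ s i0 i)⁻¹ ∈ Ov μ v := by
    have hO := div_Gen hvk G (S.mem i0) hi
    have e1 : ρ (s i0 / s i) = (uu ρ s i0 i)⁻¹ := by
      show _ = (ρ (s i / s i0))⁻¹
      rw [← S.res.inv (S.isU1 G hv hi), inv_div]
    rw [← e1]
    exact S.res.Ov hv hO
  have := mul_mem (h v hv i hi) (pow_mem h1 c)
  rwa [inv_pow, ← div_eq_mul_inv, div_div, ← pow_add] at this
end

lemma Sec.alpha [CharZero k] [Fintype ι] (G : Geo κ d) (S : Sec E s) (hQ : E Q = 1) :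
    ∃ j0 : ℕ, ∀ b ≥ j0, ∀ B : PDt κ d →₀ ℤ, B Q ≤ b → (∀ Q', E Q' = 0 → B Q' ≤ 0) → ∀ z ∈ Gam κ B,
      ∃ w ∈ Gam κ (b • E - E + Finsupp.single Q 1), z - w ≠ 0 → - (b : ℤ) + 1 ≤ ord Q (z - w) := by
  obtain ⟨L, i1, i2, μ, ρ, i0, S'⟩ := S.exists_SQ G hQ
  obtain ⟨j0, hj0⟩ := S'.lift G
  refine ⟨j0, fun b hb B hB hB0 z hz => ?_⟩
  obtain ⟨w, hw, hw'⟩ := hj0 b hb _ (S'.Hs_lc G hB hB0 hz)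
  have hw : w ∈ Gam κ (b • E - E + Finsupp.single Q 1) := hw
  refine ⟨w, hw, S'.lc_zero G (sub_mem hz.1 hw.1) ?_ (by rw [map_sub, hw', sub_self])⟩
  intro h0
  have h1 := S'.Gam_OQ G hz hB
  have h2 := S'.Gam_OQ G hw (j := b) (by simp [S'.hQ])
  have h3 := sub_mem h1 h2
  rw [← sub_div, ← ord_nonneg_iff G Q (K0_div (sub_mem hz.1 hw.1) (pow_mem S'.k0 b)) (div_ne_zero h0 (pow_ne_zero _ S'.h0)),
    S'.ord_div_pow G (sub_mem hz.1 hw.1) h0] at h3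
  omega

lemma Sec.beta [CharZero k] [Fintype ι] (G : Geo κ d) (S : Sec E s) (hQ : E Q = 1) (b : ℕ) :
    ∃ (L : Type) (_ : Field L) (_ : Algebra k L) (f : K →ₗ[k] L) (M : Submodule k L), M.FG ∧
      ∀ B : PDt κ d →₀ ℤ, B Q ≤ b → (∀ Q', E Q' = 0 → B Q' ≤ 0) → ∀ z ∈ Gam κ B, f z ∈ M ∧
        (f z = 0 → z ≠ 0 → - (b : ℤ) + 1 ≤ ord Q z) := by
  obtain ⟨L, i1, i2, μ, ρ, i0, S'⟩ := S.exists_SQ G hQ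
  obtain ⟨j0, hj0⟩ := S'.lift G
  refine ⟨L, i1, i2, lc ρ (s i0) b, Lf E s Q i0 ρ (b + j0), ?_, fun B hB hB0 z hz => ⟨?_, ?_⟩⟩
  · have := Gam_fin G ((b + j0) • E - E + Finsupp.single Q 1)
    exact ((Submodule.fg_iff_finiteDimensional _).2 this).map _
  · exact hj0 _ (by omega) _ (S'.Hs_up G j0 (S'.Hs_lc G hB hB0 hz))
  · refine S'.lc_zero G hz.1 fun h0 => ?_
    have := (mem_Gam_iff G hz.1 h0).1 hz Q
    omega

/-- union of sections with arbitrary poles along `Q` -/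
noncomputable def VV (Q : PDt κ d) (G : Geo κ d) (C : PDt κ d →₀ ℤ) : Submodule k K where
  carrier := {z | ∃ j : ℕ, z ∈ Gam κ (Finsupp.single Q (j : ℤ) + C)}
  zero_mem' := ⟨0, zero_mem _⟩
  add_mem' := by
    rintro z w ⟨j, hj⟩ ⟨j', hj'⟩
    refine ⟨j + j', add_mem (Gam_mono G (fun Q' => ?_) hj) (Gam_mono G (fun Q' => ?_) hj')⟩ <;>
    · by_cases h : Q' = Q
      · subst h; simp
      · simp [Finsupp.single_eq_of_ne h]
  smul_mem' := by
    rintro c z ⟨j, hj⟩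
    exact ⟨j, Submodule.smul_mem _ c hj⟩

lemma VV_mem {G : Geo κ d} {C : PDt κ d →₀ ℤ} {z : K} :
    z ∈ VV Q G C ↔ ∃ j : ℕ, z ∈ Gam κ (Finsupp.single Q (j : ℤ) + C) := Iff.rfl

lemma VV_bound (G : Geo κ d) {C : PDt κ d →₀ ℤ} (h : (VV Q G C).FG) :
    ∃ j : ℕ, ∀ z ∈ VV Q G C, z ∈ Gam κ (Finsupp.single Q (j : ℤ) + C) := by
  classical
  obtain ⟨T, hT⟩ := h
  have h1 : ∀ z : K, ∃ j : ℕ, z ∈ T → z ∈ Gam κ (Finsupp.single Q (j : ℤ) + C) := fun z => by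
    by_cases hz : z ∈ T
    · have : z ∈ VV Q G C := by rw [← hT]; exact Submodule.subset_span hz
      obtain ⟨j, hj⟩ := this
      exact ⟨j, fun _ => hj⟩
    · exact ⟨0, fun h => absurd h hz⟩
  choose j hj using h1
  refine ⟨T.sup j, ?_⟩
  have : VV Q G C ≤ Gam κ (Finsupp.single Q ((T.sup j : ℕ) : ℤ) + C) := by
    rw [← hT, Submodule.span_le]
    intro z hz
    refine Gam_mono G (fun Q' => ?_) (hj z hz)
    have hle : j z ≤ T.sup j := Finset.le_sup hz
    by_cases h : Q' = Q
    · subst h; simp; exact_mod_cast hle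
    · simp [Finsupp.single_eq_of_ne h]
  exact this

lemma Sec.VV_step [CharZero k] [Fintype ι] (G : Geo κ d) (S : Sec E s) {Q1 : PDt κ d} (hQ1 : E Q1 = 1) (hQ : E Q = 1)
    (hne : Q ≠ Q1) {C : PDt κ d →₀ ℤ} (hC : ∀ Q', E Q' = 0 → C Q' ≤ 0) (hCQ : 0 ≤ C Q) (h : (VV Q1 G C).FG) :
    (VV Q1 G (C + Finsupp.single Q 1)).FG := by
  obtain ⟨b, hb⟩ := Int.eq_ofNat_of_zero_le hCQ
  obtain ⟨L, i1, i2, f, M, hM, hf⟩ := S.beta G hQ (b + 1)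
  have key : ∀ (z : K) (j : ℕ), z ∈ Gam κ (Finsupp.single Q1 (j : ℤ) + (C + Finsupp.single Q 1)) → f z ∈ M ∧
        (f z = 0 → z ≠ 0 → - ((b + 1 : ℕ) : ℤ) + 1 ≤ ord Q z) := fun z j hz => by
    refine hf _ ?_ ?_ z hz
    · simp [Finsupp.single_eq_of_ne hne, hb]
    · intro Q' hQ'
      have h1 : Q' ≠ Q1 := by rintro rfl; omega
      have h2 : Q' ≠ Q := by rintro rfl; omega
      simpa [Finsupp.single_eq_of_ne h1, Finsupp.single_eq_of_ne h2] using hC Q' hQ'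
  refine Submodule.fg_of_fg_map_of_fg_inf_ker f ?_ ?_
  · refine Submodule.FG.of_le hM ?_
    rintro _ ⟨z, ⟨j, hj⟩, rfl⟩
    exact (key z j hj).1
  · refine Submodule.FG.of_le h ?_
    rintro z ⟨⟨j, hj⟩, hz⟩
    have h3 := (key z j hj).2 hz
    refine ⟨j, ?_⟩
    rw [mem_Gam_iff' G] at hj ⊢
    refine ⟨hj.1, fun h0 Q' => ?_⟩
    have h4 := hj.2 h0 Q'
    by_cases hQ' : Q' = Q
    · subst hQ'
      have := h3 h0
      simp only [Finsupp.add_apply, Finsupp.single_eq_of_ne hne, hb]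
      push_cast at this
      linarith
    · simpa [Finsupp.single_eq_of_ne hQ'] using h4

lemma Sec.VV_all [CharZero k] [Fintype ι] (G : Geo κ d) (S : Sec E s) {Q1 : PDt κ d} (hQ1 : E Q1 = 1)
    (h : (VV Q1 G 0).FG) (t : ℕ) : ∀ C : PDt κ d →₀ ℤ, (∀ Q', E Q' = 0 → C Q' = 0) → (∀ Q', 0 ≤ C Q') → C Q1 = 0 →
      (∑ Q' ∈ E.support, C Q' = t) → (VV Q1 G C).FG := by
  classical
  induction t with
  | zero =>
    intro C h1 h2 h3 h4
    have : C = 0 := by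
      ext Q'
      rcases S.one Q' with h5 | h5
      · exact h1 Q' h5
      · refine (Finset.sum_eq_zero_iff_of_nonneg (fun Q' _ => h2 Q')).1 (by simpa using h4) Q' ?_
        rw [Finsupp.mem_support_iff, h5]; exact one_ne_zero
    rw [this]; exact h
  | succ t ih =>
    intro C h1 h2 h3 h4
    obtain ⟨Q, hQs, hQ⟩ := Finset.exists_ne_zero_of_sum_ne_zero (s := E.support) (f := fun Q' => C Q') (by rw [h4]; omega)
    have hEQ : E Q = 1 := (S.one Q).resolve_left (Finsupp.mem_support_iff.1 hQs)
    have hne : Q ≠ Q1 := by rintro rfl; exact hQ h3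
    have hpos : 1 ≤ C Q := by have := h2 Q; omega
    obtain ⟨C', hC'⟩ : ∃ C' : PDt κ d →₀ ℤ, C' = C - Finsupp.single Q 1 := ⟨_, rfl⟩
    have hC : C = C' + Finsupp.single Q 1 := by rw [hC']; exact (sub_add_cancel _ _).symm
    rw [hC]
    have e1 : ∀ Q', Q' ≠ Q → C' Q' = C Q' := fun Q' hQ' => by
      simp [hC', Finsupp.single_eq_of_ne hQ']
    have e2 : C' Q = C Q - 1 := by simp [hC']
    have h0 : ∀ Q', E Q' = 0 → C' Q' = 0 := fun Q' hQ' => by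
      rw [e1 Q' (by rintro rfl; omega)]; exact h1 Q' hQ'
    refine S.VV_step G hQ1 hEQ hne (fun Q' hQ' => (h0 Q' hQ').le) (by rw [e2]; omega) (ih _ h0 (fun Q' => ?_) ?_ ?_)
    · by_cases hQ' : Q' = Q
      · rw [hQ', e2]; omega
      · rw [e1 Q' hQ']; exact h2 Q'
    · rw [e1 Q1 hne.symm]; exact h3
    · simp only [hC', Finsupp.sub_apply, Finset.sum_sub_distrib, h4]
      have : ∑ x ∈ E.support, (Finsupp.single Q (1 : ℤ)) x = 1 := by
        rw [Finset.sum_eq_single Q]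
        · simp
        · intro x _ hx; exact Finsupp.single_eq_of_ne hx
        · intro hh; exact absurd hQs hh
      rw [this]; push_cast; ring

end B18
end Bert


namespace Bert
set_option linter.unusedSectionVars false
section B19
variable {k : Type} [Field k] {n : ℕ} {K : Type} [Field K] [Algebra k K] {κ : MvPolynomial (Fin (n+1)) k →ₐ[k] K} {d : ℕ} [IsAlgClosed k]
variable {ι : Type} {E : PDt κ d →₀ ℤ} {s : ι → K} {i0 : ι} {Q : PDt κ d}

lemma Sec.alpha_unif [CharZero k] [Fintype ι] (G : Geo κ d) (S : Sec E s) :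
    ∃ J : ℕ, ∀ Q, E Q = 1 → ∀ b ≥ J, ∀ B : PDt κ d →₀ ℤ, B Q ≤ b → (∀ Q', E Q' = 0 → B Q' ≤ 0) → ∀ z ∈ Gam κ B,
      ∃ w ∈ Gam κ (b • E - E + Finsupp.single Q 1), z - w ≠ 0 → - (b : ℤ) + 1 ≤ ord Q (z - w) := by
  classical
  have h : ∀ Q, ∃ j0 : ℕ, E Q = 1 → ∀ b ≥ j0, ∀ B : PDt κ d →₀ ℤ, B Q ≤ b → (∀ Q', E Q' = 0 → B Q' ≤ 0) → ∀ z ∈ Gam κ B,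
      ∃ w ∈ Gam κ (b • E - E + Finsupp.single Q 1), z - w ≠ 0 → - (b : ℤ) + 1 ≤ ord Q (z - w) := fun Q => by
    by_cases hQ : E Q = 1
    · obtain ⟨j0, h⟩ := S.alpha G hQ
      exact ⟨j0, fun _ => h⟩
    · exact ⟨0, fun h => absurd h hQ⟩
  choose j0 hj0 using h
  refine ⟨E.support.sup j0, fun Q hQ b hb => hj0 Q hQ b (le_trans ?_ hb)⟩
  exact Finset.le_sup (Finsupp.mem_support_iff.2 (by rw [hQ]; exact one_ne_zero))

lemma Sec.desc [CharZero k] [Fintype ι] (G : Geo κ d) (S : Sec E s) {Q1 : PDt κ d} (hQ1 : E Q1 = 1) {J : ℕ}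
    (hJ : ∀ Q, E Q = 1 → ∀ b ≥ J, ∀ B : PDt κ d →₀ ℤ, B Q ≤ b → (∀ Q', E Q' = 0 → B Q' ≤ 0) → ∀ z ∈ Gam κ B,
      ∃ w ∈ Gam κ (b • E - E + Finsupp.single Q 1), z - w ≠ 0 → - (b : ℤ) + 1 ≤ ord Q (z - w)) (j t : ℕ) :
    ∀ B : PDt κ d →₀ ℤ, (∀ Q, E Q = 0 → B Q = 0) → (∀ Q, E Q = 1 → (J : ℤ) ≤ B Q ∧ B Q ≤ j) → B Q1 = j →
      (∑ Q ∈ E.support, ((j : ℤ) - B Q) = t) → ∃ z ∈ Gam κ B, z ∉ Gam κ (B - Finsupp.single Q1 1) := by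
  classical
  have hsup : ∀ Q, Q ∈ E.support ↔ E Q = 1 := fun Q => by
    rw [Finsupp.mem_support_iff]
    rcases S.one Q with h | h <;> simp [h]
  induction t with
  | zero =>
    intro B h1 h2 h3 h4
    have hB : B = j • E := by
      ext Q
      rcases S.one Q with h5 | h5
      · simp [h1 Q h5, h5]
      · have hnn : ∀ Q ∈ E.support, 0 ≤ (j : ℤ) - B Q := fun Q hQ => by
          have := (h2 Q ((hsup Q).1 hQ)).2
          omega
        have h6 := (Finset.sum_eq_zero_iff_of_nonneg hnn).1 (by rw [h4]; rfl) Q ((hsup Q).2 h5)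
        simp only [Finsupp.smul_apply, h5, nsmul_eq_mul, mul_one]; omega
    obtain ⟨v, hv⟩ := exists_pt G Q1
    have hvk := Cone.mono Q1.2.le hv
    obtain ⟨⟨i, hi⟩, -⟩ := S.emb v hvk
    refine ⟨s i ^ j, by rw [hB]; exact Gam_pow G (S.mem i) j, fun hh => ?_⟩
    rw [mem_Gam_iff' G] at hh
    have h5 := hh.2 (pow_ne_zero _ hi.ne) Q1
    rw [ord_pow G Q1 (S.mem i).1 hi.ne, (Gen_iff G hvk (S.mem i).1 hi.ne).1 hi Q1 hv, hQ1, Finsupp.sub_apply, h3,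
      Finsupp.single_eq_same] at h5
    linarith
  | succ t ih =>
    intro B h1 h2 h3 h4
    obtain ⟨Q, hQs, hQm⟩ := Finset.exists_min_image E.support (fun Q => B Q) ⟨Q1, (hsup Q1).2 hQ1⟩
    have hEQ := (hsup Q).1 hQs
    have hQj : B Q < j := by
      by_contra hc
      have : ∑ Q ∈ E.support, ((j : ℤ) - B Q) = 0 := Finset.sum_eq_zero fun Q' hQ' => by
        have h5 := hQm Q' hQ'
        have h6 := (h2 Q' ((hsup Q').1 hQ')).2
        omega
      rw [this] at h4
      omega
    have hne : Q ≠ Q1 := by rintro rfl; omega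
    obtain ⟨b, hb⟩ := Int.eq_ofNat_of_zero_le (show 0 ≤ B Q by have := (h2 Q hEQ).1; omega)
    have e1 : ∀ Q', Q' ≠ Q → (B + Finsupp.single Q 1 : PDt κ d →₀ ℤ) Q' = B Q' := fun Q' hQ' => by
      simp [Finsupp.single_eq_of_ne hQ']
    have e2 : (B + Finsupp.single Q 1 : PDt κ d →₀ ℤ) Q = B Q + 1 := by simp
    have h0 : ∀ Q', E Q' = 0 → (B + Finsupp.single Q 1 : PDt κ d →₀ ℤ) Q' = 0 := fun Q' hQ' => by
      rw [e1 Q' (by rintro rfl; omega)]; exact h1 Q' hQ'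
    obtain ⟨z, hz, hz'⟩ := ih (B + Finsupp.single Q 1) h0 (fun Q' hQ' => by
        by_cases hh : Q' = Q
        · rw [hh, e2]; have := (h2 Q hEQ).1; omega
        · rw [e1 Q' hh]; exact h2 Q' hQ') (by rw [e1 Q1 hne.symm]; exact h3) (by
        have e3 : ∑ x ∈ E.support, (Finsupp.single Q (1 : ℤ)) x = 1 := by
          rw [Finset.sum_eq_single Q]
          · simp
          · intro x _ hx; exact Finsupp.single_eq_of_ne hx
          · intro hh; exact absurd hQs hh
        simp only [Finsupp.add_apply, Finset.sum_sub_distrib, Finset.sum_add_distrib, e3] at h4 ⊢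
        push_cast at h4 ⊢
        linarith)
    obtain ⟨w, hw, hzw⟩ := hJ Q hEQ (b + 1) (by have := (h2 Q hEQ).1; omega) _ (by rw [e2, hb]; simp) (fun Q' hQ' => (h0 Q' hQ').le) z hz
    have hwB : w ∈ Gam κ (B + Finsupp.single Q 1 - Finsupp.single Q1 1) := by
      refine Gam_mono G (fun Q' => ?_) hw
      simp only [Finsupp.add_apply, Finsupp.sub_apply, Finsupp.smul_apply, nsmul_eq_mul]
      push_cast
      rcases S.one Q' with h5 | h5
      · have a1 : Q' ≠ Q1 := by rintro rfl; omega
        rw [h5, h1 Q' h5, Finsupp.single_eq_of_ne a1]; simp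
      · have h6 := hQm Q' ((hsup Q').2 h5)
        rw [h5]
        by_cases a1 : Q' = Q1
        · rw [a1, h3, Finsupp.single_eq_same]; omega
        · rw [Finsupp.single_eq_of_ne a1]
          have h6 : B Q ≤ B Q' := h6
          omega
    have hwB' : w ∈ Gam κ (B + Finsupp.single Q 1) := by
      refine Gam_mono G (fun Q' => ?_) hwB
      simp only [Finsupp.sub_apply]
      have : 0 ≤ (Finsupp.single Q1 (1 : ℤ)) Q' := by
        by_cases a1 : Q' = Q1
        · simp [a1]
        · rw [Finsupp.single_eq_of_ne a1]
      omega
    refine ⟨z - w, ?_, fun hh => hz' ?_⟩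
    · have h5 := sub_mem hz hwB'
      rw [mem_Gam_iff' G] at h5 ⊢
      refine ⟨h5.1, fun h6 Q' => ?_⟩
      by_cases hQ' : Q' = Q
      · have := hzw h6
        rw [hQ', hb]; push_cast at this; linarith
      · have := h5.2 h6 Q'
        rwa [e1 Q' hQ'] at this
    · have h5 : z - w ∈ Gam κ (B + Finsupp.single Q 1 - Finsupp.single Q1 1) := by
        refine Gam_mono G (fun Q' => ?_) hh
        simp only [Finsupp.sub_apply, Finsupp.add_apply]
        have : 0 ≤ (Finsupp.single Q (1 : ℤ)) Q' := by
          by_cases a1 : Q' = Q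
          · simp [a1]
          · rw [Finsupp.single_eq_of_ne a1]
        omega
      have := add_mem h5 hwB
      rwa [sub_add_cancel] at this

lemma Sec.nonconst [CharZero k] [Fintype ι] (G : Geo κ d) (S : Sec E s) {Q1 : PDt κ d} (hQ1 : E Q1 = 1) :
    ∃ (j : ℕ) (z : K), z ∈ Gam κ (Finsupp.single Q1 (j : ℤ)) ∧ ∀ c, z ≠ algebraMap k K c := by
  classical
  have hnot : ¬ (VV Q1 G 0).FG := fun hfg => by
    obtain ⟨J, hJ⟩ := S.alpha_unif G
    obtain ⟨C, hC⟩ : ∃ C : PDt κ d →₀ ℤ, C = J • (E - Finsupp.single Q1 1) := ⟨_, rfl⟩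
    have c1 : C Q1 = 0 := by rw [hC]; simp [hQ1]
    have c2 : ∀ Q', Q' ≠ Q1 → C Q' = J * E Q' := fun Q' h => by rw [hC]; simp [Finsupp.single_eq_of_ne h]
    have c3 : ∀ Q', E Q' = 0 → C Q' = 0 := fun Q' h => by
      rw [c2 Q' (by rintro rfl; omega), h, mul_zero]
    have c4 : ∀ Q', 0 ≤ C Q' := fun Q' => by
      by_cases h : Q' = Q1
      · rw [h, c1]
      · rw [c2 Q' h]; rcases S.one Q' with h5 | h5 <;> simp [h5]
    obtain ⟨t, ht⟩ := Int.eq_ofNat_of_zero_le (Finset.sum_nonneg fun Q' (_ : Q' ∈ E.support) => c4 Q')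
    obtain ⟨j1, hj1⟩ := VV_bound G (S.VV_all G hQ1 hfg t C c3 c4 c1 ht)
    obtain ⟨B, hB⟩ : ∃ B : PDt κ d →₀ ℤ, B = Finsupp.single Q1 ((j1 + J + 1 : ℕ) : ℤ) + C := ⟨_, rfl⟩
    have b1 : B Q1 = (j1 + J + 1 : ℕ) := by rw [hB]; simp [c1]
    have b2 : ∀ Q', Q' ≠ Q1 → B Q' = C Q' := fun Q' h => by rw [hB]; simp [Finsupp.single_eq_of_ne h]
    have b3 : ∀ Q', E Q' = 1 → (J : ℤ) ≤ B Q' ∧ B Q' ≤ (j1 + J + 1 : ℕ) := fun Q' h => by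
      by_cases h' : Q' = Q1
      · rw [h', b1]; push_cast; omega
      · rw [b2 Q' h', c2 Q' h', h]; push_cast; omega
    obtain ⟨t, ht⟩ := Int.eq_ofNat_of_zero_le (Finset.sum_nonneg fun Q' (h : Q' ∈ E.support) =>
      sub_nonneg.2 (b3 Q' ((S.one Q').resolve_left (Finsupp.mem_support_iff.1 h))).2)
    obtain ⟨z, hz, hz'⟩ := S.desc G hQ1 hJ (j1 + J + 1) t B (fun Q' h => by
      rw [b2 Q' (by rintro rfl; omega), c3 Q' h]) b3 b1 ht
    apply hz'
    refine Gam_mono G (fun Q' => ?_) (hj1 z ⟨_, by rw [← hB]; exact hz⟩)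
    simp only [Finsupp.add_apply, Finsupp.sub_apply]
    by_cases h : Q' = Q1
    · rw [h, b1, c1]; simp
    · rw [b2 Q' h, Finsupp.single_eq_of_ne h, Finsupp.single_eq_of_ne h]; simp
  by_contra hc
  push Not at hc
  apply hnot
  refine Submodule.FG.of_le (T := Submodule.span k {(1 : K)}) (Submodule.fg_span_singleton _) ?_
  rintro z ⟨j, hj⟩
  rw [add_zero] at hj
  obtain ⟨c, rfl⟩ := hc j z hj
  rw [Submodule.mem_span_singleton]
  exact ⟨c, by rw [Algebra.algebraMap_eq_smul_one]⟩

lemma SQ.not_const {L : Type} [Field L] [Algebra k L] {μ : MvPolynomial (Fin (n+1)) k →ₐ[k] L} {ρ : K →ₗ[k] L} (G : Geo κ d)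
    (S : SQ E s Q i0 μ ρ) : ¬ ∀ i, ∃ c, uu ρ s i0 i = algebraMap k L c := by
  intro h
  choose c hc using h
  obtain ⟨v, hv⟩ := exists_pt G Q
  have hvk := Cone.mono Q.2.le hv
  obtain ⟨r, p, θ, hu⟩ := (S.emb v hvk).use G hvk
  obtain ⟨l, hl⟩ := Function.ne_iff.1 hv.1
  have hl : v l ≠ 0 := hl
  have hX : eval v (X l : MvPolynomial (Fin (n+1)) k) ≠ 0 := by rwa [eval_X]
  have hXQ : (X l : MvPolynomial (Fin (n+1)) k) ∉ Q.1 := fun hh => hX (hv.2 _ hh)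
  have hce : uu ρ s i0 = fun i => algebraMap k L (c i) := funext hc
  have hconst : ∀ F : MvPolynomial ι k, aeval (uu ρ s i0) F = algebraMap k L (eval c F) := fun F => by
    rw [hce, ← aeval_eq_eval]
    exact (comp_aeval_apply (f := c) (Algebra.ofId k L) F).symm
  have hg : Gen ((r * 1) • E) v (aeval s (aeval p (X l : MvPolynomial (Fin (n+1)) k))) := by
    rw [hu.rel 1 _ (isHomogeneous_X _ _)]; exact hu.gen 1 _ (isHomogeneous_X _ _) hX
  have hne := S.gen_ne G hv (hu.deg (isHomogeneous_X _ _)) hg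
  have hsm : td k (MvPolynomial (Fin (n+1)) k ⧸ RingHom.ker μ) ≤ 1 := td_small (i0 := l) fun i => by
    have h1 := S.res_form G hu (isHomogeneous_X k i) (isHomogeneous_X k l) hXQ
    rw [hconst, hconst] at h1
    rw [hconst] at hne
    refine ⟨eval c (aeval p (X i : MvPolynomial (Fin (n+1)) k)) / eval c (aeval p (X l : MvPolynomial (Fin (n+1)) k)), ?_⟩
    rw [map_div₀, div_mul_eq_mul_div, eq_div_iff hne, h1, mul_comm]
  rw [S.res.ker, Q.2.tdim] at hsm
  have := G.two
  omega

lemma Sec.unique [CharZero k] [Fintype ι] (G : Geo κ d) (S : Sec E s) {Q1 Q2 : PDt κ d} (hQ1 : E Q1 = 1) (hQ2 : E Q2 = 1) :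
    Q1 = Q2 := by
  by_contra hne
  obtain ⟨j, z, hz, hzc⟩ := S.nonconst G hQ1
  obtain ⟨L, i1, i2, μ, ρ, i0, S'⟩ := S.exists_SQ G hQ2
  have hh : IsHom (RingHom.ker μ) := by rw [S'.res.ker]; exact Q2.2.hom
  have hi := S'.res.mu_X G
  -- regular elements on Q2 have constant residue
  have hreg : ∀ x ∈ K0 κ, (x ≠ 0 → ∀ Q', (∃ v, v ∈ Cone Q2.1 ∧ v ∈ Cone Q'.1) → 0 ≤ ord Q' x) →
      x ∈ OQ Q2 ∧ ∃ c, ρ x = algebraMap k L c := fun x hx h => by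
    have hO : ∀ v ∈ Cone Q2.1, x ∈ Ov κ v := fun v hv => by
      by_cases h0 : x = 0
      · rw [h0]; exact zero_mem _
      · exact (Ov_iff G (Cone.mono Q2.2.le hv) hx h0).2 fun Q' hQ' => h h0 Q' ⟨v, hv, hQ'⟩
    obtain ⟨v, hv⟩ := exists_pt G Q2
    refine ⟨Ov_le_OQ hv (hO v hv), const_of_reg hh hi fun v hv => ?_⟩
    have hv := S'.res.cone.1 hv
    exact S'.res.Ov hv (hO v hv)
  have hdis : ∀ Q', (∃ v, v ∈ Cone Q2.1 ∧ v ∈ Cone Q'.1) → Q' ≠ Q1 ∧ (Q' = Q2 ∨ E Q' = 0) := fun Q' ⟨v, hv, hv'⟩ => by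
    refine ⟨?_, ?_⟩
    · rintro rfl; exact hne (S.dis _ _ v hQ1 hQ2 hv' hv)
    · rcases S.one Q' with h | h
      · exact Or.inr h
      · exact Or.inl (S.dis _ _ v h hQ2 hv' hv)
  have hordz : ∀ x ∈ Gam κ (Finsupp.single Q1 (j : ℤ)), x ≠ 0 → ∀ Q', Q' ≠ Q1 → 0 ≤ ord Q' x := fun x hx h0 Q' hQ' => by
    have := (mem_Gam_iff G hx.1 h0).1 hx Q'
    rwa [Finsupp.single_eq_of_ne hQ', neg_zero] at this
  obtain ⟨hzO, c, hc⟩ := hreg z hz.1 fun h0 Q' hQ' => hordz z hz h0 Q' (hdis Q' hQ').1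
  have hcG : algebraMap k K c ∈ Gam κ (Finsupp.single Q1 (j : ℤ)) := by
    have h1 : (1 : K) ∈ Gam κ (0 : PDt κ d →₀ ℤ) := ⟨one_mem _, fun v hv => by rw [gam_zero, one_mul]; exact one_mem _⟩
    rw [Algebra.algebraMap_eq_smul_one]
    refine Submodule.smul_mem _ _ (Gam_mono G (fun Q' => ?_) h1)
    by_cases h : Q' = Q1
    · simp [h]
    · rw [Finsupp.single_eq_of_ne h]; simp
  obtain ⟨y, hy⟩ : ∃ y, y = z - algebraMap k K c := ⟨_, rfl⟩
  have hyG : y ∈ Gam κ (Finsupp.single Q1 (j : ℤ)) := by rw [hy]; exact sub_mem hz hcG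
  have hy0 : y ≠ 0 := by rw [hy]; exact sub_ne_zero.2 (hzc c)
  have hyord := hordz y hyG hy0
  have hyO : y ∈ OQ Q2 := (ord_nonneg_iff G Q2 hyG.1 hy0).1 (hyord Q2 (Ne.symm hne))
  have hρy : ρ y = 0 := by rw [hy, map_sub, hc, S'.res.const, sub_self]
  have hr1 := (S'.res.ord G hyG.1 hy0 hyO).1 hρy
  obtain ⟨r, hr⟩ := Int.eq_ofNat_of_zero_le (show 0 ≤ ord Q2 y - 1 by omega)
  have hr : ord Q2 y = r + 1 := by
    have h1 : ord Q2 y - 1 = (r : ℤ) := hr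
    omega
  have hs0 := S'.h0
  have hk0 := S'.k0
  have hx : ∀ i, y * s i0 ^ r * s i ∈ OQ Q2 ∧ ∃ c, ρ (y * s i0 ^ r * s i) = algebraMap k L c := fun i => by
    refine hreg _ (mul_mem (mul_mem hyG.1 (pow_mem hk0 r)) (S.mem i).1) fun h0 Q' hQ' => ?_
    have hsi : s i ≠ 0 := right_ne_zero_of_mul h0
    rw [ord_mul G Q' (mul_mem hyG.1 (pow_mem hk0 r)) (mul_ne_zero hy0 (pow_ne_zero _ hs0)) (S.mem i).1 hsi,
      ord_mul G Q' hyG.1 hy0 (pow_mem hk0 r) (pow_ne_zero _ hs0), ord_pow G Q' hk0 hs0]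
    have h1 := (mem_Gam_iff G (S.mem i).1 hsi).1 (S.mem i) Q'
    rcases (hdis Q' hQ').2 with h2 | h2
    · rw [h2] at h1 ⊢
      rw [S'.ho, hr]
      rw [hQ2] at h1
      linarith
    · have h3 := (mem_Gam_iff G (S.mem i0).1 hs0).1 (S.mem i0) Q'
      rw [h2] at h1 h3
      have h4 := hyord Q' (hdis Q' hQ').1
      have h5 : 0 ≤ (r : ℤ) * ord Q' (s i0) := mul_nonneg (by positivity) (by linarith)
      linarith
  have hx0 : IsU (OQ Q2) (y * s i0 ^ r * s i0) := by
    have hm := mul_mem (mul_mem hyG.1 (pow_mem hk0 r)) hk0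
    have hm0 := mul_ne_zero (mul_ne_zero hy0 (pow_ne_zero r hs0)) hs0
    rw [← ord_zero_iff G Q2 hm hm0, ord_mul G Q2 (mul_mem hyG.1 (pow_mem hk0 r)) (mul_ne_zero hy0 (pow_ne_zero _ hs0)) hk0 hs0,
      ord_mul G Q2 hyG.1 hy0 (pow_mem hk0 r) (pow_ne_zero _ hs0), ord_pow G Q2 hk0 hs0, S'.ho, hr]
    ring
  refine S'.not_const G fun i => ?_
  obtain ⟨h1, c1, hc1⟩ := hx i
  obtain ⟨h2, c2, hc2⟩ := hx i0
  refine ⟨c1 / c2, ?_⟩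
  show ρ (s i / s i0) = _
  have e1 : s i / s i0 = (y * s i0 ^ r * s i) / (y * s i0 ^ r * s i0) := by
    rw [mul_div_mul_left _ _ (mul_ne_zero hy0 (pow_ne_zero r hs0))]
  rw [e1, S'.res.div h1 hx0, hc1, hc2, map_div₀]

lemma Sec.nonempty (G : Geo κ d) (S : Sec E s) : ∃ Q, E Q = 1 := by
  by_contra hc
  push Not at hc
  have hE : E = 0 := by
    ext Q
    exact (S.one Q).resolve_right (hc Q)
  have hs : ∀ i, ∃ c, s i = algebraMap k K c := fun i => const_of_reg G.hom (kap_hom_ne G) fun v hv => by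
    have := (S.mem i).2 v hv
    rwa [hE, gam_zero, mul_one] at this
  choose c hc using hs
  obtain ⟨i, hi⟩ := kap_hom_ne G
  obtain ⟨v, hv, -⟩ := exists_off G ∅
  obtain ⟨-, r, p, θ, hp, hθ, hrel, l, hl, hg⟩ := S.emb v hv
  have hce : s = fun i => algebraMap k K (c i) := funext hc
  have hconst : ∀ F : MvPolynomial ι k, aeval s F = algebraMap k K (eval c F) := fun F => by
    rw [hce, ← aeval_eq_eval]
    exact (comp_aeval_apply (f := c) (Algebra.ofId k K) F).symm
  have hsm : td k (MvPolynomial (Fin (n+1)) k ⧸ RingHom.ker κ) ≤ 1 := td_small (i0 := l) fun i => by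
    refine ⟨eval c (p i) / eval c (p l), ?_⟩
    have h0 := hg.ne
    rw [map_div₀, ← hconst, ← hconst, hrel i]
    rw [hrel l] at h0 ⊢
    have h2 := right_ne_zero_of_mul h0
    field_simp
  rw [G.tdim] at hsm
  have := G.two
  omega

theorem Sec.irred [CharZero k] [Fintype ι] (G : Geo κ d) (S : Sec E s) : ∃ Q, E = Finsupp.single Q 1 := by
  obtain ⟨Q, hQ⟩ := S.nonempty G
  refine ⟨Q, ?_⟩
  ext Q'
  by_cases h : Q' = Q
  · rw [h, hQ]; simp
  · rw [Finsupp.single_eq_of_ne h]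
    exact (S.one Q').resolve_right fun h' => h (S.unique G h' hQ)

end B19
end Bert


namespace Bert
set_option linter.unusedSectionVars false
section B20
variable {k : Type} [Field k] {n : ℕ} {K : Type} [Field K] [Algebra k K] {κ : MvPolynomial (Fin (n+1)) k →ₐ[k] K} {d : ℕ} [IsAlgClosed k]

lemma PDt.cone_ker (Q : PDt κ d) {v : Fin (n+1) → k} (hv : v ∈ Cone Q.1) : v ∈ Cone (RingHom.ker κ) :=
  Cone.mono Q.2.le hv

/-- a section which is nowhere singular defines a smooth irreducible divisor -/
theorem good_irred [CharZero k] {ι : Type} [Fintype ι] (G : Geo κ d) {A : PDt κ d →₀ ℤ} {t : ι → K}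
    (ht : ∀ i, t i ∈ Gam κ A) (hemb : ∀ v ∈ Cone (RingHom.ker κ), EmbAt A t v) {f : K} (hf : f ∈ Gam κ A)
    (hf0 : f ≠ 0) (hgood : ∀ v ∈ Cone (RingHom.ker κ), ∃ a : k, a ≠ 0 ∧ ¬ Bad A (a • v) f) :
    ∃ Q : PDt κ d, ord Q f + A Q = 1 ∧ (∀ Q', Q' ≠ Q → ord Q' f + A Q' = 0) ∧
      ∀ v ∈ Cone Q.1, ∃ a : k, a ≠ 0 ∧ Module.finrank k (gradSpan Q.1 (a • v)) + d = n + 1 := by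
  classical
  have hK : f ∈ K0 κ := hf.1
  let dv0 : PDt κ d →₀ ℤ := Finsupp.ofSupportFinite (fun Q => ord Q f) (ord_finite G hK hf0)
  have hdv : ∀ Q, dv0 Q = ord Q f := fun Q => rfl
  have key : ∀ (v : Fin (n+1) → k) (Q : PDt κ d), v ∈ Cone Q.1 → ord Q f + A Q ≠ 0 → ∃ a : k, a ≠ 0 ∧
      ord Q f + A Q = 1 ∧ (∀ Q' : PDt κ d, v ∈ Cone Q'.1 → Q' ≠ Q → ord Q' f + A Q' = 0) ∧
      Module.finrank k (gradSpan Q.1 (a • v)) + d = n + 1 := by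
    intro v Q hv hne
    obtain ⟨a, ha, hb⟩ := hgood v (Q.cone_ker hv)
    have hv' : a • v ∈ Cone Q.1 := (Cone_smul_iff Q.2.hom ha).2 hv
    obtain ⟨h1, h2, h3⟩ := good_pt G (Q.cone_ker hv') hf hf0 hb hv' hne
    exact ⟨a, ha, h1, fun Q' hQ' => h2 Q' ((Cone_smul_iff Q'.2.hom ha).2 hQ'), h3⟩
  have S : Sec (dv0 + A) (fun l => f⁻¹ * t l) := by
    refine ⟨fun i => ?_, fun v hv => ?_, fun Q => ?_, fun Q Q' v hQ hQ' hv hv' => ?_⟩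
    · refine (mem_Gam_iff' G).2 ⟨mul_mem (K0_inv hK) (ht i).1, fun h0 Q => ?_⟩
      have h0' := right_ne_zero_of_mul h0
      have := (mem_Gam_iff G (ht i).1 h0').1 (ht i) Q
      rw [ord_mul G Q (K0_inv hK) (inv_ne_zero hf0) (ht i).1 h0', ord_inv G Q hK hf0, Finsupp.add_apply, hdv]
      linarith
    · refine (hemb v hv).twist G ?_
      rw [Gen_iff G hv (K0_inv hK) (inv_ne_zero hf0)]
      intro Q _
      rw [ord_inv G Q hK hf0, hdv]
    · rw [Finsupp.add_apply, hdv]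
      by_cases h : ord Q f + A Q = 0
      · exact Or.inl h
      · obtain ⟨v, hv⟩ := exists_pt G Q
        obtain ⟨a, -, h1, -⟩ := key v Q hv h
        exact Or.inr h1
    · rw [Finsupp.add_apply, hdv] at hQ hQ'
      obtain ⟨a, -, -, h2, -⟩ := key v Q hv (by omega)
      by_contra hne
      have := h2 Q' hv' (Ne.symm hne)
      omega
  obtain ⟨Q, hQ⟩ := S.irred G
  have hE : ∀ Q', ord Q' f + A Q' = (Finsupp.single Q 1 : PDt κ d →₀ ℤ) Q' := fun Q' => by
    rw [← hQ, Finsupp.add_apply, hdv]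
  have h1 : ord Q f + A Q = 1 := by rw [hE, Finsupp.single_eq_same]
  refine ⟨Q, h1, fun Q' h => by rw [hE, Finsupp.single_eq_of_ne h], fun v hv => ?_⟩
  obtain ⟨a, ha, -, -, h3⟩ := key v Q hv (by omega)
  exact ⟨a, ha, h3⟩

lemma exists_basisOf {V : Submodule k K} [FiniteDimensional k V] :
    ∃ (N : ℕ) (t : Fin N → K), N = Module.finrank k V ∧ Submodule.span k (Set.range t) = V ∧ LinearIndependent k t := by
  let b := Module.finBasis k V
  refine ⟨_, fun i => (b i : K), rfl, ?_, ?_⟩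
  · have : Set.range (fun i => (b i : K)) = V.subtype '' Set.range b := by
      rw [← Set.range_comp]; rfl
    rw [this, Submodule.span_image, b.span_eq, Submodule.map_top, Submodule.range_subtype]
  · exact b.linearIndependent.map' V.subtype (Submodule.ker_subtype _)

theorem emb_basis [CharZero k] {ι : Type} (G : Geo κ d) {A B C : PDt κ d →₀ ℤ} {c : ℕ} (hA : C + c • B = A)
    (hc : 1 ≤ c) {s : ι → K} (hs : ∀ i, s i ∈ Gam κ B) (h : ∀ v ∈ Cone (RingHom.ker κ), EmbAt B s v)
    (hC : ∀ v ∈ Cone (RingHom.ker κ), ∃ τ ∈ Gam κ C, Gen C v τ) :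
    ∃ (N : ℕ) (t : Fin N → K), (∀ i, t i ∈ Gam κ A) ∧ ∀ v ∈ Cone (RingHom.ker κ), EmbAt A t v := by
  haveI := Gam_fin G A
  obtain ⟨N, t, -, hsp, -⟩ := exists_basisOf (V := Gam κ A)
  have ht : ∀ i, t i ∈ Gam κ A := fun i => hsp ▸ Submodule.subset_span ⟨i, rfl⟩
  refine ⟨N, t, ht, fun v hv => ?_⟩
  obtain ⟨⟨j, hj⟩, -⟩ := id (h v hv)
  obtain ⟨τ, hτ, hτg⟩ := hC v hv
  obtain ⟨c, rfl⟩ : ∃ c', c = c' + 1 := ⟨c - 1, by omega⟩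
  have e : C + c • B + B = A := by rw [← hA, succ_nsmul, add_assoc]
  have h1 := (h v hv).twist G (Gen_mul G hτg (Gen_pow G hj c))
  rw [e] at h1
  refine h1.lin hv ht fun i => ?_
  rw [hsp]
  have := Gam_mul G (Gam_mul G hτ (Gam_pow G (hs j) c)) (hs i)
  rwa [e] at this

end B20
end Bert


namespace Bert
set_option linter.unusedSectionVars false
section B21
variable {k : Type} [Field k] {n : ℕ} {K : Type} [Field K] [Algebra k K] {κ : MvPolynomial (Fin (n+1)) k →ₐ[k] K} {d : ℕ} [IsAlgClosed k]

lemma ordAlong_sub (G : Geo κ d) {X' Y : Set (ProjPt k n)} (Q : PDt κ d)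
    (hX : _root_.vanishingIdeal X' = RingHom.ker κ) (hY : _root_.vanishingIdeal Y = Q.1)
    {e : ℕ} {a b : MvPolynomial (Fin (n+1)) k} (ha : a.IsHomogeneous e) (hb : b.IsHomogeneous e) (ha0 : κ a ≠ 0) (hb0 : κ b ≠ 0) :
    (ordAlong X' Y a : ℤ) - (ordAlong X' Y b : ℤ) = ord Q (κ a / κ b) := by
  obtain ⟨i, hi⟩ := PDt.X_notMem G Q
  have hx : ((X i : MvPolynomial (Fin (n+1)) k) ^ e).IsHomogeneous e := by simpa using (isHomogeneous_X k i).pow e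
  have hxQ : (X i : MvPolynomial (Fin (n+1)) k) ^ e ∉ Q.1 := fun h => hi (Q.2.pr.mem_of_pow_mem _ h)
  have hx0 := kne' Q hxQ
  rw [ordAlong_eq G Q hX hY ha hx ha0 hxQ, ordAlong_eq G Q hX hY hb hx hb0 hxQ,
    ← ord_div G Q (frac_mem_K0 ha hx) (div_ne_zero ha0 hx0) (frac_mem_K0 hb hx) (div_ne_zero hb0 hx0)]
  congr 1
  field_simp

/-- presentation of a map by forms -/
def IsGP {m : ℕ} (κ : MvPolynomial (Fin (n+1)) k →ₐ[k] K) (φ : ProjPt k n → ProjPt k m) (e : ℕ) (g : Fin (m+1) → MvPolynomial (Fin (n+1)) k) : Prop :=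
  (∀ j, (g j).IsHomogeneous e) ∧ ∀ v ∈ Cone (RingHom.ker κ), ∀ (hv : v ≠ 0)
    (hgv : (fun j => eval v (g j)) ≠ 0), Projectivization.mk k (fun j => eval v (g j)) hgv = φ (Projectivization.mk k v hv)

lemma mk_eq_cross {m : ℕ} {u w : Fin m → k} (hu : u ≠ 0) (hw : w ≠ 0)
    (h : Projectivization.mk k u hu = Projectivization.mk k w hw) (i j : Fin m) : u i * w j = u j * w i := by
  rw [Projectivization.mk_eq_mk_iff'] at h
  obtain ⟨a, rfl⟩ := h
  simp only [Pi.smul_apply, smul_eq_mul]; ring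

lemma mem_ker_of_cone (G : Geo κ d) {f : MvPolynomial (Fin (n+1)) k} (h : ∀ v ∈ Cone (RingHom.ker κ), eval v f = 0) : κ f = 0 := by
  obtain ⟨i, hi⟩ := kap_hom_ne G
  exact cone_vanish (Q := RingHom.ker κ) (RingHom.ker_isPrime _) (i := i) hi h

lemma IsGP.prop {m : ℕ} (G : Geo κ d) {φ : ProjPt k n → ProjPt k m} {e e' : ℕ} {g g' : Fin (m+1) → MvPolynomial (Fin (n+1)) k}
    (h : IsGP κ φ e g) (h' : IsGP κ φ e' g') (i j : Fin (m+1)) : κ (g i) * κ (g' j) = κ (g j) * κ (g' i) := by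
  rw [← sub_eq_zero, ← map_mul, ← map_mul, ← map_sub]
  refine mem_ker_of_cone G fun v hv => ?_
  rw [map_sub, map_mul, map_mul, sub_eq_zero]
  by_cases h1 : (fun j => eval v (g j)) = 0
  · rw [show eval v (g i) = 0 from congrFun h1 i, show eval v (g j) = 0 from congrFun h1 j, zero_mul, zero_mul]
  by_cases h2 : (fun j => eval v (g' j)) = 0
  · rw [show eval v (g' i) = 0 from congrFun h2 i, show eval v (g' j) = 0 from congrFun h2 j, mul_zero, mul_zero]
  exact mk_eq_cross h1 h2 ((h.2 v hv hv.1 h1).trans (h'.2 v hv hv.1 h2).symm) i j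

lemma IsGP.ratio {m : ℕ} (G : Geo κ d) {φ : ProjPt k n → ProjPt k m} {e e' : ℕ} {g g' : Fin (m+1) → MvPolynomial (Fin (n+1)) k}
    (h : IsGP κ φ e g) (h' : IsGP κ φ e' g') {i0 j : Fin (m+1)} (hi : κ (g i0) ≠ 0) (hj : κ (g' j) ≠ 0) :
    ∃ t : K, t ≠ 0 ∧ ∀ i, κ (g' i) = t * κ (g i) := by
  have h1 := h.prop G h' i0 j
  have h2 : κ (g j) ≠ 0 := fun h2 => by
    rw [h2, zero_mul] at h1; exact mul_ne_zero hi hj h1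
  refine ⟨κ (g' j) / κ (g j), div_ne_zero hj h2, fun i => ?_⟩
  have := h.prop G h' i j
  field_simp
  rw [mul_comm, ← this, mul_comm]

lemma exists_GP {m : ℕ} {Xs : Set (ProjPt k n)} (hXc : IsClosedSub Xs) (hX : _root_.vanishingIdeal Xs = RingHom.ker κ)
    {φ : ProjPt k n → ProjPt k m} (hφ : IsMorphismOn Xs φ) {v : Fin (n+1) → k} (hv : v ∈ Cone (RingHom.ker κ)) :
    ∃ (e : ℕ) (g : Fin (m+1) → MvPolynomial (Fin (n+1)) k), IsGP κ φ e g ∧ (∃ j, eval v (g j) ≠ 0) ∧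
      ∀ y ∈ Xs, ∀ (v : Fin (n+1) → k) (hv : v ≠ 0), Projectivization.mk k v hv = y →
      ∀ hgv : (fun j' => MvPolynomial.eval v (g j')) ≠ 0,
        Projectivization.mk k (fun j' => MvPolynomial.eval v (g j')) hgv = φ y := by
  have hmem : ∀ u ∈ Cone (RingHom.ker κ), ∀ hu : u ≠ 0, Projectivization.mk k u hu ∈ Xs := fun u hu hu0 =>
    (closed_mem_iff hXc hu0).2 (by rw [hX]; exact hu)
  obtain ⟨e, g, hg, ⟨j, hj⟩, h⟩ := hφ _ (hmem v hv hv.1)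
  exact ⟨e, g, ⟨hg, fun u hu hu0 hgu => h _ (hmem u hu hu0) u hu0 rfl hgu⟩,
    ⟨j, fun h0 => hj ((vanishesAt_mk_iff (hg j) hv.1).2 h0)⟩, h⟩

set_option maxHeartbeats 2000000 in
theorem emb_of_ample (G : Geo κ d) {Xs : Set (ProjPt k n)} (hXc : IsClosedSub Xs)
    (hX : _root_.vanishingIdeal Xs = RingHom.ker κ)
    (eq : PDt κ d → {Y : Set (ProjPt k n) // IsPrimeDivisorOn Xs d Y})
    (he : ∀ Q, _root_.vanishingIdeal (eq Q).1 = Q.1) (D : DivisorOn Xs d) (hamp : IsAmpleDiv Xs d D) :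
    ∃ m0 : ℕ, 0 < m0 ∧ ∀ B : PDt κ d →₀ ℤ, (∀ Q, B Q = (m0 : ℤ) * D (eq Q)) → ∃ (m : ℕ) (s : Fin (m+1) → K),
      (∀ i, s i ∈ Gam κ B) ∧ ∀ v ∈ Cone (RingHom.ker κ), EmbAt B s v := by
  obtain ⟨m0, hm0, m, φ, X', ψ, ⟨hφ, hX', -, -, hψ, hinv⟩, l, hl, hlX, D', hD', e1, g, h, hg, hh, hgX, hhX, hlin⟩ := hamp
  refine ⟨m0, hm0, fun B hB => ?_⟩
  have hmem : ∀ u ∈ Cone (RingHom.ker κ), ∀ hu : u ≠ 0, Projectivization.mk k u hu ∈ Xs := fun u hu hu0 =>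
    (closed_mem_iff hXc hu0).2 (by rw [hX]; exact hu)
  have hg0 : κ g ≠ 0 := fun h => hgX (by rw [hX]; exact h)
  have hh0 : κ h ≠ 0 := fun h => hhX (by rw [hX]; exact h)
  -- a presentation at a point off the hyperplane
  obtain ⟨e0, g0, hgp0, ⟨i0, hi0⟩, hL0⟩ : ∃ (e0 : ℕ) (g0 : Fin (m+1) → MvPolynomial (Fin (n+1)) k), IsGP κ φ e0 g0 ∧ (∃ i, κ (g0 i) ≠ 0) ∧
      κ (aeval g0 l) ≠ 0 := by
    rw [mem_vI] at hlX
    push Not at hlX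
    obtain ⟨w, hw, hwX, hwl⟩ := hlX
    rw [hX'] at hwX
    obtain ⟨x, hx, hxw⟩ := hwX
    induction x using Projectivization.ind with
    | h v hv0 =>
      have hv : v ∈ Cone (RingHom.ker κ) := by rw [← hX]; exact (closed_mem_iff hXc hv0).1 hx
      obtain ⟨e0, g0, hgp, ⟨j, hj⟩, -⟩ := exists_GP hXc hX hφ hv
      refine ⟨e0, g0, hgp, ⟨j, kne hv hj⟩, kne hv ?_⟩
      have hne : (fun j => eval v (g0 j)) ≠ 0 := fun h => hj (congrFun h j)
      have h1 := hgp.2 v hv hv0 hne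
      rw [hxw, Projectivization.mk_eq_mk_iff'] at h1
      obtain ⟨a, ha⟩ := h1
      have ha0 : a ≠ 0 := by
        rintro rfl; rw [zero_smul] at ha; exact hne ha.symm
      have h2 : eval v (aeval g0 l) = eval (a • w) l := by
        rw [ha, ← aeval_eq_eval, ← aeval_eq_eval, comp_aeval_apply]
      rw [h2, eval_smul_hom hl]
      exact mul_ne_zero (pow_ne_zero _ ha0) hwl
  let s : Fin (m+1) → K := fun j => (κ h / κ g) * (κ (g0 j) / κ (aeval g0 l))
  have hlh : ∀ {e : ℕ} {g : Fin (m+1) → MvPolynomial (Fin (n+1)) k}, (∀ j, (g j).IsHomogeneous e) → (aeval g l).IsHomogeneous e := by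
    intro e g hg
    simpa using hl.aeval g hg
  have hsK : ∀ j, s j ∈ K0 κ := fun j => mul_mem (frac_mem_K0 hh hg) (frac_mem_K0 (hgp0.1 j) (hlh hgp0.1))
  -- local analysis
  have key : ∀ v ∈ Cone (RingHom.ker κ), ∃ (e : ℕ) (gv : Fin (m+1) → MvPolynomial (Fin (n+1)) k) (j : Fin (m+1)) (ξ : K), IsGP κ φ e gv ∧
      eval v (gv j) ≠ 0 ∧ ξ ≠ 0 ∧ (∀ i, s i = ξ * κ (gv i)) ∧ Gen B v (s j) := by
    intro v hv
    obtain ⟨e, gv, hgp, ⟨j, hj⟩, hval⟩ := exists_GP hXc hX hφ hv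
    obtain ⟨t, ht0, ht⟩ := hgp0.ratio G hgp hi0 (kne hv hj)
    have hLv : κ (aeval gv l) = t * κ (aeval g0 l) := by
      rw [comp_aeval_apply, comp_aeval_apply, funext ht, aeval_scale l hl _ ht0, pow_one]
    have hLv0 : κ (aeval gv l) ≠ 0 := by rw [hLv]; exact mul_ne_zero ht0 hL0
    have hs : ∀ i, s i = (κ h / κ g / κ (aeval gv l)) * κ (gv i) := fun i => by
      rw [hLv, ht]; simp only [s]; field_simp
    refine ⟨e, gv, j, κ h / κ g / κ (aeval gv l), hgp, hj, div_ne_zero (div_ne_zero hh0 hg0) hLv0, hs, ?_⟩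
    have hj0 := kne hv hj
    have hsj : s j = (κ h / κ g) * (κ (gv j) / κ (aeval gv l)) := by rw [hs]; field_simp
    have a1 : κ h / κ g ≠ 0 := div_ne_zero hh0 hg0
    have a2 : κ (gv j) / κ (aeval gv l) ≠ 0 := div_ne_zero hj0 hLv0
    rw [Gen_iff G hv (hsK j) (by rw [hsj]; exact mul_ne_zero a1 a2)]
    intro Q hQ
    rw [hsj, ord_mul G Q (frac_mem_K0 hh hg) a1 (frac_mem_K0 (hgp.1 j) (hlh hgp.1)) a2,
      ← ordAlong_sub G Q hX (he Q) hh hg hh0 hg0, ← ordAlong_sub G Q hX (he Q) (hgp.1 j) (hlh hgp.1) hj0 hLv0, hB]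
    have b1 := hlin (eq Q)
    have b2 := hD' (eq Q) e gv j hgp.1 hval (by rw [he]; exact fun h => hj (hQ.2 _ h))
    linarith
  have hquot : ∀ v ∈ Cone (RingHom.ker κ), ∀ {e : ℕ} {gv : Fin (m+1) → MvPolynomial (Fin (n+1)) k} {j : Fin (m+1)} {ξ : K}, IsGP κ φ e gv →
      eval v (gv j) ≠ 0 → ξ ≠ 0 → (∀ i, s i = ξ * κ (gv i)) → ∀ i, s i / s j ∈ Ov κ v ∧
        ev κ v (s i / s j) = eval v (gv i) / eval v (gv j) := by
    intro v hv e gv j ξ hgp hj hξ hs i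
    have h1 : s i / s j * κ (gv j) = κ (gv i) := by
      have := kne hv hj
      rw [hs, hs]; field_simp
    have hp : s i / s j ∈ Ov κ v := (Ov_mem hv).2 ⟨e, gv i, gv j, hgp.1 i, hgp.1 j, hj, h1⟩
    refine ⟨hp, Pres.ev hv ?_⟩
    exact ⟨⟨e, hgp.1 i, hgp.1 j⟩, hj, h1⟩
  refine ⟨m, s, fun i => ⟨hsK i, fun v hv => ?_⟩, fun v hv => ?_⟩
  · obtain ⟨e, gv, j, ξ, hgp, hj, hξ, hs, hgen⟩ := key v hv
    have h1 := (hquot v hv hgp hj hξ hs i).1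
    have h2 : s i * gam v B = (s i / s j) * (s j * gam v B) := by
      rw [← mul_assoc, div_mul_cancel₀ _ hgen.ne]
    rw [h2]
    exact mul_mem h1 hgen.2.1
  · obtain ⟨e, gv, j, ξ, hgp, hj, hξ, hs, hgen⟩ := key v hv
    have hj0 := kne hv hj
    have hne : (fun j => eval v (gv j)) ≠ 0 := fun h => hj (congrFun h j)
    have hφX : ∀ u ∈ Cone (RingHom.ker κ), ∀ hu : u ≠ 0, φ (Projectivization.mk k u hu) ∈ X' := fun u hu hu0 => by
      rw [hX']; exact ⟨_, hmem u hu hu0, rfl⟩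
    obtain ⟨r, p, hp, ⟨i, hi⟩, hpval⟩ := hψ _ (hφX v hv hv.1)
    have hcomp : ∀ u i, eval u (aeval gv (p i)) = eval (fun j => eval u (gv j)) (p i) := fun u i => by
      rw [← aeval_eq_eval, ← aeval_eq_eval, comp_aeval_apply]
    have hval : ∀ u ∈ Cone (RingHom.ker κ), (fun j => eval u (gv j)) ≠ 0 → ∀ i l,
        eval u (aeval gv (p i)) * u l = eval u (aeval gv (p l)) * u i := by
      intro u hu hgu i l
      rw [hcomp, hcomp]
      by_cases h0 : (fun i => eval (fun j => eval u (gv j)) (p i)) = 0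
      · rw [show eval (fun j => eval u (gv j)) (p i) = 0 from congrFun h0 i,
          show eval (fun j => eval u (gv j)) (p l) = 0 from congrFun h0 l, zero_mul, zero_mul]
      · have := hpval _ (hφX u hu hu.1) _ hgu (hgp.2 u hu hu.1 hgu) h0
        rw [hinv _ (hmem u hu hu.1)] at this
        exact mk_eq_cross h0 hu.1 this i l
    have hpi : eval v (aeval gv (p i)) ≠ 0 := by
      intro h0
      rw [hcomp] at h0
      apply hi
      rw [← hgp.2 v hv hv.1 hne]
      exact (vanishesAt_mk_iff (hp i) hne).2 h0
    have hvi : v i ≠ 0 := by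
      intro h0
      obtain ⟨l, hl⟩ := Function.ne_iff.1 hv.1
      have := hval v hv hne i l
      rw [h0, mul_zero] at this
      exact mul_ne_zero hpi hl this
    have hXi : κ (X i) ≠ 0 := kne hv (by rw [eval_X]; exact hvi)
    have hrel : ∀ l, κ (aeval gv (p i)) * κ (X l) = κ (aeval gv (p l)) * κ (X i) := by
      intro l
      have : κ (gv j * (aeval gv (p i) * X l - aeval gv (p l) * X i)) = 0 := by
        refine mem_ker_of_cone G fun u hu => ?_
        by_cases hgu : (fun j => eval u (gv j)) = 0
        · rw [map_mul, show eval u (gv j) = 0 from congrFun hgu j, zero_mul]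
        · rw [map_mul, map_sub, map_mul, map_mul, eval_X, eval_X, hval u hu hgu i l, sub_self, mul_zero]
      rw [map_mul, map_sub, map_mul, map_mul] at this
      exact sub_eq_zero.1 ((mul_eq_zero.1 this).resolve_left hj0)
    refine ⟨⟨j, hgen⟩, r, p, ξ ^ r * (κ (aeval gv (p i)) / κ (X i)), hp,
      mul_ne_zero (pow_ne_zero _ hξ) (div_ne_zero (kne hv hpi) hXi), fun l => ?_, i, hvi, ?_⟩
    · rw [funext hs, aeval_scale _ (hp l) _ hξ, ← comp_aeval_apply, mul_assoc]
      congr 1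
      field_simp
      exact (hrel l).symm
    · have hq := hquot v hv hgp hj hξ hs
      have h1 := aeval_hom_div (p i) (hp i) s (s j) hgen.ne
      have h2 := ev_aeval hv (fun i => (hq i).1) (p i)
      have h3 : aeval s (p i) = aeval (fun i => s i / s j) (p i) * s j ^ r := by
        rw [h1, div_mul_cancel₀ _ (pow_ne_zero _ hgen.ne)]
      rw [h3]
      refine Gen_of_unit (Gen_pow G hgen r) ((isU_iff_ev hv h2.1).2 ?_)
      rw [h2.2]
      have h4 : (fun l => ev κ v (s l / s j)) = (eval v (gv j))⁻¹ • fun l => eval v (gv l) := by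
        ext l
        rw [(hq l).2, Pi.smul_apply, smul_eq_mul, div_eq_inv_mul]
      rw [h4, eval_smul_hom (hp i), ← hcomp]
      exact mul_ne_zero (pow_ne_zero _ (inv_ne_zero hj)) hpi

end B21
end Bert


namespace Bert
set_option linter.unusedSectionVars false
section B22
variable {k : Type} [Field k] {n : ℕ} {K : Type} [Field K] [Algebra k K] {κ : MvPolynomial (Fin (n+1)) k →ₐ[k] K} {d : ℕ} [IsAlgClosed k]

lemma smooth_span {Y : Set (ProjPt k n)} {I : Ideal (MvPolynomial (Fin (n+1)) k)} (hI : IsHom I) (hY : _root_.vanishingIdeal Y = I)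
    (v : Fin (n+1) → k) :
    Submodule.span k {w | ∃ h ∈ homVanishingPolys Y, w = gradientAt h v} = gradSpan I v := by
  rw [hom_gradSpan hI]
  congr 1
  ext w
  constructor
  · rintro ⟨h, ⟨hm, hv⟩, rfl⟩
    exact ⟨⟨h, by rw [← hY]; exact hv, hm⟩, rfl⟩
  · rintro ⟨⟨h, hh, hm⟩, rfl⟩
    exact ⟨h, ⟨hm, by rw [← hY] at hh; exact hh⟩, rfl⟩

lemma gradSpan_smul {I : Ideal (MvPolynomial (Fin (n+1)) k)} (hI : IsHom I) {a : k} (ha : a ≠ 0) (v : Fin (n+1) → k) :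
    gradSpan I (a • v) = gradSpan I v := by
  rw [hom_gradSpan hI, hom_gradSpan hI]
  apply le_antisymm
  · rw [Submodule.span_le]
    rintro _ ⟨h, rfl⟩
    obtain ⟨m, hm⟩ := h.2.2
    simp only [grad_hom_smul hm]
    exact Submodule.smul_mem _ _ (Submodule.subset_span ⟨h, rfl⟩)
  · rw [Submodule.span_le]
    rintro _ ⟨h, rfl⟩
    obtain ⟨m, hm⟩ := h.2.2
    have e : gradientAt h.1 v = (a ^ (m - 1))⁻¹ • gradientAt h.1 (a • v) := by
      rw [grad_hom_smul hm, smul_smul, inv_mul_cancel₀ (pow_ne_zero _ ha), one_smul]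
    simp only [e]
    exact Submodule.smul_mem _ _ (Submodule.subset_span ⟨h, rfl⟩)

lemma geo_of_smooth {Xs : Set (ProjPt k n)} (hd : 2 ≤ d) (h : IsSmoothVariety Xs d)
    (hX : _root_.vanishingIdeal Xs = RingHom.ker κ) : Geo κ d := by
  obtain ⟨hc, hi, hdim, hs⟩ := h
  have hh : IsHom (RingHom.ker κ) := hX ▸ vI_hom Xs
  have ht : td k (MvPolynomial (Fin (n+1)) k ⧸ RingHom.ker κ) = d + 1 := by
    rw [← hX]; exact (hasDim_iff hc hi d).1 hdim
  refine ⟨hh, ht, hd, fun v hv => ?_⟩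
  have h1 := hs _ ((closed_mem_iff hc hv.1).2 (by rw [hX]; exact hv)) v hv.1 rfl
  rw [smooth_span hh hX] at h1
  have h2 : td k (MvPolynomial (Fin (n+1)) k ⧸ RingHom.ker κ) ≤ td k (MvPolynomial (Fin (n+1)) k) :=
    td_le_of_surjective (Ideal.Quotient.mkₐ k _) (Ideal.Quotient.mkₐ_surjective k _)
  rw [td_mvPoly, ht] at h2
  omega

lemma div_equiv {Xs : Set (ProjPt k n)} (hXc : IsClosedSub Xs) (G : Geo κ d)
    (hX : _root_.vanishingIdeal Xs = RingHom.ker κ) :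
    ∃ eq : PDt κ d ≃ {Y : Set (ProjPt k n) // IsPrimeDivisorOn Xs d Y}, ∀ Q, _root_.vanishingIdeal (eq Q).1 = Q.1 := by
  have h2 := G.two
  have hp : ∀ Q : PDt κ d, IsClosedSub (projZeroLocus (Q.1 : Set (MvPolynomial (Fin (n+1)) k))) ∧
      IsIrredSub (projZeroLocus (Q.1 : Set (MvPolynomial (Fin (n+1)) k))) ∧
      _root_.vanishingIdeal (projZeroLocus (Q.1 : Set (MvPolynomial (Fin (n+1)) k))) = Q.1 := fun Q => by
    obtain ⟨i, hi⟩ := PDt.X_notMem G Q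
    exact projZero_props Q.2.pr Q.2.hom hi
  have hf : ∀ Q : PDt κ d, IsPrimeDivisorOn Xs d (projZeroLocus (Q.1 : Set (MvPolynomial (Fin (n+1)) k))) := fun Q => by
    obtain ⟨h1, h2, h3⟩ := hp Q
    refine ⟨closed_subset_of_vI hXc (by rw [h3, hX]; exact Q.2.le), h1, h2, (hasDim_iff h1 h2 _).2 ?_⟩
    rw [h3, Q.2.tdim]; omega
  have hb : ∀ Y : {Y : Set (ProjPt k n) // IsPrimeDivisorOn Xs d Y}, PD κ d (_root_.vanishingIdeal Y.1) := fun Y => by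
    obtain ⟨h0, h1, h2, h3⟩ := Y.2
    refine ⟨vI_prime h2, vI_hom _, by rw [← hX]; exact vI_anti h0, ?_⟩
    rw [(hasDim_iff h1 h2 _).1 h3]; omega
  refine ⟨⟨fun Q => ⟨_, hf Q⟩, fun Y => ⟨_, hb Y⟩, fun Q => Subtype.ext (hp Q).2.2, fun Y => Subtype.ext ?_⟩,
    fun Q => (hp Q).2.2⟩
  exact closed_eq_of_vI (hp ⟨_, hb Y⟩).1 Y.2.2.1 (hp ⟨_, hb Y⟩).2.2.symm

lemma common_den0 {ι : Type} [Fintype ι] [DecidableEq ι] {z : ι → K} (hz : ∀ i, z i ∈ K0 κ) :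
    ∃ (e : ℕ) (h : MvPolynomial (Fin (n+1)) k) (g : ι → MvPolynomial (Fin (n+1)) k), h.IsHomogeneous e ∧ κ h ≠ 0 ∧
      ∀ i, (g i).IsHomogeneous e ∧ κ (g i) = z i * κ h := by
  have : ∀ i, ∃ e a s, MvPolynomial.IsHomogeneous a e ∧ MvPolynomial.IsHomogeneous s e ∧ κ s ≠ 0 ∧ z i * κ s = κ a :=
    fun i => by
      obtain ⟨e, a, s, ha, hs, -, hs0, h⟩ := hz i
      exact ⟨e, a, s, ha, hs, hs0, h⟩
  choose e a s ha hs hs0 h using this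
  refine ⟨∑ i, e i, ∏ i, s i, fun i => a i * ∏ j ∈ Finset.univ.erase i, s j,
    MvPolynomial.IsHomogeneous.prod _ _ _ fun i _ => hs i, ?_, fun i => ⟨?_, ?_⟩⟩
  · rw [map_prod]; exact Finset.prod_ne_zero_iff.2 fun i _ => hs0 i
  · rw [← Finset.add_sum_erase _ e (Finset.mem_univ i)]
    exact (ha i).mul (MvPolynomial.IsHomogeneous.prod _ _ _ fun i _ => hs i)
  · rw [map_mul, ← h, mul_assoc, ← map_mul, Finset.mul_prod_erase _ s (Finset.mem_univ i)]

lemma ord_smul (G : Geo κ d) (Q : PDt κ d) {f : K} (hf : f ∈ K0 κ) (hf0 : f ≠ 0) {c : k} (hc : c ≠ 0) :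
    ord Q (c • f) = ord Q f := by
  have hc0 : algebraMap k K c ≠ 0 := by rwa [Ne, map_eq_zero]
  have hcK : algebraMap k K c ∈ K0 κ := Subalgebra.algebraMap_mem _ _
  have h0 : ord Q (algebraMap k K c) = 0 := (ord_zero_iff G Q hcK hc0).2 ⟨hc0, Subalgebra.algebraMap_mem _ _, by
    rw [← map_inv₀]; exact Subalgebra.algebraMap_mem _ _⟩
  rw [Algebra.smul_def, ord_mul G Q hcK hc0 hf hf0, h0, zero_add]

lemma GamP_ne (G : Geo κ d) {A : PDt κ d →₀ ℤ} {q : ℕ} {P : Fin q → (Fin (n+1) → k)}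
    {hP : ∀ s, P s ∈ Cone (RingHom.ker κ)} (hJ : Jet A P hP) : GamP A P hP ≠ ⊥ := by
  obtain ⟨v, hv, -⟩ := exists_off G ∅
  obtain ⟨w0, -, -, h⟩ := hJ v hv
  obtain ⟨z, hz, h1, h2⟩ := exists_dv_ne G hv
  obtain ⟨w, hw, -, h3⟩ := h z hz (Or.inr h1)
  intro hbot
  rw [hbot, Submodule.mem_bot] at hw
  rw [hw, zero_div] at h3
  obtain ⟨w', hw', -, h3'⟩ := h 0 (zero_mem _) (Or.inr (ev_zero hv))
  rw [hbot, Submodule.mem_bot] at hw'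
  rw [← h3] at h2
  apply h2
  have := dv_smul hv (0:k) (zero_mem (Ov κ v))
  rwa [smul_zero, zero_smul] at this

end B22
end Bert


namespace Bert
set_option linter.unusedSectionVars false
section B23
variable {k : Type} [Field k] {n : ℕ} {K : Type} [Field K] [Algebra k K] {κ : MvPolynomial (Fin (n+1)) k →ₐ[k] K} {d : ℕ} [IsAlgClosed k]

lemma zclosed_scale {r : ℕ} (p : MvPolynomial (Fin r) k) :
    IsZClosed k {c : Fin r → k | ∀ a : k, eval (a • c) p = 0} := by
  refine ⟨Set.range fun (a : k) (c : Fin r → k) => eval (a • c) p, ?_, ?_⟩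
  · rintro _ ⟨a, rfl⟩
    refine ⟨r, fun i => a • LinearMap.proj i, p, ?_⟩
    funext c
    congr 2
  · ext c
    simp only [Set.mem_ofPred_eq, Set.forall_mem_range]

set_option maxHeartbeats 2000000 in
theorem system [CharZero k] (G : Geo κ d) {Xs : Set (ProjPt k n)}
    (hX : _root_.vanishingIdeal Xs = RingHom.ker κ)
    (eq : PDt κ d ≃ {Y : Set (ProjPt k n) // IsPrimeDivisorOn Xs d Y})
    (he : ∀ Q, _root_.vanishingIdeal (eq Q).1 = Q.1) (D : DivisorOn Xs d) {nn : ℕ} {A : PDt κ d →₀ ℤ}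
    (hA : ∀ Q, A Q = (nn : ℤ) * D (eq Q)) {N : ℕ} {t : Fin N → K}
    (ht : ∀ i, t i ∈ Gam κ A) (hemb : ∀ v ∈ Cone (RingHom.ker κ), EmbAt A t v)
    {q : ℕ} (P : Fin q → ProjPt k n) (hP : ∀ s, (P s).rep ∈ Cone (RingHom.ker κ))
    (hJ : Jet A (fun s => (P s).rep) hP) :
      ∃ (m e : ℕ) (g : Fin (m+1) → MvPolynomial (Fin (n+1)) k)
        (h : MvPolynomial (Fin (n+1)) k),
        (∀ i, (g i).IsHomogeneous e) ∧ h.IsHomogeneous e ∧ h ∉ _root_.vanishingIdeal Xs ∧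
        (∀ E : DivisorOn Xs d,
          (HasFiniteSupport E ∧ EffectiveDiv E ∧
              LinEquivDiv E (fun Y => (nn : ℤ) * D Y) ∧ ∀ s, DivThrough E (P s)) ↔
          (∃ c : Fin (m+1) → k, (∑ i, c i • g i) ∉ _root_.vanishingIdeal Xs ∧
            E = fun Y => ((ordAlong Xs Y.1 (∑ i, c i • g i) : ℤ) -
                (ordAlong Xs Y.1 h : ℤ)) + (nn : ℤ) * D Y)) ∧
        ∃ Z : Set (Fin (m+1) → k), IsZClosed k Z ∧ IsCone k Z ∧
          (∃ c : Fin (m+1) → k, (∑ i, c i • g i) ∉ _root_.vanishingIdeal Xs ∧ c ∉ Z) ∧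
          (∀ c : Fin (m+1) → k, (∑ i, c i • g i) ∉ _root_.vanishingIdeal Xs → c ∉ Z →
            ∃ Y₀ : {Y : Set (ProjPt k n) // IsPrimeDivisorOn Xs d Y},
              (((ordAlong Xs Y₀.1 (∑ i, c i • g i) : ℤ) -
                  (ordAlong Xs Y₀.1 h : ℤ)) + (nn : ℤ) * D Y₀ = 1) ∧
              (∀ Y, Y ≠ Y₀ → ((ordAlong Xs Y.1 (∑ i, c i • g i) : ℤ) -
                  (ordAlong Xs Y.1 h : ℤ)) + (nn : ℤ) * D Y = 0) ∧
              (∀ x ∈ Y₀.1, SmoothPtAt Y₀.1 (d - 1) x)) := by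
  classical
  have hfd : FiniteDimensional k (Gam κ A) := Gam_fin G A
  have hle : GamP A (fun s => (P s).rep) hP ≤ Gam κ A := fun w hw => hw.1
  have hfd' : FiniteDimensional k (GamP A (fun s => (P s).rep) hP) := Submodule.finiteDimensional_of_le hle
  obtain ⟨N', w, hN', hspan, hli⟩ := exists_basisOf (V := GamP A (fun s => (P s).rep) hP)
  obtain ⟨m, rfl⟩ : ∃ m, N' = m + 1 := by
    refine ⟨N' - 1, ?_⟩
    have : N' ≠ 0 := fun h0 => GamP_ne G hJ (Submodule.finrank_eq_zero.1 (by rw [← hN', h0]))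
    omega
  have hwP : ∀ i, w i ∈ GamP A (fun s => (P s).rep) hP := fun i => hspan ▸ Submodule.subset_span ⟨i, rfl⟩
  obtain ⟨e, h, g, hh, hh0, hg⟩ := common_den0 (fun i => (hwP i).1.1)
  have hPY : ∀ s (Q : PDt κ d), P s ∈ (eq Q).1 ↔ (P s).rep ∈ Cone Q.1 := by
    intro s Q
    have := closed_mem_iff (eq Q).2.2.1 (P s).rep_nonzero
    rwa [Projectivization.mk_rep, he] at this
  have hfP : ∀ c : Fin (m+1) → k, ∑ i, c i • w i ∈ GamP A (fun s => (P s).rep) hP := fun c =>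
    Submodule.sum_mem _ fun i _ => Submodule.smul_mem _ _ (hwP i)
  have hκ : ∀ c : Fin (m+1) → k, κ (∑ i, c i • g i) = (∑ i, c i • w i) * κ h := fun c => by
    rw [map_sum, Finset.sum_mul]
    refine Finset.sum_congr rfl fun i _ => ?_
    rw [map_smul, (hg i).2, smul_mul_assoc]
  have hmem : ∀ c : Fin (m+1) → k, (∑ i, c i • g i) ∉ _root_.vanishingIdeal Xs ↔ ∑ i, c i • w i ≠ 0 := fun c => by
    rw [hX, RingHom.mem_ker, hκ, mul_eq_zero, or_iff_left hh0]
  have hghom : ∀ c : Fin (m+1) → k, (∑ i, c i • g i).IsHomogeneous e := fun c =>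
    MvPolynomial.IsHomogeneous.sum _ _ _ fun i _ => by
      rw [smul_eq_C_mul]; simpa using (isHomogeneous_C _ (c i)).mul (hg i).1
  have hord : ∀ c : Fin (m+1) → k, ∑ i, c i • w i ≠ 0 → ∀ Q, (ordAlong Xs (eq Q).1 (∑ i, c i • g i) : ℤ) -
      (ordAlong Xs (eq Q).1 h : ℤ) = ord Q (∑ i, c i • w i) := fun c hc Q => by
    rw [ordAlong_sub G Q hX (he Q) (hghom c) hh (by rw [hκ]; exact mul_ne_zero hc hh0) hh0, hκ, mul_div_cancel_right₀ _ hh0]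
  have hhX : h ∉ _root_.vanishingIdeal Xs := by rw [hX]; exact hh0
  refine ⟨m, e, g, h, fun i => (hg i).1, hh, hhX, fun E => ⟨?_, ?_⟩, ?_⟩
  · rintro ⟨-, heff, ⟨e1, g1, h1, hg1, hh1, hg1X, hh1X, hlin⟩, hthru⟩
    rw [hX] at hg1X hh1X
    have hz0 : κ g1 / κ h1 ≠ 0 := div_ne_zero hg1X hh1X
    have hzK : κ g1 / κ h1 ∈ K0 κ := frac_mem_K0 hg1 hh1
    have hE : ∀ Q, E (eq Q) = ord Q (κ g1 / κ h1) + A Q := fun Q => by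
      have := hlin (eq Q)
      rw [ordAlong_sub G Q hX (he Q) hg1 hh1 hg1X hh1X] at this
      rw [hA]; linarith
    have hz : κ g1 / κ h1 ∈ GamP A (fun s => (P s).rep) hP := by
      refine mem_GamP.2 ⟨(mem_Gam_iff G hzK hz0).2 fun Q => ?_, fun s hgen => ?_⟩
      · have h1 := heff (eq Q)
        rw [hE] at h1; linarith
      · obtain ⟨Y, hY, hPs⟩ := hthru s
        obtain ⟨Q, rfl⟩ := eq.surjective Y
        rw [hE] at hY
        have := (Gen_iff G (hP s) hzK hz0).1 hgen Q ((hPY s Q).1 hPs)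
        omega
    rw [← hspan, Submodule.mem_span_range_iff_exists_fun k] at hz
    obtain ⟨c, hc⟩ := hz
    have hc0 : ∑ i, c i • w i ≠ 0 := by rw [hc]; exact hz0
    refine ⟨c, (hmem c).2 hc0, funext fun Y => ?_⟩
    obtain ⟨Q, rfl⟩ := eq.surjective Y
    rw [hord c hc0, hc, hE, hA]
  · rintro ⟨c, hc, rfl⟩
    have hc0 := (hmem c).1 hc
    have hfK : ∑ i, c i • w i ∈ K0 κ := (hfP c).1.1
    have hE : ∀ Q, ((ordAlong Xs (eq Q).1 (∑ i, c i • g i) : ℤ) -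
        (ordAlong Xs (eq Q).1 h : ℤ)) + (nn : ℤ) * D (eq Q) = ord Q (∑ i, c i • w i) + A Q := fun Q => by
      rw [hord c hc0, hA]
    refine ⟨?_, fun Y => ?_, ⟨e, ∑ i, c i • g i, h, hghom c, hh, hc, hhX, fun Y => add_sub_cancel_right _ _⟩, fun s => ?_⟩
    · refine (((ord_finite G hfK hc0).union A.support.finite_toSet).image eq).subset fun Y hY => ?_
      obtain ⟨Q, rfl⟩ := eq.surjective Y
      refine ⟨Q, ?_, rfl⟩
      by_contra hcon
      rw [Set.mem_union, not_or, Set.mem_ofPred_eq, not_not, Finset.mem_coe, Finsupp.notMem_support_iff] at hcon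
      exact hY ((hE Q).trans (by rw [hcon.1, hcon.2, add_zero]))
    · obtain ⟨Q, rfl⟩ := eq.surjective Y
      have h1 := (mem_Gam_iff G hfK hc0).1 (hfP c).1 Q
      exact le_of_le_of_eq (by linarith) (hE Q).symm
    · have h1 := (mem_GamP.1 (hfP c)).2 s
      rw [Gen_iff G (hP s) hfK hc0] at h1
      push Not at h1
      obtain ⟨Q, hQ, h2⟩ := h1
      refine ⟨eq Q, fun h0 => h2 ?_, (hPY s Q).2 hQ⟩
      have := (hE Q).symm.trans h0
      linarith
  · obtain ⟨Φ, hΦ, hΦg⟩ := bertini G hJ w hspan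
    have hΨ : Φ * X 0 ≠ 0 := mul_ne_zero hΦ (X_ne_zero 0)
    refine ⟨{c | ∀ a : k, eval (a • c) (Φ * X 0) = 0}, ?_, ?_, ?_, ?_⟩
    · exact zclosed_scale _
    · intro b c hc a
      have := hc (a * b)
      rwa [mul_smul] at this
    · obtain ⟨c, hc⟩ : ∃ c, eval c (Φ * X 0) ≠ 0 := by
        by_contra hcon
        push Not at hcon
        exact hΨ (MvPolynomial.funext fun c => by rw [hcon c, map_zero])
      refine ⟨c, (hmem c).2 fun h0 => ?_, fun hz => hc (by have := hz 1; rwa [one_smul] at this)⟩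
      have := Fintype.linearIndependent_iff.1 hli c h0 0
      rw [map_mul, eval_X, this, mul_zero] at hc
      exact hc rfl
    · intro c hc hcZ
      have hc0 := (hmem c).1 hc
      rw [Set.mem_ofPred_eq] at hcZ
      push Not at hcZ
      obtain ⟨a, ha⟩ := hcZ
      rw [map_mul, eval_X] at ha
      have ha0 : a ≠ 0 := by
        rintro rfl
        exact ha (by rw [zero_smul, Pi.zero_apply, mul_zero])
      have hf : ∑ i, (a • c) i • w i = a • ∑ i, c i • w i := by
        rw [Finset.smul_sum]
        exact Finset.sum_congr rfl fun i _ => by rw [Pi.smul_apply, smul_assoc]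
      have hgood := hΦg _ (left_ne_zero_of_mul ha)
      have hK : ∑ i, c i • w i ∈ K0 κ := (hfP c).1.1
      obtain ⟨Q, h1, h2, h3⟩ := good_irred G ht hemb (hfP (a • c)).1 (by rw [hf]; exact smul_ne_zero ha0 hc0) hgood
      rw [hf] at h1 h2
      refine ⟨eq Q, ?_, fun Y hY => ?_, fun x hx v hv hvx => ?_⟩
      · rw [hord c hc0, ← hA, ← ord_smul G Q hK hc0 ha0]; exact h1
      · obtain ⟨Q', rfl⟩ := eq.surjective Y
        rw [hord c hc0, ← hA, ← ord_smul G Q' hK hc0 ha0]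
        exact h2 Q' fun h => hY (by rw [h])
      · rw [← hvx, closed_mem_iff (eq Q).2.2.1, he] at hx
        obtain ⟨b, hb, h4⟩ := h3 v hx
        rw [gradSpan_smul Q.2.hom hb] at h4
        rw [smooth_span Q.2.hom (he Q)]
        have := G.two
        omega

end B23
end Bert

/-- **Bertini for linear systems of ample divisors through `q ≤ n+1` points in general
position.**  Let `X` be an irreducible smooth projective variety of dimension `d ≥ 2` in
`ℙⁿ` over an algebraically closed field of characteristic zero and `D` an ample divisor on
`X`.  Then there is `n₀ > 0` such that for all `m ≥ n₀` and any `q ≤ n+1` closed points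
`P 0, …, P (q-1)` on `X` in general position, a general member of `|mD|_q` (the linear
system of effective divisors in `|mD|` passing through the `q` points) is irreducible and
smooth. -/
theorem general_member_of_ample_system_through_q_points_irreducible_smooth
    {k : Type} [Field k] [IsAlgClosed k] [CharZero k] {n : ℕ}
    (X : Set (ProjPt k n)) (d : ℕ) (hd : 2 ≤ d) (hX : IsSmoothVariety X d)
    (D : DivisorOn X d) (hfin : HasFiniteSupport D) (hamp : IsAmpleDiv X d D) :
    ∃ n₀ : ℕ, 0 < n₀ ∧ ∀ nn : ℕ, n₀ ≤ nn →
      ∀ (q : ℕ), q ≤ n + 1 → ∀ P : Fin q → ProjPt k n, (∀ s, P s ∈ X) →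
        InGeneralPosition P →
      ∃ (m e : ℕ) (g : Fin (m+1) → MvPolynomial (Fin (n+1)) k)
        (h : MvPolynomial (Fin (n+1)) k),
        (∀ i, (g i).IsHomogeneous e) ∧ h.IsHomogeneous e ∧ h ∉ vanishingIdeal X ∧
        (∀ E : DivisorOn X d,
          (HasFiniteSupport E ∧ EffectiveDiv E ∧
              LinEquivDiv E (fun Y => (nn : ℤ) * D Y) ∧ ∀ s, DivThrough E (P s)) ↔
          (∃ c : Fin (m+1) → k, (∑ i, c i • g i) ∉ vanishingIdeal X ∧
            E = fun Y => ((ordAlong X Y.1 (∑ i, c i • g i) : ℤ) -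
                (ordAlong X Y.1 h : ℤ)) + (nn : ℤ) * D Y)) ∧
        ∃ Z : Set (Fin (m+1) → k), IsZClosed k Z ∧ IsCone k Z ∧
          (∃ c : Fin (m+1) → k, (∑ i, c i • g i) ∉ vanishingIdeal X ∧ c ∉ Z) ∧
          (∀ c : Fin (m+1) → k, (∑ i, c i • g i) ∉ vanishingIdeal X → c ∉ Z →
            ∃ Y₀ : {Y : Set (ProjPt k n) // IsPrimeDivisorOn X d Y},
              (((ordAlong X Y₀.1 (∑ i, c i • g i) : ℤ) -
                  (ordAlong X Y₀.1 h : ℤ)) + (nn : ℤ) * D Y₀ = 1) ∧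
              (∀ Y, Y ≠ Y₀ → ((ordAlong X Y.1 (∑ i, c i • g i) : ℤ) -
                  (ordAlong X Y.1 h : ℤ)) + (nn : ℤ) * D Y = 0) ∧
              (∀ x ∈ Y₀.1, SmoothPtAt Y₀.1 (d - 1) x)) := by
  have hprime := Bert.vI_prime hX.2.1
  obtain ⟨K, _, _, κ, hker, -⟩ := Bert.exists_frac (vanishingIdeal X)
  have G : Bert.Geo κ d := Bert.geo_of_smooth hd hX hker.symm
  obtain ⟨eq, he⟩ := Bert.div_equiv hX.1 G hker.symm
  obtain ⟨m0, hm0, hB⟩ := Bert.emb_of_ample G hX.1 hker.symm eq he D hamp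
  have hfin' : (Function.support fun Q => D (eq Q)).Finite :=
    Set.Finite.preimage eq.injective.injOn hfin
  let D' : Bert.PDt κ d →₀ ℤ := Finsupp.ofSupportFinite (fun Q => D (eq Q)) hfin'
  have hD' : ∀ (r : ℕ) Q, (r • D') Q = (r : ℤ) * D (eq Q) := fun r Q => by
    rw [Finsupp.smul_apply, nsmul_eq_mul]; rfl
  obtain ⟨mm, s, hs, hemb⟩ := hB (m0 • D') (hD' m0)
  obtain ⟨n0, hn0, hmain⟩ := Bert.gen_main G hm0 hs hemb (n+2)
  refine ⟨n0, hn0, fun nn hnn q hq P hP _ => ?_⟩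
  obtain ⟨C, hC, hCg⟩ := hmain nn hnn
  have hPc : ∀ s, (P s).rep ∈ Bert.Cone (RingHom.ker κ) := fun s => by
    have := Bert.closed_mem_iff hX.1 (P s).rep_nonzero
    rw [Projectivization.mk_rep, ← hker] at this
    exact this.1 (hP s)
  obtain ⟨N, t, ht, htemb⟩ := Bert.emb_basis G hC (by omega) hs hemb hCg
  have hJ : Bert.Jet (nn • D') (fun s => (P s).rep) hPc := fun v hv =>
    Bert.JET G hC (by omega) hs hemb hCg _ hPc hv
  exact Bert.system G hker.symm eq he D (hD' nn) ht htemb P hPc hJ
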